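/- Let p, q, s be distinct primes with p ≡ 5 (mod 8), q ≡ 3 (mod 8), s ≡ 3 (mod 4), (p/q) = (p/s) = 1, and suppose h₂(pqs) = 4 and the 2-class number of ℚ(√(2p), √(2s), √q) equals 4. Then for every n ≥ 0, the 2-Sylow subgroup of the ideal class group of ℚ(√p, √q, √s, 2cos(2π/2^{n+2})) has order 2. -/

import Mathlib

open NumberField

/-- The real quadratic field `ℚ(√d)`, realized inside `ℂ`. -/
noncomputable def quadF (d : ℕ) : IntermediateField ℚ ℂ :=
  IntermediateField.adjoin ℚ {((Real.sqrt d : ℝ) : ℂ)}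

/-- The triquadratic field `C(K) = ℚ(√(2p), √(2s), √q)`, realized inside `ℂ`. -/
noncomputable def CK (p q s : ℕ) : IntermediateField ℚ ℂ :=
  IntermediateField.adjoin ℚ
    {((Real.sqrt (2 * p) : ℝ) : ℂ), ((Real.sqrt (2 * s) : ℝ) : ℂ),
     ((Real.sqrt q : ℝ) : ℂ)}

/-- The field `Cₙ(F) = ℚ(√p, √q, √s, 2cos(2π/2^(n+2)))`, realized inside `ℂ`. -/
noncomputable def CnF (p q s n : ℕ) : IntermediateField ℚ ℂ :=
  IntermediateField.adjoin ℚ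
    {((Real.sqrt p : ℝ) : ℂ), ((Real.sqrt q : ℝ) : ℂ), ((Real.sqrt s : ℝ) : ℂ),
     ((2 * Real.cos (2 * Real.pi / 2 ^ (n + 2)) : ℝ) : ℂ)}

section
section AbstractChevalley

variable {X I : Type*} [CommGroup X] [CommGroup I]

/-- `x ↦ x / s x`. -/
def phiHom (s : X →* X) : X →* X where
  toFun x := x / s x
  map_one' := by simp
  map_mul' x y := by rw [map_mul, mul_div_mul_comm]

/-- `x ↦ x * s x`. -/
def nuHom (s : X →* X) : X →* X where
  toFun x := x * s x
  map_one' := by simp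
  map_mul' x y := by rw [map_mul, mul_mul_mul_comm]

@[simp] theorem phiHom_apply (s : X →* X) (x : X) : phiHom s x = x / s x := rfl
@[simp] theorem nuHom_apply (s : X →* X) (x : X) : nuHom s x = x * s x := rfl

theorem mem_phiHom_ker {s : X →* X} {x : X} : x ∈ (phiHom s).ker ↔ s x = x := by
  rw [MonoidHom.mem_ker, phiHom_apply, div_eq_one, eq_comm]

theorem mem_nuHom_ker {s : X →* X} {x : X} : x ∈ (nuHom s).ker ↔ x * s x = 1 := by
  rw [MonoidHom.mem_ker, nuHom_apply]

theorem relIndex_map_map_of_ker_le {Y : Type*} [Group Y] (f : X →* Y) (H K : Subgroup X)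
    (hH : f.ker ≤ H) (hK : f.ker ≤ K) : (H.map f).relIndex (K.map f) = H.relIndex K := by
  rw [Subgroup.relIndex_map_map, sup_of_le_left hH, sup_of_le_left hK]

/-- Abstract form of the ambiguous class number formula. -/
theorem abstract_chevalley (s : X →* X) (t : I →* I) (π : X →* I)
    (hs : ∀ x, s (s x) = x) (ht : ∀ x, t (t x) = x)
    (hπ : ∀ x, π (s x) = t (π x))
    (h90 : ∀ x, x * s x = 1 → ∃ y, x = y / s y)
    (h90I : ∀ x, x * t x = 1 → ∃ y, x = y / t y)
    (J : Subgroup I) (hJ : J ≤ (phiHom t).ker)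
    (hKJ : ((phiHom s).ker).map π ≤ J)
    (hH : (π.ker.map (phiHom s)).relIndex (π.ker ⊓ (nuHom s).ker) =
      2 * (π.ker.map (nuHom s)).relIndex (π.ker ⊓ (phiHom s).ker)) :
    π.range.relIndex (π.range.comap (phiHom t)) * 2 *
      ((nuHom s).range.relIndex (π.ker ⊓ (phiHom s).ker)) =
    (((phiHom s).ker).map π).relIndex J * J.relIndex (phiHom t).ker := by
  have hφE : ∀ e, π e = 1 → π (s e) = 1 := fun e he => by rw [hπ, he, map_one]
  -- (a)
  have ha : (((phiHom s).ker).map π).relIndex ((phiHom t).ker ⊓ π.range) =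
      (π.ker.map (phiHom s)).relIndex (π.ker ⊓ (nuHom s).ker) := by
    set Y : Subgroup X := (π.ker).comap (phiHom s) with hY
    have e1 : ((phiHom s).ker).map π = ((phiHom s).ker ⊔ π.ker).map π := by
      rw [Subgroup.map_sup]; simp [(Subgroup.map_eq_bot_iff _).2 le_rfl]
    have e2 : (π.ker).map (phiHom s) = ((phiHom s).ker ⊔ π.ker).map (phiHom s) := by
      rw [Subgroup.map_sup]; simp [(Subgroup.map_eq_bot_iff _).2 le_rfl]
    have e3 : (phiHom t).ker ⊓ π.range = Y.map π := by
      ext i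
      constructor
      · rintro ⟨h1, x, rfl⟩
        refine ⟨x, ?_, rfl⟩
        replace h1 := mem_phiHom_ker.1 h1
        simp [hY, MonoidHom.mem_ker, hπ, h1]
      · rintro ⟨x, h1, rfl⟩
        refine ⟨mem_phiHom_ker.2 ?_, x, rfl⟩
        simp only [hY, SetLike.mem_coe, Subgroup.mem_comap, phiHom_apply, MonoidHom.mem_ker, map_div,
          div_eq_one, hπ] at h1
        exact h1.symm
    have e4 : π.ker ⊓ (nuHom s).ker = Y.map (phiHom s) := by
      ext i
      constructor
      · rintro ⟨h1, h2⟩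
        obtain ⟨y, rfl⟩ := h90 i (mem_nuHom_ker.1 h2)
        exact ⟨y, h1, rfl⟩
      · rintro ⟨x, h1, rfl⟩
        refine ⟨h1, mem_nuHom_ker.2 ?_⟩
        simp [hs]
    have hker1 : π.ker ≤ Y := fun e he => by
      simp only [hY, Subgroup.mem_comap, MonoidHom.mem_ker, phiHom_apply, map_div] at he ⊢
      rw [he, hφE e he, div_one]
    have hker2 : (phiHom s).ker ≤ Y := fun e he => by
      rw [hY, Subgroup.mem_comap, MonoidHom.mem_ker.1 he]; exact one_mem _
    rw [e1, e2, e3, e4, relIndex_map_map_of_ker_le _ _ _ le_sup_right hker1,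
      relIndex_map_map_of_ker_le _ _ _ le_sup_left hker2]
  -- (b)
  have hb : (π.range ⊔ (phiHom t).ker).relIndex (π.range.comap (phiHom t)) =
      (π.ker.map (nuHom s)).relIndex ((nuHom s).range ⊓ (π.ker ⊓ (phiHom s).ker)) := by
    set Y : Subgroup X := (π.ker).comap (nuHom s) with hY
    have hle : π.range ≤ π.range.comap (phiHom t) := by
      rintro _ ⟨x, rfl⟩
      exact ⟨x / s x, by simp [hπ]⟩
    have hle2 : (phiHom t).ker ≤ π.range.comap (phiHom t) := fun x hx => by
      rw [Subgroup.mem_comap, MonoidHom.mem_ker.1 hx]; exact one_mem _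
    rw [← relIndex_map_map_of_ker_le (phiHom t) _ _ le_sup_right hle2]
    have e1 : (π.range ⊔ (phiHom t).ker).map (phiHom t) = ((phiHom s).range ⊔ π.ker).map π := by
      rw [Subgroup.map_sup, (Subgroup.map_eq_bot_iff (phiHom t).ker).2 le_rfl, Subgroup.map_sup,
        (Subgroup.map_eq_bot_iff π.ker).2 le_rfl, sup_bot_eq, sup_bot_eq, MonoidHom.map_range,
        MonoidHom.map_range]
      congr 1
      ext x
      simp [hπ]
    have e2 : (π.range.comap (phiHom t)).map (phiHom t) = Y.map π := by
      ext i
      constructor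
      · rintro ⟨j, ⟨x, hx⟩, rfl⟩
        refine ⟨x, ?_, hx⟩
        simp only [hY, SetLike.mem_coe, Subgroup.mem_comap, MonoidHom.mem_ker, nuHom_apply, map_mul,
          hπ, hx, phiHom_apply, map_div, ht]
        simp
      · rintro ⟨x, hx, rfl⟩
        simp only [hY, SetLike.mem_coe, Subgroup.mem_comap, MonoidHom.mem_ker, nuHom_apply, map_mul,
          hπ] at hx
        obtain ⟨y, hy⟩ := h90I _ hx
        exact ⟨y, ⟨x, hy⟩, hy.symm⟩
    have hk : (nuHom s).ker = (phiHom s).range := by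
      ext x
      rw [mem_nuHom_ker]
      constructor
      · intro h
        obtain ⟨y, rfl⟩ := h90 x h
        exact ⟨y, rfl⟩
      · rintro ⟨y, rfl⟩
        simp [hs]
    have hEY : π.ker ≤ Y := fun e he => by
      simp only [hY, Subgroup.mem_comap, MonoidHom.mem_ker, nuHom_apply, map_mul] at he ⊢
      rw [he, hφE e he, one_mul]
    have hNY : (nuHom s).ker ≤ Y := fun x hx => by
      rw [hY, Subgroup.mem_comap, MonoidHom.mem_ker.1 hx]; exact one_mem _
    rw [e1, e2, relIndex_map_map_of_ker_le π _ _ le_sup_right hEY,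
      ← relIndex_map_map_of_ker_le (nuHom s) _ _ (hk ▸ le_sup_left) hNY, Subgroup.map_sup, ← hk,
      (Subgroup.map_eq_bot_iff (nuHom s).ker).2 le_rfl, bot_sup_eq]
    congr 1
    ext x
    constructor
    · rintro ⟨y, hy, rfl⟩
      refine ⟨⟨y, rfl⟩, hy, ?_⟩
      simp [hs, mul_comm, mem_phiHom_ker]
    · rintro ⟨⟨y, rfl⟩, h1, h2⟩
      exact ⟨y, h1, rfl⟩
  have h1 : π.range.relIndex (π.range.comap (phiHom t)) =
      π.range.relIndex (phiHom t).ker *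
      (π.range ⊔ (phiHom t).ker).relIndex (π.range.comap (phiHom t)) := by
    rw [← Subgroup.relIndex_sup_left (H := (phiHom t).ker) (K := π.range), Subgroup.relIndex_mul_relIndex _ _ _ le_sup_left]
    refine sup_le ?_ ?_
    · rintro _ ⟨x, rfl⟩
      exact ⟨x / s x, by simp [hπ]⟩
    · intro x hx
      rw [Subgroup.mem_comap, MonoidHom.mem_ker.1 hx]; exact one_mem _
  have h2 : (((phiHom s).ker).map π).relIndex J * J.relIndex (phiHom t).ker =
      (((phiHom s).ker).map π).relIndex ((phiHom t).ker ⊓ π.range) * π.range.relIndex (phiHom t).ker := by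
    rw [Subgroup.relIndex_mul_relIndex _ _ _ hKJ hJ, ← Subgroup.inf_relIndex_left (phiHom t).ker π.range,
      Subgroup.relIndex_mul_relIndex _ _ _ _ inf_le_left]
    refine le_inf (hKJ.trans hJ) ?_
    rintro _ ⟨x, _, rfl⟩
    exact ⟨x, rfl⟩
  have h3 : (π.ker.map (nuHom s)).relIndex (π.ker ⊓ (phiHom s).ker) =
      (π.ker.map (nuHom s)).relIndex ((nuHom s).range ⊓ (π.ker ⊓ (phiHom s).ker)) *
      (nuHom s).range.relIndex (π.ker ⊓ (phiHom s).ker) := by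
    rw [← Subgroup.inf_relIndex_right (nuHom s).range,
      Subgroup.relIndex_mul_relIndex _ _ _ _ inf_le_right]
    rintro _ ⟨x, hx, rfl⟩
    refine ⟨⟨x, rfl⟩, ?_, ?_⟩
    · have hx' := MonoidHom.mem_ker.1 hx
      simp [MonoidHom.mem_ker, hx', hφE x hx']
    · simp [hs, mul_comm, mem_phiHom_ker]
  rw [h1, h2, ha, hH, h3, hb]
  ring

end AbstractChevalley
end

section
section HerbrandQuotient

open Module

theorem index_two_nsmul (M : Type*) [AddCommGroup M] [Module.Finite ℤ M] (z : M) (hz0 : z ≠ 0)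
    (hz : ∀ x : M, x ∈ Submodule.torsion ℤ M ↔ x = 0 ∨ x = z) (hz2 : ∀ x : M, 2 • x ≠ z) :
    (nsmulAddMonoidHom (α := M) 2).range.index = 2 ^ (finrank ℤ M + 1) := by
  set T := Submodule.torsion ℤ M with hT
  haveI : Module.Free ℤ (M ⧸ T) := inferInstance
  have h1 : finrank ℤ (M ⧸ T) = finrank ℤ M := finrank_quotient_eq_of_le_torsion le_rfl
  have h2 := AddSubgroup.index_range_nsmul (M ⧸ T) 2
  let f : M →+ M ⧸ T := T.mkQ.toAddMonoidHom
  have hf : Function.Surjective f := T.mkQ_surjective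
  set S := (nsmulAddMonoidHom (α := M) 2).range with hS
  have hker : f.ker = T.toAddSubgroup := by
    ext x
    simp [f]
  have h3 : (S ⊔ T.toAddSubgroup).index = 2 ^ finrank ℤ M := by
    rw [← h1, ← h2, ← AddSubgroup.index_map_eq (f := f) _ hf (by rw [hker]; exact le_sup_right)]
    congr 1
    rw [AddSubgroup.map_sup, ← hker, (AddSubgroup.map_eq_bot_iff _).2 le_rfl, sup_bot_eq]
    ext x
    constructor
    · rintro ⟨_, ⟨y, rfl⟩, rfl⟩
      exact ⟨f y, by simp⟩
    · rintro ⟨y, rfl⟩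
      obtain ⟨y, rfl⟩ := hf y
      exact ⟨2 • y, ⟨y, rfl⟩, by simp⟩
  have h4 : S.relIndex T.toAddSubgroup = 2 := by
    rw [← AddSubgroup.inf_relIndex_right]
    have : S ⊓ T.toAddSubgroup = ⊥ := by
      rw [eq_bot_iff]
      rintro x ⟨⟨y, rfl⟩, h⟩
      rcases (hz _).1 h with h | h
      · exact h
      · exact absurd h (hz2 y)
    rw [this, AddSubgroup.relIndex_bot_left]
    have : (T.toAddSubgroup : Set M) = {0, z} := by
      ext x; simpa using hz x
    rw [← SetLike.coe_sort_coe, this, Nat.card_coe_set_eq, Set.ncard_pair hz0.symm]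
  rw [pow_succ, ← h3, ← AddSubgroup.relIndex_mul_index (le_sup_left : S ≤ S ⊔ T.toAddSubgroup),
    AddSubgroup.relIndex_sup_left, h4, mul_comm]

theorem index_squares (M : Type*) [CommGroup M] [Module.Finite ℤ (Additive M)] (z : M) (hz0 : z ≠ 1)
    (hz2' : z ^ 2 = 1)
    (hz : ∀ x : M, IsOfFinOrder x → x = 1 ∨ x = z) (hz2 : ∀ x : M, x ^ 2 ≠ z) :
    (powMonoidHom (α := M) 2).range.index = 2 ^ (finrank ℤ (Additive M) + 1) := by
  rw [← index_two_nsmul (Additive M) (Additive.ofMul z) hz0 _ hz2]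
  · rfl
  intro x
  rw [Submodule.mem_torsion_iff]
  constructor
  · rintro ⟨⟨n, hn⟩, h⟩
    have hn' : n ≠ 0 := nonZeroDivisors.ne_zero hn
    refine hz x.toMul (isOfFinOrder_iff_zpow_eq_one.2 ⟨n, hn', h⟩)
  · have h2 : (2 : ℤ) ∈ nonZeroDivisors ℤ := by simp
    rintro (h | h) <;> rw [h]
    · exact ⟨⟨2, h2⟩, by simp⟩
    · refine ⟨⟨2, h2⟩, ?_⟩
      show (2 : ℤ) • Additive.ofMul z = 0
      rw [two_zsmul, ← ofMul_mul, ← sq, hz2', ofMul_one]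

theorem relIndex_squares {M : Type*} [CommGroup M] [Module.Finite ℤ (Additive M)] (S : Subgroup M)
    (z : M) (hzS : z ∈ S) (hz0 : z ≠ 1)
    (hz2' : z ^ 2 = 1)
    (hz : ∀ x : M, IsOfFinOrder x → x = 1 ∨ x = z) (hz2 : ∀ x : M, x ^ 2 ≠ z) :
    (S.map (powMonoidHom (α := M) 2)).relIndex S = 2 ^ (finrank ℤ (Additive S) + 1) := by
  haveI : Module.Finite ℤ (Additive S) :=
    Module.Finite.of_injective (M := Additive S) (N := Additive M)
      (S.subtype.toAdditive.toIntLinearMap) (fun a b h => Subtype.ext h)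
  rw [← index_squares S ⟨z, hzS⟩ (fun h => hz0 (congrArg Subtype.val h)) (Subtype.ext hz2')
    (fun x hx => ?_) (fun x hx => hz2 x (congrArg Subtype.val hx)), Subgroup.relIndex]
  · congr 1
    ext x
    simp only [Subgroup.mem_subgroupOf, Subgroup.mem_map, MonoidHom.mem_range, powMonoidHom_apply]
    constructor
    · rintro ⟨y, hy, h⟩
      exact ⟨⟨y, hy⟩, Subtype.ext h⟩
    · rintro ⟨y, h⟩
      exact ⟨y, y.2, congrArg Subtype.val h⟩
  · rcases hz x ((Submonoid.isOfFinOrder_coe (H := S.toSubmonoid) (x := x)).2 hx) with h | h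
    · exact Or.inl (Subtype.ext h)
    · exact Or.inr (Subtype.ext h)

theorem finrank_plus_minus {E : Type*} [AddCommGroup E] [Module.Finite ℤ E] (s : E →ₗ[ℤ] E)
    (hs : ∀ x, s (s x) = x) :
    finrank ℤ (LinearMap.ker (LinearMap.id - s)) + finrank ℤ (LinearMap.ker (LinearMap.id + s)) =
      finrank ℤ E := by
  set P := LinearMap.ker (LinearMap.id - s)
  set Q := LinearMap.ker (LinearMap.id + s)
  apply le_antisymm
  · have hsum : finrank ℤ P + finrank ℤ Q =
        finrank ℤ (P ⊔ Q : Submodule ℤ E) + finrank ℤ (P ⊓ Q : Submodule ℤ E) := by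
      have := Submodule.rank_sup_add_rank_inf_eq P Q
      rw [← finrank_eq_rank, ← finrank_eq_rank, ← finrank_eq_rank, ← finrank_eq_rank] at this
      exact_mod_cast this.symm
    rw [hsum]
    have : finrank ℤ (P ⊓ Q : Submodule ℤ E) = 0 := by
      rw [Module.finrank_eq_zero_iff_isTorsion]
      rintro ⟨x, hx1, hx2⟩
      refine ⟨⟨2, by simp⟩, Subtype.ext ?_⟩
      simp only [P, Q, SetLike.mem_coe, LinearMap.mem_ker, LinearMap.sub_apply, LinearMap.add_apply,
        LinearMap.id_apply] at hx1 hx2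
      show (2 : ℤ) • x = 0
      calc (2 : ℤ) • x = (x - s x) + (x + s x) := by rw [two_zsmul]; abel
        _ = 0 := by rw [hx1, hx2, add_zero]
    rw [this, add_zero]
    exact Submodule.finrank_le _
  · have h1 := Submodule.finrank_quotient_add_finrank P
    rw [LinearEquiv.finrank_eq (LinearMap.quotKerEquivRange (LinearMap.id - s))] at h1
    have h2 : LinearMap.range (LinearMap.id - s) ≤ Q := by
      rintro _ ⟨x, rfl⟩
      simp [Q, hs]
    have := Submodule.finrank_mono h2
    omega

/-- Herbrand quotient of the unit group of a totally real field under an involution. -/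
theorem herbrand_two {E : Type*} [CommGroup E] [Module.Finite ℤ (Additive E)] (s : E →* E)
    (hs : ∀ x, s (s x) = x) (z : E) (hz0 : z ≠ 1) (hz2' : z ^ 2 = 1) (hzs : s z = z)
    (hz : ∀ x : E, IsOfFinOrder x → x = 1 ∨ x = z) (hz2 : ∀ x : E, x ^ 2 ≠ z)
    (hr : finrank ℤ (Additive E) = 2 * finrank ℤ (Additive (phiHom s).ker) + 1) :
    ((phiHom s).range).relIndex ((nuHom s).ker) =
      2 * ((nuHom s).range).relIndex ((phiHom s).ker) := by
  have hrk : finrank ℤ (Additive (nuHom s).ker) = finrank ℤ (Additive (phiHom s).ker) + 1 := by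
    have := finrank_plus_minus s.toAdditive.toIntLinearMap hs
    have e1 : finrank ℤ (Additive (phiHom s).ker) =
        finrank ℤ (LinearMap.ker (LinearMap.id - s.toAdditive.toIntLinearMap)) :=
      LinearEquiv.finrank_eq (AddEquiv.toIntLinearEquiv
        { toFun := fun x => ⟨Additive.ofMul (x.toMul : E), x.toMul.2⟩
          invFun := fun x => Additive.ofMul ⟨(x : Additive E).toMul, x.2⟩
          left_inv := fun x => rfl
          right_inv := fun x => rfl
          map_add' := fun x y => rfl })
    have e2 : finrank ℤ (Additive (nuHom s).ker) =
        finrank ℤ (LinearMap.ker (LinearMap.id + s.toAdditive.toIntLinearMap)) :=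
      LinearEquiv.finrank_eq (AddEquiv.toIntLinearEquiv
        { toFun := fun x => ⟨Additive.ofMul (x.toMul : E), x.toMul.2⟩
          invFun := fun x => Additive.ofMul ⟨(x : Additive E).toMul, x.2⟩
          left_inv := fun x => rfl
          right_inv := fun x => rfl
          map_add' := fun x y => rfl })
    omega
  set P := (phiHom s).ker with hP
  set Q := (nuHom s).ker with hQ
  have sP := relIndex_squares P z (by rw [hP, mem_phiHom_ker, hzs]) hz0 hz2' hz hz2
  have sQ := relIndex_squares Q z (by rw [hQ, mem_nuHom_ker, hzs, ← sq, hz2']) hz0 hz2' hz hz2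
  have eP : P.map (powMonoidHom 2) = (P ⊔ Q).map (nuHom s) := by
    rw [Subgroup.map_sup, hQ, (Subgroup.map_eq_bot_iff (nuHom s).ker).2 le_rfl, sup_bot_eq]
    ext x
    constructor <;> rintro ⟨y, hy, rfl⟩ <;> refine ⟨y, hy, ?_⟩ <;>
      simp [mem_phiHom_ker.1 hy, sq]
  have eQ : Q.map (powMonoidHom 2) = (P ⊔ Q).map (phiHom s) := by
    rw [Subgroup.map_sup, hP, (Subgroup.map_eq_bot_iff (phiHom s).ker).2 le_rfl, bot_sup_eq]
    ext x
    constructor <;> rintro ⟨y, hy, rfl⟩ <;> refine ⟨y, hy, ?_⟩ <;>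
      simp [eq_inv_of_mul_eq_one_right (mem_nuHom_ker.1 hy), sq]
  have rP : (nuHom s).range ≤ P := by
    rintro _ ⟨x, rfl⟩; simp [hP, mem_phiHom_ker, hs, mul_comm]
  have rQ : (phiHom s).range ≤ Q := by
    rintro _ ⟨x, rfl⟩; simp [hQ, mem_nuHom_ker, hs]
  have mP : (P.map (powMonoidHom 2)).relIndex (nuHom s).range = (P ⊔ Q).index := by
    rw [eP, MonoidHom.range_eq_map, relIndex_map_map_of_ker_le _ _ _ (hQ ▸ le_sup_right) le_top,
      Subgroup.relIndex_top_right]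
  have mQ : (Q.map (powMonoidHom 2)).relIndex (phiHom s).range = (P ⊔ Q).index := by
    rw [eQ, MonoidHom.range_eq_map, relIndex_map_map_of_ker_le _ _ _ (hP ▸ le_sup_left) le_top,
      Subgroup.relIndex_top_right]
  rw [← Subgroup.relIndex_mul_relIndex _ (nuHom s).range P
    (by rw [eP]; exact Subgroup.map_le_range _ _) rP, mP] at sP
  rw [← Subgroup.relIndex_mul_relIndex _ (phiHom s).range Q
    (by rw [eQ]; exact Subgroup.map_le_range _ _) rQ, mQ, hrk, pow_succ, ← sP] at sQ
  have h0 : (P ⊔ Q).index ≠ 0 := by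
    intro h; rw [h, zero_mul] at sP; exact absurd sP.symm (by positivity)
  apply Nat.eq_of_mul_eq_mul_left (Nat.pos_of_ne_zero h0)
  rw [sQ]; ring

end HerbrandQuotient
end

section
open scoped nonZeroDivisors

section IdealAction
variable {L : Type*} [Field L] [NumberField L]

/-- Units of the group of fractional ideals. -/
abbrev FI (L : Type*) [Field L] [NumberField L] := (FractionalIdeal (𝓞 L)⁰ L)ˣ

/-- The Galois action on fractional ideals. -/
noncomputable def idAct (σ : L ≃ₐ[ℚ] L) : FI L →* FI L :=
  Units.map ((FractionalIdeal.ringEquivOfRingEquiv L L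
    (RingOfIntegers.mapRingEquiv (σ : L ≃+* L)) :
      FractionalIdeal (𝓞 L)⁰ L ≃+* FractionalIdeal (𝓞 L)⁰ L) :
      FractionalIdeal (𝓞 L)⁰ L →* FractionalIdeal (𝓞 L)⁰ L)

theorem frac_act (σ : L ≃ₐ[ℚ] L) (x : L) :
    IsFractionRing.ringEquivOfRingEquiv (K := L) (L := L)
      (RingOfIntegers.mapRingEquiv (σ : L ≃+* L)) x = σ x := by
  obtain ⟨a, b, hb, rfl⟩ := IsFractionRing.div_surjective (A := 𝓞 L) x
  rw [map_div₀, map_div₀, IsFractionRing.ringEquivOfRingEquiv_algebraMap,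
    IsFractionRing.ringEquivOfRingEquiv_algebraMap]
  rfl

theorem idAct_principal (σ : L ≃ₐ[ℚ] L) (x : Lˣ) :
    idAct σ (toPrincipalIdeal (𝓞 L) L x)
      = toPrincipalIdeal (𝓞 L) L (Units.map (σ : L →* L) x) := by
  ext1
  rw [coe_toPrincipalIdeal]
  change FractionalIdeal.ringEquivOfRingEquiv L L
    (RingOfIntegers.mapRingEquiv (σ : L ≃+* L)) _ = _
  rw [coe_toPrincipalIdeal, FractionalIdeal.ringEquivOfRingEquiv_spanSingleton, frac_act]
  rfl

theorem mem_idAct (σ : L ≃ₐ[ℚ] L) (I : FI L) (x : L) :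
    x ∈ (idAct σ I : FractionalIdeal (𝓞 L)⁰ L) ↔
      ∃ y ∈ (I : FractionalIdeal (𝓞 L)⁰ L), σ y = x := by
  change x ∈ (FractionalIdeal.ringEquivOfRingEquiv L L
    (RingOfIntegers.mapRingEquiv (σ : L ≃+* L))
      (I : FractionalIdeal (𝓞 L)⁰ L)).val ↔ _
  rw [FractionalIdeal.ringEquivOfRingEquiv_apply_val]
  constructor
  · rintro ⟨y, hy, rfl⟩
    exact ⟨y, hy, (frac_act σ y).symm⟩
  · rintro ⟨y, hy, rfl⟩
    exact ⟨y, hy, frac_act σ y⟩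

theorem idAct_mul (σ τ : L ≃ₐ[ℚ] L) (I : FI L) :
    idAct (σ * τ) I = idAct σ (idAct τ I) := by
  ext1
  ext x
  rw [mem_idAct, mem_idAct]
  constructor
  · rintro ⟨y, hy, rfl⟩
    exact ⟨τ y, (mem_idAct _ _ _).2 ⟨y, hy, rfl⟩, rfl⟩
  · rintro ⟨y, hy, rfl⟩
    obtain ⟨z, hz, rfl⟩ := (mem_idAct _ _ _).1 hy
    exact ⟨z, hz, rfl⟩

theorem idAct_one (I : FI L) : idAct (1 : L ≃ₐ[ℚ] L) I = I := by
  ext1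
  ext x
  rw [mem_idAct]
  simp

theorem mk_eq_one_iff' (I : FI L) :
    ClassGroup.mk L I = 1 ↔ I ∈ (toPrincipalIdeal (𝓞 L) L).range := by
  rw [← (ClassGroup.equiv L).injective.eq_iff]
  simp only [ClassGroup.equiv_mk, FractionalIdeal.canonicalEquiv_self, RingEquiv.coe_mulEquiv_refl,
    QuotientGroup.mk'_apply, map_one, QuotientGroup.eq_one_iff]
  rfl

theorem mk_ker : (ClassGroup.mk L : FI L →* ClassGroup (𝓞 L)).ker
    = (toPrincipalIdeal (𝓞 L) L).range := by
  ext I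
  rw [MonoidHom.mem_ker, mk_eq_one_iff']

theorem mk_surj : Function.Surjective (ClassGroup.mk L : FI L →* ClassGroup (𝓞 L)) := by
  intro c
  obtain ⟨I, rfl⟩ := ClassGroup.mk0_surjective c
  exact ⟨_, ClassGroup.mk_mk0 L I⟩

/-- The Galois action on the class group. -/
noncomputable def clAct (σ : L ≃ₐ[ℚ] L) : ClassGroup (𝓞 L) →* ClassGroup (𝓞 L) :=
  (QuotientGroup.lift (toPrincipalIdeal (𝓞 L) L).range ((ClassGroup.mk L).comp (idAct σ)) (by
    rintro _ ⟨x, rfl⟩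
    rw [MonoidHom.mem_ker, MonoidHom.comp_apply, idAct_principal, mk_eq_one_iff']
    exact ⟨_, rfl⟩)).comp (ClassGroup.equiv L : _ ≃* _).toMonoidHom

theorem clAct_mk (σ : L ≃ₐ[ℚ] L) (I : FI L) :
    clAct σ (ClassGroup.mk L I) = ClassGroup.mk L (idAct σ I) := by
  have : ClassGroup.equiv L (ClassGroup.mk L I) = QuotientGroup.mk I := by
    rw [ClassGroup.equiv_mk]
    simp only [FractionalIdeal.canonicalEquiv_self, RingEquiv.coe_mulEquiv_refl,
    QuotientGroup.mk'_apply]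
    rfl
  simp only [clAct, MonoidHom.comp_apply]
  change QuotientGroup.lift _ _ _ (ClassGroup.equiv L (ClassGroup.mk L I)) = _
  rw [this]
  rfl

theorem clAct_mul (σ τ : L ≃ₐ[ℚ] L) (c : ClassGroup (𝓞 L)) :
    clAct (σ * τ) c = clAct σ (clAct τ c) := by
  obtain ⟨I, rfl⟩ := mk_surj c
  simp only [clAct_mk, idAct_mul]

theorem clAct_one (c : ClassGroup (𝓞 L)) : clAct (1 : L ≃ₐ[ℚ] L) c = c := by
  obtain ⟨I, rfl⟩ := mk_surj c
  simp only [clAct_mk, idAct_one]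

/-- Hilbert 90 for ideals. -/
theorem h90_ideal (σ : L ≃ₐ[ℚ] L) (hσ : ∀ x, σ (σ x) = x) (I : FI L)
    (hI : I * idAct σ I = 1) : ∃ J : FI L, I = J / idAct σ J := by
  have hne : (1 : FractionalIdeal (𝓞 L)⁰ L) + (I : FractionalIdeal (𝓞 L)⁰ L) ≠ 0 := by
    intro h
    have h1 : (1 : FractionalIdeal (𝓞 L)⁰ L) ≤ 1 + (I : FractionalIdeal (𝓞 L)⁰ L) := by
      exact le_add_of_nonneg_right (by simp)
    rw [h] at h1
    have : (1 : FractionalIdeal (𝓞 L)⁰ L) = 0 := le_antisymm h1 (by simp)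
    exact one_ne_zero this
  refine ⟨Units.mk0 _ hne, ?_⟩
  rw [eq_div_iff_mul_eq']
  ext1
  have hI' : (idAct σ I : FractionalIdeal (𝓞 L)⁰ L) * I = 1 := by
    rw [mul_comm, ← Units.val_mul, hI]; rfl
  have : ((idAct σ (Units.mk0 _ hne) : FI L) : FractionalIdeal (𝓞 L)⁰ L)
      = 1 + (idAct σ I : FractionalIdeal (𝓞 L)⁰ L) := by
    change FractionalIdeal.ringEquivOfRingEquiv L L _ (1 + (I : FractionalIdeal (𝓞 L)⁰ L)) = _
    rw [map_add, map_one]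
    rfl
  rw [Units.val_mul, this, mul_comm, add_mul, hI', one_mul, Units.val_mk0, add_comm]

theorem h90_units (σ : L ≃ₐ[ℚ] L) (hσ : ∀ x, σ (σ x) = x) (hne : ∃ x, σ x ≠ x) (x : Lˣ)
    (hx : x * Units.map (σ : L →* L) x = 1) : ∃ y : Lˣ, x = y / Units.map (σ : L →* L) y := by
  have hx' : (x : L) * σ x = 1 := by
    have := congrArg Units.val hx
    simpa using this
  by_cases h : (x : L) = -1
  · obtain ⟨d, hd⟩ := hne
    have hd' : d - σ d ≠ 0 := fun h => hd (sub_eq_zero.1 h).symm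
    refine ⟨Units.mk0 _ hd', ?_⟩
    rw [eq_div_iff_mul_eq']
    ext1
    simp [h, hσ]
  · have hd' : 1 + (x : L) ≠ 0 := fun h' => h (eq_neg_of_add_eq_zero_right h')
    refine ⟨Units.mk0 _ hd', ?_⟩
    rw [eq_div_iff_mul_eq']
    ext1
    simp only [Units.val_mul, Units.coe_map, Units.val_mk0, MonoidHom.coe_coe, map_add, map_one]
    rw [mul_add, mul_one, hx', add_comm]

end IdealAction
end

section
open scoped nonZeroDivisors

/-- `σ` is the nontrivial automorphism of the quadratic extension `L/K`. -/
structure IsQuad (K L : Type*) [Field K] [NumberField K] [Field L] [NumberField L] [Algebra K L]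
    (σ : L ≃ₐ[ℚ] L) : Prop where
  invol : ∀ x, σ (σ x) = x
  fix : ∀ x, σ x = x ↔ ∃ y : K, algebraMap K L y = x
  ne : ∃ x, σ x ≠ x

section Quad
variable {K L : Type*} [Field K] [NumberField K] [Field L] [NumberField L] [Algebra K L]
  {σ : L ≃ₐ[ℚ] L}

theorem IsQuad.fixK (h : IsQuad K L σ) (y : K) : σ (algebraMap K L y) = algebraMap K L y :=
  (h.fix _).2 ⟨y, rfl⟩

theorem IsQuad.finrank (h : IsQuad K L σ) : Module.finrank K L = 2 := by
  obtain ⟨d, hd⟩ := h.ne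
  set δ := d - σ d with hδ
  have hδ0 : δ ≠ 0 := fun h => hd (sub_eq_zero.1 h).symm
  have hδs : σ δ = -δ := by simp [hδ, h.invol]
  let f : (K × K) →ₗ[K] L :=
    { toFun := fun a => algebraMap K L a.1 + algebraMap K L a.2 * δ
      map_add' := by intro a b; simp; ring
      map_smul' := by intro a b; simp [Algebra.smul_def]; ring }
  have hf : Function.Bijective f := by
    constructor
    · rw [injective_iff_map_eq_zero]
      rintro ⟨a, b⟩ hab
      have h1 : algebraMap K L a + algebraMap K L b * δ = 0 := hab
      have h2 := congrArg σ h1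
      simp only [map_add, map_mul, h.fixK, hδs, map_zero] at h2
      have h3 : (2 : L) * algebraMap K L a = 0 := by linear_combination h1 + h2
      have h4 : algebraMap K L a = 0 := by simpa using h3
      have h5 : algebraMap K L b = 0 := by
        rw [h4, zero_add] at h1
        simpa [hδ0] using h1
      simp only [map_eq_zero] at h4 h5
      simp [h4, h5]
    · intro x
      have h1 : σ ((x + σ x) / 2) = (x + σ x) / 2 := by
        rw [map_div₀, map_add, h.invol, map_ofNat, add_comm]
      have h2 : σ ((x - σ x) / (2 * δ)) = (x - σ x) / (2 * δ) := by
        rw [map_div₀, map_sub, h.invol, map_mul, map_ofNat, hδs]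
        field_simp
        ring
      obtain ⟨a, ha⟩ := (h.fix _).1 h1
      obtain ⟨b, hb⟩ := (h.fix _).1 h2
      refine ⟨(a, b), ?_⟩
      change algebraMap K L a + algebraMap K L b * δ = x
      rw [ha, hb]
      field_simp
      ring
  rw [← (LinearEquiv.ofBijective f hf).finrank_eq]
  simp

/-- Galois action on units of the ring of integers. -/
noncomputable def uAct (σ : L ≃ₐ[ℚ] L) : (𝓞 L)ˣ →* (𝓞 L)ˣ :=
  Units.map ((RingOfIntegers.mapRingEquiv (σ : L ≃+* L) : 𝓞 L ≃+* 𝓞 L) : 𝓞 L →* 𝓞 L)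

/-- Galois action on nonzero elements. -/
noncomputable def lAct (σ : L ≃ₐ[ℚ] L) : Lˣ →* Lˣ := Units.map (σ : L →* L)

theorem lAct_val (σ : L ≃ₐ[ℚ] L) (x : Lˣ) : ((lAct σ x : Lˣ) : L) = σ x := rfl

/-- Inclusion of units. -/
noncomputable def uEmb (L : Type*) [Field L] [NumberField L] : (𝓞 L)ˣ →* Lˣ :=
  Units.map (algebraMap (𝓞 L) L : 𝓞 L →* L)

theorem uEmb_inj : Function.Injective (uEmb L) :=
  Units.map_injective (RingOfIntegers.coe_injective)

theorem uEmb_uAct (x : (𝓞 L)ˣ) : uEmb L (uAct σ x) = lAct σ (uEmb L x) := rfl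

theorem principal_ker : (toPrincipalIdeal (𝓞 L) L).ker = (uEmb L).range := by
  ext x
  rw [MonoidHom.mem_ker]
  constructor
  · intro hx
    have h1 : FractionalIdeal.spanSingleton (𝓞 L)⁰ (x : L) = 1 := by
      have := congrArg Units.val hx
      rwa [coe_toPrincipalIdeal] at this
    have h2 : FractionalIdeal.spanSingleton (𝓞 L)⁰ ((x⁻¹ : Lˣ) : L) = 1 := by
      have hx' : toPrincipalIdeal (𝓞 L) L x⁻¹ = 1 := by rw [map_inv, hx, inv_one]
      have := congrArg Units.val hx'
      rwa [coe_toPrincipalIdeal] at this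
    have m1 : (x : L) ∈ (1 : FractionalIdeal (𝓞 L)⁰ L) := by
      rw [← h1]; exact FractionalIdeal.mem_spanSingleton_self _ _
    have m2 : ((x⁻¹ : Lˣ) : L) ∈ (1 : FractionalIdeal (𝓞 L)⁰ L) := by
      rw [← h2]; exact FractionalIdeal.mem_spanSingleton_self _ _
    obtain ⟨a, ha⟩ := (FractionalIdeal.mem_one_iff _).1 m1
    obtain ⟨b, hb⟩ := (FractionalIdeal.mem_one_iff _).1 m2
    have hab : a * b = 1 := by
      apply RingOfIntegers.coe_injective
      change algebraMap (𝓞 L) L (a * b) = algebraMap (𝓞 L) L 1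
      rw [map_mul, ha, hb, map_one]; simp
    refine ⟨⟨a, b, hab, by rw [mul_comm, hab]⟩, ?_⟩
    ext1
    exact ha
  · rintro ⟨u, rfl⟩
    ext1
    rw [coe_toPrincipalIdeal]
    have : FractionalIdeal.spanSingleton (𝓞 L)⁰ ((uEmb L u : Lˣ) : L) =
       ((Ideal.span {(u : 𝓞 L)} : Ideal (𝓞 L)) : FractionalIdeal (𝓞 L)⁰ L) := by
      rw [FractionalIdeal.coeIdeal_span_singleton]; rfl
    rw [this, Ideal.span_singleton_eq_top.2 u.isUnit]
    simp

theorem uAct_invol (h : IsQuad K L σ) (x : (𝓞 L)ˣ) : uAct σ (uAct σ x) = x := by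
  apply uEmb_inj
  rw [uEmb_uAct, uEmb_uAct]
  ext1
  exact h.invol _

theorem exists_real_emb [IsTotallyReal L] : Nonempty (L →+* ℝ) := by
  obtain ⟨w⟩ : Nonempty (InfinitePlace L) := inferInstance
  exact ⟨InfinitePlace.embedding_of_isReal (IsTotallyReal.isReal w)⟩

theorem inj_real_emb (f : L →+* ℝ) : Function.Injective f := f.injective

theorem torsion_real [IsTotallyReal L] (x : (𝓞 L)ˣ) (hx : IsOfFinOrder x) : x = 1 ∨ x = -1 := by
  obtain ⟨f⟩ := exists_real_emb (L := L)
  obtain ⟨n, hn, hx⟩ := isOfFinOrder_iff_pow_eq_one.1 hx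
  let g : 𝓞 L →+* ℝ := f.comp (algebraMap (𝓞 L) L)
  have hg : Function.Injective g := f.injective.comp RingOfIntegers.coe_injective
  have h1 : (g x) ^ n = 1 := by
    rw [← map_pow, ← Units.val_pow_eq_pow_val, hx]; simp
  have h2 : |g x| = 1 := by
    have : |g x| ^ n = 1 := by rw [← abs_pow, h1, abs_one]
    exact (pow_eq_one_iff_of_nonneg (abs_nonneg _) (by omega)).1 this
  rcases eq_or_eq_neg_of_abs_eq h2 with h3 | h3
  · left; ext1; apply hg; simp [h3]
  · right; ext1; apply hg; simp [h3]

theorem fixed_ker_equiv (h : IsQuad K L σ) :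
    Nonempty ((𝓞 K)ˣ ≃* (phiHom (uAct σ)).ker) := by
  let f : (𝓞 K)ˣ →* (𝓞 L)ˣ := Units.map (algebraMap (𝓞 K) (𝓞 L) : 𝓞 K →* 𝓞 L)
  have hf : Function.Injective f :=
    Units.map_injective (FaithfulSMul.algebraMap_injective (𝓞 K) (𝓞 L))
  have hr : f.range = (phiHom (uAct σ)).ker := by
    ext x
    rw [mem_phiHom_ker]
    constructor
    · rintro ⟨u, rfl⟩
      apply uEmb_inj
      rw [uEmb_uAct]
      ext1
      exact h.fixK _
    · intro hx
      have h1 : σ ((x : 𝓞 L) : L) = ((x : 𝓞 L) : L) :=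
        congrArg (fun u : (𝓞 L)ˣ => ((u : 𝓞 L) : L)) hx
      have h2 : σ (((x⁻¹ : (𝓞 L)ˣ) : 𝓞 L) : L) = (((x⁻¹ : (𝓞 L)ˣ) : 𝓞 L) : L) := by
        have hx' : uAct σ x⁻¹ = x⁻¹ := by rw [map_inv, hx]
        exact congrArg (fun u : (𝓞 L)ˣ => ((u : 𝓞 L) : L)) hx'
      obtain ⟨a, ha⟩ := (h.fix _).1 h1
      obtain ⟨b, hb⟩ := (h.fix _).1 h2
      have ia : IsIntegral ℤ a := by
        rw [← isIntegral_algebraMap_iff (algebraMap K L).injective, ha]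
        exact RingOfIntegers.isIntegral_coe _
      have ib : IsIntegral ℤ b := by
        rw [← isIntegral_algebraMap_iff (algebraMap K L).injective, hb]
        exact RingOfIntegers.isIntegral_coe _
      have hab : a * b = 1 := by
        apply (algebraMap K L).injective
        rw [map_mul, ha, hb, map_one]
        have := congrArg (fun u : (𝓞 L)ˣ => ((u : 𝓞 L) : L)) (mul_inv_cancel x)
        simpa using this
      refine ⟨⟨⟨a, ia⟩, ⟨b, ib⟩, ?_, ?_⟩, ?_⟩
      · apply RingOfIntegers.coe_injective; exact hab
      · apply RingOfIntegers.coe_injective; exact (mul_comm b a).trans hab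
      · ext1
        apply RingOfIntegers.coe_injective
        exact ha
  exact ⟨(MonoidHom.ofInjective hf).trans (MulEquiv.subgroupCongr hr)⟩

theorem herbrand_units (h : IsQuad K L σ) [IsTotallyReal L] :
    (phiHom (uAct σ)).range.relIndex (nuHom (uAct σ)).ker
      = 2 * (nuHom (uAct σ)).range.relIndex (phiHom (uAct σ)).ker := by
  have hK : IsTotallyReal K := IsTotallyReal.of_algebra K L
  obtain ⟨e⟩ := fixed_ker_equiv h
  apply herbrand_two (uAct σ) (uAct_invol h) (-1)
  · intro h1
    obtain ⟨f⟩ := exists_real_emb (L := L)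
    have := congrArg (fun u : (𝓞 L)ˣ => ((u : 𝓞 L) : L)) h1
    simp at this
    norm_num at this
  · simp
  · ext1; simp [uAct]
  · exact torsion_real
  · intro x hx
    obtain ⟨f⟩ := exists_real_emb (L := L)
    have := congrArg (fun u : (𝓞 L)ˣ => f ((u : 𝓞 L) : L)) hx
    simp at this
    nlinarith [sq_nonneg (f ((x : 𝓞 L) : L))]
  · have e' : Additive (𝓞 K)ˣ ≃ₗ[ℤ] Additive (phiHom (uAct σ)).ker :=
      (MulEquiv.toAdditive e).toIntLinearEquiv
    rw [← e'.finrank_eq, Units.finrank_eq, Units.finrank_eq]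
    unfold Units.rank
    have h1 := Module.finrank_mul_finrank ℚ K L
    have hL : Module.finrank ℚ L = Fintype.card (InfinitePlace L) := by
      have := IsTotallyReal.finrank (K := L)
      rw [this]
      have := InfinitePlace.card_eq_nrRealPlaces_add_nrComplexPlaces (K := L)
      rw [this, IsTotallyReal.nrComplexPlaces_eq_zero, add_zero]
    have hK' : Module.finrank ℚ K = Fintype.card (InfinitePlace K) := by
      have := IsTotallyReal.finrank (K := K)
      rw [this]
      have := InfinitePlace.card_eq_nrRealPlaces_add_nrComplexPlaces (K := K)
      rw [this, IsTotallyReal.nrComplexPlaces_eq_zero, add_zero]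
    rw [h.finrank, hL, hK'] at h1
    have : 0 < Fintype.card (InfinitePlace K) := Fintype.card_pos
    omega

theorem herbrand_L (h : IsQuad K L σ) [IsTotallyReal L] :
    ((toPrincipalIdeal (𝓞 L) L).ker.map (phiHom (lAct σ))).relIndex
        ((toPrincipalIdeal (𝓞 L) L).ker ⊓ (nuHom (lAct σ)).ker)
      = 2 * ((toPrincipalIdeal (𝓞 L) L).ker.map (nuHom (lAct σ))).relIndex
        ((toPrincipalIdeal (𝓞 L) L).ker ⊓ (phiHom (lAct σ)).ker) := by
  rw [principal_ker]
  have e1 : (uEmb L).range.map (phiHom (lAct σ)) = (phiHom (uAct σ)).range.map (uEmb L) := by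
    rw [MonoidHom.range_eq_map, MonoidHom.range_eq_map, Subgroup.map_map, Subgroup.map_map]
    congr 1
  have e2 : (uEmb L).range.map (nuHom (lAct σ)) = (nuHom (uAct σ)).range.map (uEmb L) := by
    rw [MonoidHom.range_eq_map, MonoidHom.range_eq_map, Subgroup.map_map, Subgroup.map_map]
    congr 1
  have e3 : (uEmb L).range ⊓ (nuHom (lAct σ)).ker = (nuHom (uAct σ)).ker.map (uEmb L) := by
    ext x
    constructor
    · rintro ⟨⟨u, rfl⟩, hx⟩
      refine ⟨u, ?_, rfl⟩
      change uEmb L u ∈ (nuHom (lAct σ)).ker at hx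
      change u ∈ (nuHom (uAct σ)).ker
      rw [mem_nuHom_ker] at hx ⊢
      apply uEmb_inj
      rw [map_mul, uEmb_uAct, hx, map_one]
    · rintro ⟨u, hu, rfl⟩
      refine ⟨⟨u, rfl⟩, ?_⟩
      change u ∈ (nuHom (uAct σ)).ker at hu
      change uEmb L u ∈ (nuHom (lAct σ)).ker
      rw [mem_nuHom_ker] at hu ⊢
      rw [← uEmb_uAct, ← map_mul, hu, map_one]
  have e4 : (uEmb L).range ⊓ (phiHom (lAct σ)).ker = (phiHom (uAct σ)).ker.map (uEmb L) := by
    ext x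
    constructor
    · rintro ⟨⟨u, rfl⟩, hx⟩
      refine ⟨u, ?_, rfl⟩
      change uEmb L u ∈ (phiHom (lAct σ)).ker at hx
      change u ∈ (phiHom (uAct σ)).ker
      rw [mem_phiHom_ker] at hx ⊢
      apply uEmb_inj
      rw [uEmb_uAct, hx]
    · rintro ⟨u, hu, rfl⟩
      refine ⟨⟨u, rfl⟩, ?_⟩
      change u ∈ (phiHom (uAct σ)).ker at hu
      change uEmb L u ∈ (phiHom (lAct σ)).ker
      rw [mem_phiHom_ker] at hu ⊢
      rw [← uEmb_uAct, hu]
  rw [e1, e2, e3, e4, Subgroup.relIndex_map_map_of_injective _ _ uEmb_inj,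
    Subgroup.relIndex_map_map_of_injective _ _ uEmb_inj]
  exact herbrand_units h
end Quad
end

section
open scoped nonZeroDivisors

section Chev
variable {K L : Type*} [Field K] [NumberField K] [Field L] [NumberField L] [Algebra K L]
  {σ : L ≃ₐ[ℚ] L}

/-- Extension of fractional ideals. -/
noncomputable def extI (K L : Type*) [Field K] [NumberField K] [Field L] [NumberField L]
    [Algebra K L] : FI K →* FI L :=
  Units.map (FractionalIdeal.extendedHom L (𝓞 L) :
    FractionalIdeal (𝓞 K)⁰ K →+* FractionalIdeal (𝓞 L)⁰ L).toMonoidHom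

theorem extI_inj : Function.Injective (extI K L) :=
  Units.map_injective (FractionalIdeal.extendedHom_injective (𝓞 K) K L (𝓞 L))

/-- Inclusion of nonzero elements. -/
noncomputable def kEmb (K L : Type*) [Field K] [NumberField K] [Field L] [NumberField L]
    [Algebra K L] : Kˣ →* Lˣ := Units.map (algebraMap K L : K →* L)

theorem fracmap_eq (x : K) : IsFractionRing.map (FaithfulSMul.algebraMap_injective (𝓞 K) (𝓞 L)) x
    = algebraMap K L x := by
  obtain ⟨a, b, hb, rfl⟩ := IsFractionRing.div_surjective (A := 𝓞 K) x
  rw [map_div₀, map_div₀]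
  simp only [IsFractionRing.map, IsLocalization.map_eq]
  rfl

theorem extI_principal (x : Kˣ) : extI K L (toPrincipalIdeal (𝓞 K) K x)
    = toPrincipalIdeal (𝓞 L) L (kEmb K L x) := by
  ext1
  rw [coe_toPrincipalIdeal]
  change FractionalIdeal.extendedHom L (𝓞 L) _ = _
  rw [coe_toPrincipalIdeal, FractionalIdeal.extendedHom_spanSingleton, fracmap_eq]
  rfl

theorem idAct_extI (h : IsQuad K L σ) (I : FI K) : idAct σ (extI K L I) = extI K L I := by
  have key : ∀ x, x ∈ (extI K L I : FractionalIdeal (𝓞 L)⁰ L) →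
      σ x ∈ (extI K L I : FractionalIdeal (𝓞 L)⁰ L) := by
    have e : ((extI K L I : FractionalIdeal (𝓞 L)⁰ L) : Submodule (𝓞 L) L) =
      Submodule.span (𝓞 L) (algebraMap K L '' (I : FractionalIdeal (𝓞 K)⁰ K)) :=
        FractionalIdeal.coe_extendedHom_eq_span L (𝓞 L) (I : FractionalIdeal (𝓞 K)⁰ K)
    intro x hx
    rw [← FractionalIdeal.mem_coe, e] at hx ⊢
    induction hx using Submodule.span_induction with
    | mem x hx =>
      obtain ⟨y, hy, rfl⟩ := hx
      rw [h.fixK]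
      exact Submodule.subset_span ⟨y, hy, rfl⟩
    | zero => rw [map_zero]; exact Submodule.zero_mem _
    | add x y _ _ hx hy => rw [map_add]; exact Submodule.add_mem _ hx hy
    | smul a x _ hx =>
      have : σ (a • x) = (RingOfIntegers.mapRingEquiv (σ : L ≃+* L) a) • σ x := by
        rw [Algebra.smul_def, Algebra.smul_def, map_mul]
        rfl
      rw [this]
      exact Submodule.smul_mem _ _ hx
  ext1
  ext x
  rw [mem_idAct]
  constructor
  · rintro ⟨y, hy, rfl⟩
    exact key y hy
  · intro hx
    exact ⟨σ x, key x hx, h.invol x⟩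

theorem ambig_card (σ : L ≃ₐ[ℚ] L) :
    (toPrincipalIdeal (𝓞 L) L).range.relIndex
      ((toPrincipalIdeal (𝓞 L) L).range.comap (phiHom (idAct σ)))
      = Nat.card (phiHom (clAct σ)).ker := by
  rw [← mk_ker, Subgroup.relIndex_ker]
  congr 1
  have : ((ClassGroup.mk L : FI L →* ClassGroup (𝓞 L)).ker.comap (phiHom (idAct σ)))
      = (phiHom (clAct σ)).ker.comap (ClassGroup.mk L) := by
    ext I
    rw [Subgroup.mem_comap, MonoidHom.mem_ker, Subgroup.mem_comap, mem_phiHom_ker, phiHom_apply,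
      clAct_mk, map_div, div_eq_one]
    exact eq_comm
  rw [this, Subgroup.map_comap_eq_self_of_surjective mk_surj]

/-- index of norms in units of `K`. -/
noncomputable def unitIdx (σ : L ≃ₐ[ℚ] L) : ℕ :=
  (nuHom (lAct σ)).range.relIndex ((uEmb L).range ⊓ (phiHom (lAct σ)).ker)

/-- index of extended ideals in ambiguous ideals. -/
noncomputable def ramIdx (K : Type*) {L : Type*} [Field K] [NumberField K] [Field L] [NumberField L]
    [Algebra K L] (σ : L ≃ₐ[ℚ] L) : ℕ :=
  (extI K L).range.relIndex (phiHom (idAct σ)).ker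

theorem chevalley (h : IsQuad K L σ) [IsTotallyReal L] :
    Nat.card (phiHom (clAct σ)).ker * 2 * unitIdx σ
      = Nat.card (ClassGroup (𝓞 K)) * ramIdx K σ := by
  have hker : (phiHom (lAct σ)).ker = (kEmb K L).range := by
    ext x
    rw [mem_phiHom_ker]
    constructor
    · intro hx
      obtain ⟨y, hy⟩ := (h.fix (x : L)).1 (congrArg Units.val hx)
      have hy0 : y ≠ 0 := by
        rintro rfl
        rw [map_zero] at hy
        exact x.ne_zero hy.symm
      exact ⟨Units.mk0 y hy0, by ext1; exact hy⟩
    · rintro ⟨y, rfl⟩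
      ext1
      exact h.fixK _
  have hmap : (phiHom (lAct σ)).ker.map (toPrincipalIdeal (𝓞 L) L)
      = (toPrincipalIdeal (𝓞 K) K).range.map (extI K L) := by
    rw [hker, MonoidHom.range_eq_map, MonoidHom.range_eq_map, Subgroup.map_map, Subgroup.map_map]
    congr 1
    ext1 x
    exact (extI_principal x).symm
  have := abstract_chevalley (lAct σ) (idAct σ) (toPrincipalIdeal (𝓞 L) L)
    (fun x => by ext1; exact h.invol _)
    (fun I => by
      rw [← idAct_mul]
      have : σ * σ = 1 := by ext x; exact h.invol x
      rw [this, idAct_one])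
    (fun x => (idAct_principal σ x).symm)
    (fun x hx => h90_units σ h.invol h.ne x hx)
    (fun I hI => h90_ideal σ h.invol I hI)
    (extI K L).range
    (by
      rintro _ ⟨I, rfl⟩
      rw [mem_phiHom_ker]
      exact idAct_extI h I)
    (by
      rw [hmap, MonoidHom.range_eq_map]
      rw [MonoidHom.range_eq_map]
      exact Subgroup.map_mono le_top)
    (herbrand_L h)
  rw [ambig_card, principal_ker, hmap, MonoidHom.range_eq_map (extI K L),
    Subgroup.relIndex_map_map_of_injective _ _ extI_inj, Subgroup.relIndex_top_right,
    ← mk_ker, Subgroup.index_ker, MonoidHom.range_eq_top.2 mk_surj,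
    Subgroup.card_top, ← MonoidHom.range_eq_map] at this
  exact this
end Chev
end

section
open scoped nonZeroDivisors

section Ram
variable {K L : Type*} [Field K] [NumberField K] [Field L] [NumberField L] [Algebra K L]
  {σ : L ≃ₐ[ℚ] L}

/-- Galois action on integers. -/
noncomputable def oAct (σ : L ≃ₐ[ℚ] L) : 𝓞 L ≃+* 𝓞 L := RingOfIntegers.mapRingEquiv (σ : L ≃+* L)

theorem oAct_coe (σ : L ≃ₐ[ℚ] L) (x : 𝓞 L) : ((oAct σ x : 𝓞 L) : L) = σ x := rfl

theorem IsQuad.oAct_invol (h : IsQuad K L σ) (x : 𝓞 L) : oAct σ (oAct σ x) = x := by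
  apply RingOfIntegers.coe_injective
  exact h.invol _

theorem IsQuad.oAct_fix (h : IsQuad K L σ) (x : 𝓞 L) (hx : oAct σ x = x) :
    ∃ y : 𝓞 K, algebraMap (𝓞 K) (𝓞 L) y = x := by
  obtain ⟨a, ha⟩ := (h.fix (x : L)).1 (congrArg (fun z : 𝓞 L => (z : L)) hx)
  have ia : IsIntegral ℤ a := by
    rw [← isIntegral_algebraMap_iff (algebraMap K L).injective, ha]
    exact RingOfIntegers.isIntegral_coe _
  refine ⟨⟨a, ia⟩, ?_⟩
  apply RingOfIntegers.coe_injective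
  exact ha

theorem IsQuad.oAct_fixK (h : IsQuad K L σ) (y : 𝓞 K) :
    oAct σ (algebraMap (𝓞 K) (𝓞 L) y) = algebraMap (𝓞 K) (𝓞 L) y := by
  apply RingOfIntegers.coe_injective
  exact h.fixK _

/-- Galois action on integral ideals. -/
noncomputable def iAct (σ : L ≃ₐ[ℚ] L) (I : Ideal (𝓞 L)) : Ideal (𝓞 L) := I.map (oAct σ)

theorem mem_iAct (σ : L ≃ₐ[ℚ] L) (I : Ideal (𝓞 L)) (x : 𝓞 L) :
    x ∈ iAct σ I ↔ ∃ y ∈ I, oAct σ y = x := by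
  unfold iAct
  exact Ideal.mem_map_of_equiv (oAct σ) x

theorem IsQuad.mem_iAct' (h : IsQuad K L σ) (I : Ideal (𝓞 L)) (x : 𝓞 L) :
    x ∈ iAct σ I ↔ oAct σ x ∈ I := by
  rw [mem_iAct]
  constructor
  · rintro ⟨y, hy, rfl⟩
    rwa [h.oAct_invol]
  · intro hx
    exact ⟨_, hx, h.oAct_invol x⟩

instance iAct_prime (σ : L ≃ₐ[ℚ] L) (P : Ideal (𝓞 L)) [P.IsPrime] : (iAct σ P).IsPrime :=
  Ideal.map_isPrime_of_equiv (oAct σ)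

/-- primes with trivial inertia test failing: the ramified primes. -/
def ramSet (σ : L ≃ₐ[ℚ] L) : Set (Ideal (𝓞 L)) :=
  {P | P.IsPrime ∧ P ≠ ⊥ ∧ ∀ x : 𝓞 L, x - oAct σ x ∈ P}

theorem IsQuad.trichotomy (h : IsQuad K L σ) (P : Ideal (𝓞 L)) [hP : P.IsPrime] (hP0 : P ≠ ⊥) :
    (iAct σ P ≠ P ∧ (P.under (𝓞 K)).map (algebraMap (𝓞 K) (𝓞 L)) = P * iAct σ P) ∨
    (iAct σ P = P ∧ ((P.under (𝓞 K)).map (algebraMap (𝓞 K) (𝓞 L)) = P ∨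
      ((P.under (𝓞 K)).map (algebraMap (𝓞 K) (𝓞 L)) = P ^ 2 ∧ P ∈ ramSet σ))) := by
  set p := P.under (𝓞 K) with hp
  have hp0 : p ≠ ⊥ := by
    intro h0
    exact hP0 (Ideal.eq_bot_of_comap_eq_bot (R := 𝓞 K) h0)
  have hPm : P.IsMaximal := hP.isMaximal hP0
  have hpP : p.IsPrime := Ideal.IsPrime.under (𝓞 K) P
  have hpm : p.IsMaximal := hpP.isMaximal hp0
  have hlo : P.LiesOver p := ⟨hp⟩
  have hlo' : (iAct σ P).LiesOver p := by
    constructor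
    ext x
    rw [hp, Ideal.under_def, Ideal.under_def, Ideal.mem_comap, Ideal.mem_comap, h.mem_iAct', h.oAct_fixK]
  have hfin : Module.finrank (𝓞 K) (𝓞 L) = 2 := by
    rw [← IsFractionRing.finrank_eq (𝓞 K) K (𝓞 L) L, h.finrank]
  letI : Fintype (p.primesOver (𝓞 L)) := (Algebra.QuasiFinite.finite_primesOver p).fintype
  have hsum : ∑ Q ∈ (p.primesOver (𝓞 L)).toFinset, Q.ramificationIdx (𝓞 K) * Q.inertiaDeg (𝓞 K) = 2 := by
    rw [← hfin, ← Ideal.sum_ramification_inertia_eq_finrank p (𝓞 L)]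
    exact (Finset.sum_set_coe (p.primesOver (𝓞 L)) (f := fun Q => Q.ramificationIdx (𝓞 K) * Q.inertiaDeg (𝓞 K))).symm
  have hprod := Ideal.map_algebraMap_eq_finsetProd_pow (S := 𝓞 K) (R := 𝓞 L) (p := p) hp0
  have hpos : ∀ Q ∈ (p.primesOver (𝓞 L)).toFinset, 0 < Q.ramificationIdx (𝓞 K) ∧ 0 < Q.inertiaDeg (𝓞 K) := by
    intro Q hQ
    have hQ' : Q ∈ p.primesOver (𝓞 L) := by simpa using hQ
    have := hQ'.1
    exact ⟨Ideal.ramificationIdx_pos Q (𝓞 K), Ideal.inertiaDeg_pos Q (𝓞 K)⟩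
  have hmemP : P ∈ (p.primesOver (𝓞 L)).toFinset := by simpa using ⟨hP, hlo⟩
  have hmemP' : iAct σ P ∈ (p.primesOver (𝓞 L)).toFinset := by
    simpa using ⟨iAct_prime σ P, hlo'⟩
  by_cases hs : iAct σ P = P
  · right
    refine ⟨hs, ?_⟩
    have hset : (p.primesOver (𝓞 L)).toFinset = {P} := by
      ext Q
      rw [Finset.mem_singleton]
      constructor
      · intro hQ
        have hQ' : Q ∈ p.primesOver (𝓞 L) := by simpa using hQ
        have hQp := hQ'.1
        have hQm : Q.IsMaximal := hQp.isMaximal (Ideal.ne_bot_of_mem_primesOver hp0 hQ')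
        apply hQm.eq_of_le hP.ne_top
        intro a ha
        have h1 : oAct σ (a * oAct σ a) = a * oAct σ a := by
          rw [map_mul, h.oAct_invol, mul_comm]
        obtain ⟨y, hy⟩ := h.oAct_fix _ h1
        have h2 : y ∈ p := by
          rw [hQ'.2.over, Ideal.under_def, Ideal.mem_comap, hy]
          exact Q.mul_mem_right _ ha
        have h3 : a * oAct σ a ∈ P := by
          rw [← hy]
          rw [hp, Ideal.under_def, Ideal.mem_comap] at h2
          exact h2
        rcases hP.mem_or_mem h3 with h4 | h4
        · exact h4
        · rw [← hs, h.mem_iAct']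
          exact h4
      · rintro rfl
        exact hmemP
    rw [hset, Finset.sum_singleton] at hsum
    rw [hset, Finset.prod_singleton] at hprod
    obtain ⟨he, hf⟩ := hpos P hmemP
    have hf2 : P.inertiaDeg (𝓞 K) = 1 ∨ P.inertiaDeg (𝓞 K) = 2 := by
      have : P.inertiaDeg (𝓞 K) ∣ 2 := ⟨_, by rw [mul_comm, hsum]⟩
      exact (Nat.dvd_prime Nat.prime_two).1 this
    rcases hf2 with hf1 | hf1
    · right
      have he2 : P.ramificationIdx (𝓞 K) = 2 := by simpa [hf1] using hsum
      refine ⟨by rw [hprod, he2], hP, hP0, ?_⟩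
      intro x
      have hfr : Module.finrank ((𝓞 K) ⧸ p) ((𝓞 L) ⧸ P) = 1 := by
        rw [← Ideal.inertiaDeg_eq_of_isMaximal p P, hf1]
      letI : Field ((𝓞 K) ⧸ p) := Ideal.Quotient.field p
      letI : Field ((𝓞 L) ⧸ P) := Ideal.Quotient.field P
      obtain ⟨c, hc⟩ := (finrank_eq_one_iff_of_nonzero' (K := (𝓞 K) ⧸ p) (1 : (𝓞 L) ⧸ P) one_ne_zero).1 hfr
        (Ideal.Quotient.mk P x)
      obtain ⟨y, rfl⟩ := Ideal.Quotient.mk_surjective c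
      have h1 : x - algebraMap (𝓞 K) (𝓞 L) y ∈ P := by
        rw [← Ideal.Quotient.mk_eq_mk_iff_sub_mem, ← hc, Algebra.smul_def, mul_one]
        rfl
      have h2 : oAct σ x - algebraMap (𝓞 K) (𝓞 L) y ∈ P := by
        rw [← hs, h.mem_iAct', map_sub, h.oAct_invol, h.oAct_fixK]
        exact h1
      have := P.sub_mem h1 h2
      rwa [sub_sub_sub_cancel_right] at this
    · left
      have he2 : P.ramificationIdx (𝓞 K) = 1 := by
        rw [hf1] at hsum; omega
      rw [hprod, he2, pow_one]
  · left
    refine ⟨hs, ?_⟩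
    have hsub : ({P, iAct σ P} : Finset (Ideal (𝓞 L))) ⊆ (p.primesOver (𝓞 L)).toFinset := by
      intro Q hQ
      rw [Finset.mem_insert, Finset.mem_singleton] at hQ
      rcases hQ with rfl | rfl
      · exact hmemP
      · exact hmemP'
    have hge : ∀ Q ∈ (p.primesOver (𝓞 L)).toFinset, 1 ≤ Q.ramificationIdx (𝓞 K) * Q.inertiaDeg (𝓞 K) :=
      fun Q hQ => Nat.mul_pos (hpos Q hQ).1 (hpos Q hQ).2
    have hcard : (p.primesOver (𝓞 L)).toFinset.card ≤ 2 := by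
      rw [← hsum, Finset.card_eq_sum_ones]
      exact Finset.sum_le_sum hge
    have hset : ({P, iAct σ P} : Finset (Ideal (𝓞 L))) = (p.primesOver (𝓞 L)).toFinset := by
      apply Finset.eq_of_subset_of_card_le hsub
      rw [Finset.card_pair (Ne.symm hs)]
      exact hcard
    rw [← hset, Finset.sum_pair (Ne.symm hs)] at hsum
    rw [← hset, Finset.prod_pair (Ne.symm hs)] at hprod
    obtain ⟨e1, f1⟩ := hpos _ hmemP
    obtain ⟨e2, f2⟩ := hpos _ hmemP'
    have g1 := hge _ hmemP
    have g2 := hge _ hmemP'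
    have a1 : P.ramificationIdx (𝓞 K) = 1 := Nat.eq_one_of_mul_eq_one_right (by omega : P.ramificationIdx (𝓞 K) * P.inertiaDeg (𝓞 K) = 1)
    have a2 : (iAct σ P).ramificationIdx (𝓞 K) = 1 := Nat.eq_one_of_mul_eq_one_right (by omega : (iAct σ P).ramificationIdx (𝓞 K) * (iAct σ P).inertiaDeg (𝓞 K) = 1)
    rw [hprod, a1, a2, pow_one, pow_one]
end Ram
end

section
open scoped nonZeroDivisors Pointwise

theorem card_closure_le {G : Type*} [CommGroup G] (S : Set G) (hS : S.Finite)
    (h2 : ∀ x ∈ S, x ^ 2 = 1) :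
    Finite (Subgroup.closure S) ∧ Nat.card (Subgroup.closure S) ≤ 2 ^ S.ncard := by
  induction S, hS using Set.Finite.induction_on with
  | empty => simp; exact Finite.of_subsingleton
  | @insert a S ha hS ih =>
    obtain ⟨f1, c1⟩ := ih (fun x hx => h2 x (Set.mem_insert_of_mem _ hx))
    have e : ((Subgroup.closure (insert a S) : Subgroup G) : Set G)
        = (({1, a} : Set G) * (Subgroup.closure S : Set G)) := by
      rw [Set.insert_eq, Subgroup.closure_union, Subgroup.mul_normal]
      congr 1
      rw [← Subgroup.zpowers_eq_closure]
      ext x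
      simp only [SetLike.mem_coe, Set.mem_insert_iff, Set.mem_singleton_iff]
      constructor
      · intro hx
        obtain ⟨k, rfl⟩ := Subgroup.mem_zpowers_iff.1 hx
        have ha2 := h2 a (Set.mem_insert _ _)
        rcases Int.even_or_odd' k with ⟨m, rfl | rfl⟩
        · left
          rw [zpow_mul]; norm_cast; rw [ha2, one_zpow]
        · right
          rw [zpow_add, zpow_mul]; norm_cast; rw [ha2, one_zpow]; simp
      · rintro (rfl | rfl)
        · exact one_mem _
        · exact Subgroup.mem_zpowers _
    have f1' : (Subgroup.closure S : Set G).Finite := Set.toFinite _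
    have f2 : ((Subgroup.closure (insert a S) : Subgroup G) : Set G).Finite := by
      rw [e]
      exact Set.Finite.mul (Set.toFinite _) f1'
    refine ⟨f2.to_subtype, ?_⟩
    have : Nat.card (Subgroup.closure (insert a S)) = Nat.card
      (({1, a} : Set G) * (Subgroup.closure S : Set G) : Set G) := by
      rw [← e]; rfl
    rw [this, Set.ncard_insert_of_notMem ha hS, pow_succ']
    refine (Set.natCard_mul_le).trans ?_
    have h3 : Nat.card ({1, a} : Set G) ≤ 2 := by
      rw [Nat.card_coe_set_eq]
      exact Set.ncard_insert_le _ _ |>.trans (by simp)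
    exact Nat.mul_le_mul h3 c1

theorem relIndex_le_two_pow {G : Type*} [CommGroup G] (J M : Subgroup G) (S : Set G) (hS : S.Finite)
    (h2 : ∀ x ∈ S, x ^ 2 ∈ J) (hM : M ≤ J ⊔ Subgroup.closure S) :
    J.relIndex M ≠ 0 ∧ J.relIndex M ≤ 2 ^ S.ncard := by
  have e : J.relIndex M = Nat.card (M.map (QuotientGroup.mk' J)) := by
    conv_lhs => rw [← QuotientGroup.ker_mk' J]
    rw [Subgroup.relIndex_ker]
  have hle : M.map (QuotientGroup.mk' J) ≤ Subgroup.closure (QuotientGroup.mk' J '' S) := by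
    refine (Subgroup.map_mono hM).trans ?_
    rw [Subgroup.map_sup, MonoidHom.map_closure]
    refine sup_le ?_ le_rfl
    rintro _ ⟨x, hx, rfl⟩
    have : QuotientGroup.mk' J x = 1 := (QuotientGroup.eq_one_iff x).2 hx
    rw [this]
    exact one_mem _
  obtain ⟨f, c⟩ := card_closure_le (QuotientGroup.mk' J '' S) (hS.image _) (by
    rintro _ ⟨x, hx, rfl⟩
    rw [← map_pow]
    exact (QuotientGroup.eq_one_iff _).2 (h2 x hx))
  have hfin : Finite (M.map (QuotientGroup.mk' J)) := Finite.of_injective _ (Subgroup.inclusion_injective hle)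
  rw [e]
  refine ⟨Nat.card_pos.ne', ?_⟩
  refine (Subgroup.card_le_of_le hle).trans (c.trans ?_)
  exact Nat.pow_le_pow_right (by norm_num) (Set.ncard_image_le hS)

theorem relIndex_two_pow {G : Type*} [CommGroup G] (J M : Subgroup G)
    (h2 : ∀ x ∈ M, x ^ 2 ∈ J) (hM : J.relIndex M ≠ 0) : ∃ k, J.relIndex M = 2 ^ k := by
  have e : J.relIndex M = Nat.card (M.map (QuotientGroup.mk' J)) := by
    conv_lhs => rw [← QuotientGroup.ker_mk' J]
    rw [Subgroup.relIndex_ker]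
  rw [e] at hM ⊢
  have hf : Finite (M.map (QuotientGroup.mk' J)) := Nat.finite_of_card_ne_zero hM
  have hpg : IsPGroup 2 (M.map (QuotientGroup.mk' J)) := by
    rintro ⟨_, x, hx, rfl⟩
    refine ⟨1, ?_⟩
    ext1
    simp only [pow_one, Subgroup.coe_pow, Subgroup.coe_one]
    rw [← map_pow]
    exact (QuotientGroup.eq_one_iff _).2 (h2 x hx)
  haveI : Fact (Nat.Prime 2) := ⟨Nat.prime_two⟩
  exact (IsPGroup.iff_card).1 hpg

section Ram
variable {K L : Type*} [Field K] [NumberField K] [Field L] [NumberField L] [Algebra K L]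
  {σ : L ≃ₐ[ℚ] L}

/-- Integral ideal as unit fractional ideal. -/
noncomputable def fu (I : Ideal (𝓞 L)) (h : I ≠ ⊥) : FI L :=
  Units.mk0 (I : FractionalIdeal (𝓞 L)⁰ L) (FractionalIdeal.coeIdeal_ne_zero.2 h)

theorem fu_coe (I : Ideal (𝓞 L)) (h : I ≠ ⊥) :
    ((fu I h : FI L) : FractionalIdeal (𝓞 L)⁰ L) = (I : FractionalIdeal (𝓞 L)⁰ L) := rfl

theorem idAct_of_coe (I : FI L) (A : Ideal (𝓞 L))
    (hI : (I : FractionalIdeal (𝓞 L)⁰ L) = (A : FractionalIdeal (𝓞 L)⁰ L)) :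
    (idAct σ I : FractionalIdeal (𝓞 L)⁰ L) = (iAct σ A : FractionalIdeal (𝓞 L)⁰ L) := by
  ext x
  rw [mem_idAct, hI, FractionalIdeal.mem_coeIdeal]
  constructor
  · rintro ⟨y, hy, rfl⟩
    obtain ⟨z, hz, rfl⟩ := (FractionalIdeal.mem_coeIdeal _).1 hy
    exact ⟨oAct σ z, (mem_iAct _ _ _).2 ⟨z, hz, rfl⟩, rfl⟩
  · rintro ⟨y, hy, rfl⟩
    obtain ⟨z, hz, rfl⟩ := (mem_iAct _ _ _).1 hy
    exact ⟨z, (FractionalIdeal.mem_coeIdeal _).2 ⟨z, hz, rfl⟩, rfl⟩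

theorem iAct_ne_bot (I : Ideal (𝓞 L)) (h : I ≠ ⊥) : iAct σ I ≠ ⊥ := by
  intro h0
  apply h
  rw [eq_bot_iff]
  intro x hx
  have : oAct σ x ∈ iAct σ I := (mem_iAct _ _ _).2 ⟨x, hx, rfl⟩
  rw [h0, Ideal.mem_bot] at this
  simpa using this

theorem idAct_fu (I : Ideal (𝓞 L)) (h : I ≠ ⊥) :
    idAct σ (fu I h) = fu (iAct σ I) (iAct_ne_bot I h) := by
  ext1
  exact idAct_of_coe _ _ rfl

theorem extI_coe (I : FI K) (A : Ideal (𝓞 K))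
    (hI : (I : FractionalIdeal (𝓞 K)⁰ K) = (A : FractionalIdeal (𝓞 K)⁰ K)) :
    (extI K L I : FractionalIdeal (𝓞 L)⁰ L)
      = (A.map (algebraMap (𝓞 K) (𝓞 L)) : FractionalIdeal (𝓞 L)⁰ L) := by
  change FractionalIdeal.extendedHom L (𝓞 L) (I : FractionalIdeal (𝓞 K)⁰ K) = _
  rw [hI, FractionalIdeal.extendedHom_coeIdeal_eq_map]

theorem under_ne_bot (P : Ideal (𝓞 L)) (h : P ≠ ⊥) : P.under (𝓞 K) ≠ ⊥ := by
  intro h0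
  exact h (Ideal.eq_bot_of_comap_eq_bot (R := 𝓞 K) h0)

/-- An integral ideal which is an extension of an ideal of `K`. -/
theorem mem_ext_of_map_eq (P A : Ideal (𝓞 L)) (hP : P ≠ ⊥) (I : FI L)
    (hI : (I : FractionalIdeal (𝓞 L)⁰ L) = (A : FractionalIdeal (𝓞 L)⁰ L))
    (h : (P.under (𝓞 K)).map (algebraMap (𝓞 K) (𝓞 L)) = A) : I ∈ (extI K L).range := by
  refine ⟨fu (P.under (𝓞 K)) (under_ne_bot P hP), ?_⟩
  ext1
  rw [extI_coe _ _ (fu_coe _ _), h, hI]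

/-- the subgroup generated by extended ideals and ramified primes -/
noncomputable def ramGen (σ : L ≃ₐ[ℚ] L) : Set (FI L) :=
  {I | ∃ P ∈ ramSet σ, (I : FractionalIdeal (𝓞 L)⁰ L) = (P : FractionalIdeal (𝓞 L)⁰ L)}

theorem ram_stable (h : IsQuad K L σ) (P : Ideal (𝓞 L)) (hP : P ∈ ramSet σ) : iAct σ P = P := by
  have hp := hP.2.2
  ext x
  rw [h.mem_iAct']
  constructor
  · intro hx
    have := P.add_mem (hp x) hx
    simpa using this
  · intro hx
    have := P.sub_mem hx (hp x)
    simpa using this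

theorem ambig_integral (h : IsQuad K L σ) (A : Ideal (𝓞 L)) : ∀ I : FI L,
    (I : FractionalIdeal (𝓞 L)⁰ L) = (A : FractionalIdeal (𝓞 L)⁰ L) → idAct σ I = I →
    I ∈ (extI K L).range ⊔ Subgroup.closure (ramGen σ) := by
  induction A using WellFoundedGT.induction with
  | ind A ih =>
    intro I hI hs
    by_cases hA : A = ⊤
    · have : I = 1 := by
        ext1; rw [hI, hA]; simp
      rw [this]; exact one_mem _
    have hA0 : A ≠ ⊥ := by
      rintro rfl
      apply I.ne_zero
      rw [hI]; simp
    have hsA : iAct σ A = A := by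
      have h1 := idAct_of_coe (σ := σ) I A hI
      rw [hs, hI] at h1
      exact (FractionalIdeal.coeIdeal_injective h1).symm
    obtain ⟨P, hPm, hAP⟩ := Ideal.exists_le_maximal A hA
    have hPp := hPm.isPrime
    have hP0 : P ≠ ⊥ := by
      rintro rfl
      exact hA0 (le_bot_iff.1 hAP)
    have key : ∀ B : Ideal (𝓞 L), B ∣ A → B ≠ ⊤ → iAct σ B = B →
        (∀ J : FI L, (J : FractionalIdeal (𝓞 L)⁰ L) = (B : FractionalIdeal (𝓞 L)⁰ L) →
          J ∈ (extI K L).range ⊔ Subgroup.closure (ramGen σ)) →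
        I ∈ (extI K L).range ⊔ Subgroup.closure (ramGen σ) := by
      rintro B ⟨C, rfl⟩ hB hBs hBm
      have hB0 : B ≠ ⊥ := by rintro rfl; simp at hA0
      have hC0 : C ≠ ⊥ := by rintro rfl; simp at hA0
      have e : I = fu B hB0 * fu C hC0 := by
        ext1
        rw [hI, Units.val_mul, fu_coe, fu_coe, FractionalIdeal.coeIdeal_mul]
      have hlt : B * C < C := by
        refine lt_of_le_of_ne Ideal.mul_le_right ?_
        intro h1
        have : B * C = 1 * C := by rw [one_mul, h1]
        have h2 := mul_right_cancel₀ (b := C) hC0 this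
        exact hB (by rw [h2, Ideal.one_eq_top])
      have hCs : idAct σ (fu C hC0) = fu C hC0 := by
        have h1 : idAct σ (fu B hB0) = fu B hB0 := by
          rw [idAct_fu]
          ext1
          rw [fu_coe, fu_coe, hBs]
        rw [e, map_mul, h1] at hs
        exact mul_left_cancel hs
      rw [e]
      exact mul_mem (hBm _ rfl) (ih C hlt _ rfl hCs)
    rcases h.trichotomy P hP0 with ⟨h1, h2⟩ | ⟨h1, h2 | ⟨h2, h3⟩⟩
    · apply key (P * iAct σ P)
      · apply IsCoprime.mul_dvd
        · rw [Ideal.isCoprime_iff_sup_eq]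
          haveI : (iAct σ P).IsMaximal := (iAct_prime σ P).isMaximal (iAct_ne_bot P hP0)
          exact Ideal.IsMaximal.coprime_of_ne hPm this (Ne.symm h1)
        · exact Ideal.dvd_iff_le.2 hAP
        · rw [Ideal.dvd_iff_le]
          intro x hx
          rw [h.mem_iAct']
          apply hAP
          rw [← h.mem_iAct', hsA]
          exact hx
      · intro ht
        apply hPm.ne_top
        rw [eq_top_iff, ← ht]
        exact Ideal.mul_le_left
      · have : iAct σ (iAct σ P) = P := by
          ext x; rw [h.mem_iAct', h.mem_iAct', h.oAct_invol]
        have h4 : iAct σ (P * iAct σ P) = iAct σ P * iAct σ (iAct σ P) := by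
          unfold iAct
          exact Ideal.map_mul _ _ _
        rw [h4, this, mul_comm]
      · intro J hJ
        exact Subgroup.mem_sup_left (mem_ext_of_map_eq P _ hP0 J hJ h2)
    · apply key P (Ideal.dvd_iff_le.2 hAP) hPm.ne_top h1
      intro J hJ
      exact Subgroup.mem_sup_left (mem_ext_of_map_eq P _ hP0 J hJ h2)
    · apply key P (Ideal.dvd_iff_le.2 hAP) hPm.ne_top h1
      intro J hJ
      exact Subgroup.mem_sup_right (Subgroup.subset_closure ⟨P, h3, hJ⟩)

theorem ambig_le (h : IsQuad K L σ) :
    (phiHom (idAct σ)).ker ≤ (extI K L).range ⊔ Subgroup.closure (ramGen σ) := by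
  intro I hI
  rw [mem_phiHom_ker] at hI
  set d := FractionalIdeal.den (I : FractionalIdeal (𝓞 L)⁰ L) with hd
  have hd0 : (d : 𝓞 L) ≠ 0 := nonZeroDivisors.coe_ne_zero d
  have hdL : algebraMap (𝓞 L) L (d : 𝓞 L) ≠ 0 := by simpa using hd0
  have hsd : algebraMap (𝓞 L) L (oAct σ (d : 𝓞 L)) ≠ 0 := by simpa using hd0
  have hnum := FractionalIdeal.den_mul_self_eq_num' (𝓞 L)⁰ L (I : FractionalIdeal (𝓞 L)⁰ L)
  let N : Lˣ := Units.mk0 _ (mul_ne_zero hdL hsd)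
  have hN : toPrincipalIdeal (𝓞 L) L N ∈ (extI K L).range := by
    have : σ (N : L) = N := by
      change σ (_ * _) = _
      rw [map_mul]
      have e1 : σ (algebraMap (𝓞 L) L (d : 𝓞 L)) = algebraMap (𝓞 L) L (oAct σ (d : 𝓞 L)) := rfl
      have e2 : σ (algebraMap (𝓞 L) L (oAct σ (d : 𝓞 L))) = algebraMap (𝓞 L) L (d : 𝓞 L) := by
        rw [← e1]; exact h.invol _
      rw [e2, e1, mul_comm]; rfl
    obtain ⟨y, hy⟩ := (h.fix _).1 this
    have hy0 : y ≠ 0 := by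
      rintro rfl
      rw [map_zero] at hy
      exact N.ne_zero hy.symm
    refine ⟨toPrincipalIdeal (𝓞 K) K (Units.mk0 y hy0), ?_⟩
    rw [extI_principal]
    congr 1
    ext1
    exact hy
  have hIntg : ((toPrincipalIdeal (𝓞 L) L N * I : FI L) : FractionalIdeal (𝓞 L)⁰ L)
      = ((Ideal.span {oAct σ (d : 𝓞 L)} * FractionalIdeal.num (I : FractionalIdeal (𝓞 L)⁰ L) :
        Ideal (𝓞 L)) : FractionalIdeal (𝓞 L)⁰ L) := by
    rw [Units.val_mul, coe_toPrincipalIdeal, FractionalIdeal.coeIdeal_mul, ← hnum,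
      FractionalIdeal.coeIdeal_span_singleton, ← mul_assoc,
      FractionalIdeal.spanSingleton_mul_spanSingleton]
    congr 2
    exact mul_comm _ _
  have hfix : idAct σ (toPrincipalIdeal (𝓞 L) L N * I) = toPrincipalIdeal (𝓞 L) L N * I := by
    rw [map_mul, hI]
    obtain ⟨J, hJ⟩ := hN
    rw [← hJ, idAct_extI h]
  have := ambig_integral h _ _ hIntg hfix
  have h2 := mul_mem (inv_mem (Subgroup.mem_sup_left (T := Subgroup.closure (ramGen σ)) hN)) this
  rwa [inv_mul_cancel_left] at h2

theorem ramSet_finite (h : IsQuad K L σ) : (ramSet σ).Finite := by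
  have : ∃ x : 𝓞 L, x - oAct σ x ≠ 0 := by
    by_contra hcon
    push Not at hcon
    obtain ⟨x, hx⟩ := h.ne
    obtain ⟨a, b, hb, rfl⟩ := IsFractionRing.div_surjective (A := 𝓞 L) x
    apply hx
    rw [map_div₀]
    have ha := congrArg (fun z : 𝓞 L => (z : L)) (sub_eq_zero.1 (hcon a))
    have hb := congrArg (fun z : 𝓞 L => (z : L)) (sub_eq_zero.1 (hcon b))
    simp only [oAct_coe] at ha hb
    rw [← ha, ← hb]
  obtain ⟨x, hx⟩ := this
  have hfin := Ideal.finite_factors (I := Ideal.span {x - oAct σ x}) (by simpa using hx)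
  refine (hfin.image (fun v => v.asIdeal)).subset ?_
  rintro P ⟨hP, hP0, hPx⟩
  refine ⟨⟨P, hP, hP0⟩, ?_, rfl⟩
  change P ∣ _
  rw [Ideal.dvd_iff_le, Ideal.span_singleton_le_iff_mem]
  exact hPx x

theorem ramIdx_bound (h : IsQuad K L σ) :
    ramIdx K σ ≠ 0 ∧ ramIdx K σ ≤ 2 ^ (ramSet σ).ncard := by
  classical
  have hfin := ramSet_finite h
  let f : FI L → Ideal (𝓞 L) := fun I => if hI : ∃ P : Ideal (𝓞 L), (I : FractionalIdeal (𝓞 L)⁰ L) =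
    (P : FractionalIdeal (𝓞 L)⁰ L) then hI.choose else ⊥
  have hf : ∀ (I : FI L) (P : Ideal (𝓞 L)), (I : FractionalIdeal (𝓞 L)⁰ L) =
    (P : FractionalIdeal (𝓞 L)⁰ L) → f (I : FI L) = P := by
    intro I P hIP
    have hI : ∃ P : Ideal (𝓞 L), (I : FractionalIdeal (𝓞 L)⁰ L) =
      (P : FractionalIdeal (𝓞 L)⁰ L) := ⟨P, hIP⟩
    have : f I = hI.choose := dif_pos hI
    rw [this]
    exact FractionalIdeal.coeIdeal_injective (hI.choose_spec.symm.trans hIP)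
  have hmaps : ∀ I ∈ ramGen σ, f I ∈ ramSet σ := by
    rintro I ⟨P, hP, hIP⟩
    rw [hf I P hIP]; exact hP
  have hinj : Set.InjOn f (ramGen σ) := by
    rintro I ⟨P, hP, hIP⟩ I' ⟨P', hP', hIP'⟩ e
    rw [hf I P hIP, hf I' P' hIP'] at e
    ext1
    rw [hIP, hIP', e]
  have hgfin : (ramGen σ).Finite := Set.Finite.of_injOn hmaps hinj hfin
  have := relIndex_le_two_pow (extI K L).range (phiHom (idAct σ)).ker (ramGen σ) hgfin (by
    rintro I ⟨P, hP, hIP⟩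
    have hPp := hP.1
    have h2 : ((I ^ 2 : FI L) : FractionalIdeal (𝓞 L)⁰ L) = ((P ^ 2 : Ideal (𝓞 L)) :
      FractionalIdeal (𝓞 L)⁰ L) := by
      rw [Units.val_pow_eq_pow_val, hIP, FractionalIdeal.coeIdeal_pow]
    rcases h.trichotomy P hP.2.1 with ⟨h1, _⟩ | ⟨_, h1 | ⟨h1, _⟩⟩
    · exact absurd (ram_stable h P hP) h1
    · exact pow_mem (mem_ext_of_map_eq P _ hP.2.1 I hIP h1) 2
    · exact mem_ext_of_map_eq P _ hP.2.1 _ h2 h1) (ambig_le h)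
  refine ⟨this.1, this.2.trans ?_⟩
  exact Nat.pow_le_pow_right (by norm_num) (Set.ncard_le_ncard_of_injOn f hmaps hinj hfin)

/-- every ideal times its conjugate is an extended ideal -/
theorem norm_mem_ext (h : IsQuad K L σ) (I : FI L) : I * idAct σ I ∈ (extI K L).range := by
  have hprime : ∀ P : Ideal (𝓞 L), P.IsPrime → ∀ hP0 : P ≠ ⊥,
      fu P hP0 * idAct σ (fu P hP0) ∈ (extI K L).range := by
    intro P hP hP0
    rcases h.trichotomy P hP0 with ⟨h1, h2⟩ | ⟨h1, h2 | ⟨h2, h3⟩⟩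
    · apply mem_ext_of_map_eq P _ hP0 _ _ h2
      rw [Units.val_mul, idAct_fu, fu_coe, fu_coe, FractionalIdeal.coeIdeal_mul]
    · have : fu P hP0 ∈ (extI K L).range := mem_ext_of_map_eq P _ hP0 _ rfl h2
      obtain ⟨J, hJ⟩ := this
      rw [← hJ, idAct_extI h]
      exact mul_mem ⟨J, rfl⟩ ⟨J, rfl⟩
    · apply mem_ext_of_map_eq P _ hP0 _ _ h2
      rw [Units.val_mul, idAct_fu, fu_coe, fu_coe, h1, sq, FractionalIdeal.coeIdeal_mul]
  have hIntg : ∀ A : Ideal (𝓞 L), ∀ hA : A ≠ ⊥,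
      fu A hA * idAct σ (fu A hA) ∈ (extI K L).range := by
    intro A
    induction A using UniqueFactorizationMonoid.induction_on_prime with
    | h₁ => intro hA; exact absurd rfl hA
    | h₂ A hA =>
      intro hA0
      rw [Ideal.isUnit_iff] at hA
      have : fu A hA0 = 1 := by ext1; rw [fu_coe, hA]; simp
      rw [this, map_one, one_mul]
      exact one_mem _
    | h₃ A P hA0 hP ih =>
      intro hPA
      have e : fu (P * A) hPA = fu P hP.ne_zero * fu A hA0 := by
        ext1; rw [Units.val_mul, fu_coe, fu_coe, fu_coe, FractionalIdeal.coeIdeal_mul]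
      rw [e, map_mul, mul_mul_mul_comm]
      exact mul_mem (hprime P (Ideal.isPrime_of_prime hP) hP.ne_zero) (ih hA0)
  set d := FractionalIdeal.den (I : FractionalIdeal (𝓞 L)⁰ L) with hd
  have hd0 : (d : 𝓞 L) ≠ 0 := nonZeroDivisors.coe_ne_zero d
  have hnum := FractionalIdeal.den_mul_self_eq_num' (𝓞 L)⁰ L (I : FractionalIdeal (𝓞 L)⁰ L)
  have hD0 : Ideal.span {(d : 𝓞 L)} ≠ ⊥ := by simpa using hd0
  have hn0 : FractionalIdeal.num (I : FractionalIdeal (𝓞 L)⁰ L) ≠ ⊥ := by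
    rw [Ne, ← Ideal.zero_eq_bot, FractionalIdeal.num_eq_zero_iff]
    exact I.ne_zero
  have e : fu _ hD0 * I = fu _ hn0 := by
    ext1
    rw [Units.val_mul, fu_coe, fu_coe, FractionalIdeal.coeIdeal_span_singleton, ← hnum]
  have e2 : I = fu _ hn0 / fu _ hD0 := by rw [← e, mul_div_cancel_left]
  rw [e2, map_div, div_mul_div_comm]
  exact div_mem (hIntg _ _) (hIntg _ _)

end Ram
end

section
open scoped nonZeroDivisors

section TwoPart
variable {G : Type*} [CommGroup G]

/-- The 2-primary part. -/
def tp (G : Type*) [CommGroup G] : Subgroup G where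
  carrier := {x | ∃ n : ℕ, x ^ (2 ^ n) = 1}
  one_mem' := ⟨0, by simp⟩
  mul_mem' := by
    rintro a b ⟨m, hm⟩ ⟨n, hn⟩
    refine ⟨m + n, ?_⟩
    rw [mul_pow]
    have h1 : a ^ (2 ^ (m + n)) = 1 := by rw [pow_add, pow_mul, hm, one_pow]
    have h2 : b ^ (2 ^ (m + n)) = 1 := by rw [add_comm, pow_add, pow_mul, hn, one_pow]
    rw [h1, h2, one_mul]
  inv_mem' := by
    rintro a ⟨m, hm⟩
    exact ⟨m, by rw [inv_pow, hm, inv_one]⟩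

theorem mem_tp {x : G} : x ∈ tp G ↔ ∃ n : ℕ, x ^ (2 ^ n) = 1 := Iff.rfl

/-- The 2-class number. -/
noncomputable def h2 (G : Type*) [CommGroup G] : ℕ := Nat.card (tp G)

theorem tp_isPGroup : IsPGroup 2 (tp G) := by
  rintro ⟨x, n, hn⟩
  exact ⟨n, by ext1; simpa using hn⟩

theorem sylow_eq_tp [Finite G] (Q : Sylow 2 G) : (Q : Subgroup G) = tp G := by
  haveI : Fact (Nat.Prime 2) := ⟨Nat.prime_two⟩
  have h1 : (Q : Subgroup G) ≤ tp G := by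
    intro x hx
    obtain ⟨n, hn⟩ := Q.isPGroup' ⟨x, hx⟩
    exact ⟨n, by simpa using congrArg Subtype.val hn⟩
  exact (Q.is_maximal' tp_isPGroup h1).symm

theorem sylow_card [Finite G] (Q : Sylow 2 G) : Nat.card (Q : Subgroup G) = h2 G := by
  rw [sylow_eq_tp]; rfl

theorem h2_pow [Finite G] : ∃ k, h2 G = 2 ^ k := by
  haveI : Fact (Nat.Prime 2) := ⟨Nat.prime_two⟩
  exact (IsPGroup.iff_card).1 (tp_isPGroup (G := G))

theorem h2_pos [Finite G] : 0 < h2 G := Nat.card_pos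

theorem card_eq_h2 [Finite G] : ∃ m, Odd m ∧ Nat.card G = h2 G * m := by
  haveI : Fact (Nat.Prime 2) := ⟨Nat.prime_two⟩
  have Q : Sylow 2 G := default
  refine ⟨(Q : Subgroup G).index, ?_, ?_⟩
  · rw [← Nat.not_even_iff_odd, even_iff_two_dvd]
    exact Q.not_dvd_index
  · rw [← sylow_card Q, Subgroup.card_mul_index]

/-- The order of the `σ`-fixed part of 2-part. -/
noncomputable def h2f (s : G →* G) : ℕ := Nat.card (tp G ⊓ (phiHom s).ker : Subgroup G)

theorem h2_sub (H : Subgroup G) : h2 H = Nat.card (tp G ⊓ H : Subgroup G) := by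
  refine Nat.card_congr ⟨fun x => ⟨x.1.1, ?_, x.1.2⟩, fun x => ⟨⟨x.1, x.2.2⟩, ?_⟩, ?_, ?_⟩
  · obtain ⟨n, hn⟩ := x.2
    exact ⟨n, by simpa using congrArg Subtype.val hn⟩
  · obtain ⟨n, hn⟩ := x.2.1
    exact ⟨n, by ext1; simpa using hn⟩
  · intro x; rfl
  · intro x; rfl

theorem two_pow_odd_cancel {x y m n : ℕ} (hm : Odd m) (hn : Odd n) (h : 2 ^ x * m = 2 ^ y * n) :
    x = y := by
  have hm2 : ¬ 2 ∣ m := by rwa [← even_iff_two_dvd, Nat.not_even_iff_odd]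
  have hn2 : ¬ 2 ∣ n := by rwa [← even_iff_two_dvd, Nat.not_even_iff_odd]
  by_contra hne
  rcases lt_or_gt_of_ne hne with hlt | hlt
  · obtain ⟨k, rfl⟩ := Nat.exists_eq_add_of_lt hlt
    rw [pow_succ, pow_add, mul_assoc, mul_assoc] at h
    have := Nat.eq_of_mul_eq_mul_left (by positivity) h
    exact hm2 ⟨2 ^ k * n, by rw [this]; ring⟩
  · obtain ⟨k, rfl⟩ := Nat.exists_eq_add_of_lt hlt
    rw [pow_succ, pow_add, mul_assoc, mul_assoc] at h
    have := Nat.eq_of_mul_eq_mul_left (by positivity) h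
    exact hn2 ⟨2 ^ k * m, by rw [← this]; ring⟩

/-- lower bound for relative index from independent elements -/
theorem relIndex_ge {G : Type*} [CommGroup G] (J M : Subgroup G) (h2 : ∀ x ∈ M, x ^ 2 ∈ J)
    (hM : J.relIndex M ≠ 0) {k : ℕ} (u : Fin k → G) (hu : ∀ i, u i ∈ M)
    (hn : ∀ T : Finset (Fin k), T.Nonempty → ∏ i ∈ T, u i ∉ J) : 2 ^ k ≤ J.relIndex M := by
  classical
  have e : J.relIndex M = Nat.card (M.map (QuotientGroup.mk' J)) := by
    conv_lhs => rw [← QuotientGroup.ker_mk' J]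
    rw [Subgroup.relIndex_ker]
  rw [e] at hM ⊢
  have hf : Finite (M.map (QuotientGroup.mk' J)) := Nat.finite_of_card_ne_zero hM
  let f : Finset (Fin k) → (M.map (QuotientGroup.mk' J)) := fun T =>
    ⟨QuotientGroup.mk' J (∏ i ∈ T, u i), Subgroup.mem_map_of_mem _ (prod_mem fun i _ => hu i)⟩
  have hinj : Function.Injective f := by
    intro T T' hT
    have h1 : (QuotientGroup.mk (∏ i ∈ T, u i) : G ⧸ J) = QuotientGroup.mk (∏ i ∈ T', u i) :=
      congrArg Subtype.val hT
    by_contra hne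
    have hne' : (symmDiff T T').Nonempty := by
      rw [Finset.nonempty_iff_ne_empty]
      intro h0
      exact hne (symmDiff_eq_bot.1 h0)
    apply hn _ hne'
    rw [QuotientGroup.eq] at h1
    have hsq : (∏ i ∈ T \ T', u i) ^ 2 ∈ J := h2 _ (prod_mem fun i _ => hu i)
    have e1 : ∏ i ∈ T, u i = (∏ i ∈ T \ T', u i) * ∏ i ∈ T ∩ T', u i := by
      rw [← Finset.prod_union (Finset.disjoint_sdiff_inter _ _), Finset.sdiff_union_inter]
    have e2 : ∏ i ∈ T', u i = (∏ i ∈ T' \ T, u i) * ∏ i ∈ T ∩ T', u i := by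
      rw [Finset.inter_comm, ← Finset.prod_union (Finset.disjoint_sdiff_inter _ _),
        Finset.sdiff_union_inter]
    have e3 : ∏ i ∈ symmDiff T T', u i = (∏ i ∈ T \ T', u i) * ∏ i ∈ T' \ T, u i := by
      rw [symmDiff_def, Finset.sup_eq_union, Finset.prod_union]
      exact disjoint_sdiff_sdiff
    have := mul_mem hsq h1
    rw [e3]
    rw [e1, e2] at this
    convert this using 1
    rw [mul_inv, sq]
    generalize (∏ i ∈ T \ T', u i) = a
    generalize (∏ i ∈ T' \ T, u i) = b
    generalize (∏ i ∈ T ∩ T', u i) = c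
    calc a * b = a * b * (a * a⁻¹) * (c⁻¹ * c) := by simp
      _ = a * a * (a⁻¹ * c⁻¹ * (b * c)) := by
        simp only [mul_comm, mul_left_comm, mul_assoc]
  have := Nat.card_le_card_of_injective f hinj
  rwa [Nat.card_eq_fintype_card, Fintype.card_finset, Fintype.card_fin] at this

/-- A nontrivial 2-group with an involution has nontrivial fixed points. -/
theorem h2_one_of_h2f_one [Finite G] (s : G →* G) (hs : ∀ x, s (s x) = x) (h : h2f s = 1) :
    h2 G = 1 := by
  by_contra hne
  have hbot : tp G ≠ ⊥ := by
    intro h0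
    apply hne
    unfold h2
    rw [h0]; simp
  obtain ⟨⟨x, hx⟩, hx0⟩ := Subgroup.ne_bot_iff_exists_ne_one.1 hbot
  have hx1 : x ≠ 1 := fun h => hx0 (Subtype.ext h)
  have hfix : ∀ y ∈ tp G, s y = y → y = 1 := by
    intro y hy hsy
    have h1 : (tp G ⊓ (phiHom s).ker : Subgroup G) = ⊥ := Subgroup.eq_bot_of_card_eq _ h
    have : y ∈ (tp G ⊓ (phiHom s).ker : Subgroup G) := ⟨hy, mem_phiHom_ker.2 hsy⟩
    rw [h1] at this
    simpa using this
  have hsm : ∀ y ∈ tp G, s y ∈ tp G := by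
    rintro y ⟨n, hn⟩
    exact ⟨n, by rw [← map_pow, hn, map_one]⟩
  have hinv : ∀ y ∈ tp G, s y = y⁻¹ := by
    intro y hy
    have : y * s y = 1 := by
      apply hfix _ (mul_mem hy (hsm y hy))
      rw [map_mul, hs, mul_comm]
    exact (inv_eq_of_mul_eq_one_right this).symm
  obtain ⟨n, hn⟩ := hx
  have : ∀ n : ℕ, ∀ x ∈ tp G, x ^ (2 ^ n) = 1 → x = 1 := by
    intro n
    induction n with
    | zero => intro x _ h; simpa using h
    | succ n ih =>
      intro x hx h
      rw [pow_succ, pow_mul] at h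
      apply ih x hx
      apply hfix _ (pow_mem hx _)
      rw [hinv _ (pow_mem hx _)]
      rw [inv_eq_iff_mul_eq_one, ← sq, h]
  exact hx1 (this n x ⟨n, hn⟩ hn)

end TwoPart

section Two
variable {K L : Type*} [Field K] [NumberField K] [Field L] [NumberField L] [Algebra K L]
  {σ : L ≃ₐ[ℚ] L}

theorem clAct_invol (h : IsQuad K L σ) (c : ClassGroup (𝓞 L)) : clAct σ (clAct σ c) = c := by
  rw [← clAct_mul]
  have : σ * σ = 1 := by ext x; exact h.invol x
  rw [this, clAct_one]

theorem ramIdx_pow (h : IsQuad K L σ) : ∃ k, ramIdx K σ = 2 ^ k := by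
  apply relIndex_two_pow
  · intro I hI
    rw [mem_phiHom_ker] at hI
    have := norm_mem_ext h I
    rwa [hI, ← sq] at this
  · exact (ramIdx_bound h).1

theorem unitIdx_ne_zero (h : IsQuad K L σ) [IsTotallyReal L] : unitIdx σ ≠ 0 := by
  intro h0
  have := chevalley h
  rw [h0, mul_zero] at this
  have h1 := (ramIdx_bound h).1
  have h2 : Nat.card (ClassGroup (𝓞 K)) ≠ 0 := Nat.card_pos.ne'
  exact (mul_ne_zero h2 h1) this.symm

theorem unit_sq (x : Lˣ) (hx : x ∈ (uEmb L).range ⊓ (phiHom (lAct σ)).ker) :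
    x ^ 2 ∈ (nuHom (lAct σ)).range := by
  refine ⟨x, ?_⟩
  have := mem_phiHom_ker.1 hx.2
  change x * lAct σ x = _
  rw [this, sq]

theorem unitIdx_pow (h : IsQuad K L σ) [IsTotallyReal L] : ∃ k, unitIdx σ = 2 ^ k :=
  relIndex_two_pow _ _ unit_sq (unitIdx_ne_zero h)

/-- The 2-part of the ambiguous class number formula. -/
theorem chev2 (h : IsQuad K L σ) [IsTotallyReal L] :
    h2f (clAct σ) * 2 * unitIdx σ = h2 (ClassGroup (𝓞 K)) * ramIdx K σ := by
  have hc := chevalley h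
  obtain ⟨i, hi⟩ := unitIdx_pow h
  obtain ⟨j, hj⟩ := ramIdx_pow h
  obtain ⟨m, hm, hm'⟩ := card_eq_h2 (G := ClassGroup (𝓞 K))
  obtain ⟨n, hn, hn'⟩ := card_eq_h2 (G := (phiHom (clAct σ)).ker)
  obtain ⟨a, ha⟩ := h2_pow (G := ClassGroup (𝓞 K))
  obtain ⟨b, hb⟩ := h2_pow (G := (phiHom (clAct σ)).ker)
  have e : h2f (clAct σ) = 2 ^ b := by rw [← hb, h2_sub]; rfl
  rw [hn', hm', hi, hj, ha, hb] at hc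
  rw [e, hi, hj, ha]
  have : 2 ^ (b + 1 + i) * n = 2 ^ (a + j) * m := by
    rw [pow_add, pow_add, pow_add, pow_one]
    linarith
  have := two_pow_odd_cancel hn hm this
  calc 2 ^ b * 2 * 2 ^ i = 2 ^ (b + 1 + i) := by ring
    _ = 2 ^ (a + j) := by rw [this]
    _ = _ := by ring

/-- upper bound from independent non-norm units -/
theorem chev_upper (h : IsQuad K L σ) [IsTotallyReal L] {k : ℕ} (u : Fin k → Lˣ)
    (hu : ∀ i, u i ∈ (uEmb L).range) (hf : ∀ i, σ (u i) = u i)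
    (hn : ∀ T : Finset (Fin k), T.Nonempty → ∀ x : L, x * σ x ≠ ∏ i ∈ T, (u i : L)) {t : ℕ}
    (ht : (ramSet σ).ncard ≤ t) :
    h2f (clAct σ) * 2 ^ (k + 1) ≤ h2 (ClassGroup (𝓞 K)) * 2 ^ t := by
  have hi : 2 ^ k ≤ unitIdx σ := by
    have hmem : ∀ i, u i ∈ (uEmb L).range ⊓ (phiHom (lAct σ)).ker := by
      intro i
      refine ⟨hu i, ?_⟩
      apply mem_phiHom_ker.2
      ext1
      rw [lAct_val]; exact hf i
    refine relIndex_ge (nuHom (lAct σ)).range ((uEmb L).range ⊓ (phiHom (lAct σ)).ker)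
      unit_sq (unitIdx_ne_zero h) u hmem ?_
    rintro T hT ⟨x, hx⟩
    apply hn T hT x
    have := congrArg Units.val hx
    rw [Units.coe_prod] at this
    rw [← this]
    rfl
  have hr : ramIdx K σ ≤ 2 ^ t :=
    (ramIdx_bound h).2.trans (Nat.pow_le_pow_right (by norm_num) ht)
  calc h2f (clAct σ) * 2 ^ (k + 1) = h2f (clAct σ) * 2 * 2 ^ k := by ring
    _ ≤ h2f (clAct σ) * 2 * unitIdx σ := by gcongr
    _ = _ := chev2 h
    _ ≤ _ := by gcongr

/-- If `h2 K = 1` and at most one prime ramifies then every unit of `K` is a norm. -/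
theorem unit_norm_of_one (h : IsQuad K L σ) [IsTotallyReal L]
    (hK : h2 (ClassGroup (𝓞 K)) = 1) (ht : (ramSet σ).ncard ≤ 1) (u : Lˣ)
    (hu : u ∈ (uEmb L).range) (hf : σ u = u) : ∃ x : L, x * σ x = u := by
  by_contra hcon
  push Not at hcon
  have := chev_upper h (k := 1) (fun _ => u) (fun _ => hu) (fun _ => hf) (by
    intro T hT x
    have : T = {0} := by
      apply Finset.eq_singleton_iff_nonempty_unique_mem.2 ⟨hT, ?_⟩
      intro x _; exact Subsingleton.elim _ _
    rw [this, Finset.prod_singleton]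
    exact hcon x) ht
  rw [hK] at this
  have h1 : 0 < h2f (clAct σ) := Nat.card_pos
  omega

theorem h2_one_of_bound (h : IsQuad K L σ) (hb : h2f (clAct σ) ≤ 1) :
    h2 (ClassGroup (𝓞 L)) = 1 := by
  have h1 : 0 < h2f (clAct σ) := Nat.card_pos
  exact h2_one_of_h2f_one (clAct σ) (clAct_invol h) (by omega)

/-- `c * σ c` comes from `K`, so `σ` inverts the 2-part if `h2 K = 1`. -/
theorem inv_of_h2_one (h : IsQuad K L σ) (hK : h2 (ClassGroup (𝓞 K)) = 1)
    (c : ClassGroup (𝓞 L)) (hc : c ∈ tp (ClassGroup (𝓞 L))) : clAct σ c = c⁻¹ := by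
  obtain ⟨I, rfl⟩ := mk_surj c
  obtain ⟨J, hJ⟩ := norm_mem_ext h I
  obtain ⟨m, hm, hm'⟩ := card_eq_h2 (G := ClassGroup (𝓞 K))
  rw [hK, one_mul] at hm'
  have h1 : (ClassGroup.mk (R := 𝓞 L) (K := L) (I * idAct σ I)) ^ m = 1 := by
    have h2 : (ClassGroup.mk (R := 𝓞 K) (K := K) J) ^ m = 1 := by
      rw [← hm']; exact pow_card_eq_one'
    rw [← map_pow] at h2
    have h3 : J ^ m ∈ (toPrincipalIdeal (𝓞 K) K).range := by
      rw [← mk_ker]; exact h2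
    obtain ⟨y, hy⟩ := h3
    rw [← map_pow, ← hJ, ← map_pow, ← hy, extI_principal]
    have : toPrincipalIdeal (𝓞 L) L (kEmb K L y) ∈ (ClassGroup.mk (R := 𝓞 L) (K := L)).ker := by
      rw [mk_ker]; exact ⟨_, rfl⟩
    exact this
  rw [map_mul, ← clAct_mk] at h1
  set c := ClassGroup.mk (R := 𝓞 L) (K := L) I
  obtain ⟨n, hn⟩ := hc
  have h2 : (c * clAct σ c) ^ (2 ^ n) = 1 := by
    rw [mul_pow, ← map_pow (clAct σ), hn, map_one, one_mul]
  have hcop : Nat.Coprime m (2 ^ n) := Nat.Coprime.pow_right _ (Nat.coprime_two_right.2 hm)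
  have h3 : c * clAct σ c = 1 := by
    have h4 := orderOf_dvd_of_pow_eq_one h1
    have h5 := orderOf_dvd_of_pow_eq_one h2
    have := Nat.dvd_gcd h4 h5
    rw [hcop] at this
    exact orderOf_eq_one_iff.1 (Nat.dvd_one.1 this)
  exact (inv_eq_of_mul_eq_one_right h3).symm

end Two
end

section
open scoped nonZeroDivisors

/-- `L = K(r)` is a quadratic extension of `K` inside `ℂ`, `r² ∈ K`. -/
structure QE (K L : IntermediateField ℚ ℂ) (r : ℂ) : Prop where
  le : K ≤ L
  mem : r ∈ L
  nmem : r ∉ K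
  sq : r ^ 2 ∈ K
  gen : ∀ x ∈ L, ∃ a ∈ K, ∃ b ∈ K, x = a + b * r

/-- the field `K(r)` for `r² ∈ K`, `r ∉ K` -/
def quadExt (K : IntermediateField ℚ ℂ) (r : ℂ) (hr : r ∉ K) (h2 : r ^ 2 ∈ K) :
    IntermediateField ℚ ℂ where
  carrier := {x | ∃ a ∈ K, ∃ b ∈ K, x = a + b * r}
  mul_mem' := by
    rintro _ _ ⟨a, ha, b, hb, rfl⟩ ⟨c, hc, d, hd, rfl⟩
    refine ⟨a * c + b * d * r ^ 2, add_mem (mul_mem ha hc) (mul_mem (mul_mem hb hd) h2),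
      a * d + b * c, add_mem (mul_mem ha hd) (mul_mem hb hc), by ring⟩
  add_mem' := by
    rintro _ _ ⟨a, ha, b, hb, rfl⟩ ⟨c, hc, d, hd, rfl⟩
    exact ⟨a + c, add_mem ha hc, b + d, add_mem hb hd, by ring⟩
  algebraMap_mem' := fun x => ⟨algebraMap ℚ ℂ x, K.algebraMap_mem x, 0, zero_mem _, by ring⟩
  inv_mem' := by
    rintro _ ⟨a, ha, b, hb, rfl⟩
    by_cases h0 : a + b * r = 0
    · exact ⟨0, zero_mem _, 0, zero_mem _, by rw [h0]; simp⟩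
    have h1 : a - b * r ≠ 0 := by
      intro h1
      have hb0 : b = 0 := by
        by_contra hb0
        apply hr
        have : r = a / b := by field_simp; linear_combination -h1
        rw [this]; exact div_mem ha hb
      subst hb0
      apply h0
      linear_combination h1
    have hn : a ^ 2 - b ^ 2 * r ^ 2 ∈ K :=
      sub_mem (pow_mem ha 2) (mul_mem (pow_mem hb 2) h2)
    have hn0 : a ^ 2 - b ^ 2 * r ^ 2 ≠ 0 := by
      have : a ^ 2 - b ^ 2 * r ^ 2 = (a + b * r) * (a - b * r) := by ring
      rw [this]; exact mul_ne_zero h0 h1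
    refine ⟨a / (a ^ 2 - b ^ 2 * r ^ 2), div_mem ha hn, (-b) / (a ^ 2 - b ^ 2 * r ^ 2),
      div_mem (neg_mem hb) hn, ?_⟩
    rw [inv_eq_iff_eq_inv, ← one_div, eq_div_iff]
    · field_simp; ring
    · intro h3
      have : (a - b * r) / (a ^ 2 - b ^ 2 * r ^ 2) = 0 := by rw [← h3]; ring
      rw [div_eq_zero_iff] at this
      exact this.elim h1 hn0

theorem QE.mk' {K L : IntermediateField ℚ ℂ} {r : ℂ} (hle : K ≤ L) (hm : r ∈ L) (hr : r ∉ K)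
    (h2 : r ^ 2 ∈ K)
    (hL : ∀ M : IntermediateField ℚ ℂ, K ≤ M → r ∈ M → L ≤ M) : QE K L r := by
  refine ⟨hle, hm, hr, h2, ?_⟩
  have := hL (quadExt K r hr h2) (fun x hx => ⟨x, hx, 0, zero_mem _, by ring⟩)
    ⟨0, zero_mem _, 1, one_mem _, by ring⟩
  exact fun x hx => this hx

namespace QE
variable {K L : IntermediateField ℚ ℂ} {r : ℂ}

theorem uniq (h : QE K L r) {a b c d : ℂ} (ha : a ∈ K) (hb : b ∈ K) (hc : c ∈ K) (hd : d ∈ K)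
    (e : a + b * r = c + d * r) : a = c ∧ b = d := by
  have : b = d := by
    by_contra hne
    apply h.nmem
    have h1 : b - d ≠ 0 := sub_ne_zero.2 hne
    have : r = (c - a) / (b - d) := by field_simp; linear_combination e
    rw [this]
    exact div_mem (sub_mem hc ha) (sub_mem hb hd)
  subst this
  exact ⟨by linear_combination e, rfl⟩

/-- conjugation function -/
noncomputable def cj (h : QE K L r) (x : L) : L :=
  ⟨(h.gen x x.2).choose - (h.gen x x.2).choose_spec.2.choose * r, by
    have h1 := (h.gen x x.2).choose_spec.1
    have h2 := (h.gen x x.2).choose_spec.2.choose_spec.1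
    exact sub_mem (h.le h1) (mul_mem (h.le h2) h.mem)⟩

theorem cj_eq (h : QE K L r) (x : L) {a b : ℂ} (ha : a ∈ K) (hb : b ∈ K) (e : (x : ℂ) = a + b * r) :
    (h.cj x : ℂ) = a - b * r := by
  have h1 := (h.gen x x.2).choose_spec.1
  have h2 := (h.gen x x.2).choose_spec.2.choose_spec.1
  have h3 := (h.gen x x.2).choose_spec.2.choose_spec.2
  obtain ⟨e1, e2⟩ := h.uniq h1 h2 ha hb (h3.symm.trans e)
  change (h.gen x x.2).choose - (h.gen x x.2).choose_spec.2.choose * r = _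
  exact congrArg₂ (fun u v => u - v * r) e1 e2

theorem cj_cj (h : QE K L r) (x : L) : h.cj (h.cj x) = x := by
  obtain ⟨a, ha, b, hb, e⟩ := h.gen x x.2
  have e1 := h.cj_eq x ha hb e
  have e2 := h.cj_eq (h.cj x) ha (neg_mem hb) (by rw [e1]; ring)
  ext1
  rw [e2, e]; ring

/-- The nontrivial automorphism of `L/K`. -/
noncomputable def sigma (h : QE K L r) : L ≃ₐ[ℚ] L :=
  AlgEquiv.ofRingEquiv (f := { toFun := h.cj
                               invFun := h.cj
                               left_inv := h.cj_cj
                               right_inv := h.cj_cj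
                               map_mul' := by
                                intro x y
                                obtain ⟨a, ha, b, hb, e⟩ := h.gen x x.2
                                obtain ⟨c, hc, d, hd, e'⟩ := h.gen y y.2
                                have e1 := h.cj_eq x ha hb e
                                have e2 := h.cj_eq y hc hd e'
                                have e3 := h.cj_eq (x * y) (a := a * c + b * d * r ^ 2)
                                  (b := a * d + b * c)
                                  (add_mem (mul_mem ha hc) (mul_mem (mul_mem hb hd) h.sq))
                                  (add_mem (mul_mem ha hd) (mul_mem hb hc)) (by
                                    push_cast; rw [e, e']; ring)
                                ext1
                                push_cast
                                rw [e1, e2, e3]; ring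
                               map_add' := by
                                intro x y
                                obtain ⟨a, ha, b, hb, e⟩ := h.gen x x.2
                                obtain ⟨c, hc, d, hd, e'⟩ := h.gen y y.2
                                have e1 := h.cj_eq x ha hb e
                                have e2 := h.cj_eq y hc hd e'
                                have e3 := h.cj_eq (x + y) (a := a + c) (b := b + d)
                                  (add_mem ha hc) (add_mem hb hd) (by
                                    push_cast; rw [e, e']; ring)
                                ext1
                                push_cast
                                rw [e1, e2, e3]; ring })
    (by
      intro x
      ext1
      change (h.cj _ : ℂ) = _
      have := h.cj_eq (algebraMap ℚ L x) (a := algebraMap ℚ ℂ x) (b := 0) (K.algebraMap_mem x)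
        (zero_mem _) (by rw [zero_mul, add_zero]; rfl)
      rw [this, zero_mul, sub_zero]; rfl)

theorem sigma_eq (h : QE K L r) (x : L) {a b : ℂ} (ha : a ∈ K) (hb : b ∈ K)
    (e : (x : ℂ) = a + b * r) : (h.sigma x : ℂ) = a - b * r := h.cj_eq x ha hb e

theorem sigma_K (h : QE K L r) (x : L) (hx : (x : ℂ) ∈ K) : h.sigma x = x := by
  ext1
  rw [h.sigma_eq x hx (zero_mem K) (by ring)]; ring

theorem sigma_r (h : QE K L r) (x : L) (c : ℂ) (hc : c ∈ K) (hx : (x : ℂ) = c * r) :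
    h.sigma x = -x := by
  ext1
  rw [h.sigma_eq x (zero_mem K) hc (by rw [hx]; ring)]; push_cast; rw [hx]; ring

/-- the algebra structure -/
noncomputable abbrev alg (h : QE K L r) : Algebra K L := (IntermediateField.inclusion h.le).toAlgebra

theorem isQuad (h : QE K L r) [NumberField K] [NumberField L] :
    letI := h.alg
    IsQuad K L h.sigma := by
  letI := h.alg
  refine ⟨h.cj_cj, ?_, ?_⟩
  · intro x
    constructor
    · intro hx
      obtain ⟨a, ha, b, hb, e⟩ := h.gen x x.2
      have e1 := h.sigma_eq x ha hb e
      rw [hx, e] at e1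
      have := h.uniq ha hb ha (neg_mem hb) (by rw [e1]; ring)
      have hb0 : b = 0 := by
        have := this.2
        linear_combination this / 2
      refine ⟨⟨a, ha⟩, ?_⟩
      ext1
      change a = (x : ℂ)
      rw [e, hb0]; ring
    · rintro ⟨y, rfl⟩
      exact h.sigma_K _ y.2
  · refine ⟨⟨r, h.mem⟩, ?_⟩
    have := h.sigma_r ⟨r, h.mem⟩ 1 (one_mem _) (by simp)
    rw [this]
    intro h1
    have h2 := congrArg Subtype.val h1
    push_cast at h2
    apply h.nmem
    have : r = 0 := by linear_combination -h2 / 2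
    rw [this]; exact zero_mem _

theorem numberField (h : QE K L r) [NumberField K] : NumberField L := by
  letI := h.alg
  haveI : IsScalarTower ℚ K L := IsScalarTower.of_algebraMap_eq (fun x => rfl)
  have : Module.Finite K L := by
    refine ⟨⟨{1, ⟨r, h.mem⟩}, ?_⟩⟩
    rw [eq_top_iff]
    rintro x -
    obtain ⟨a, ha, b, hb, e⟩ := h.gen x x.2
    have : x = (⟨a, ha⟩ : K) • (1 : L) + (⟨b, hb⟩ : K) • (⟨r, h.mem⟩ : L) := by
      rw [Algebra.smul_def, Algebra.smul_def]
      ext1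
      change (x : ℂ) = a * 1 + b * r
      rw [e, mul_one]
    rw [this]
    refine add_mem (Submodule.smul_mem _ _ (Submodule.subset_span ?_))
      (Submodule.smul_mem _ _ (Submodule.subset_span ?_)) <;> simp
  haveI : FiniteDimensional ℚ L := Module.Finite.trans K L
  exact { }

theorem finrank (h : QE K L r) [NumberField K] [NumberField L] :
    Module.finrank ℚ L = 2 * Module.finrank ℚ K := by
  letI := h.alg
  haveI : IsScalarTower ℚ K L := IsScalarTower.of_algebraMap_eq (fun x => rfl)
  have h1 := h.isQuad
  have := h1.finrank
  rw [← Module.finrank_mul_finrank ℚ K L, this, mul_comm]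

end QE

/-- `u` is of the form `a² - d b²` over `F`. -/
def NF (F : IntermediateField ℚ ℂ) (d u : ℂ) : Prop := ∃ a ∈ F, ∃ b ∈ F, u = a ^ 2 - d * b ^ 2

theorem NF.descend {F K : IntermediateField ℚ ℂ} {t d f g u : ℂ} (h : QE F K t) (hd : d ∈ F)
    (hf : f ∈ F) (hg : g ∈ F) (hu : u = f + g * t) (hN : NF K d u) :
    NF F d (f ^ 2 - t ^ 2 * g ^ 2) := by
  obtain ⟨a, ha, b, hb, e⟩ := hN
  obtain ⟨a0, ha0, a1, ha1, rfl⟩ := h.gen a ha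
  obtain ⟨b0, hb0, b1, hb1, rfl⟩ := h.gen b hb
  have hm := h.sq
  have e1 : f + g * t = (a0 ^ 2 + t ^ 2 * a1 ^ 2 - d * (b0 ^ 2 + t ^ 2 * b1 ^ 2)) +
    (2 * a0 * a1 - d * (2 * b0 * b1)) * t := by rw [← hu, e]; ring
  have hA : a0 ^ 2 + t ^ 2 * a1 ^ 2 - d * (b0 ^ 2 + t ^ 2 * b1 ^ 2) ∈ F :=
    sub_mem (add_mem (pow_mem ha0 2) (mul_mem hm (pow_mem ha1 2)))
      (mul_mem hd (add_mem (pow_mem hb0 2) (mul_mem hm (pow_mem hb1 2))))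
  have h2F : (2 : ℂ) ∈ F := by
    have := F.algebraMap_mem 2
    simpa using this
  have hB : 2 * a0 * a1 - d * (2 * b0 * b1) ∈ F :=
    sub_mem (mul_mem (mul_mem h2F ha0) ha1) (mul_mem hd (mul_mem (mul_mem h2F hb0) hb1))
  obtain ⟨rfl, rfl⟩ := h.uniq hf hg hA hB e1
  refine ⟨a0 ^ 2 - t ^ 2 * a1 ^ 2 + d * (b0 ^ 2 - t ^ 2 * b1 ^ 2), ?_,
    2 * (a0 * b0 - t ^ 2 * a1 * b1), ?_, by ring⟩
  · exact add_mem (sub_mem (pow_mem ha0 2) (mul_mem hm (pow_mem ha1 2)))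
      (mul_mem hd (sub_mem (pow_mem hb0 2) (mul_mem hm (pow_mem hb1 2))))
  · exact mul_mem h2F (sub_mem (mul_mem ha0 hb0) (mul_mem (mul_mem hm ha1) hb1))

theorem QE.norm_NF {K L : IntermediateField ℚ ℂ} {r : ℂ} (h : QE K L r) (x : L) :
    NF K (r ^ 2) ((x * h.sigma x : L) : ℂ) := by
  obtain ⟨a, ha, b, hb, e⟩ := h.gen x x.2
  refine ⟨a, ha, b, hb, ?_⟩
  push_cast
  rw [h.sigma_eq x ha hb e, e]; ring
end

section
open scoped nonZeroDivisors

section Low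
variable {K L : Type*} [Field K] [NumberField K] [Field L] [NumberField L] [Algebra K L]
  {σ : L ≃ₐ[ℚ] L}

/-- `2 ^ k ≤ ramIdx` if there are `k` distinct genuinely ramified primes. -/
theorem ramIdx_ge (h : IsQuad K L σ) {k : ℕ} (P : Fin k → Ideal (𝓞 L)) (hinj : Function.Injective P)
    (hp : ∀ i, (P i).IsPrime) (h0 : ∀ i, P i ≠ ⊥)
    (hm : ∀ i, ((P i).under (𝓞 K)).map (algebraMap (𝓞 K) (𝓞 L)) = P i ^ 2)
    (hs : ∀ i, iAct σ (P i) = P i) : 2 ^ k ≤ ramIdx K σ := by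
  have hsq : ∀ x ∈ (phiHom (idAct σ)).ker, x ^ 2 ∈ (extI K L).range := by
    intro I hI
    have hI := mem_phiHom_ker.1 hI
    have := norm_mem_ext h I
    rwa [hI, ← sq] at this
  refine relIndex_ge (extI K L).range (phiHom (idAct σ)).ker hsq (ramIdx_bound h).1
    (fun i => fu (P i) (h0 i)) ?_ ?_
  · intro i
    apply mem_phiHom_ker.2
    rw [idAct_fu]
    ext1
    rw [fu_coe, fu_coe, hs]
  · rintro T ⟨j, hj⟩ ⟨J, hJ⟩
    have h1 : ∀ i, extI K L (fu ((P i).under (𝓞 K)) (under_ne_bot _ (h0 i))) = (fu (P i) (h0 i)) ^ 2 := by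
      intro i
      ext1
      rw [extI_coe _ _ (fu_coe _ _), hm, Units.val_pow_eq_pow_val, fu_coe,
        FractionalIdeal.coeIdeal_pow]
    have h2 : J ^ 2 = ∏ i ∈ T, fu ((P i).under (𝓞 K)) (under_ne_bot _ (h0 i)) := by
      apply extI_inj (K := K) (L := L)
      rw [map_pow, hJ, map_prod, ← Finset.prod_pow]
      exact Finset.prod_congr rfl (fun i _ => (h1 i).symm)
    have h3 := congrArg Units.val h2
    rw [Units.val_pow_eq_pow_val, Units.coe_prod] at h3
    let v : Fin k → IsDedekindDomain.HeightOneSpectrum (𝓞 K) := fun i =>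
      ⟨(P i).under (𝓞 K), (hp i).under _, under_ne_bot _ (h0 i)⟩
    have hv : ∀ i, i ≠ j → v i ≠ v j := by
      intro i hij he
      apply hij
      have h4 : (P i).under (𝓞 K) = (P j).under (𝓞 K) :=
        congrArg IsDedekindDomain.HeightOneSpectrum.asIdeal he
      have h5 : P i ^ 2 = P j ^ 2 := by rw [← hm, ← hm, h4]
      apply hinj
      have h6 : P j ^ 2 ≤ P i := by rw [← h5]; exact Ideal.pow_le_self two_ne_zero
      have h7 : P j ≤ P i := (hp i).le_of_pow_le h6
      have h8 : P i ^ 2 ≤ P j := by rw [h5]; exact Ideal.pow_le_self two_ne_zero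
      exact le_antisymm ((hp j).le_of_pow_le h8) h7
    have h4 := congrArg (FractionalIdeal.count K (v j)) h3
    rw [FractionalIdeal.count_pow, FractionalIdeal.count_prod _ _ _ _ (fun i _ => Units.ne_zero _),
      Finset.sum_eq_single j] at h4
    · have h5 := FractionalIdeal.count_self K (v j)
      rw [fu_coe] at h4
      change _ = FractionalIdeal.count K (v j) ((v j).asIdeal : FractionalIdeal (𝓞 K)⁰ K) at h4
      rw [h5] at h4
      omega
    · intro i _ hi
      rw [fu_coe]
      exact FractionalIdeal.count_maximal_coprime K (v j) (hv i hi)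
    · intro hh; exact absurd hj hh

theorem exists_nonnorm (h : IsQuad K L σ) [IsTotallyReal L] {k : ℕ}
    (hr : 2 ^ k ≤ ramIdx K σ) (hlt : h2f (clAct σ) * 2 < h2 (ClassGroup (𝓞 K)) * 2 ^ k) :
    ∃ u : Lˣ, u ∈ (uEmb L).range ∧ σ u = u ∧ ∀ x : L, x * σ x ≠ u := by
  by_contra hcon
  push Not at hcon
  have h1 : unitIdx σ = 1 := by
    unfold unitIdx
    rw [Subgroup.relIndex_eq_one]
    rintro u ⟨hu, hs⟩
    obtain ⟨x, hx⟩ := hcon u hu (by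
      have := mem_phiHom_ker.1 hs
      exact congrArg Units.val this)
    have hx0 : x ≠ 0 := by
      rintro rfl
      rw [zero_mul] at hx
      exact u.ne_zero hx.symm
    exact ⟨Units.mk0 x hx0, by ext1; exact hx⟩
  have := chev2 h
  rw [h1, mul_one] at this
  have h2 : h2 (ClassGroup (𝓞 K)) * 2 ^ k ≤ h2 (ClassGroup (𝓞 K)) * ramIdx K σ :=
    Nat.mul_le_mul_left _ hr
  omega

/-- norms of elements become norms of units after an odd power -/
theorem unit_norm_odd (h : IsQuad K L σ) (hL : h2 (ClassGroup (𝓞 L)) = 1) (u : Lˣ)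
    (hu : u ∈ (uEmb L).range) (x : L) (hx : x * σ x = u) :
    ∃ m : ℕ, Odd m ∧ ∃ e : Lˣ, e ∈ (uEmb L).range ∧ (e : L) * σ e = (u : L) ^ m := by
  obtain ⟨m, hm, hm'⟩ := card_eq_h2 (G := ClassGroup (𝓞 L))
  rw [hL, one_mul] at hm'
  have hx0 : x ≠ 0 := by
    rintro rfl
    rw [zero_mul] at hx
    exact u.ne_zero hx.symm
  let X : Lˣ := Units.mk0 x hx0
  have hX : X * lAct σ X = u := by ext1; exact hx
  have h1 : toPrincipalIdeal (𝓞 L) L X * idAct σ (toPrincipalIdeal (𝓞 L) L X) = 1 := by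
    rw [idAct_principal]
    change _ * toPrincipalIdeal (𝓞 L) L (lAct σ X) = 1
    rw [← map_mul, hX]
    have : u ∈ (toPrincipalIdeal (𝓞 L) L).ker := by rw [principal_ker]; exact hu
    exact this
  obtain ⟨J, hJ⟩ := h90_ideal σ h.invol _ h1
  have h2 : J ^ m ∈ (toPrincipalIdeal (𝓞 L) L).range := by
    rw [← mk_ker, MonoidHom.mem_ker, map_pow, ← hm']
    exact pow_card_eq_one'
  obtain ⟨y, hy⟩ := h2
  refine ⟨m, hm, X ^ m / (y / lAct σ y), ?_, ?_⟩
  · rw [← principal_ker, MonoidHom.mem_ker, map_div, map_div, map_pow, hJ, hy]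
    have : toPrincipalIdeal (𝓞 L) L (lAct σ y) = idAct σ (J ^ m) := by
      rw [← hy, idAct_principal]; rfl
    rw [this, map_pow, div_pow, div_self']
  · have hyy : lAct σ (lAct σ y) = y := by ext1; exact h.invol _
    have : (X ^ m / (y / lAct σ y)) * lAct σ (X ^ m / (y / lAct σ y)) = u ^ m := by
      rw [map_div, map_div, hyy, map_pow, ← hX, mul_pow, div_mul_div_comm]
      simp
    have := congrArg Units.val this
    rw [Units.val_mul, Units.val_pow_eq_pow_val] at this
    exact this

end Low

/-- algebraic units in `ℂ` -/
def IsUn (u : ℂ) : Prop := u ≠ 0 ∧ IsIntegral ℤ u ∧ IsIntegral ℤ u⁻¹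

theorem IsUn.mul {u v : ℂ} (hu : IsUn u) (hv : IsUn v) : IsUn (u * v) :=
  ⟨mul_ne_zero hu.1 hv.1, hu.2.1.mul hv.2.1, by rw [mul_inv]; exact hu.2.2.mul hv.2.2⟩

theorem IsUn.of_mul {u v : ℂ} (hu : IsIntegral ℤ u) (hv : IsIntegral ℤ v) (h : u * v = 1) :
    IsUn u :=
  ⟨left_ne_zero_of_mul_eq_one h, hu, by rw [inv_eq_of_mul_eq_one_right h]; exact hv⟩

theorem IsUn.neg_one : IsUn (-1) := IsUn.of_mul isIntegral_one.neg isIntegral_one.neg (by norm_num)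

section
variable {L : IntermediateField ℚ ℂ} [NumberField L]

theorem isIntegral_coe_iff (x : L) : IsIntegral ℤ (x : ℂ) ↔ IsIntegral ℤ x :=
  isIntegral_algebraMap_iff (R := ℤ) (B := ℂ) (A := L) (x := x) Subtype.val_injective

theorem mem_uEmb_of_isUn (x : Lˣ) (h : IsUn ((x : L) : ℂ)) : x ∈ (uEmb L).range := by
  obtain ⟨h0, h1, h2⟩ := h
  have i1 : IsIntegral ℤ (x : L) := (isIntegral_coe_iff _).1 h1
  have i2 : IsIntegral ℤ ((x⁻¹ : Lˣ) : L) := by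
    rw [← isIntegral_coe_iff]
    rw [Units.val_inv_eq_inv_val]
    push_cast
    exact h2
  refine ⟨⟨⟨x, i1⟩, ⟨_, i2⟩, ?_, ?_⟩, ?_⟩
  · ext1; change (x : L) * ((x⁻¹ : Lˣ) : L) = 1; simp
  · ext1; change ((x⁻¹ : Lˣ) : L) * (x : L) = 1; simp
  · ext1; rfl

theorem isUn_of_mem_uEmb (x : Lˣ) (h : x ∈ (uEmb L).range) : IsUn ((x : L) : ℂ) := by
  obtain ⟨e, rfl⟩ := h
  have h1 : IsIntegral ℤ (((uEmb L e : Lˣ) : L) : ℂ) :=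
    (isIntegral_coe_iff _).2 (RingOfIntegers.isIntegral_coe (e : 𝓞 L))
  have h2 : IsIntegral ℤ (((uEmb L e⁻¹ : Lˣ) : L) : ℂ) :=
    (isIntegral_coe_iff _).2 (RingOfIntegers.isIntegral_coe ((e⁻¹ : (𝓞 L)ˣ) : 𝓞 L))
  refine IsUn.of_mul h1 h2 ?_
  have : uEmb L e * uEmb L e⁻¹ = 1 := by rw [← map_mul, mul_inv_cancel, map_one]
  have := congrArg (fun z : Lˣ => ((z : L) : ℂ)) this
  simpa using this
end

/-- The 2-class number of a subfield of `ℂ`. -/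
noncomputable def hh (L : IntermediateField ℚ ℂ) : ℕ := h2 (ClassGroup (𝓞 L))

namespace QE
variable {K L : IntermediateField ℚ ℂ} {r : ℂ} [NumberField K] [NumberField L]

theorem upper (h : QE K L r) [IsTotallyReal L] {k t : ℕ} (u : Fin k → ℂ) (hK : ∀ i, u i ∈ K)
    (hu : ∀ i, IsUn (u i))
    (hn : ∀ T : Finset (Fin k), T.Nonempty → ¬ NF K (r ^ 2) (∏ i ∈ T, u i))
    (ht : (ramSet h.sigma).ncard ≤ t) :
    h2f (clAct h.sigma) * 2 ^ (k + 1) ≤ hh K * 2 ^ t := by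
  letI := h.alg
  let U : Fin k → Lˣ := fun i => Units.mk0 ⟨u i, h.le (hK i)⟩ (by
    intro h0
    exact (hu i).1 (congrArg Subtype.val h0))
  refine chev_upper h.isQuad U (fun i => mem_uEmb_of_isUn _ (hu i)) (fun i => h.sigma_K _ (hK i))
    ?_ ht
  intro T hT x hx
  apply hn T hT
  have := h.norm_NF x
  rw [hx] at this
  convert this using 1
  have e : ((∏ i ∈ T, ((U i : Lˣ) : L) : L) : ℂ) = ∏ i ∈ T, (((U i : Lˣ) : L) : ℂ) :=
    map_prod L.val _ _
  rw [e]
  rfl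

/-- no units used -/
theorem upper0 (h : QE K L r) [IsTotallyReal L] {t : ℕ}
    (ht : (ramSet h.sigma).ncard ≤ t) :
    h2f (clAct h.sigma) * 2 ≤ hh K * 2 ^ t := by
  have := h.upper (k := 0) (fun _ => 1) (fun i => i.elim0) (fun i => i.elim0) (by
    intro T hT
    obtain ⟨i, _⟩ := hT
    exact i.elim0) ht
  simpa using this

theorem upper1 (h : QE K L r) [IsTotallyReal L] {t : ℕ} (u : ℂ) (hK : u ∈ K)
    (hu : IsUn u) (hn : ¬ NF K (r ^ 2) u)
    (ht : (ramSet h.sigma).ncard ≤ t) :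
    h2f (clAct h.sigma) * 4 ≤ hh K * 2 ^ t := by
  have := h.upper (k := 1) (fun _ => u) (fun _ => hK) (fun _ => hu) (by
    intro T hT
    have : T = {0} := by
      apply Finset.eq_singleton_iff_nonempty_unique_mem.2 ⟨hT, ?_⟩
      intro x _; exact Subsingleton.elim _ _
    rw [this, Finset.prod_singleton]
    exact hn) ht
  simpa using this

theorem upper2 (h : QE K L r) [IsTotallyReal L] {t : ℕ} (u v : ℂ) (hK : u ∈ K) (hKv : v ∈ K)
    (hu : IsUn u) (hv : IsUn v) (hnu : ¬ NF K (r ^ 2) u) (hnv : ¬ NF K (r ^ 2) v)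
    (hnuv : ¬ NF K (r ^ 2) (u * v)) (ht : (ramSet h.sigma).ncard ≤ t) :
    h2f (clAct h.sigma) * 8 ≤ hh K * 2 ^ t := by
  have := h.upper (k := 2) ![u, v] (by intro i; fin_cases i <;> simpa)
    (by intro i; fin_cases i <;> simpa) (by
    intro T hT
    have : T = {0} ∨ T = {1} ∨ T = {0, 1} := by
      revert T; decide
    rcases this with rfl | rfl | rfl
    · simpa using hnu
    · simpa using hnv
    · simpa using hnuv) ht
  simpa using this

theorem odd_of_bound (h : QE K L r) (hb : h2f (clAct h.sigma) ≤ 1) : hh L = 1 := by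
  letI := h.alg
  exact h2_one_of_bound h.isQuad hb

theorem inv (h : QE K L r) (hK : hh K = 1) (c : ClassGroup (𝓞 L)) (hc : c ∈ tp (ClassGroup (𝓞 L))) :
    clAct h.sigma c = c⁻¹ := by
  letI := h.alg
  exact inv_of_h2_one h.isQuad hK c hc

/-- one ramified prime, odd class number -/
theorem one_ram (h : QE K L r) [IsTotallyReal L] (hK : hh K = 1)
    (ht : (ramSet h.sigma).ncard ≤ 1) : hh L = 1 ∧ ∀ u ∈ K, IsUn u →
      ∃ m : ℕ, Odd m ∧ ∃ a ∈ K, ∃ b ∈ K, IsUn (a + b * r) ∧ a ^ 2 - r ^ 2 * b ^ 2 = u ^ m := by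
  letI := h.alg
  have h1 : hh L = 1 := by
    apply h.odd_of_bound
    have := h.upper0 ht
    rw [hK] at this
    omega
  refine ⟨h1, ?_⟩
  intro u hu hU
  have hu0 : (⟨u, h.le hu⟩ : L) ≠ 0 := fun h0 => hU.1 (congrArg Subtype.val h0)
  let U : Lˣ := Units.mk0 ⟨u, h.le hu⟩ hu0
  have hUm : U ∈ (uEmb L).range := mem_uEmb_of_isUn U hU
  obtain ⟨x, hx⟩ := unit_norm_of_one h.isQuad hK ht U hUm (h.sigma_K _ hu)
  obtain ⟨m, hm, e, he, hee⟩ := unit_norm_odd h.isQuad h1 U hUm x hx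
  obtain ⟨a, ha, b, hb, hab⟩ := h.gen (e : L) (e : L).2
  refine ⟨m, hm, a, ha, b, hb, ?_, ?_⟩
  · rw [← hab]; exact isUn_of_mem_uEmb e he
  · have := congrArg (fun z : L => (z : ℂ)) hee
    simp only [IntermediateField.coe_mul, IntermediateField.coe_pow] at this
    rw [h.sigma_eq _ ha hb hab, hab] at this
    have e2 : ((U : L) : ℂ) = u := rfl
    rw [e2] at this
    rw [← this]; ring

end QE
end

section
open scoped nonZeroDivisors

/-- span over `F₂` -/
def sp : List (Finset (Fin 4)) → List (Finset (Fin 4))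
  | [] => [∅]
  | v :: W => sp W ++ (sp W).map (fun x => symmDiff v x)

theorem mem_sp_cons {v w : Finset (Fin 4)} {W : List (Finset (Fin 4))} :
    w ∈ sp (v :: W) ↔ w ∈ sp W ∨ symmDiff v w ∈ sp W := by
  simp only [sp, List.mem_append, List.mem_map]
  constructor
  · rintro (h | ⟨x, hx, rfl⟩)
    · exact Or.inl h
    · right
      rwa [symmDiff_symmDiff_cancel_left]
  · rintro (h | h)
    · exact Or.inl h
    · exact Or.inr ⟨_, h, symmDiff_symmDiff_cancel_left _ _⟩

/-- four distinct primes -/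
structure PG (g : Fin 4 → ℕ) : Prop where
  prime : ∀ i, (g i).Prime
  inj : Function.Injective g

section
variable (g : Fin 4 → ℕ)

/-- product of the primes in `w` -/
def dd (w : Finset (Fin 4)) : ℕ := ∏ i ∈ w, g i

/-- square root of `dd g w` -/
noncomputable def R (w : Finset (Fin 4)) : ℂ := ((Real.sqrt (dd g w : ℝ) : ℝ) : ℂ)

/-- multiquadratic field -/
noncomputable def MQ (W : List (Finset (Fin 4))) : IntermediateField ℚ ℂ :=
  IntermediateField.adjoin ℚ {x | ∃ w ∈ W, x = R g w}

variable {g}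

theorem R_sq (w : Finset (Fin 4)) : R g w ^ 2 = (dd g w : ℂ) := by
  unfold R
  rw [← Complex.ofReal_pow, Real.sq_sqrt (by positivity)]
  simp

theorem R_empty : R g ∅ = 1 := by simp [R, dd]

theorem R_real_pos (hg : PG g) (w : Finset (Fin 4)) : 0 < Real.sqrt (dd g w : ℝ) := by
  apply Real.sqrt_pos.2
  have : 0 < dd g w := Finset.prod_pos (fun i _ => (hg.prime i).pos)
  exact_mod_cast this

theorem R_ne_zero (hg : PG g) (w : Finset (Fin 4)) : R g w ≠ 0 := by
  unfold R
  exact_mod_cast (R_real_pos hg w).ne'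

theorem Rg_mul (v w : Finset (Fin 4)) : R g v * R g w = dd g (v ∩ w) * R g (symmDiff v w) := by
  unfold R
  rw [← Complex.ofReal_mul, ← Real.sqrt_mul (by positivity)]
  have : dd g v * dd g w = (dd g (v ∩ w)) ^ 2 * dd g (symmDiff v w) := by
    unfold dd
    have h1 : v ∪ w = (v ∩ w) ∪ symmDiff v w := by
      ext x; simp only [Finset.mem_union, Finset.mem_inter, Finset.mem_symmDiff]; tauto
    rw [← Finset.prod_union_inter, h1, Finset.prod_union]
    · ring
    · rw [Finset.disjoint_left]
      intro x; simp only [Finset.mem_inter, Finset.mem_symmDiff]; tauto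
  have h2 : (dd g v : ℝ) * (dd g w : ℝ) = (dd g (v ∩ w) : ℝ) ^ 2 * (dd g (symmDiff v w) : ℝ) := by
    exact_mod_cast this
  rw [h2, Real.sqrt_mul (by positivity), Real.sqrt_sq (by positivity)]
  push_cast
  rfl

theorem natCast_mem' (F : IntermediateField ℚ ℂ) (n : ℕ) : (n : ℂ) ∈ F := natCast_mem F n

theorem R_mem_of_mem {w : Finset (Fin 4)} {W : List (Finset (Fin 4))} (h : w ∈ W) :
    R g w ∈ MQ g W := IntermediateField.subset_adjoin _ _ ⟨w, h, rfl⟩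

theorem MQ_le_iff {W : List (Finset (Fin 4))} {F : IntermediateField ℚ ℂ} :
    MQ g W ≤ F ↔ ∀ w ∈ W, R g w ∈ F := by
  unfold MQ
  rw [IntermediateField.adjoin_le_iff]
  constructor
  · intro h w hw
    exact h ⟨w, hw, rfl⟩
  · rintro h _ ⟨w, hw, rfl⟩
    exact h w hw

theorem MQ_mono_cons (v : Finset (Fin 4)) (W : List (Finset (Fin 4))) : MQ g W ≤ MQ g (v :: W) :=
  MQ_le_iff.2 (fun _ hw => R_mem_of_mem (List.mem_cons_of_mem _ hw))

theorem mem_symmDiff_iff (hg : PG g) {v w : Finset (Fin 4)} {F : IntermediateField ℚ ℂ}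
    (hv : R g v ∈ F) : R g (symmDiff v w) ∈ F ↔ R g w ∈ F := by
  have h0 := R_ne_zero hg v
  have hd : (dd g (v ∩ w) : ℂ) ≠ 0 := by
    have : 0 < dd g (v ∩ w) := Finset.prod_pos (fun i _ => (hg.prime i).pos)
    exact_mod_cast this.ne'
  have e := Rg_mul (g := g) v w
  constructor
  · intro h
    have : R g w = dd g (v ∩ w) * R g (symmDiff v w) / R g v := by
      field_simp; linear_combination e
    rw [this]
    exact div_mem (mul_mem (natCast_mem F _) h) hv
  · intro h
    have : R g (symmDiff v w) = R g v * R g w / dd g (v ∩ w) := by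
      field_simp; linear_combination -e
    rw [this]
    exact div_mem (mul_mem hv h) (natCast_mem F _)

theorem R_mem (hg : PG g) {w : Finset (Fin 4)} {W : List (Finset (Fin 4))} (h : w ∈ sp W) :
    R g w ∈ MQ g W := by
  induction W generalizing w with
  | nil =>
    simp only [sp, List.mem_singleton] at h
    rw [h, R_empty]; exact one_mem _
  | cons v W ih =>
    rcases mem_sp_cons.1 h with h | h
    · exact MQ_mono_cons v W (ih h)
    · have := MQ_mono_cons v W (ih h)
      exact (mem_symmDiff_iff hg (R_mem_of_mem (List.mem_cons_self))).1 this

theorem MQ_le (hg : PG g) {W W' : List (Finset (Fin 4))} (h : ∀ v ∈ W, v ∈ sp W') :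
    MQ g W ≤ MQ g W' := MQ_le_iff.2 (fun v hv => R_mem hg (h v hv))

theorem dd_pos (hg : PG g) (w : Finset (Fin 4)) : 0 < dd g w :=
  Finset.prod_pos (fun i _ => (hg.prime i).pos)

theorem prime_dvd_dd (hg : PG g) {w : Finset (Fin 4)} {i : Fin 4} : g i ∣ dd g w ↔ i ∈ w := by
  constructor
  · intro h
    obtain ⟨j, hj, h2⟩ := ((hg.prime i).prime.dvd_finset_prod_iff _).1 h
    rwa [hg.inj ((Nat.prime_dvd_prime_iff_eq (hg.prime i) (hg.prime j)).1 h2)]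
  · intro h
    exact Finset.dvd_prod_of_mem _ h

theorem dd_erase {w : Finset (Fin 4)} {i : Fin 4} (hi : i ∈ w) : g i * dd g (w.erase i) = dd g w :=
  Finset.mul_prod_erase _ _ hi

theorem dd_not_sq (hg : PG g) {w : Finset (Fin 4)} (hw : w ≠ ∅) : ¬ IsSquare (dd g w) := by
  obtain ⟨i, hi⟩ := Finset.nonempty_iff_ne_empty.2 hw
  rintro ⟨r, hr⟩
  have h1 : g i ∣ r * r := by rw [← hr]; exact (prime_dvd_dd hg).2 hi
  have h2 : g i ∣ r := by
    rcases (hg.prime i).dvd_mul.1 h1 with h | h <;> exact h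
  have h3 : g i * g i ∣ g i * dd g (w.erase i) := by
    rw [dd_erase hi, hr]; exact mul_dvd_mul h2 h2
  have h4 := Nat.dvd_of_mul_dvd_mul_left (hg.prime i).pos h3
  rw [prime_dvd_dd hg] at h4
  simp at h4

theorem R_not_rat (hg : PG g) {w : Finset (Fin 4)} (hw : w ≠ ∅) :
    R g w ∉ (⊥ : IntermediateField ℚ ℂ) := by
  intro h
  obtain ⟨x, hx⟩ := IntermediateField.mem_bot.1 h
  have h2 : ((x ^ 2 : ℚ) : ℂ) = ((dd g w : ℚ) : ℂ) := by
    push_cast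
    rw [← R_sq, ← hx]; rfl
  have h3 : x ^ 2 = (dd g w : ℚ) := by exact_mod_cast h2
  have h4 : IsSquare (dd g w : ℚ) := ⟨x, by rw [← h3]; ring⟩
  rw [Rat.isSquare_natCast_iff] at h4
  exact dd_not_sq hg hw h4

theorem MQ_nil : MQ g [] = ⊥ := by
  rw [eq_bot_iff, MQ_le_iff]
  intro w hw
  exact absurd hw List.not_mem_nil

theorem MQ_cons_le {v : Finset (Fin 4)} {W : List (Finset (Fin 4))} {F : IntermediateField ℚ ℂ}
    (h1 : MQ g W ≤ F) (h2 : R g v ∈ F) : MQ g (v :: W) ≤ F := by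
  rw [MQ_le_iff]
  intro w hw
  rcases List.mem_cons.1 hw with rfl | hw
  · exact h2
  · exact h1 (R_mem_of_mem hw)

theorem R_nmem_qe (hg : PG g) {v : Finset (Fin 4)} {W : List (Finset (Fin 4))}
    (h : R g v ∉ MQ g W) : QE (MQ g W) (MQ g (v :: W)) (R g v) :=
  QE.mk' (MQ_mono_cons v W) (R_mem_of_mem List.mem_cons_self) h
    (by rw [R_sq]; exact natCast_mem _ _) (fun _ h1 h2 => MQ_cons_le h1 h2)

theorem mem_sp_of_R_mem (hg : PG g) {w : Finset (Fin 4)} {W : List (Finset (Fin 4))}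
    (h : R g w ∈ MQ g W) : w ∈ sp W := by
  induction W generalizing w with
  | nil =>
    rw [MQ_nil] at h
    by_contra hw
    apply R_not_rat hg _ h
    simpa [sp] using hw
  | cons v W ih =>
    rw [mem_sp_cons]
    by_cases hv : R g v ∈ MQ g W
    · left
      exact ih (MQ_cons_le le_rfl hv h)
    · have q := R_nmem_qe hg hv
      obtain ⟨a, ha, b, hb, e⟩ := q.gen _ h
      have e2 : (a ^ 2 + b ^ 2 * dd g v) + (2 * a * b) * R g v = dd g w + 0 * R g v := by
        rw [← R_sq w, e, ← R_sq v]; ring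
      have hd : ∀ n : ℕ, (n : ℂ) ∈ MQ g W := natCast_mem _
      have h2 : (2 : ℂ) ∈ MQ g W := by exact_mod_cast hd 2
      have := (q.uniq (add_mem (pow_mem ha 2) (mul_mem (pow_mem hb 2) (hd _)))
        (mul_mem (mul_mem h2 ha) hb) (hd _) (zero_mem _) e2).2
      have hab : a = 0 ∨ b = 0 := by
        simpa [mul_assoc] using this
      rcases hab with rfl | rfl
      · right
        apply ih
        have e3 : dd g (v ∩ w) * R g (symmDiff v w) = b * dd g v := by
          rw [← Rg_mul, e, ← R_sq]; ring
        have hd0 : (dd g (v ∩ w) : ℂ) ≠ 0 := by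
          have : 0 < dd g (v ∩ w) := Finset.prod_pos (fun i _ => (hg.prime i).pos)
          exact_mod_cast this.ne'
        have : R g (symmDiff v w) = b * dd g v / dd g (v ∩ w) := by
          field_simp; linear_combination e3
        rw [this]
        exact div_mem (mul_mem hb (hd _)) (hd _)
      · left
        apply ih
        rw [e, zero_mul, add_zero]; exact ha

/-- main constructor of quadratic extensions -/
theorem MQ_qe (hg : PG g) {w : Finset (Fin 4)} {W W' : List (Finset (Fin 4))}
    (h1 : ∀ v ∈ W, v ∈ sp W') (h2 : w ∈ sp W') (h3 : w ∉ sp W) (h4 : ∀ v ∈ W', v ∈ sp (w :: W)) :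
    QE (MQ g W) (MQ g W') (R g w) :=
  QE.mk' (MQ_le hg h1) (R_mem hg h2) (fun h => h3 (mem_sp_of_R_mem hg h))
    (by rw [R_sq]; exact natCast_mem _ _)
    (fun _ h5 h6 => (MQ_le hg h4).trans (MQ_cons_le h5 h6))

theorem isIntegral_R (w : Finset (Fin 4)) : IsIntegral ℤ (R g w) := by
  refine IsIntegral.of_pow (n := 2) two_pos ?_
  rw [R_sq]
  exact_mod_cast (isIntegral_algebraMap (R := ℤ) (x := (dd g w : ℤ)))

instance MQ_numberField (W : List (Finset (Fin 4))) : NumberField (MQ g W) := by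
  have : FiniteDimensional ℚ (MQ g W) := by
    unfold MQ
    have hfin : Set.Finite {x | ∃ w ∈ W, x = R g w} := by
      have : {x | ∃ w ∈ W, x = R g w} = (R g) '' {w | w ∈ W} := by
        ext x; simp only [Set.mem_setOf_eq, Set.mem_image]
        exact ⟨fun ⟨w, h, e⟩ => ⟨w, h, e.symm⟩, fun ⟨w, h, e⟩ => ⟨w, h, e.symm⟩⟩
      rw [this]
      exact (Set.toFinite _).image _
    haveI := hfin.to_subtype
    apply IntermediateField.finiteDimensional_adjoin
    rintro _ ⟨w, _, rfl⟩
    exact (isIntegral_R w).tower_top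
  exact { }

theorem MQ_finrank_le (hg : PG g) (W : List (Finset (Fin 4))) :
    Module.finrank ℚ (MQ g W) ≤ 2 ^ W.length := by
  induction W with
  | nil => rw [MQ_nil]; simp
  | cons v W ih =>
    rw [List.length_cons, pow_succ']
    by_cases hv : R g v ∈ MQ g W
    · have : MQ g (v :: W) = MQ g W := le_antisymm (MQ_cons_le le_rfl hv) (MQ_mono_cons v W)
      rw [this]; omega
    · rw [(R_nmem_qe hg hv).finrank]; omega

theorem MQ_normal (W : List (Finset (Fin 4))) : Normal ℚ (MQ g W) := by
  rw [normal_iff]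
  intro x
  refine ⟨Algebra.IsIntegral.isIntegral x, ?_⟩
  have := IntermediateField.splits_of_mem_adjoin (F := ℚ) (K := ℂ) (L := MQ g W)
    (S := {x | ∃ w ∈ W, x = R g w}) ?_ x.2
  · have e : minpoly ℚ x = minpoly ℚ (x : ℂ) := (minpoly.algebraMap_eq (A := ℚ) (B := MQ g W) (B' := ℂ)
      Subtype.val_injective x).symm
    rw [e]; exact this
  · rintro _ ⟨w, hw, rfl⟩
    refine ⟨(isIntegral_R w).tower_top, ?_⟩
    have hdvd : minpoly ℚ (R g w) ∣ (Polynomial.X ^ 2 - Polynomial.C (dd g w : ℚ)) := by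
      apply minpoly.dvd
      simp [R_sq]
    have hs : ((Polynomial.X ^ 2 - Polynomial.C (dd g w : ℚ)).map (algebraMap ℚ (MQ g W))).Splits := by
      have : (Polynomial.X ^ 2 - Polynomial.C (dd g w : ℚ)).map (algebraMap ℚ (MQ g W)) =
        (Polynomial.X - Polynomial.C (⟨R g w, R_mem_of_mem hw⟩ : MQ g W)) *
        (Polynomial.X + Polynomial.C (⟨R g w, R_mem_of_mem hw⟩ : MQ g W)) := by
        have e : algebraMap ℚ (MQ g W) (dd g w : ℚ) = (⟨R g w, R_mem_of_mem hw⟩ : MQ g W) ^ 2 := by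
          ext1
          push_cast
          rw [R_sq]
        rw [Polynomial.map_sub, Polynomial.map_pow, Polynomial.map_X, Polynomial.map_C, e]
        rw [Polynomial.C_pow]; ring
      rw [this]
      apply Polynomial.Splits.mul
      · exact Polynomial.Splits.X_sub_C _
      · exact Polynomial.Splits.X_add_C _
    refine Polynomial.Splits.of_dvd hs ?_ (Polynomial.map_dvd _ hdvd)
    apply Polynomial.map_ne_zero
    exact Polynomial.X_pow_sub_C_ne_zero two_pos _

instance MQ_galois (W : List (Finset (Fin 4))) : IsGalois ℚ (MQ g W) := by
  haveI := MQ_normal (g := g) W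
  exact { }

end
end

section
open scoped nonZeroDivisors

/-- membership of a complex number in an ideal -/
def inP {L : IntermediateField ℚ ℂ} (P : Ideal (𝓞 L)) (x : ℂ) : Prop :=
  ∃ y : 𝓞 L, y ∈ P ∧ ((y : L) : ℂ) = x

/-- `x` is an integer of `L` -/
def OI (L : IntermediateField ℚ ℂ) (x : ℂ) : Prop := x ∈ L ∧ IsIntegral ℤ x

section
variable {L : IntermediateField ℚ ℂ}

theorem OI.lift {x : ℂ} (h : OI L x) : ∃ y : 𝓞 L, ((y : L) : ℂ) = x :=
  ⟨⟨⟨x, h.1⟩, (isIntegral_algebraMap_iff (R := ℤ) (B := ℂ) (A := L) (x := ⟨x, h.1⟩) Subtype.val_injective).1 h.2⟩, rfl⟩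

theorem OI.coe (y : 𝓞 L) : OI L ((y : L) : ℂ) :=
  ⟨(y : L).2, (isIntegral_algebraMap_iff (R := ℤ) (B := ℂ) (A := L) (x := (y : L)) Subtype.val_injective).2
    (RingOfIntegers.isIntegral_coe y)⟩

theorem OI.add {x y : ℂ} (hx : OI L x) (hy : OI L y) : OI L (x + y) :=
  ⟨add_mem hx.1 hy.1, hx.2.add hy.2⟩
theorem OI.sub {x y : ℂ} (hx : OI L x) (hy : OI L y) : OI L (x - y) :=
  ⟨sub_mem hx.1 hy.1, hx.2.sub hy.2⟩
theorem OI.mul {x y : ℂ} (hx : OI L x) (hy : OI L y) : OI L (x * y) :=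
  ⟨mul_mem hx.1 hy.1, hx.2.mul hy.2⟩
theorem OI.neg {x : ℂ} (hx : OI L x) : OI L (-x) :=
  ⟨neg_mem hx.1, hx.2.neg⟩
theorem OI.pow {x : ℂ} (hx : OI L x) (n : ℕ) : OI L (x ^ n) :=
  ⟨pow_mem hx.1 n, hx.2.pow n⟩
theorem OI.nat (n : ℕ) : OI L (n : ℂ) :=
  ⟨natCast_mem L n, by exact_mod_cast (isIntegral_algebraMap (R := ℤ) (A := ℂ) (x := (n : ℤ)))⟩
theorem OI.int (n : ℤ) : OI L (n : ℂ) :=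
  ⟨intCast_mem L n, by exact_mod_cast (isIntegral_algebraMap (R := ℤ) (A := ℂ) (x := n))⟩
theorem OI.one : OI L 1 := ⟨one_mem L, isIntegral_one⟩
theorem OI.two : OI L 2 := by exact_mod_cast OI.nat (L := L) 2

theorem inP.oi {P : Ideal (𝓞 L)} {x : ℂ} (h : inP P x) : OI L x := by
  obtain ⟨y, _, rfl⟩ := h; exact OI.coe y

theorem inP.add {P : Ideal (𝓞 L)} {x y : ℂ} (hx : inP P x) (hy : inP P y) : inP P (x + y) := by
  obtain ⟨a, ha, rfl⟩ := hx
  obtain ⟨b, hb, rfl⟩ := hy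
  exact ⟨a + b, P.add_mem ha hb, by push_cast; rfl⟩

theorem inP.neg {P : Ideal (𝓞 L)} {x : ℂ} (hx : inP P x) : inP P (-x) := by
  obtain ⟨a, ha, rfl⟩ := hx
  exact ⟨-a, P.neg_mem ha, by push_cast; rfl⟩

theorem inP.sub {P : Ideal (𝓞 L)} {x y : ℂ} (hx : inP P x) (hy : inP P y) : inP P (x - y) := by
  rw [sub_eq_add_neg]; exact hx.add hy.neg

theorem inP.mul_left {P : Ideal (𝓞 L)} {a x : ℂ} (ha : OI L a) (hx : inP P x) : inP P (a * x) := by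
  obtain ⟨b, rfl⟩ := ha.lift
  obtain ⟨y, hy, rfl⟩ := hx
  exact ⟨b * y, P.mul_mem_left _ hy, by push_cast; rfl⟩

theorem inP.mul_right {P : Ideal (𝓞 L)} {a x : ℂ} (ha : OI L a) (hx : inP P x) : inP P (x * a) := by
  rw [mul_comm]; exact hx.mul_left ha

theorem inP.mul {P Q : Ideal (𝓞 L)} {x y : ℂ} (hx : inP P x) (hy : inP Q y) : inP (P * Q) (x * y) := by
  obtain ⟨a, ha, rfl⟩ := hx
  obtain ⟨b, hb, rfl⟩ := hy
  exact ⟨a * b, Ideal.mul_mem_mul ha hb, by push_cast; rfl⟩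

theorem inP_coe {P : Ideal (𝓞 L)} (y : 𝓞 L) : inP P ((y : L) : ℂ) ↔ y ∈ P := by
  constructor
  · rintro ⟨z, hz, e⟩
    have : z = y := by
      apply RingOfIntegers.ext
      exact Subtype.val_injective e
    rwa [← this]
  · intro h; exact ⟨y, h, rfl⟩

theorem inP.prime {P : Ideal (𝓞 L)} (hP : P.IsPrime) {x y : ℂ} (hx : OI L x) (hy : OI L y)
    (h : inP P (x * y)) : inP P x ∨ inP P y := by
  obtain ⟨a, rfl⟩ := hx.lift
  obtain ⟨b, rfl⟩ := hy.lift
  have e : ((a : L) : ℂ) * ((b : L) : ℂ) = (((a * b : 𝓞 L) : L) : ℂ) := by push_cast; rfl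
  rw [e, inP_coe] at h
  rw [inP_coe, inP_coe]
  exact hP.mem_or_mem h

theorem inP.of_sq {P : Ideal (𝓞 L)} (hP : P.IsPrime) {x : ℂ} (hx : OI L x)
    (h : inP P (x ^ 2)) : inP P x := by
  rw [sq] at h
  rcases h.prime hP hx hx with h | h <;> exact h

theorem not_inP_one {P : Ideal (𝓞 L)} (hP : P.IsPrime) : ¬ inP P 1 := by
  intro h
  have e : (1 : ℂ) = (((1 : 𝓞 L) : L) : ℂ) := by push_cast; rfl
  rw [e, inP_coe] at h
  exact hP.ne_top ((Ideal.eq_top_iff_one _).2 h)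

theorem inP_nat {P : Ideal (𝓞 L)} (n : ℕ) : inP P (n : ℂ) ↔ (n : 𝓞 L) ∈ P := by
  have e : (n : ℂ) = (((n : 𝓞 L) : L) : ℂ) := by push_cast; rfl
  rw [e, inP_coe]

theorem inP_coprime {P : Ideal (𝓞 L)} (hP : P.IsPrime) {m n : ℤ} (h : IsCoprime m n)
    (h1 : inP P (m : ℂ)) (h2 : inP P (n : ℂ)) : False := by
  obtain ⟨a, b, e⟩ := h
  apply not_inP_one hP
  have : (1 : ℂ) = a * m + b * n := by exact_mod_cast e.symm
  rw [this]
  exact (h1.mul_left (OI.int a)).add (h2.mul_left (OI.int b))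

theorem inP_coprime_nat {P : Ideal (𝓞 L)} (hP : P.IsPrime) {m n : ℕ} (h : Nat.Coprime m n)
    (h1 : inP P (m : ℂ)) (h2 : inP P (n : ℂ)) : False :=
  inP_coprime hP (Nat.isCoprime_iff_coprime.2 h) (by exact_mod_cast h1) (by exact_mod_cast h2)

/-- primes over `l` -/
def PO (L : IntermediateField ℚ ℂ) (l : ℕ) : Set (Ideal (𝓞 L)) :=
  {P | P.IsPrime ∧ P ≠ ⊥ ∧ inP P (l : ℂ)}

variable [NumberField L]

theorem PO_finite {l : ℕ} (hl : l ≠ 0) : (PO L l).Finite := by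
  have hl0 : (l : 𝓞 L) ≠ 0 := Nat.cast_ne_zero.2 hl
  have h0 : Ideal.span {(l : 𝓞 L)} ≠ ⊥ := by simpa using hl0
  refine ((Ideal.finite_factors h0).image
    (fun v : IsDedekindDomain.HeightOneSpectrum (𝓞 L) => v.asIdeal)).subset ?_
  rintro P ⟨h1, h2, h3⟩
  refine ⟨⟨P, h1, h2⟩, ?_, rfl⟩
  change P ∣ _
  rw [Ideal.dvd_span_singleton]
  exact (inP_nat l).1 h3

theorem PO_card {l e f : ℕ} (hl : l.Prime) (he : ∀ P ∈ PO L l, inP (P ^ e) (l : ℂ))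
    (hf : ∀ P ∈ PO L l, l ^ f ≤ Ideal.absNorm P) :
    (PO L l).ncard * (e * f) ≤ Module.finrank ℚ L := by
  set S := (PO_finite (L := L) hl.ne_zero).toFinset with hS
  have hc : (PO L l).ncard = S.card := Set.ncard_eq_toFinset_card _ _
  have hmem : ∀ P ∈ S, P ∈ PO L l := fun P hP => (Set.Finite.mem_toFinset _).1 hP
  have hdvd : ∏ P ∈ S, P ^ e ∣ Ideal.span {(l : 𝓞 L)} := by
    apply Finset.prod_dvd_of_coprime
    · intro P hP Q hQ hne
      have hP := hmem P hP
      have hQ := hmem Q hQ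
      have : IsCoprime P Q := by
        rw [Ideal.isCoprime_iff_sup_eq]
        exact Ideal.IsMaximal.coprime_of_ne (hP.1.isMaximal hP.2.1) (hQ.1.isMaximal hQ.2.1) hne
      exact this.pow
    · intro P hP
      rw [Ideal.dvd_span_singleton, ← inP_nat]
      exact he P (hmem P hP)
  have h1 := Ideal.absNorm_dvd_absNorm_of_le (Ideal.le_of_dvd hdvd)
  rw [map_prod, Ideal.absNorm_span_singleton] at h1
  have h2 : (Algebra.norm ℤ) (l : 𝓞 L) = (l : ℤ) ^ Module.finrank ℚ L := by
    have := Algebra.norm_algebraMap (R := ℤ) (S := 𝓞 L) (l : ℤ)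
    rw [RingOfIntegers.rank] at this
    simpa using this
  rw [h2, Int.natAbs_pow, Int.natAbs_natCast] at h1
  have h3 : (l ^ (f * e)) ^ S.card ≤ ∏ P ∈ S, Ideal.absNorm (P ^ e) := by
    rw [← Finset.prod_const]
    apply Finset.prod_le_prod'
    intro P hP
    rw [map_pow, pow_mul]
    exact Nat.pow_le_pow_left (hf P (hmem P hP)) e
  have h4 := h3.trans (Nat.le_of_dvd (pow_pos hl.pos _) h1)
  rw [← pow_mul] at h4
  have := (Nat.pow_le_pow_iff_right hl.one_lt).1 h4
  rw [hc]; linarith [mul_comm S.card (e*f), mul_comm e f]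

theorem absNorm_ge {l : ℕ} (hl : l.Prime) {P : Ideal (𝓞 L)} (hP : P ∈ PO L l) : l ^ 1 ≤ Ideal.absNorm P := by
  obtain ⟨h1, h2, h3⟩ := hP
  haveI := h1.isMaximal h2
  have hd : Ideal.absNorm P ∣ Ideal.absNorm (Ideal.span {(l : 𝓞 L)}) :=
    Ideal.absNorm_dvd_absNorm_of_le (by
      rw [Ideal.span_singleton_le_iff_mem]; exact (inP_nat l).1 h3)
  have h4 : (Algebra.norm ℤ) (l : 𝓞 L) = (l : ℤ) ^ Module.finrank ℚ L := by
    have := Algebra.norm_algebraMap (R := ℤ) (S := 𝓞 L) (l : ℤ)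
    rw [RingOfIntegers.rank] at this
    simpa using this
  rw [Ideal.absNorm_span_singleton, h4, Int.natAbs_pow, Int.natAbs_natCast] at hd
  obtain ⟨k, hk, e⟩ := (Nat.dvd_prime_pow hl).1 hd
  rw [e]
  apply Nat.pow_le_pow_right hl.pos
  rcases Nat.eq_zero_or_pos k with rfl | h
  · rw [pow_zero, Ideal.absNorm_eq_one_iff] at e
    exact absurd e h1.ne_top
  · exact h

theorem absNorm_ge2 {l : ℕ} (hl : l.Prime) {P : Ideal (𝓞 L)} (hP : P ∈ PO L l) {x : ℂ} (hx : OI L x)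
    (hn : ∀ n : ℕ, ¬ inP P (x - n)) : l ^ 2 ≤ Ideal.absNorm P := by
  obtain ⟨h1, h2, h3⟩ := hP
  haveI := h1.isMaximal h2
  have hd : Ideal.absNorm P ∣ Ideal.absNorm (Ideal.span {(l : 𝓞 L)}) :=
    Ideal.absNorm_dvd_absNorm_of_le (by
      rw [Ideal.span_singleton_le_iff_mem]; exact (inP_nat l).1 h3)
  have h4 : (Algebra.norm ℤ) (l : 𝓞 L) = (l : ℤ) ^ Module.finrank ℚ L := by
    have := Algebra.norm_algebraMap (R := ℤ) (S := 𝓞 L) (l : ℤ)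
    rw [RingOfIntegers.rank] at this
    simpa using this
  rw [Ideal.absNorm_span_singleton, h4, Int.natAbs_pow, Int.natAbs_natCast] at hd
  obtain ⟨k, hk, e⟩ := (Nat.dvd_prime_pow hl).1 hd
  rw [e]
  apply Nat.pow_le_pow_right hl.pos
  by_contra hk2
  have : k = 0 ∨ k = 1 := by omega
  rcases this with rfl | rfl
  · rw [pow_zero, Ideal.absNorm_eq_one_iff] at e
    exact absurd e h1.ne_top
  · rw [pow_one, Ideal.absNorm_apply, Submodule.cardQuot_apply] at e
    obtain ⟨y, rfl⟩ := hx.lift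
    -- the map `Fin l → 𝓞/P` is injective, hence surjective
    have hfin : Finite (𝓞 L ⧸ P) := Nat.finite_of_card_ne_zero (by rw [e]; exact hl.ne_zero)
    let φ : Fin l → 𝓞 L ⧸ P := fun i => Ideal.Quotient.mk P ((i : ℕ) : 𝓞 L)
    have hinj : Function.Injective φ := by
      intro i j hij
      have h5 := Ideal.Quotient.eq.1 hij
      by_contra hne
      have hne' : (i : ℤ) - (j : ℤ) ≠ 0 := by
        intro h; apply hne; ext; omega
      have hc : IsCoprime ((i : ℤ) - (j : ℤ)) (l : ℤ) := by
        rw [isCoprime_comm, Prime.coprime_iff_not_dvd (Nat.prime_iff_prime_int.1 hl)]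
        intro h
        have := Int.eq_zero_of_abs_lt_dvd h (by
          rw [abs_lt]; have := i.2; have := j.2; constructor <;> omega)
        exact hne' this
      refine inP_coprime h1 hc ?_ (by exact_mod_cast h3)
      rw [← inP_coe] at h5
      convert h5 using 1
      push_cast; rfl
    have hbij : Function.Bijective φ := by
      haveI := Fintype.ofFinite (𝓞 L ⧸ P)
      rw [Fintype.bijective_iff_injective_and_card]
      refine ⟨hinj, ?_⟩
      rw [Fintype.card_fin, ← Nat.card_eq_fintype_card]; exact e.symm
    obtain ⟨i, hi⟩ := hbij.2 (Ideal.Quotient.mk P y)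
    have h5 := Ideal.Quotient.eq.1 hi.symm
    rw [← inP_coe] at h5
    apply hn i
    convert h5 using 1
    push_cast; rfl
end
end

section
open scoped nonZeroDivisors

theorem totReal_of {L : IntermediateField ℚ ℂ} (h : ∀ φ : L →+* ℂ, ∀ x, (starRingEnd ℂ) (φ x) = φ x) :
    IsTotallyReal L := by
  refine ⟨fun v => ?_⟩
  rw [InfinitePlace.isReal_iff, ComplexEmbedding.isReal_iff]
  ext x
  rw [ComplexEmbedding.conjugate_coe_eq]
  exact h _ x

theorem real_of_totReal {L : IntermediateField ℚ ℂ} [IsTotallyReal L] (φ : L →+* ℂ) (x : L) :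
    (starRingEnd ℂ) (φ x) = φ x := by
  have h : (InfinitePlace.mk φ).IsReal := IsTotallyReal.isReal _
  rw [InfinitePlace.isReal_mk_iff] at h
  rw [ComplexEmbedding.isReal_iff] at h
  rw [← ComplexEmbedding.conjugate_coe_eq, h]

theorem real_of_sq {z : ℂ} {a : ℝ} (ha : 0 ≤ a) (h : z ^ 2 = (a : ℂ)) : (starRingEnd ℂ) z = z := by
  have : z ^ 2 = ((Real.sqrt a : ℝ) : ℂ) ^ 2 := by
    rw [h, ← Complex.ofReal_pow, Real.sq_sqrt ha]
  rcases sq_eq_sq_iff_eq_or_eq_neg.1 this with h | h <;> rw [h] <;> simp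

instance MQ_totReal {g : Fin 4 → ℕ} (W : List (Finset (Fin 4))) : IsTotallyReal (MQ g W) := by
  apply totReal_of
  intro φ
  have : ((starRingEnd ℂ).comp φ).toRatAlgHom = φ.toRatAlgHom := by
    apply IntermediateField.algHom_ext_of_eq_adjoin ℚ (S := MQ g W) rfl
    rintro x ⟨w, hw, rfl⟩
    change (starRingEnd ℂ) (φ _) = φ _
    apply real_of_sq (a := dd g w) (by positivity)
    rw [← map_pow]
    have : (⟨R g w, R_mem_of_mem hw⟩ : MQ g W) ^ 2 = (dd g w : MQ g W) := by
      ext1; push_cast; exact R_sq w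
    rw [this]; simp
  intro x
  exact DFunLike.congr_fun this x

/-- The arithmetic hypotheses. -/
structure CG (g : Fin 4 → ℕ) : Prop extends PG g where
  g0 : g 0 = 2
  g1 : g 1 % 8 = 5
  g2 : g 2 % 8 = 3
  g3 : g 3 % 4 = 3
  q2 : IsSquare (g 1 : ZMod (g 2))
  q3 : IsSquare (g 1 : ZMod (g 3))

section
variable {L : IntermediateField ℚ ℂ}

theorem inP_cancel {P : Ideal (𝓞 L)} {m n : ℕ} {x : ℂ} (h : Nat.Coprime m n) (h1 : inP P (m * x))
    (h2 : inP P (n * x)) : inP P x := by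
  obtain ⟨a, b, e⟩ := Nat.isCoprime_iff_coprime.2 h
  have : x = a * (m * x) + b * (n * x) := by
    have : (1 : ℂ) = a * m + b * n := by exact_mod_cast e.symm
    linear_combination x * this
  rw [this]
  exact (h1.mul_left (OI.int a)).add (h2.mul_left (OI.int b))

theorem inP_int {P : Ideal (𝓞 L)} {l : ℕ} (h : inP P (l : ℂ)) {n : ℤ} (hn : (l : ℤ) ∣ n) : inP P (n : ℂ) := by
  obtain ⟨c, rfl⟩ := hn
  push_cast
  exact h.mul_right (OI.int c)

variable {g : Fin 4 → ℕ} {W : List (Finset (Fin 4))}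

theorem OI_R (hg : PG g) {v : Finset (Fin 4)} (h : v ∈ sp W) : OI (MQ g W) (R g v) :=
  ⟨R_mem hg h, isIntegral_R v⟩

theorem dd_coprime (hg : PG g) {i : Fin 4} {v : Finset (Fin 4)} (h : i ∉ v) : Nat.Coprime (dd g v) (g i) := by
  rw [Nat.coprime_comm, (hg.prime i).coprime_iff_not_dvd, prime_dvd_dd hg]
  exact h

/-- `e ≥ 2` at a prime dividing a radicand -/
theorem e2 (hg : PG g) {i : Fin 4} {v : Finset (Fin 4)} (hv : v ∈ sp W) (hi : i ∈ v)
    {P : Ideal (𝓞 (MQ g W))} (hP : P ∈ PO (MQ g W) (g i)) : inP (P ^ 2) (g i : ℂ) := by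
  have h1 : R g v ^ 2 = dd g (v.erase i) * g i := by
    rw [R_sq, ← dd_erase hi]; push_cast; ring
  have h2 : inP P (R g v) := by
    apply inP.of_sq hP.1 (OI_R hg hv)
    rw [h1]; exact hP.2.2.mul_left (OI.nat _)
  rw [sq] at h1 ⊢
  apply inP_cancel (dd_coprime hg (Finset.notMem_erase i v))
  · rw [← h1]; exact h2.mul h2
  · exact hP.2.2.mul hP.2.2

/-- `e ≥ 2` at two, radicand `3 mod 4` -/
theorem e2' (hg : CG g) {v : Finset (Fin 4)} (hv : v ∈ sp W) (hi : dd g v % 4 = 3)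
    {P : Ideal (𝓞 (MQ g W))} (hP : P ∈ PO (MQ g W) (g 0)) : inP (P ^ 2) (g 0 : ℂ) := by
  have hR := OI_R hg.toPG hv
  have h2 : inP P 2 := by have := hP.2.2; rw [hg.g0] at this; exact_mod_cast this
  obtain ⟨k, hk⟩ : ∃ k, dd g v = 4 * k + 3 := ⟨dd g v / 4, by omega⟩
  have hsq : R g v ^ 2 = 4 * k + 3 := by rw [R_sq, hk]; push_cast; ring
  have h4 : inP (P ^ 2) (2 * 2) := by rw [sq]; exact h2.mul h2
  have h1 : inP P (1 + R g v) := by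
    apply inP.of_sq hP.1 (OI.one.add hR)
    have : (1 + R g v) ^ 2 = (2 * k + 2 + R g v) * 2 := by linear_combination hsq
    rw [this]
    exact h2.mul_left (by exact_mod_cast (OI.nat (2 * k + 2)).add hR)
  have h3 : inP (P ^ 2) (2 * R g v) := by
    have : 2 * R g v = (1 + R g v) * (1 + R g v) - (k + 1 : ℕ) * (2 * 2) := by
      push_cast; linear_combination -hsq
    rw [this]
    refine inP.sub (by rw [sq]; exact h1.mul h1) (h4.mul_left (OI.nat _))
  rw [hg.g0]
  apply inP_cancel (m := dd g v) (n := 2)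
  · rw [Nat.coprime_comm, Nat.coprime_two_left, Nat.odd_iff]; omega
  · rw [← R_sq]
    have : R g v ^ 2 * ((2 : ℕ) : ℂ) = R g v * (2 * R g v) := by push_cast; ring
    rw [this]; exact h3.mul_left hR
  · exact_mod_cast h4

/-- `e ≥ 4` at two -/
theorem e4 (hg : CG g) {v w : Finset (Fin 4)} (hv : v ∈ sp W) (hw : w ∈ sp W) (hi : dd g w % 4 = 3)
    (h0 : 0 ∈ v)
    {P : Ideal (𝓞 (MQ g W))} (hP : P ∈ PO (MQ g W) (g 0)) : inP (P ^ 4) (g 0 : ℂ) := by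
  have hy := OI_R hg.toPG hw
  have ht := OI_R hg.toPG hv
  have h2 : inP P 2 := by have := hP.2.2; rw [hg.g0] at this; exact_mod_cast this
  obtain ⟨k, hk⟩ : ∃ k, dd g w = 4 * k + 3 := ⟨dd g w / 4, by omega⟩
  have hysq : R g w ^ 2 = 4 * k + 3 := by rw [R_sq, hk]; push_cast; ring
  have hmodd : dd g (v.erase 0) % 2 = 1 := by
    have := dd_coprime hg.toPG (Finset.notMem_erase 0 v)
    rw [hg.g0, Nat.coprime_comm, Nat.coprime_two_left, Nat.odd_iff] at this
    exact this
  obtain ⟨n, hn⟩ : ∃ n, dd g (v.erase 0) = 2 * n + 1 := ⟨dd g (v.erase 0) / 2, by omega⟩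
  have htsq : R g v ^ 2 = 2 * (2 * n + 1) := by
    rw [R_sq, ← dd_erase h0, hn, hg.g0]; push_cast; ring
  set t := R g v with htd
  set y := R g w with hyd
  have hz : OI (MQ g W) ((1 + y) * t / 2) := by
    refine ⟨div_mem (mul_mem (add_mem (one_mem _) hy.1) ht.1) (by exact_mod_cast natCast_mem (MQ g W) 2), ?_⟩
    refine IsIntegral.of_pow (n := 2) two_pos ?_
    have : ((1 + y) * t / 2) ^ 2 = (2 * n + 1 : ℕ) * ((2 * k + 2 : ℕ) + y) := by
      push_cast
      linear_combination (1 + y) ^ 2 / 4 * htsq + (2 * n + 1) / 2 * hysq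
    rw [this]
    exact ((OI.nat (L := MQ g W) _).mul ((OI.nat _).add hy)).2
  set z := (1 + y) * t / 2 with hzd
  have e1 : z ^ 2 = 2 * (k + 1) * (2 * n + 1) + t * z - (2 * n + 1) := by
    rw [hzd]
    linear_combination ((1 + y) ^ 2 / 4 - (1 + y)/ 2) * htsq + (2 * n + 1) / 2 * hysq
  have htP : inP P t := by
    apply inP.of_sq hP.1 ht
    rw [htsq]
    exact h2.mul_right (by exact_mod_cast OI.nat (2 * n + 1))
  have h4 : inP (P ^ 2) (2 * 2) := by rw [sq]; exact h2.mul h2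
  have h22 : inP (P ^ 2) 2 := by
    have := e2 hg.toPG hv h0 hP
    rw [hg.g0] at this; exact_mod_cast this
  have hz1 : inP P (z ^ 2 + 1) := by
    have : z ^ 2 + 1 = ((((k : ℤ) + 1) * (2 * n + 1) - n : ℤ) : ℂ) * 2 + z * t := by
      push_cast; linear_combination e1
    rw [this]
    exact (h2.mul_left (OI.int _)).add (htP.mul_left hz)
  have hz2 : inP P (z + 1) := by
    apply inP.of_sq hP.1 (hz.add OI.one)
    have : (z + 1) ^ 2 = (z ^ 2 + 1) + z * 2 := by ring
    rw [this]
    exact hz1.add (h2.mul_left hz)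
  have htz : inP (P ^ 2) (t * z) := by
    have : t * z = (z + 1) * (z + 1) - ((((k : ℤ) + 1) * (2 * n + 1) - n : ℤ) : ℂ) * 2 - z * 2 := by
      push_cast; linear_combination -e1
    rw [this]
    refine ((inP.sub (by rw [sq]; exact hz2.mul hz2) (h22.mul_left (OI.int _)))).sub (h22.mul_left hz)
  have htP2 : inP (P ^ 2) t := by
    have : t = t * (z ^ 2 + 1) - z * (t * z) := by ring
    rw [this]
    exact (inP.sub (by rw [sq]; exact htP.mul hz1) (htz.mul_left hz))
  rw [hg.g0]
  have e4 : P ^ 4 = P ^ 2 * P ^ 2 := by ring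
  rw [e4]
  apply inP_cancel (m := 2 * n + 1) (n := 2)
  · rw [Nat.coprime_comm, Nat.coprime_two_left, Nat.odd_iff]; omega
  · have : ((2 * n + 1 : ℕ) : ℂ) * ((2 : ℕ) : ℂ) = t * t := by push_cast; linear_combination -htsq
    rw [this]; exact htP2.mul htP2
  · exact_mod_cast h22.mul h22

theorem isIntegral_half {v : Finset (Fin 4)} (h : dd g v % 4 = 1) : IsIntegral ℤ ((1 + R g v) / 2) := by
  obtain ⟨k, hk⟩ : ∃ k, dd g v = 4 * k + 1 := ⟨dd g v / 4, by omega⟩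
  refine ⟨Polynomial.X ^ 2 - Polynomial.X - Polynomial.C (k : ℤ), ?_, ?_⟩
  · monicity!
  · simp only [Polynomial.eval₂_sub, Polynomial.eval₂_pow, Polynomial.eval₂_X, Polynomial.eval₂_C]
    have := R_sq (g := g) v
    rw [hk] at this
    push_cast at this ⊢
    linear_combination this / 4

theorem OI_half (hg : PG g) {v : Finset (Fin 4)} (hv : v ∈ sp W) (h : dd g v % 4 = 1) :
    OI (MQ g W) ((1 + R g v) / 2) :=
  ⟨div_mem (add_mem (one_mem _) (R_mem hg hv)) (by exact_mod_cast natCast_mem (MQ g W) 2), isIntegral_half h⟩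

theorem f1 (hg : PG g) {i : Fin 4} {P : Ideal (𝓞 (MQ g W))} (hP : P ∈ PO (MQ g W) (g i)) :
    g i ^ 1 ≤ Ideal.absNorm P := absNorm_ge (hg.prime i) hP

theorem e1 {i : Fin 4} {P : Ideal (𝓞 (MQ g W))} (hP : P ∈ PO (MQ g W) (g i)) :
    inP (P ^ 1) (g i : ℂ) := by rw [pow_one]; exact hP.2.2

/-- `f ≥ 2` at two -/
theorem f2' (hg : CG g) {v : Finset (Fin 4)} (hv : v ∈ sp W) (hi : dd g v % 8 = 5)
    {P : Ideal (𝓞 (MQ g W))} (hP : P ∈ PO (MQ g W) (g 0)) : g 0 ^ 2 ≤ Ideal.absNorm P := by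
  have hx := OI_half hg.toPG hv (by omega)
  apply absNorm_ge2 (hg.prime 0) hP hx
  intro n hn
  obtain ⟨k, hk⟩ : ∃ k, dd g v = 8 * k + 5 := ⟨dd g v / 8, by omega⟩
  have hsq : R g v ^ 2 = 8 * k + 5 := by rw [R_sq, hk]; push_cast; ring
  have h1 := hn.mul_left ((hx.add (OI.nat n)).sub OI.one)
  have h2 : ((1 + R g v) / 2 + n - 1) * ((1 + R g v) / 2 - n) = ((2 * k + 1 - n * (n - 1) : ℤ) : ℂ) := by
    push_cast; linear_combination hsq / 4
  rw [h2] at h1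
  refine inP_coprime hP.1 (m := (2 * k + 1 - n * (n - 1) : ℤ)) (n := (g 0 : ℤ)) ?_ h1
    (by exact_mod_cast hP.2.2)
  have he : Even ((n : ℤ) * (n - 1)) := Int.even_mul_pred_self _
  obtain ⟨c, hc⟩ := he
  rw [hc, hg.g0]
  exact ⟨1, c - k, by push_cast; ring⟩

/-- `f ≥ 2` from a nonresidue -/
theorem f2 (hg : PG g) {i : Fin 4} {v : Finset (Fin 4)} (hv : v ∈ sp W)
    (hi : ¬ IsSquare (dd g v : ZMod (g i)))
    {P : Ideal (𝓞 (MQ g W))} (hP : P ∈ PO (MQ g W) (g i)) : g i ^ 2 ≤ Ideal.absNorm P := by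
  have hx := OI_R hg hv
  apply absNorm_ge2 (hg.prime i) hP hx
  intro n hn
  have h1 := hn.mul_left (hx.add (OI.nat n))
  have h2 : (R g v + n) * (R g v - n) = ((dd g v - n ^ 2 : ℤ) : ℂ) := by
    push_cast; linear_combination R_sq (g := g) v
  rw [h2] at h1
  refine inP_coprime hP.1 (m := (dd g v - n ^ 2 : ℤ)) (n := (g i : ℤ)) ?_ h1
    (by exact_mod_cast hP.2.2)
  rw [isCoprime_comm, Prime.coprime_iff_not_dvd (Nat.prime_iff_prime_int.1 (hg.prime i))]
  intro h
  apply hi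
  rw [← ZMod.intCast_zmod_eq_zero_iff_dvd] at h
  push_cast at h
  exact ⟨n, by linear_combination h⟩

theorem PO_MQ (hg : PG g) {i : Fin 4} (e f : ℕ) (he : ∀ P ∈ PO (MQ g W) (g i), inP (P ^ e) (g i : ℂ))
    (hf : ∀ P ∈ PO (MQ g W) (g i), g i ^ f ≤ Ideal.absNorm P) :
    (PO (MQ g W) (g i)).ncard * (e * f) ≤ 2 ^ W.length :=
  (PO_card (hg.prime i) he hf).trans (MQ_finrank_le hg W)

theorem inP_uniq (hg : PG g) {P : Ideal (𝓞 L)} (hP : P.IsPrime) {i j : Fin 4} (hi : inP P (g i : ℂ))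
    (hj : inP P (g j : ℂ)) : i = j := by
  by_contra h
  exact inP_coprime_nat hP ((Nat.coprime_primes (hg.prime i) (hg.prime j)).2 (fun e => h (hg.inj e))) hi hj

theorem inP_dd {P : Ideal (𝓞 L)} (hP : P.IsPrime) {v : Finset (Fin 4)} (h : inP P (dd g v : ℂ)) :
    ∃ i ∈ v, inP P (g i : ℂ) := by
  rw [inP_nat] at h
  unfold dd at h
  push_cast at h
  obtain ⟨i, hi, h2⟩ := (Ideal.IsPrime.prod_mem_iff).1 h
  exact ⟨i, hi, (inP_nat _).2 h2⟩

theorem ram_gen {K : IntermediateField ℚ ℂ} {r : ℂ} [NumberField K] [NumberField L] (h : QE K L r)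
    {P : Ideal (𝓞 L)} (hP : P ∈ ramSet h.sigma)
    {a b : ℂ} (ha : a ∈ K) (hb : b ∈ K) (hi : IsIntegral ℤ (a + b * r)) : inP P (2 * b * r) := by
  have hO : OI L (a + b * r) := ⟨add_mem (h.le ha) (mul_mem (h.le hb) h.mem), hi⟩
  obtain ⟨y, hy⟩ := hO.lift
  have h1 := hP.2.2 y
  rw [← inP_coe] at h1
  convert h1 using 1
  have := h.sigma_eq (y : L) ha hb hy
  have e2 : (((oAct h.sigma y : 𝓞 L) : L) : ℂ) = a - b * r := this
  push_cast
  rw [hy, e2]; ring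

/-- quotient of two radicals -/
theorem ratio_mem (hg : PG g) {W1 : List (Finset (Fin 4))} {v w : Finset (Fin 4)}
    (h : symmDiff w v ∈ sp W1) : ∃ b ∈ MQ g W1, R g v = b * R g w := by
  have h0 := R_ne_zero hg w
  have h1 : R g w ^ 2 ≠ 0 := pow_ne_zero _ h0
  refine ⟨dd g (w ∩ v) * R g (symmDiff w v) / R g w ^ 2, ?_, ?_⟩
  · rw [R_sq]
    exact div_mem (mul_mem (natCast_mem _ _) (R_mem hg h)) (natCast_mem _ _)
  · rw [← Rg_mul]; field_simp

theorem ramA (hg : CG g) {W1 : List (Finset (Fin 4))} {w : Finset (Fin 4)}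
    (h : QE (MQ g W1) (MQ g W) (R g w)) {P : Ideal (𝓞 (MQ g W))} (hP : P ∈ ramSet h.sigma)
    (v : Finset (Fin 4)) (hv : v ∈ sp W) (hs : symmDiff w v ∈ sp W1) :
    ∃ i ∈ insert 0 v, inP P (g i : ℂ) := by
  obtain ⟨b, hb, e⟩ := ratio_mem hg.toPG hs
  have h1 := ram_gen h hP (zero_mem _) hb (by rw [zero_add, ← e]; exact isIntegral_R v)
  rw [mul_assoc, ← e] at h1
  rcases h1.prime hP.1 OI.two (OI_R hg.toPG hv) with h2 | h2
  · exact ⟨0, Finset.mem_insert_self _ _, by rw [hg.g0]; exact_mod_cast h2⟩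
  · have h3 := h2.mul_left (OI_R hg.toPG hv)
    rw [← sq, R_sq] at h3
    obtain ⟨i, hi, h4⟩ := inP_dd hP.1 h3
    exact ⟨i, Finset.mem_insert_of_mem hi, h4⟩

theorem ramB (hg : CG g) {W1 : List (Finset (Fin 4))} {w : Finset (Fin 4)}
    (h : QE (MQ g W1) (MQ g W) (R g w)) {P : Ideal (𝓞 (MQ g W))} (hP : P ∈ ramSet h.sigma)
    (v : Finset (Fin 4)) (hv : v ∈ sp W) (hs : symmDiff w v ∈ sp W1) (hd : dd g v % 4 = 1) :
    ∃ i ∈ v, inP P (g i : ℂ) := by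
  obtain ⟨b, hb, e⟩ := ratio_mem hg.toPG hs
  have h2m : (2 : ℂ) ∈ MQ g W1 := by exact_mod_cast natCast_mem (MQ g W1) 2
  have h1 := ram_gen h hP (a := 1 / 2) (b := b / 2) (div_mem (one_mem _) h2m) (div_mem hb h2m) (by
    have : 1 / 2 + b / 2 * R g w = (1 + R g v) / 2 := by rw [e]; ring
    rw [this]; exact isIntegral_half hd)
  have e2 : 2 * (b / 2) * R g w = R g v := by rw [e]; ring
  rw [e2] at h1
  have h3 := h1.mul_left (OI_R hg.toPG hv)
  rw [← sq, R_sq] at h3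
  exact inP_dd hP.1 h3

/-- counting the ramified primes -/
theorem ram_count [NumberField L] (hg : PG g) {S : Set (Ideal (𝓞 L))} (T : Finset (Fin 4))
    (hS : ∀ P ∈ S, P.IsPrime ∧ P ≠ ⊥ ∧ ∃ i ∈ T, inP P (g i : ℂ)) :
    S.ncard ≤ ∑ i ∈ T, (PO L (g i)).ncard := by
  have hsub : S ⊆ ⋃ i ∈ T, PO L (g i) := by
    intro P hP
    obtain ⟨h1, h2, i, hi, h3⟩ := hS P hP
    simp only [Set.mem_iUnion]
    exact ⟨i, hi, h1, h2, h3⟩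
  have hfin : (⋃ i ∈ T, PO L (g i)).Finite :=
    Set.Finite.biUnion T.finite_toSet (fun i _ => PO_finite (hg.prime i).ne_zero)
  refine (Set.ncard_le_ncard hsub hfin).trans ?_
  exact Finset.set_ncard_biUnion_le T _
end
end

section
open scoped nonZeroDivisors

theorem padic_sq_odd {l : ℕ} [Fact l.Prime] (hl : l ≠ 2) {n : ℕ} (h : IsSquare (n : ZMod l)) (hn : ¬ l ∣ n) :
    ∃ z : ℤ_[l], z ^ 2 = (n : ℤ_[l]) := by
  obtain ⟨a, ha⟩ := h
  obtain ⟨a, rfl⟩ := ZMod.intCast_surjective a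
  have hp : l.Prime := Fact.out
  have h1 : (l : ℤ) ∣ a ^ 2 - n := by
    rw [← ZMod.intCast_zmod_eq_zero_iff_dvd]; push_cast; rw [ha]; ring
  have h2 : ¬ (l : ℤ) ∣ 2 * a := by
    intro h
    have hpi := Nat.prime_iff_prime_int.1 hp
    rcases hpi.dvd_mul.1 h with h | h
    · have : l ∣ 2 := by exact_mod_cast h
      exact hl ((Nat.prime_dvd_prime_iff_eq hp Nat.prime_two).1 this)
    · apply hn
      have h3 := dvd_sub (dvd_pow h two_ne_zero) h1
      rw [sub_sub_cancel] at h3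
      exact_mod_cast h3
  have key := hensels_lemma (p := l) (R := ℤ) (F := Polynomial.X ^ 2 - Polynomial.C (n : ℤ)) (a := (a : ℤ_[l])) (by
    have e1 : (Polynomial.aeval (a : ℤ_[l])) (Polynomial.X ^ 2 - Polynomial.C (n : ℤ)) = ((a ^ 2 - n : ℤ) : ℤ_[l]) := by
      simp
    have e2 : (Polynomial.aeval (a : ℤ_[l])) (Polynomial.derivative (Polynomial.X ^ 2 - Polynomial.C (n : ℤ))) = ((2 * a : ℤ) : ℤ_[l]) := by
      simp [Polynomial.derivative_X_pow, map_ofNat]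
    rw [e1, e2]
    have n1 : ‖((a ^ 2 - n : ℤ) : ℤ_[l])‖ < 1 := (PadicInt.norm_int_lt_one_iff_dvd _).2 h1
    have n2 : ‖((2 * a : ℤ) : ℤ_[l])‖ = 1 := by
      apply le_antisymm (PadicInt.norm_le_one _)
      by_contra h
      exact h2 ((PadicInt.norm_int_lt_one_iff_dvd _).1 (not_le.1 h))
    rw [n2]; simpa using n1)
  obtain ⟨z, hz, _⟩ := key
  refine ⟨z, ?_⟩
  simp at hz
  linear_combination hz

theorem padic_sq_two [Fact (Nat.Prime 2)] {n : ℕ} (h : n % 8 = 1) : ∃ z : ℤ_[2], z ^ 2 = (n : ℤ_[2]) := by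
  have key := hensels_lemma (p := 2) (R := ℤ) (F := Polynomial.X ^ 2 - Polynomial.C (n : ℤ)) (a := (1 : ℤ_[2])) (by
    have e1 : (Polynomial.aeval (1 : ℤ_[2])) (Polynomial.X ^ 2 - Polynomial.C (n : ℤ)) = ((1 - n : ℤ) : ℤ_[2]) := by
      simp
    have e2 : (Polynomial.aeval (1 : ℤ_[2])) (Polynomial.derivative (Polynomial.X ^ 2 - Polynomial.C (n : ℤ))) = ((2 : ℕ) : ℤ_[2]) := by
      simp [Polynomial.derivative_X_pow, map_ofNat]
    rw [e1, e2, PadicInt.norm_p]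
    have : ((2 ^ 3 : ℕ) : ℤ) ∣ (1 - n : ℤ) := by norm_num; omega
    have := (PadicInt.norm_int_le_pow_iff_dvd (p := 2) (k := (1 - n : ℤ)) (n := 3)).2 (by exact_mod_cast this)
    refine this.trans_lt ?_
    norm_num)
  obtain ⟨z, hz, _⟩ := key
  refine ⟨z, ?_⟩
  simp at hz
  linear_combination hz

theorem padic_nonnorm_odd {l : ℕ} [Fact l.Prime] (hl : l % 4 = 3) {m : ℕ} (hm : ¬ l ∣ m) (a b : ℚ_[l]) :
    (-1 : ℚ_[l]) ≠ a ^ 2 - ((l * m : ℕ) : ℚ_[l]) * b ^ 2 := by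
  have hp : l.Prime := Fact.out
  have main : ∀ a b : ℚ_[l], ‖a‖ ≤ 1 → a ^ 2 + 1 = ((l * m : ℕ) : ℚ_[l]) * b ^ 2 → False := by
    intro a b ha e
    set c := ((l * m : ℕ) : ℚ_[l]) * b with hc
    have e2 : c ^ 2 = ((l * m : ℕ) : ℚ_[l]) * (a ^ 2 + 1) := by rw [e, hc]; ring
    have hc1 : ‖c‖ ≤ 1 := by
      have h1 : ‖c‖ ^ 2 ≤ 1 := by
        rw [← norm_pow, e2, norm_mul]
        have n1 : ‖((l * m : ℕ) : ℚ_[l])‖ ≤ 1 := by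
          exact_mod_cast Padic.norm_int_le_one (p := l) ((l * m : ℕ) : ℤ)
        have n2 : ‖a ^ 2 + 1‖ ≤ 1 := by
          refine (Padic.nonarchimedean _ _).trans (max_le ?_ (by simp))
          rw [norm_pow]; exact pow_le_one₀ (norm_nonneg _) ha
        exact mul_le_one₀ n1 (norm_nonneg _) n2
      by_contra h
      have := one_lt_pow₀ (not_le.1 h) two_ne_zero
      linarith
    set A : ℤ_[l] := ⟨a, ha⟩ with hA
    set C : ℤ_[l] := ⟨c, hc1⟩ with hC
    have E : C ^ 2 = (l * m : ℕ) * (A ^ 2 + 1) := by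
      apply Subtype.ext
      push_cast
      push_cast at e2
      exact e2
    have h1 : PadicInt.toZMod C = 0 := by
      have := congrArg PadicInt.toZMod E
      rw [map_mul, map_natCast] at this
      push_cast at this
      rw [ZMod.natCast_self] at this
      simp at this; exact this
    have h2 : (l : ℤ_[l]) ∣ C := by
      have : C ∈ RingHom.ker (PadicInt.toZMod (p := l)) := h1
      rw [PadicInt.ker_toZMod, PadicInt.maximalIdeal_eq_span_p, Ideal.mem_span_singleton] at this
      exact this
    obtain ⟨D, hD⟩ := h2
    have hl0 : (l : ℤ_[l]) ≠ 0 := Nat.cast_ne_zero.2 hp.ne_zero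
    have E2 : (l : ℤ_[l]) * D ^ 2 = m * (A ^ 2 + 1) := by
      apply mul_left_cancel₀ hl0
      push_cast at E
      rw [hD] at E
      linear_combination E
    have h3 := congrArg PadicInt.toZMod E2
    rw [map_mul, map_mul, map_natCast, map_natCast, ZMod.natCast_self, zero_mul] at h3
    have h4 : (m : ZMod l) ≠ 0 := by rw [Ne, ZMod.natCast_eq_zero_iff]; exact hm
    have h5 := (mul_eq_zero.1 h3.symm).resolve_left h4
    rw [map_add, map_pow, map_one] at h5
    have h6 : IsSquare (-1 : ZMod l) := ⟨PadicInt.toZMod A, by linear_combination -h5⟩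
    rw [ZMod.exists_sq_eq_neg_one_iff] at h6
    exact h6 hl
  intro e
  by_cases ha : ‖a‖ ≤ 1
  · exact main a b ha (by linear_combination -e)
  · have ha0 : a ≠ 0 := by rintro rfl; simp at ha
    refine main a⁻¹ (b / a) ?_ ?_
    · rw [norm_inv]; exact inv_le_one_of_one_le₀ (not_le.1 ha).le
    · field_simp; linear_combination -e

theorem padic_nonnorm_two [Fact (Nat.Prime 2)] {d : ℕ} (hd : d % 4 = 3) (a b : ℚ_[2]) :
    (-1 : ℚ_[2]) ≠ a ^ 2 - (d : ℚ_[2]) * b ^ 2 := by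
  have hnd : ‖(d : ℚ_[2])‖ = 1 := by
    rw [Padic.norm_natCast_eq_one_iff, Nat.coprime_two_left, Nat.odd_iff]; omega
  have main : ∀ a b : ℚ_[2], ‖a‖ ≤ 1 → a ^ 2 + 1 = (d : ℚ_[2]) * b ^ 2 → False := by
    intro a b ha e
    have hc1 : ‖b‖ ≤ 1 := by
      have h1 : ‖b‖ ^ 2 ≤ 1 := by
        have n2 : ‖a ^ 2 + 1‖ ≤ 1 := by
          refine (Padic.nonarchimedean _ _).trans (max_le ?_ (by simp))
          rw [norm_pow]; exact pow_le_one₀ (norm_nonneg _) ha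
        rw [e, norm_mul, hnd, one_mul, norm_pow] at n2
        exact n2
      by_contra h
      have := one_lt_pow₀ (not_le.1 h) two_ne_zero
      linarith
    set A : ℤ_[2] := ⟨a, ha⟩ with hA
    set C : ℤ_[2] := ⟨b, hc1⟩ with hC
    have E : A ^ 2 + 1 = (d : ℕ) * C ^ 2 := by
      apply Subtype.ext
      push_cast
      exact e
    have h3 := congrArg (PadicInt.toZModPow (p := 2) 2) E
    rw [map_mul, map_add, map_pow, map_pow, map_one, map_natCast] at h3
    have h4 : ((d : ℕ) : ZMod (2 ^ 2)) = 3 := by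
      change ((d : ℕ) : ZMod 4) = ((3 : ℕ) : ZMod 4)
      rw [ZMod.natCast_eq_natCast_iff]; exact hd
    rw [h4] at h3
    have : ∀ x y : ZMod (2 ^ 2), x ^ 2 + 1 ≠ 3 * y ^ 2 := by decide
    exact this _ _ h3
  intro e
  by_cases ha : ‖a‖ ≤ 1
  · exact main a b ha (by linear_combination -e)
  · have ha0 : a ≠ 0 := by rintro rfl; simp at ha
    refine main a⁻¹ (b / a) ?_ ?_
    · rw [norm_inv]; exact inv_le_one_of_one_le₀ (not_le.1 ha).le
    · field_simp; linear_combination -e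

section
variable {g : Fin 4 → ℕ} {W : List (Finset (Fin 4))}

theorem exists_emb {k : Type*} [Field k] [Algebra ℚ k] (hW : ∀ w ∈ W, ∃ z : k, z ^ 2 = (dd g w : k)) :
    Nonempty (MQ g W →+* k) := by
  have := IntermediateField.exists_algHom_adjoin_of_splits (F := ℚ) (E := ℂ) (K := k)
    (S := {x | ∃ w ∈ W, x = R g w}) ?_ (L := ⊥)
    ((Algebra.ofId ℚ k).comp (IntermediateField.botEquiv ℚ ℂ).toAlgHom) bot_le
  · obtain ⟨φ, _⟩ := this
    exact ⟨φ.toRingHom⟩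
  · rintro _ ⟨w, hw, rfl⟩
    refine ⟨(isIntegral_R w).tower_top, ?_⟩
    obtain ⟨z, hz⟩ := hW w hw
    have hdvd : minpoly ℚ (R g w) ∣ (Polynomial.X ^ 2 - Polynomial.C (dd g w : ℚ)) := by
      apply minpoly.dvd
      simp [R_sq]
    have hs : ((Polynomial.X ^ 2 - Polynomial.C (dd g w : ℚ)).map (algebraMap ℚ k)).Splits := by
      have : (Polynomial.X ^ 2 - Polynomial.C (dd g w : ℚ)).map (algebraMap ℚ k) =
        (Polynomial.X - Polynomial.C z) * (Polynomial.X + Polynomial.C z) := by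
        have e : algebraMap ℚ k (dd g w : ℚ) = z ^ 2 := by
          rw [hz]; simp
        rw [Polynomial.map_sub, Polynomial.map_pow, Polynomial.map_X, Polynomial.map_C, e]
        rw [Polynomial.C_pow]; ring
      rw [this]
      apply Polynomial.Splits.mul
      · exact Polynomial.Splits.X_sub_C _
      · exact Polynomial.Splits.X_add_C _
    refine Polynomial.Splits.of_dvd hs ?_ (Polynomial.map_dvd _ hdvd)
    apply Polynomial.map_ne_zero
    exact Polynomial.X_pow_sub_C_ne_zero two_pos _

theorem nf_emb {F : IntermediateField ℚ ℂ} {k : Type*} [Field k] (φ : F →+* k) {d : ℕ}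
    (h : NF F d (-1)) : ∃ a b : k, (-1 : k) = a ^ 2 - d * b ^ 2 := by
  obtain ⟨a, ha, b, hb, e⟩ := h
  refine ⟨φ ⟨a, ha⟩, φ ⟨b, hb⟩, ?_⟩
  have : (-1 : F) = ⟨a, ha⟩ ^ 2 - d * ⟨b, hb⟩ ^ 2 := by
    ext1; push_cast; exact e
  have := congrArg φ this
  rwa [map_sub, map_mul, map_pow, map_pow, map_natCast, map_neg, map_one] at this

theorem nonnorm_odd (hg : PG g) (i : Fin 4) (hi : g i % 4 = 3) {v : Finset (Fin 4)} (hv : i ∈ v)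
    (hW : ∀ w ∈ W, i ∉ w ∧ IsSquare (dd g w : ZMod (g i))) : ¬ NF (MQ g W) (R g v ^ 2) (-1) := by
  intro h
  rw [R_sq] at h
  haveI : Fact (g i).Prime := ⟨hg.prime i⟩
  have h2 : g i ≠ 2 := by intro h; rw [h] at hi; omega
  obtain ⟨φ⟩ := exists_emb (g := g) (W := W) (k := ℚ_[g i]) (fun w hw => by
    obtain ⟨z, hz⟩ := padic_sq_odd h2 (hW w hw).2 (by rw [prime_dvd_dd hg]; exact (hW w hw).1)
    exact ⟨z, by exact_mod_cast congrArg (fun x : ℤ_[g i] => (x : ℚ_[g i])) hz⟩)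
  obtain ⟨a, b, e⟩ := nf_emb φ h
  rw [← dd_erase hv] at e
  refine padic_nonnorm_odd hi ?_ a b e
  rw [prime_dvd_dd hg]; exact Finset.notMem_erase i v

theorem nonnorm_two {v : Finset (Fin 4)} (hv : dd g v % 4 = 3)
    (hW : ∀ w ∈ W, dd g w % 8 = 1) : ¬ NF (MQ g W) (R g v ^ 2) (-1) := by
  intro h
  rw [R_sq] at h
  haveI : Fact (Nat.Prime 2) := ⟨Nat.prime_two⟩
  obtain ⟨φ⟩ := exists_emb (g := g) (W := W) (k := ℚ_[2]) (fun w hw => by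
    obtain ⟨z, hz⟩ := padic_sq_two (hW w hw)
    exact ⟨z, by exact_mod_cast congrArg (fun x : ℤ_[2] => (x : ℚ_[2])) hz⟩)
  obtain ⟨a, b, e⟩ := nf_emb φ h
  exact padic_nonnorm_two hv a b e

theorem NF.div_sq {F : IntermediateField ℚ ℂ} {d u c : ℂ} (hc : c ∈ F) (h0 : c ≠ 0)
    (h : NF F d (u * c ^ 2)) : NF F d u := by
  obtain ⟨a, ha, b, hb, e⟩ := h
  refine ⟨a / c, div_mem ha hc, b / c, div_mem hb hc, ?_⟩
  field_simp; linear_combination e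
end
end

section
open scoped nonZeroDivisors

theorem isSquare_mul_iff' {l : ℕ} [Fact l.Prime] {a b : ZMod l} (ha : a ≠ 0) (hb : b ≠ 0) :
    IsSquare (a * b) ↔ (IsSquare a ↔ IsSquare b) := by
  rw [← quadraticChar_one_iff_isSquare ha, ← quadraticChar_one_iff_isSquare hb,
    ← quadraticChar_one_iff_isSquare (mul_ne_zero ha hb), map_mul]
  rcases quadraticChar_dichotomy ha with h | h <;> rcases quadraticChar_dichotomy hb with h' | h' <;>
    rw [h, h'] <;> decide

theorem hh_nil {g : Fin 4 → ℕ} : hh (MQ g []) = 1 := by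
  unfold hh h2
  rw [MQ_nil]
  have e : (⊥ : IntermediateField ℚ ℂ) ≃+* ℚ := (IntermediateField.botEquiv ℚ ℂ).toRingEquiv
  have e2 := ClassGroup.mulEquiv (RingOfIntegers.mapRingEquiv e)
  have h1 : Nat.card (ClassGroup (𝓞 ℚ)) = 1 := by
    have := Rat.classNumber_eq
    rw [classNumber, ← Nat.card_eq_fintype_card] at this
    exact this
  have h2 : Nat.card (ClassGroup (𝓞 (⊥ : IntermediateField ℚ ℂ))) = 1 := by
    rw [Nat.card_congr e2.toEquiv]; exact h1
  have h3 : Subsingleton (ClassGroup (𝓞 (⊥ : IntermediateField ℚ ℂ))) := (Nat.card_eq_one_iff_unique.1 h2).1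
  rw [Nat.card_eq_one_iff_unique]
  exact ⟨inferInstance, inferInstance⟩

/-- relative norm relation -/
def Nrel (F : IntermediateField ℚ ℂ) (t u n : ℂ) : Prop :=
  ∃ f ∈ F, ∃ k ∈ F, u = f + k * t ∧ f ^ 2 - t ^ 2 * k ^ 2 = n

theorem Nrel.mono {F F' : IntermediateField ℚ ℂ} {t u n : ℂ} (h : F ≤ F') (hN : Nrel F t u n) :
    Nrel F' t u n := by
  obtain ⟨f, hf, k, hk, e1, e2⟩ := hN
  exact ⟨f, h hf, k, h hk, e1, e2⟩

theorem Nrel.base {F : IntermediateField ℚ ℂ} {t u : ℂ} (h : u ∈ F) : Nrel F t u (u ^ 2) :=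
  ⟨u, h, 0, zero_mem _, by ring, by ring⟩

theorem Nrel.mul {F : IntermediateField ℚ ℂ} {t u v m n : ℂ} (ht : t ^ 2 ∈ F) (h1 : Nrel F t u m)
    (h2 : Nrel F t v n) : Nrel F t (u * v) (m * n) := by
  obtain ⟨a, ha, b, hb, rfl, rfl⟩ := h1
  obtain ⟨c, hc, d, hd, rfl, rfl⟩ := h2
  exact ⟨a * c + t ^ 2 * (b * d), add_mem (mul_mem ha hc) (mul_mem ht (mul_mem hb hd)),
    a * d + b * c, add_mem (mul_mem ha hd) (mul_mem hb hc), by ring, by ring⟩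

theorem Nrel.pow {F : IntermediateField ℚ ℂ} {t u m : ℂ} (ht : t ^ 2 ∈ F) (h1 : Nrel F t u m) (k : ℕ) :
    Nrel F t (u ^ k) (m ^ k) := by
  induction k with
  | zero => simpa using Nrel.base (t := t) (one_mem F)
  | succ k ih => rw [pow_succ, pow_succ]; exact Nrel.mul ht ih h1

theorem NF.desc {F K : IntermediateField ℚ ℂ} {t d u n : ℂ} (h : QE F K t) (hd : d ∈ F)
    (hN : Nrel F t u n) (hu : NF K d u) : NF F d n := by
  obtain ⟨f, hf, k, hk, e1, rfl⟩ := hN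
  exact NF.descend h hd hf hk e1 hu

section
variable {g : Fin 4 → ℕ} {W : List (Finset (Fin 4))}

theorem R_sq_mem (v : Finset (Fin 4)) (F : IntermediateField ℚ ℂ) : R g v ^ 2 ∈ F := by
  rw [R_sq]; exact natCast_mem F _

theorem sigma_R_fix (hg : PG g) {W1 : List (Finset (Fin 4))} {w v : Finset (Fin 4)}
    (h : QE (MQ g W1) (MQ g W) (R g w)) (hv : v ∈ sp W1) (x : MQ g W) (hx : (x : ℂ) = R g v) :
    ((h.sigma x : MQ g W) : ℂ) = R g v := by
  rw [h.sigma_K x (by rw [hx]; exact R_mem hg hv), hx]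

theorem sigma_R_neg (hg : PG g) {W1 : List (Finset (Fin 4))} {w v : Finset (Fin 4)}
    (h : QE (MQ g W1) (MQ g W) (R g w)) (hv : symmDiff w v ∈ sp W1) (x : MQ g W) (hx : (x : ℂ) = R g v) :
    ((h.sigma x : MQ g W) : ℂ) = - R g v := by
  obtain ⟨b, hb, e⟩ := ratio_mem hg hv
  have := h.sigma_r x b hb (by rw [hx, e])
  rw [this, ← hx]; push_cast; rfl

theorem MQ_aut_ext {σ τ : MQ g W ≃ₐ[ℚ] MQ g W}
    (h : ∀ v ∈ W, ∀ x : MQ g W, (x : ℂ) = R g v → σ x = τ x) : σ = τ := by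
  have : (σ : MQ g W →ₐ[ℚ] MQ g W) = τ := by
    apply IntermediateField.algHom_ext_of_eq_adjoin ℚ (S := MQ g W) rfl
    rintro x ⟨w, hw, rfl⟩
    exact h w hw _ rfl
  ext1 x
  exact DFunLike.congr_fun this x

/-- the sign check -/
theorem sigma_mul (hg : PG g) {W1 W2 W3 : List (Finset (Fin 4))} {w1 w2 w3 : Finset (Fin 4)}
    (h1 : QE (MQ g W1) (MQ g W) (R g w1)) (h2 : QE (MQ g W2) (MQ g W) (R g w2))
    (h3 : QE (MQ g W3) (MQ g W) (R g w3))
    (hc : ∀ v ∈ W, (v ∈ sp W1 ∧ v ∈ sp W2 ∧ v ∈ sp W3) ∨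
      (v ∈ sp W1 ∧ symmDiff w2 v ∈ sp W2 ∧ symmDiff w3 v ∈ sp W3) ∨
      (symmDiff w1 v ∈ sp W1 ∧ v ∈ sp W2 ∧ symmDiff w3 v ∈ sp W3) ∨
      (symmDiff w1 v ∈ sp W1 ∧ symmDiff w2 v ∈ sp W2 ∧ v ∈ sp W3)) :
    h1.sigma * h2.sigma = h3.sigma := by
  apply MQ_aut_ext
  intro v hv x hx
  rw [AlgEquiv.mul_apply]
  ext1
  have hn : ((-x : MQ g W) : ℂ) = - R g v := by push_cast; rw [hx]
  rcases hc v hv with ⟨a, b, c⟩ | ⟨a, b, c⟩ | ⟨a, b, c⟩ | ⟨a, b, c⟩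
  · rw [sigma_R_fix hg h3 c x hx]
    exact sigma_R_fix hg h1 a _ (sigma_R_fix hg h2 b x hx)
  · rw [sigma_R_neg hg h3 c x hx]
    have : h2.sigma x = -x := by ext1; rw [sigma_R_neg hg h2 b x hx, hn]
    rw [this, map_neg]; push_cast
    rw [sigma_R_fix hg h1 a x hx]
  · rw [sigma_R_neg hg h3 c x hx]
    exact sigma_R_neg hg h1 a _ (sigma_R_fix hg h2 b x hx)
  · rw [sigma_R_fix hg h3 c x hx]
    have : h2.sigma x = -x := by ext1; rw [sigma_R_neg hg h2 b x hx, hn]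
    rw [this, map_neg]; push_cast
    rw [sigma_R_neg hg h1 a x hx]; ring

theorem dd1 (i : Fin 4) : dd g {i} = g i := by simp [dd]
theorem dd2 {i j : Fin 4} (h : i ≠ j) : dd g {i, j} = g i * g j := by simp [dd, h]
theorem dd3 {i j k : Fin 4} (h : i ≠ j) (h2 : i ≠ k) (h3 : j ≠ k) : dd g {i, j, k} = g i * (g j * g k) := by
  simp [dd, h, h2, h3]

theorem ZMod_ne_zero (hg : PG g) {i j : Fin 4} (h : i ≠ j) : ((g j : ℕ) : ZMod (g i)) ≠ 0 := by
  rw [Ne, ZMod.natCast_eq_zero_iff, Nat.prime_dvd_prime_iff_eq (hg.prime i) (hg.prime j)]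
  exact fun e => h (hg.inj e)

theorem nsq_m1 (hg : PG g) {i : Fin 4} (h : g i % 4 = 3) : ¬ IsSquare (-1 : ZMod (g i)) := by
  haveI : Fact (g i).Prime := ⟨hg.prime i⟩
  rw [ZMod.exists_sq_eq_neg_one_iff]; omega

theorem sq_two_iff (hg : CG g) {i : Fin 4} (h : i ≠ 0) :
    IsSquare ((g 0 : ℕ) : ZMod (g i)) ↔ g i % 8 = 1 ∨ g i % 8 = 7 := by
  haveI : Fact (g i).Prime := ⟨hg.prime i⟩
  rw [hg.g0]
  push_cast
  apply ZMod.exists_sq_eq_two_iff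
  rw [← hg.g0]; exact fun e => h (hg.inj e)

theorem sq_pair (hg : PG g) {i j k : Fin 4} (hij : i ≠ j) (hik : i ≠ k) (hjk : j ≠ k) :
    IsSquare (dd g {j, k} : ZMod (g i)) ↔ (IsSquare (g j : ZMod (g i)) ↔ IsSquare (g k : ZMod (g i))) := by
  haveI : Fact (g i).Prime := ⟨hg.prime i⟩
  rw [dd2 hjk]; push_cast
  exact isSquare_mul_iff' (ZMod_ne_zero hg hij) (ZMod_ne_zero hg hik)

theorem CG.sqqp (hg : CG g) : IsSquare (g 2 : ZMod (g 1)) := by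
  haveI : Fact (g 1).Prime := ⟨hg.prime 1⟩
  haveI : Fact (g 2).Prime := ⟨hg.prime 2⟩
  have := hg.g1
  have := hg.g2
  rw [ZMod.exists_sq_eq_prime_iff_of_mod_four_eq_one (p := g 1) (q := g 2)]
  · exact hg.q2
  · omega
  · intro h; omega
theorem CG.sqsp (hg : CG g) : IsSquare (g 3 : ZMod (g 1)) := by
  haveI : Fact (g 1).Prime := ⟨hg.prime 1⟩
  haveI : Fact (g 3).Prime := ⟨hg.prime 3⟩
  have := hg.g1
  have := hg.g3
  rw [ZMod.exists_sq_eq_prime_iff_of_mod_four_eq_one (p := g 1) (q := g 3)]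
  · exact hg.q3
  · omega
  · intro h; omega
theorem CG.sqqs (hg : CG g) : IsSquare (g 3 : ZMod (g 2)) ↔ ¬ IsSquare (g 2 : ZMod (g 3)) := by
  haveI : Fact (g 2).Prime := ⟨hg.prime 2⟩
  haveI : Fact (g 3).Prime := ⟨hg.prime 3⟩
  have := hg.g2
  have := hg.g3
  apply ZMod.exists_sq_eq_prime_iff_of_mod_four_eq_three
  · omega
  · omega
  · exact fun e => absurd (hg.inj e) (by decide)

/-- `MQ_qe` with the base check -/
theorem le_ram (hg : PG g) {W1 : List (Finset (Fin 4))} {w : Finset (Fin 4)}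
    (h : QE (MQ g W1) (MQ g W) (R g w)) (T : Finset (Fin 4))
    (hT : ∀ P ∈ ramSet h.sigma, ∃ i ∈ T, inP P (g i : ℂ)) :
    (ramSet h.sigma).ncard ≤ ∑ i ∈ T, (PO (MQ g W) (g i)).ncard :=
  ram_count hg T (fun P hP => ⟨hP.1, hP.2.1, hT P hP⟩)

/-- combine two tests -/
theorem test2 (hg : PG g) {L : IntermediateField ℚ ℂ} {P : Ideal (𝓞 L)} (hP : P.IsPrime) {S T U : Finset (Fin 4)}
    (h1 : ∃ i ∈ S, inP P (g i : ℂ)) (h2 : ∃ i ∈ T, inP P (g i : ℂ)) (h : S ∩ T ⊆ U) :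
    ∃ i ∈ U, inP P (g i : ℂ) := by
  obtain ⟨i, hi, h1⟩ := h1
  obtain ⟨j, hj, h2⟩ := h2
  obtain rfl := inP_uniq hg hP h1 h2
  exact ⟨i, h (Finset.mem_inter.2 ⟨hi, hj⟩), h1⟩

/-- Step 1 : `ℚ(√p)` -/
theorem step1 (hg : CG g) : hh (MQ g [{1}]) = 1 ∧ ∃ ε, IsUn ε ∧ Nrel (MQ g []) (R g {1}) ε (-1) := by
  have h := MQ_qe hg.toPG (W := []) (W' := [{1}]) (w := {1}) (by decide) (by decide) (by decide) (by decide)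
  have ht : (ramSet h.sigma).ncard ≤ 1 := by
    refine (le_ram hg.toPG h {1} (fun P hP => ramB hg h hP {1} (by decide) (by decide) (by
      rw [dd1]; have := hg.g1; omega))).trans ?_
    have := PO_MQ (W := [{1}]) hg.toPG (i := 1) 2 1 (fun P hP => e2 hg.toPG (v := {1}) (by decide) (by decide) hP)
      (fun P hP => f1 hg.toPG hP)
    simp at this ⊢; omega
  obtain ⟨h1, h2⟩ := h.one_ram hh_nil ht
  refine ⟨h1, ?_⟩
  obtain ⟨m, hm, a, ha, b, hb, hu, e⟩ := h2 (-1) (neg_mem (one_mem _)) IsUn.neg_one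
  exact ⟨_, hu, a, ha, b, hb, rfl, by rw [e, hm.neg_one_pow]⟩

/-- Step 2 : `ℚ(√2)` -/
theorem step2 (hg : CG g) : hh (MQ g [{0}]) = 1 := by
  have h := MQ_qe hg.toPG (W := []) (W' := [{0}]) (w := {0}) (by decide) (by decide) (by decide) (by decide)
  have ht : (ramSet h.sigma).ncard ≤ 1 := by
    refine (le_ram hg.toPG h {0} (fun P hP => by
      simpa using ramA hg h hP {0} (by decide) (by decide))).trans ?_
    have := PO_MQ (W := [{0}]) hg.toPG (i := 0) 2 1 (fun P hP => e2 hg.toPG (v := {0}) (by decide) (by decide) hP)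
      (fun P hP => f1 hg.toPG hP)
    simp at this ⊢; omega
  exact (h.one_ram hh_nil ht).1

theorem eps2 (hg : CG g) : IsUn (1 + R g {0}) ∧ Nrel (MQ g []) (R g {0}) (1 + R g {0}) (-1) := by
  have e : R g {0} ^ 2 = 2 := by rw [R_sq, dd1, hg.g0]; norm_num
  refine ⟨IsUn.of_mul (v := R g {0} - 1) (isIntegral_one.add (isIntegral_R _)) ((isIntegral_R _).sub isIntegral_one)
    (by linear_combination e), 1, one_mem _, 1, one_mem _, by ring, by rw [e]; norm_num⟩

/-- Step 3 -/
theorem step3 (hg : CG g) : hh (MQ g [{2, 3}]) = 1 := by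
  have h := MQ_qe hg.toPG (W := []) (W' := [{2, 3}]) (w := {2, 3}) (by decide) (by decide) (by decide) (by decide)
  have ht : (ramSet h.sigma).ncard ≤ 2 := by
    refine (le_ram hg.toPG h {2, 3} (fun P hP => ramB hg h hP {2, 3} (by decide) (by decide) (by
      rw [dd2 (by decide), Nat.mul_mod]; have := hg.g2; have := hg.g3;
      have : g 2 % 4 = 3 := by omega
      rw [this, hg.g3]))).trans ?_
    have a2 := PO_MQ (W := [{2, 3}]) hg.toPG (i := 2) 2 1 (fun P hP => e2 hg.toPG (v := {2, 3}) (by decide) (by decide) hP)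
      (fun P hP => f1 hg.toPG hP)
    have a3 := PO_MQ (W := [{2, 3}]) hg.toPG (i := 3) 2 1 (fun P hP => e2 hg.toPG (v := {2, 3}) (by decide) (by decide) hP)
      (fun P hP => f1 hg.toPG hP)
    rw [Finset.sum_pair (by decide)]
    simp at a2 a3 ⊢; omega
  have := h.upper1 (-1) (neg_mem (one_mem _)) IsUn.neg_one (nonnorm_odd hg.toPG 3 hg.g3 (by decide) (by simp)) ht
  rw [hh_nil] at this
  exact h.odd_of_bound (by omega)
end
end

section
open scoped nonZeroDivisors

section
variable {g : Fin 4 → ℕ} {W : List (Finset (Fin 4))}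

theorem cnt (hg : PG g) {i : Fin 4} (n e f : ℕ) (he : ∀ P ∈ PO (MQ g W) (g i), inP (P ^ e) (g i : ℂ))
    (hf : ∀ P ∈ PO (MQ g W) (g i), g i ^ f ≤ Ideal.absNorm P) (hn : 2 ^ W.length < (n + 1) * (e * f)) :
    (PO (MQ g W) (g i)).ncard ≤ n := by
  have := PO_MQ hg e f he hf
  by_contra hc
  have : (n + 1) * (e * f) ≤ (PO (MQ g W) (g i)).ncard * (e * f) := Nat.mul_le_mul_right _ (by omega)
  omega

theorem Nrel.neg {F : IntermediateField ℚ ℂ} {t u n : ℂ} (h : Nrel F t u n) : Nrel F t (-u) n := by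
  obtain ⟨f, hf, k, hk, e1, e2⟩ := h
  exact ⟨-f, neg_mem hf, -k, neg_mem hk, by rw [e1]; ring, by rw [← e2]; ring⟩

theorem Nrel.mem {F K : IntermediateField ℚ ℂ} {t u n : ℂ} (h : QE F K t) (hN : Nrel F t u n) : u ∈ K := by
  obtain ⟨f, hf, k, hk, rfl, e2⟩ := hN
  exact add_mem (h.le hf) (mul_mem (h.le hk) h.mem)

theorem IsUn.ne_zero {u : ℂ} (h : IsUn u) : u ≠ 0 := h.1

theorem neg_one_mem' (F : IntermediateField ℚ ℂ) : (-1 : ℂ) ∈ F := neg_mem (one_mem F)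

theorem CG.q34 (hg : CG g) : g 2 % 4 = 3 := by have := hg.g2; omega

theorem step456 (hg : CG g) (i : Fin 4) (v : Finset (Fin 4))
    (h : QE (MQ g [{1}]) (MQ g [{1}, v]) (R g v)) (hi : g i % 4 = 3) (hv : i ∈ v) (h0 : insert 0 v = {0, i})
    (hi1 : i ≠ 1) (hi0 : (0 : Fin 4) ≠ i) (hs : IsSquare (g 1 : ZMod (g i)))
    (hvm : v ∈ sp [{1}, v]) (h1m : {1} ∈ sp [{1}, v]) (he : ∅ ∈ sp [{1}])
    (ht2 : ∀ P ∈ PO (MQ g [{1}, v]) (g 0), inP (P ^ 2) (g 0 : ℂ)) :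
    hh (MQ g [{1}, v]) = 1 := by
  obtain ⟨hK, ε, hε, hN⟩ := step1 hg
  have hQ := MQ_qe hg.toPG (W := []) (W' := [{1}]) (w := {1}) (by decide) (by decide) (by decide) (by decide)
  have ht : (ramSet h.sigma).ncard ≤ 3 := by
    refine (le_ram hg.toPG h {0, i} (fun P hP => by
      have := ramA hg h hP v hvm (by simpa using he)
      rwa [h0] at this)).trans ?_
    have a0 := cnt hg.toPG (W := [{1}, v]) (i := 0) 1 2 2 ht2
      (fun P hP => f2' hg (v := {1}) h1m (by rw [dd1]; exact hg.g1) hP) (by norm_num)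
    have a1 := cnt hg.toPG (W := [{1}, v]) (i := i) 2 2 1 (fun P hP => e2 hg.toPG hvm hv hP)
      (fun P hP => f1 hg.toPG hP) (by norm_num)
    rw [Finset.sum_pair hi0]; omega
  have n1 : ¬ NF (MQ g []) (R g v ^ 2) (-1) := nonnorm_odd hg.toPG i hi hv (by simp)
  have := h.upper2 (-1) ε (neg_one_mem' _) (hN.mem hQ) IsUn.neg_one hε
    (nonnorm_odd hg.toPG i hi hv (by simp [dd1, hs, hi1])) (fun hc => n1 (hc.desc hQ (R_sq_mem _ _) hN))
    (fun hc => n1 (NF.desc hQ (R_sq_mem _ _) hN.neg (by simpa using hc))) ht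
  rw [hK] at this
  exact h.odd_of_bound (by omega)

theorem step4 (hg : CG g) : hh (MQ g [{1}, {2}]) = 1 :=
  step456 hg 2 {2} (MQ_qe hg.toPG (by decide) (by decide) (by decide) (by decide)) hg.q34 (by decide)
    (by decide) (by decide) (by decide) hg.q2 (by decide) (by decide) (by decide)
    (fun P hP => e2' hg (v := {2}) (by decide) (by rw [dd1]; exact hg.q34) hP)

theorem step5 (hg : CG g) : hh (MQ g [{1}, {3}]) = 1 :=
  step456 hg 3 {3} (MQ_qe hg.toPG (by decide) (by decide) (by decide) (by decide)) hg.g3 (by decide)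
    (by decide) (by decide) (by decide) hg.q3 (by decide) (by decide) (by decide)
    (fun P hP => e2' hg (v := {3}) (by decide) (by rw [dd1]; exact hg.g3) hP)

theorem step6 (hg : CG g) : hh (MQ g [{1}, {0, 3}]) = 1 :=
  step456 hg 3 {0, 3} (MQ_qe hg.toPG (by decide) (by decide) (by decide) (by decide)) hg.g3 (by decide)
    (by decide) (by decide) (by decide) hg.q3 (by decide) (by decide) (by decide)
    (fun P hP => e2 hg.toPG (v := {0, 3}) (by decide) (by decide) hP)

theorem step7 (hg : CG g) : hh (MQ g [{0}, {1}]) = 1 ∧ ∃ η, IsUn η ∧ ∃ m, Odd m ∧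
    Nrel (MQ g [{0}]) (R g {1}) η ((1 + R g {0}) ^ m) := by
  have h := MQ_qe hg.toPG (W := [{0}]) (W' := [{0}, {1}]) (w := {1}) (by decide) (by decide) (by decide) (by decide)
  have ht : (ramSet h.sigma).ncard ≤ 1 := by
    refine (le_ram hg.toPG h {1} (fun P hP => ramB hg h hP {1} (by decide) (by decide) (by
      rw [dd1]; have := hg.g1; omega))).trans ?_
    have := cnt (W := [{0}, {1}]) hg.toPG (i := 1) 1 2 2 (fun P hP => e2 hg.toPG (v := {1}) (by decide) (by decide) hP)
      (fun P hP => f2 hg.toPG (v := {0}) (by decide) (by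
        rw [dd1, sq_two_iff hg (by decide)]; have := hg.g1; omega) hP) (by norm_num)
    simpa
  obtain ⟨h1, h2⟩ := h.one_ram (step2 hg) ht
  refine ⟨h1, ?_⟩
  obtain ⟨m, hm, a, ha, b, hb, hu, e⟩ := h2 (1 + R g {0}) (add_mem (one_mem _) (R_mem hg.toPG (by decide))) (eps2 hg).1
  exact ⟨_, hu, m, hm, a, ha, b, hb, rfl, e⟩

theorem step8 (hg : CG g) : hh (MQ g [{0}, {3}]) = 1 := by
  have h := MQ_qe hg.toPG (W := [{0}]) (W' := [{0}, {3}]) (w := {3}) (by decide) (by decide) (by decide) (by decide)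
  have hQ := MQ_qe hg.toPG (W := []) (W' := [{0}]) (w := {0}) (by decide) (by decide) (by decide) (by decide)
  have hr := (le_ram hg.toPG h {0, 3} (fun P hP => ramA hg h hP {3} (by decide) (by decide)))
  rw [Finset.sum_pair (by decide)] at hr
  have a0 := cnt hg.toPG (W := [{0}, {3}]) (i := 0) 1 4 1
    (fun P hP => e4 hg (v := {0}) (w := {3}) (by decide) (by decide) (by rw [dd1, hg.g3]) (by decide) hP)
      (fun P hP => f1 hg.toPG hP) (by norm_num)
  have n1 : ¬ NF (MQ g []) (R g {3} ^ 2) (-1) := nonnorm_odd hg.toPG 3 hg.g3 (by decide) (by simp)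
  obtain ⟨e1, e2⟩ := eps2 hg
  have n2 : ¬ NF (MQ g [{0}]) (R g {3} ^ 2) (1 + R g {0}) := fun hc => n1 (hc.desc hQ (R_sq_mem _ _) e2)
  by_cases hs : g 3 % 8 = 7
  · have a3 := cnt hg.toPG (W := [{0}, {3}]) (i := 3) 2 2 1 (fun P hP => _root_.e2 hg.toPG (v := {3}) (by decide) (by decide) hP)
      (fun P hP => f1 hg.toPG hP) (by norm_num)
    have := h.upper2 (-1) (1 + R g {0}) (neg_one_mem' _) (e2.mem hQ) IsUn.neg_one e1
      (nonnorm_odd hg.toPG 3 hg.g3 (by decide) (by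
        have := (sq_two_iff hg (i := 3) (by decide)).2 (Or.inr hs)
        simp [dd1, this])) n2 (fun hc => n1 (NF.desc hQ (R_sq_mem _ _) e2.neg (by simpa using hc))) (t := 3) (by omega)
    rw [step2 hg] at this
    exact h.odd_of_bound (by omega)
  · have a3 := cnt hg.toPG (W := [{0}, {3}]) (i := 3) 1 2 2 (fun P hP => _root_.e2 hg.toPG (v := {3}) (by decide) (by decide) hP)
      (fun P hP => f2 hg.toPG (v := {0}) (by decide) (by
        rw [dd1, sq_two_iff hg (by decide)]; have := hg.g3; omega) hP) (by norm_num)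
    have := h.upper1 (1 + R g {0}) (e2.mem hQ) e1 n2 (t := 2) (by omega)
    rw [step2 hg] at this
    exact h.odd_of_bound (by omega)

end
end

section
open scoped nonZeroDivisors

section
variable {g : Fin 4 → ℕ} {W : List (Finset (Fin 4))}

theorem step9a (hg : CG g) {η : ℂ} (hη : IsUn η) {m : ℕ} (hm : Odd m)
    (hN : Nrel (MQ g [{0}]) (R g {1}) η ((1 + R g {0}) ^ m)) {ε : ℂ} (hε : IsUn ε)
    (hNε : Nrel (MQ g []) (R g {1}) ε (-1)) (hs : g 3 % 8 = 7) (T : Finset (Fin 4)) (hT : T.Nonempty) :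
    ¬ NF (MQ g [{0}, {1}]) (R g {3} ^ 2) (∏ i ∈ T, (![-1, 1 + R g {0}, ε, η] : Fin 4 → ℂ) i) := by
  have hQ := MQ_qe hg.toPG (W := []) (W' := [{0}]) (w := {0}) (by decide) (by decide) (by decide) (by decide)
  have hQ1 := MQ_qe hg.toPG (W := []) (W' := [{1}]) (w := {1}) (by decide) (by decide) (by decide) (by decide)
  have hQ01 := MQ_qe hg.toPG (W := [{0}]) (W' := [{0}, {1}]) (w := {1}) (by decide) (by decide) (by decide) (by decide)
  have hQ10 := MQ_qe hg.toPG (W := [{1}]) (W' := [{0}, {1}]) (w := {0}) (by decide) (by decide) (by decide) (by decide)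
  have s2 := (sq_two_iff hg (i := 3) (by decide)).2 (Or.inr hs)
  have n0 : ¬ NF (MQ g []) (R g {3} ^ 2) (-1) := nonnorm_odd hg.toPG 3 hg.g3 (by decide) (by simp)
  have n1 : ¬ NF (MQ g [{0}]) (R g {3} ^ 2) (-1) := nonnorm_odd hg.toPG 3 hg.g3 (by decide) (by simp [dd1, s2])
  have n2 : ¬ NF (MQ g [{1}]) (R g {3} ^ 2) (-1) := nonnorm_odd hg.toPG 3 hg.g3 (by decide) (by simp [dd1, hg.q3])
  have n3 : ¬ NF (MQ g [{0}, {1}]) (R g {3} ^ 2) (-1) :=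
    nonnorm_odd hg.toPG 3 hg.g3 (by decide) (by simp [dd1, hg.q3, s2])
  obtain ⟨e1, e2⟩ := eps2 hg
  set ε2 := 1 + R g {0} with hε2
  have m2 : ε2 ∈ MQ g [{0}] := e2.mem hQ
  have mε : ε ∈ MQ g [{1}] := hNε.mem hQ1
  have hle0 : MQ g [] ≤ MQ g [{0}] := hQ.le
  have hle1 : MQ g [] ≤ MQ g [{1}] := hQ1.le
  intro hc
  have key : ∏ i ∈ T, (![-1, ε2, ε, η] : Fin 4 → ℂ) i =
    (-1) ^ (if 0 ∈ T then 1 else 0) * ε2 ^ (if 1 ∈ T then 1 else 0) * ε ^ (if 2 ∈ T then 1 else 0)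
      * η ^ (if 3 ∈ T then 1 else 0) := by
    rw [← Finset.univ_inter T, ← Finset.prod_ite_mem, Fin.prod_univ_four]
    simp only [Finset.univ_inter]
    congr 1
    · congr 1
      · congr 1
        · split_ifs <;> simp
        · split_ifs <;> simp
      · split_ifs <;> simp
    · split_ifs <;> simp
  rw [key] at hc
  generalize ha : (if 0 ∈ T then 1 else 0) = a at hc
  generalize hb : (if 1 ∈ T then 1 else 0) = b at hc
  generalize hcc : (if 2 ∈ T then 1 else 0) = c at hc
  have nm : ∀ (F : IntermediateField ℚ ℂ) (t : ℂ) (a : ℕ), Nrel F t ((-1) ^ a) 1 := fun F t a => by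
    have := Nrel.base (t := t) (pow_mem (neg_one_mem' F) a)
    rwa [← pow_mul, mul_comm, pow_mul, neg_one_sq, one_pow] at this
  by_cases h3 : 3 ∈ T
  · rw [if_pos h3, pow_one] at hc
    have r1 : Nrel (MQ g [{0}]) (R g {1}) ((-1) ^ a * ε2 ^ b * ε ^ c * η) (1 * (ε2 ^ 2) ^ b * (-1) ^ c * ε2 ^ m) :=
      (((nm _ _ a).mul (R_sq_mem _ _) ((Nrel.base m2).pow (R_sq_mem _ _) b)).mul (R_sq_mem _ _)
        ((hNε.mono hle0).pow (R_sq_mem _ _) c)).mul (R_sq_mem _ _) hN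
    have h2 := hc.desc hQ01 (R_sq_mem _ _) r1
    have r2 : Nrel (MQ g []) (R g {0}) (1 * (ε2 ^ 2) ^ b * (-1) ^ c * ε2 ^ m) (1 ^ 2 * (((-1) ^ 2) ^ b) * 1 * (-1) ^ m) :=
      (((Nrel.base (one_mem _)).mul (R_sq_mem _ _) ((e2.pow (R_sq_mem _ _) 2).pow (R_sq_mem _ _) b)).mul (R_sq_mem _ _)
        (nm _ _ c)).mul (R_sq_mem _ _) (e2.pow (R_sq_mem _ _) m)
    have h4 := h2.desc hQ (R_sq_mem _ _) r2
    rw [hm.neg_one_pow] at h4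
    simp at h4
    exact n0 h4
  rw [if_neg h3, pow_zero, mul_one] at hc
  by_cases h1 : 1 ∈ T
  · rw [if_pos h1] at hb
    subst hb
    have r1 : Nrel (MQ g [{1}]) (R g {0}) ((-1) ^ a * ε2 ^ 1 * ε ^ c) (1 * (-1) ^ 1 * (ε ^ c) ^ 2) :=
      (((nm _ _ a).mul (R_sq_mem _ _) ((e2.mono hle1).pow (R_sq_mem _ _) 1)).mul (R_sq_mem _ _)
        (Nrel.base (pow_mem mε c)))
    have h2 := (hc.desc hQ10 (R_sq_mem _ _) r1).div_sq (pow_mem mε c) (pow_ne_zero _ hε.1)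
    simp at h2
    exact n2 h2
  rw [if_neg h1] at hb
  subst hb
  by_cases h2 : 2 ∈ T
  · rw [if_pos h2] at hcc
    subst hcc
    have r1 : Nrel (MQ g [{0}]) (R g {1}) ((-1) ^ a * ε2 ^ 0 * ε ^ 1) (1 * 1 ^ 2 * (-1) ^ 1) :=
      (((nm _ _ a).mul (R_sq_mem _ _) (by rw [pow_zero]; exact Nrel.base (one_mem _))).mul (R_sq_mem _ _)
        ((hNε.mono hle0).pow (R_sq_mem _ _) 1))
    have h2 := (hc.desc hQ01 (R_sq_mem _ _) r1)
    simp at h2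
    exact n1 h2
  · rw [if_neg h2] at hcc
    subst hcc
    have h0 : 0 ∈ T := by
      obtain ⟨i, hi⟩ := hT
      fin_cases i
      · exact hi
      · exact absurd hi h1
      · exact absurd hi h2
      · exact absurd hi h3
    rw [if_pos h0] at ha
    subst ha
    simp at hc
    exact n3 hc

theorem step9 (hg : CG g) : hh (MQ g [{0}, {1}, {3}]) = 1 := by
  obtain ⟨hK, η, hη, m, hm, hN⟩ := step7 hg
  obtain ⟨-, ε, hε, hNε⟩ := step1 hg
  have hQ := MQ_qe hg.toPG (W := []) (W' := [{0}]) (w := {0}) (by decide) (by decide) (by decide) (by decide)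
  have hQ1 := MQ_qe hg.toPG (W := []) (W' := [{1}]) (w := {1}) (by decide) (by decide) (by decide) (by decide)
  have hQ01 := MQ_qe hg.toPG (W := [{0}]) (W' := [{0}, {1}]) (w := {1}) (by decide) (by decide) (by decide) (by decide)
  have hQ10 := MQ_qe hg.toPG (W := [{1}]) (W' := [{0}, {1}]) (w := {0}) (by decide) (by decide) (by decide) (by decide)
  have h := MQ_qe hg.toPG (W := [{0}, {1}]) (W' := [{0}, {1}, {3}]) (w := {3}) (by decide) (by decide) (by decide) (by decide)
  have hr := (le_ram hg.toPG h {0, 3} (fun P hP => ramA hg h hP {3} (by decide) (by decide)))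
  rw [Finset.sum_pair (by decide)] at hr
  have a0 := cnt hg.toPG (W := [{0}, {1}, {3}]) (i := 0) 1 4 2
    (fun P hP => e4 hg (v := {0}) (w := {3}) (by decide) (by decide) (by rw [dd1, hg.g3]) (by decide) hP)
      (fun P hP => f2' hg (v := {1}) (by decide) (by rw [dd1]; exact hg.g1) hP) (by norm_num)
  have n0 : ¬ NF (MQ g []) (R g {3} ^ 2) (-1) := nonnorm_odd hg.toPG 3 hg.g3 (by decide) (by simp)
  have n2 : ¬ NF (MQ g [{1}]) (R g {3} ^ 2) (-1) := nonnorm_odd hg.toPG 3 hg.g3 (by decide) (by simp [dd1, hg.q3])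
  obtain ⟨e1, e2⟩ := eps2 hg
  have m2 := e2.mem hQ
  have mη := hN.mem hQ01
  by_cases hs : g 3 % 8 = 7
  · have a3 := cnt hg.toPG (W := [{0}, {1}, {3}]) (i := 3) 4 2 1 (fun P hP => _root_.e2 hg.toPG (v := {3}) (by decide) (by decide) hP)
      (fun P hP => f1 hg.toPG hP) (by norm_num)
    have := h.upper (k := 4) (t := 5) (![-1, 1 + R g {0}, ε, η])
      (by
        intro i; fin_cases i
        · exact neg_one_mem' _
        · exact hQ01.le m2
        · exact hQ10.le (hNε.mem hQ1)
        · exact mη)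
      (by
        intro i; fin_cases i
        · exact IsUn.neg_one
        · exact e1
        · exact hε
        · exact hη) (step9a hg hη hm hN hε hNε hs) (by omega)
    rw [hK] at this
    exact h.odd_of_bound (by omega)
  · have a3 := cnt hg.toPG (W := [{0}, {1}, {3}]) (i := 3) 2 2 2 (fun P hP => _root_.e2 hg.toPG (v := {3}) (by decide) (by decide) hP)
      (fun P hP => f2 hg.toPG (v := {0}) (by decide) (by
        rw [dd1, sq_two_iff hg (by decide)]; have := hg.g3; omega) hP) (by norm_num)
    have := h.upper2 (1 + R g {0}) η (hQ01.le m2) mη e1 hη (t := 3)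
      (fun hc => n2 (hc.desc hQ10 (R_sq_mem _ _) (e2.mono hQ1.le)))
      (fun hc => by
        have h4 := (hc.desc hQ01 (R_sq_mem _ _) hN).desc hQ (R_sq_mem _ _) (e2.pow (R_sq_mem _ _) m)
        rw [hm.neg_one_pow] at h4
        exact n0 h4)
      (fun hc => by
        have h4 := (hc.desc hQ01 (R_sq_mem _ _) ((Nrel.base m2).mul (R_sq_mem _ _) hN)).desc hQ (R_sq_mem _ _)
          ((e2.pow (R_sq_mem _ _) 2).mul (R_sq_mem _ _) (e2.pow (R_sq_mem _ _) m))
        rw [hm.neg_one_pow] at h4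
        simp at h4
        exact n0 h4) (by omega)
    rw [hK] at this
    exact h.odd_of_bound (by omega)

theorem CG.n2q (hg : CG g) : ¬ IsSquare (g 0 : ZMod (g 2)) := by
  rw [sq_two_iff hg (by decide)]; have := hg.g2; omega
theorem CG.n2p (hg : CG g) : ¬ IsSquare (g 0 : ZMod (g 1)) := by
  rw [sq_two_iff hg (by decide)]; have := hg.g1; omega
theorem CG.qs1 (hg : CG g) : dd g {2, 3} % 4 = 1 := by
  rw [dd2 (by decide), Nat.mul_mod, hg.q34, hg.g3]
theorem CG.p1 (hg : CG g) : dd g {1} % 4 = 1 := by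
  rw [dd1]; have := hg.g1; omega

theorem step10 (hg : CG g) : hh (MQ g [{0}, {3}, {2}]) = 1 := by
  have h := MQ_qe hg.toPG (W := [{0}, {3}]) (W' := [{0}, {3}, {2}]) (w := {2}) (by decide) (by decide) (by decide) (by decide)
  have hQ := MQ_qe hg.toPG (W := []) (W' := [{0}]) (w := {0}) (by decide) (by decide) (by decide) (by decide)
  have hr := (le_ram hg.toPG h {2} (fun P hP => test2 hg.toPG hP.1 (ramA hg h hP {2} (by decide) (by decide))
    (ramB hg h hP {2, 3} (by decide) (by decide) hg.qs1) (by decide)))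
  rw [Finset.sum_singleton] at hr
  have a3 := cnt hg.toPG (W := [{0}, {3}, {2}]) (i := 2) 2 2 2 (fun P hP => e2 hg.toPG (v := {2}) (by decide) (by decide) hP)
      (fun P hP => f2 hg.toPG (v := {0}) (by decide) (by rw [dd1]; exact hg.n2q) hP) (by norm_num)
  obtain ⟨e1, e2⟩ := eps2 hg
  have := h.upper1 (1 + R g {0}) (MQ_le hg.toPG (by decide) (e2.mem hQ)) e1 (t := 2) (fun hc => by
    by_cases hs : IsSquare (g 3 : ZMod (g 2))
    · have hQ3 := MQ_qe hg.toPG (W := [{3}]) (W' := [{0}, {3}]) (w := {0}) (by decide) (by decide) (by decide) (by decide)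
      exact nonnorm_odd hg.toPG 2 hg.q34 (v := {2}) (by decide) (by simp [dd1, hs])
        (hc.desc hQ3 (R_sq_mem _ _) (e2.mono (MQ_le hg.toPG (by decide))))
    · have hQ3 := MQ_qe hg.toPG (W := [{0, 3}]) (W' := [{0}, {3}]) (w := {0}) (by decide) (by decide) (by decide) (by decide)
      exact nonnorm_odd hg.toPG 2 hg.q34 (v := {2}) (by decide) (by
        simp only [List.mem_singleton, forall_eq]
        exact ⟨by decide, (sq_pair hg.toPG (by decide) (by decide) (by decide)).2 (by simp [hs, hg.n2q])⟩)
        (hc.desc hQ3 (R_sq_mem _ _) (e2.mono (MQ_le hg.toPG (by decide))))) (by omega)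
  rw [step8 hg] at this
  exact h.odd_of_bound (by omega)

theorem CG.q0 (hg : CG g) : QE (MQ g [{0}, {1}, {3}]) (MQ g [{0}, {1}, {2}, {3}]) (R g {2}) :=
  MQ_qe hg.toPG (by decide) (by decide) (by decide) (by decide)

theorem step11 (hg : CG g) : h2f (clAct hg.q0.sigma) ≤ 2 := by
  have h := hg.q0
  obtain ⟨-, η, hη, m, hm, hN⟩ := step7 hg
  have hQ := MQ_qe hg.toPG (W := []) (W' := [{0}]) (w := {0}) (by decide) (by decide) (by decide) (by decide)
  have hQ01 := MQ_qe hg.toPG (W := [{0}]) (W' := [{0}, {1}]) (w := {1}) (by decide) (by decide) (by decide) (by decide)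
  have hP := MQ_qe hg.toPG (W := [{0}, {3}]) (W' := [{0}, {1}, {3}]) (w := {1}) (by decide) (by decide) (by decide) (by decide)
  have hr := (le_ram hg.toPG h {2} (fun P hP => test2 hg.toPG hP.1 (ramA hg h hP {2} (by decide) (by decide))
    (ramB hg h hP {2, 3} (by decide) (by decide) hg.qs1) (by decide)))
  rw [Finset.sum_singleton] at hr
  have a3 := cnt hg.toPG (W := [{0}, {1}, {2}, {3}]) (i := 2) 4 2 2 (fun P hP => e2 hg.toPG (v := {2}) (by decide) (by decide) hP)
      (fun P hP => f2 hg.toPG (v := {0}) (by decide) (by rw [dd1]; exact hg.n2q) hP) (by norm_num)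
  obtain ⟨e1, e2⟩ := eps2 hg
  have m2 := e2.mem hQ
  obtain ⟨F, F', hF1, hF2, hF3, n1, n2⟩ : ∃ F F' : IntermediateField ℚ ℂ, QE F (MQ g [{0}, {3}]) (R g {0}) ∧
      QE F' (MQ g [{0}, {1}, {3}]) (R g {0}) ∧ F ≤ F' ∧ ¬ NF F (R g {2} ^ 2) (-1) ∧ ¬ NF F' (R g {2} ^ 2) (-1) := by
    by_cases hs : IsSquare (g 3 : ZMod (g 2))
    · refine ⟨MQ g [{3}], MQ g [{1}, {3}], MQ_qe hg.toPG (by decide) (by decide) (by decide) (by decide),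
        MQ_qe hg.toPG (by decide) (by decide) (by decide) (by decide), MQ_le hg.toPG (by decide),
        nonnorm_odd hg.toPG 2 hg.q34 (by decide) (by simp [dd1, hs]),
        nonnorm_odd hg.toPG 2 hg.q34 (by decide) (by simp [dd1, hs, hg.q2])⟩
    · have : IsSquare (dd g {0, 3} : ZMod (g 2)) :=
        (sq_pair hg.toPG (by decide) (by decide) (by decide)).2 (by simp [hs, hg.n2q])
      refine ⟨MQ g [{0, 3}], MQ g [{1}, {0, 3}], MQ_qe hg.toPG (by decide) (by decide) (by decide) (by decide),
        MQ_qe hg.toPG (by decide) (by decide) (by decide) (by decide), MQ_le hg.toPG (by decide),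
        nonnorm_odd hg.toPG 2 hg.q34 (by decide) (by simp [this]),
        nonnorm_odd hg.toPG 2 hg.q34 (by decide) (by simp [dd1, this, hg.q2])⟩
  have b1 : MQ g [] ≤ F := by rw [MQ_nil]; exact bot_le
  have hle := MQ_le hg.toPG (W := [{0}]) (W' := [{0}, {3}]) (by decide)
  have := h.upper2 (1 + R g {0}) η (MQ_le hg.toPG (by decide) m2) (MQ_le hg.toPG (by decide) (hN.mem hQ01)) e1 hη (t := 4)
      (fun hc => n2 (hc.desc hF2 (R_sq_mem _ _) (e2.mono (b1.trans hF3))))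
      (fun hc => by
        have h4 := (hc.desc hP (R_sq_mem _ _) (hN.mono hle)).desc hF1 (R_sq_mem _ _) ((e2.mono b1).pow (R_sq_mem _ _) m)
        rw [hm.neg_one_pow] at h4
        exact n1 h4)
      (fun hc => by
        have h4 := (hc.desc hP (R_sq_mem _ _) ((Nrel.base (hle m2)).mul (R_sq_mem _ _) (hN.mono hle))).desc hF1 (R_sq_mem _ _)
          (((e2.mono b1).pow (R_sq_mem _ _) 2).mul (R_sq_mem _ _) ((e2.mono b1).pow (R_sq_mem _ _) m))
        rw [hm.neg_one_pow] at h4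
        simp at h4
        exact n1 h4) (by omega)
  rw [step9 hg] at this
  omega

end
end

section
open scoped nonZeroDivisors

section
variable {G : Type*} [CommGroup G]

theorem h2f_eq_h2 [Finite G] (s : G →* G) (h : ∀ c ∈ tp G, s c = c) : h2f s = h2 G := by
  unfold h2f h2
  congr 2
  ext x
  simp only [Subgroup.mem_inf, mem_phiHom_ker]
  constructor
  · rintro ⟨a, -⟩; exact a
  · intro a; exact ⟨a, h x a⟩

theorem map_tp (s : G →* G) {x : G} (hx : x ∈ tp G) : s x ∈ tp G := by
  obtain ⟨n, hn⟩ := hx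
  exact ⟨n, by rw [← map_pow, hn, map_one]⟩

theorem h2_le_mul [Finite G] (s t : G →* G) (hs : ∀ x, s (s x) = x) (ht : ∀ x ∈ tp G, t x = (s x)⁻¹) :
    h2 G ≤ h2f s * h2f t := by
  let f : tp G →* tp G :=
    { toFun := fun x => ⟨x * s x, mul_mem x.2 (map_tp s x.2)⟩
      map_one' := by ext1; simp
      map_mul' := fun a b => by ext1; simp; exact mul_mul_mul_comm _ _ _ _ }
  have e := Subgroup.card_mul_index f.ker
  rw [Subgroup.index_ker] at e
  have h1 : Nat.card f.range ≤ h2f s := by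
    apply Nat.card_le_card_of_injective (fun x => (⟨x.1.1, x.1.2, by
      obtain ⟨x, y, hy⟩ := x
      have hy : y.1 * s y.1 = x.1 := congrArg Subtype.val hy
      refine mem_phiHom_ker.2 ?_
      change s x.1 = x.1
      rw [← hy, map_mul, hs, mul_comm]⟩ : (tp G ⊓ (phiHom s).ker : Subgroup G)))
    intro a b hab
    have hab' : a.1.1 = b.1.1 := by injection hab
    exact Subtype.ext (Subtype.ext hab')
  have h2' : Nat.card f.ker ≤ h2f t := by
    apply Nat.card_le_card_of_injective (fun x => (⟨x.1.1, x.1.2, by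
      obtain ⟨y, hy⟩ := x
      refine mem_phiHom_ker.2 ?_
      change t y.1 = y.1
      have : (y.1 : G) * s y.1 = 1 := congrArg Subtype.val hy
      rw [ht _ y.2]
      exact inv_eq_of_mul_eq_one_left this⟩ : (tp G ⊓ (phiHom t).ker : Subgroup G)))
    intro a b hab
    have hab' : a.1.1 = b.1.1 := by injection hab
    exact Subtype.ext (Subtype.ext hab')
  unfold h2
  rw [← e, mul_comm]
  exact Nat.mul_le_mul h1 h2'

theorem h2f_three [Finite G] {s : G →* G} (h : h2f s ≤ 2) {x y : G} (hx : x ∈ tp G) (hy : y ∈ tp G)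
    (sx : s x = x) (sy : s y = y) (h1 : x ≠ 1) (h2 : y ≠ 1) : x = y := by
  by_contra hne
  have : Nat.card (Fin 3) ≤ h2f s := by
    apply Nat.card_le_card_of_injective (![1, ⟨x, hx, mem_phiHom_ker.2 sx⟩, ⟨y, hy, mem_phiHom_ker.2 sy⟩] :
      Fin 3 → (tp G ⊓ (phiHom s).ker : Subgroup G))
    intro a b hab
    rw [Subtype.ext_iff] at hab
    have h1' := Ne.symm h1
    have h2' := Ne.symm h2
    have hne' := Ne.symm hne
    fin_cases a <;> fin_cases b <;> first | rfl | (exfalso; simp at hab; tauto)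
  simp at this
  omega

/-- Step 20, the group theory. -/
theorem group20 [Finite G] (q a t : G →* G) (hq : ∀ x ∈ tp G, q x = x⁻¹) (hq2 : h2f q ≤ 2)
    (ha : h2f a ≤ 2) (ht : h2f t ≤ 2) (hat : ∀ x ∈ tp G, t x = (a x)⁻¹) (hai : Function.Injective a) : h2 G ≤ 2 := by
  by_contra hc
  obtain ⟨x, hx, hx2⟩ : ∃ x ∈ tp G, x ^ 2 ≠ 1 := by
    by_contra hcon
    push Not at hcon
    apply hc
    rw [← h2f_eq_h2 q]
    · exact hq2
    · intro c hc'
      rw [hq c hc']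
      exact inv_eq_of_mul_eq_one_left (by rw [← sq]; exact hcon c hc')
  obtain ⟨y, hy, hy2, hy4⟩ : ∃ y ∈ tp G, y ^ 2 ≠ 1 ∧ y ^ 4 = 1 := by
    obtain ⟨n, hn⟩ := mem_tp.1 hx
    induction n generalizing x with
    | zero => simp at hn; simp [hn] at hx2
    | succ n ih =>
      by_cases h4 : x ^ 4 = 1
      · exact ⟨x, hx, hx2, h4⟩
      · exact ih (x ^ 2) (pow_mem hx 2) (by rwa [← pow_mul]) (by rw [← pow_mul]; rwa [pow_succ, mul_comm] at hn)
  have two : ∀ z ∈ tp G, z ^ 2 = 1 → z ≠ 1 → z = y ^ 2 := by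
    intro z hz hz2 hz1
    refine h2f_three hq2 hz (pow_mem hy 2) ?_ ?_ hz1 hy2
    · rw [hq z hz]; exact inv_eq_of_mul_eq_one_left (by rw [← sq]; exact hz2)
    · rw [hq _ (pow_mem hy 2)]; exact inv_eq_of_mul_eq_one_left (by rw [← pow_add]; exact hy4)
  have hy1 : y ≠ 1 := by rintro rfl; simp at hy2
  have e1 : a (y ^ 2) = y ^ 2 := by
    refine two _ (map_tp a (pow_mem hy 2)) ?_ ?_
    · rw [← map_pow, ← pow_mul, hy4, map_one]
    · intro h; rw [← map_one a] at h; exact hy2 (hai h)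
  have ne : y ≠ y ^ 2 := by
    intro h
    apply hy1
    have : y * 1 = y * y := by rw [mul_one, ← sq]; exact h
    exact (mul_left_cancel this).symm
  by_cases h1 : a y = y
  · exact ne (h2f_three ha hy (pow_mem hy 2) h1 e1 hy1 hy2)
  · have h3 : a y * y⁻¹ = y ^ 2 := by
      refine two _ (mul_mem (map_tp a hy) (inv_mem hy)) ?_ ?_
      · rw [mul_pow, ← map_pow, e1, ← mul_pow, mul_inv_cancel, one_pow]
      · intro h; exact h1 (mul_inv_eq_one.1 h)
    have h4 : t y = y := by
      rw [hat y hy, mul_inv_eq_iff_eq_mul.1 h3, inv_eq_iff_mul_eq_one, ← pow_succ, ← pow_succ]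
      exact hy4
    have h5 : t (y ^ 2) = y ^ 2 := by rw [map_pow, h4]
    exact ne (h2f_three ht hy (pow_mem hy 2) h4 h5 hy1 hy2)
end

section
variable {g : Fin 4 → ℕ} {W : List (Finset (Fin 4))}

theorem unram (hg : PG g) {W1 : List (Finset (Fin 4))} {w : Finset (Fin 4)}
    (h : QE (MQ g W1) (MQ g W) (R g w)) (hT : ∀ P ∈ ramSet h.sigma, ∃ i ∈ (∅ : Finset (Fin 4)), inP P (g i : ℂ)) :
    h2f (clAct h.sigma) * 2 ≤ hh (MQ g W1) := by
  have := h.upper0 (t := 0) (by simpa using le_ram hg h ∅ hT)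
  simpa using this

/-- product of two inverting involutions is trivial -/
theorem triv_of_inv (hg : PG g) {W1 W2 W3 : List (Finset (Fin 4))} {w1 w2 w3 : Finset (Fin 4)}
    (h1 : QE (MQ g W1) (MQ g W) (R g w1)) (h2 : QE (MQ g W2) (MQ g W) (R g w2))
    (h3 : QE (MQ g W3) (MQ g W) (R g w3)) (e : h1.sigma * h2.sigma = h3.sigma) (o1 : hh (MQ g W1) = 1)
    (o2 : hh (MQ g W2) = 1) : hh (MQ g W) = h2f (clAct h3.sigma) := by
  symm
  apply h2f_eq_h2
  intro c hc
  rw [← e, clAct_mul, h2.inv o2 c hc, map_inv, h1.inv o1 c hc, inv_inv]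

theorem step12 (hg : CG g) (hyp : hh (MQ g [{1, 2, 3}]) = 4) : hh (MQ g [{1}, {2, 3}]) ≤ 2 := by
  have h := MQ_qe hg.toPG (W := [{1, 2, 3}]) (W' := [{1}, {2, 3}]) (w := {1}) (by decide) (by decide) (by decide) (by decide)
  have h1 := MQ_qe hg.toPG (W := [{2, 3}]) (W' := [{1}, {2, 3}]) (w := {1}) (by decide) (by decide) (by decide) (by decide)
  have h2 := MQ_qe hg.toPG (W := [{1}]) (W' := [{1}, {2, 3}]) (w := {2, 3}) (by decide) (by decide) (by decide) (by decide)
  have u := unram hg.toPG h (fun P hP => test2 hg.toPG hP.1 (ramB hg h hP {1} (by decide) (by decide) hg.p1)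
    (ramB hg h hP {2, 3} (by decide) (by decide) hg.qs1) (by decide))
  rw [triv_of_inv hg.toPG h1 h2 h (sigma_mul hg.toPG h1 h2 h (by decide)) (step3 hg) (step1 hg).1]
  omega

theorem step13 (hg : CG g) (hyp : hh (MQ g [{1, 2, 3}]) = 4) : hh (MQ g [{1}, {2}, {3}]) ≤ 2 := by
  have h := MQ_qe hg.toPG (W := [{1}, {2, 3}]) (W' := [{1}, {2}, {3}]) (w := {2}) (by decide) (by decide) (by decide) (by decide)
  have h1 := MQ_qe hg.toPG (W := [{1}, {2}]) (W' := [{1}, {2}, {3}]) (w := {3}) (by decide) (by decide) (by decide) (by decide)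
  have h2 := MQ_qe hg.toPG (W := [{1}, {3}]) (W' := [{1}, {2}, {3}]) (w := {2}) (by decide) (by decide) (by decide) (by decide)
  have hr := (le_ram hg.toPG h {0} (fun P hP => test2 hg.toPG hP.1 (ramA hg h hP {2} (by decide) (by decide))
    (ramA hg h hP {3} (by decide) (by decide)) (by decide)))
  rw [Finset.sum_singleton] at hr
  have a3 := cnt hg.toPG (W := [{1}, {2}, {3}]) (i := 0) 2 2 2
      (fun P hP => e2' hg (v := {2}) (by decide) (by rw [dd1, hg.q34]) hP)
      (fun P hP => f2' hg (v := {1}) (by decide) (by rw [dd1]; exact hg.g1) hP) (by norm_num)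
  rw [triv_of_inv hg.toPG h1 h2 h (sigma_mul hg.toPG h1 h2 h (by decide)) (step4 hg) (step5 hg)]
  obtain ⟨-, ε, hε, hN⟩ := step1 hg
  have hQ1 := MQ_qe hg.toPG (W := []) (W' := [{1}]) (w := {1}) (by decide) (by decide) (by decide) (by decide)
  have := h.upper1 ε (MQ_le hg.toPG (by decide) (hN.mem hQ1)) hε (t := 2) (fun hc => by
    have e8 : dd g {2, 3} % 8 = 1 ∨ dd g {1, 2, 3} % 8 = 1 := by
      rw [dd2 (by decide), dd3 (by decide) (by decide) (by decide), Nat.mul_mod, Nat.mul_mod (g 1), Nat.mul_mod (g 2)]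
      rw [hg.g1, hg.g2]
      have := hg.g3
      have : g 3 % 8 = 3 ∨ g 3 % 8 = 7 := by omega
      rcases this with h | h <;> rw [h] <;> simp
    rcases e8 with h8 | h8
    · exact nonnorm_two (W := [{2, 3}]) (by rw [dd1]; exact hg.q34) (by simpa using h8) (hc.desc (MQ_qe hg.toPG (by decide) (by decide) (by decide) (by decide)) (R_sq_mem _ _)
        (hN.mono (MQ_le hg.toPG (by decide))))
    · exact nonnorm_two (W := [{1, 2, 3}]) (by rw [dd1]; exact hg.q34) (by simpa using h8) (hc.desc (MQ_qe hg.toPG (by decide) (by decide) (by decide) (by decide)) (R_sq_mem _ _)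
        (hN.mono (MQ_le hg.toPG (by decide))))) (by omega)
  have := step12 hg hyp
  omega

theorem step16 (hg : CG g) (k2 : hh (MQ g [{0, 1, 2, 3}]) ≤ 4) (k3 : hh (MQ g [{0, 2, 3}]) ≤ 2) :
    hh (MQ g [{1}, {0, 2, 3}]) ≤ 4 := by
  have h := MQ_qe hg.toPG (W := [{0, 1, 2, 3}]) (W' := [{1}, {0, 2, 3}]) (w := {1}) (by decide) (by decide) (by decide) (by decide)
  have h1 := MQ_qe hg.toPG (W := [{0, 2, 3}]) (W' := [{1}, {0, 2, 3}]) (w := {1}) (by decide) (by decide) (by decide) (by decide)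
  have h2 := MQ_qe hg.toPG (W := [{1}]) (W' := [{1}, {0, 2, 3}]) (w := {0, 2, 3}) (by decide) (by decide) (by decide) (by decide)
  have u := unram hg.toPG h (fun P hP => test2 hg.toPG hP.1 (ramB hg h hP {1} (by decide) (by decide) hg.p1)
    (ramA hg h hP {0, 2, 3} (by decide) (by decide)) (by decide))
  have e := sigma_mul hg.toPG h1 h2 h (by decide)
  have hr := le_ram hg.toPG h1 {1} (fun P hP => (ramB hg h1 hP {1} (by decide) (by decide) hg.p1))
  rw [Finset.sum_singleton] at hr
  have a := cnt hg.toPG (W := [{1}, {0, 2, 3}]) (i := 1) 1 2 2 (fun P hP => e2 hg.toPG (v := {1}) (by decide) (by decide) hP)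
      (fun P hP => f2 hg.toPG (v := {0, 2, 3}) (by decide) (by
        haveI : Fact (g 1).Prime := ⟨hg.prime 1⟩
        rw [dd3 (by decide) (by decide) (by decide)]
        push_cast
        rw [isSquare_mul_iff' (ZMod_ne_zero hg.toPG (by decide)) (mul_ne_zero (ZMod_ne_zero hg.toPG (by decide))
          (ZMod_ne_zero hg.toPG (by decide))), isSquare_mul_iff' (ZMod_ne_zero hg.toPG (by decide))
          (ZMod_ne_zero hg.toPG (by decide))]
        simp [hg.n2p, hg.sqqp, hg.sqsp]) hP) (by norm_num)
  have u1 := h1.upper0 (t := 1) (by omega)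
  have b1 : h2f (clAct h1.sigma) ≤ 2 := by omega
  have b2 : h2f (clAct h.sigma) ≤ 2 := by omega
  have := h2_le_mul (clAct h1.sigma) (clAct h.sigma) (letI := h1.alg; clAct_invol h1.isQuad) (fun x hx => by
    rw [← e, clAct_mul, h2.inv (step1 hg).1 x hx, map_inv])
  calc _ ≤ _ := this
    _ ≤ 2 * 2 := Nat.mul_le_mul b1 b2

theorem step17 (hg : CG g) (k2 : hh (MQ g [{0, 1, 2, 3}]) ≤ 4) (k3 : hh (MQ g [{0, 2, 3}]) ≤ 2) :
    hh (MQ g [{1}, {2}, {0, 3}]) ≤ 4 := by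
  have h := MQ_qe hg.toPG (W := [{1}, {0, 2, 3}]) (W' := [{1}, {2}, {0, 3}]) (w := {2}) (by decide) (by decide) (by decide) (by decide)
  have h1 := MQ_qe hg.toPG (W := [{1}, {2}]) (W' := [{1}, {2}, {0, 3}]) (w := {0, 3}) (by decide) (by decide) (by decide) (by decide)
  have h2 := MQ_qe hg.toPG (W := [{1}, {0, 3}]) (W' := [{1}, {2}, {0, 3}]) (w := {2}) (by decide) (by decide) (by decide) (by decide)
  have hr := (le_ram hg.toPG h {0} (fun P hP => test2 hg.toPG hP.1 (ramA hg h hP {2} (by decide) (by decide))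
    (ramA hg h hP {0, 3} (by decide) (by decide)) (by decide)))
  rw [Finset.sum_singleton] at hr
  have a3 := cnt hg.toPG (W := [{1}, {2}, {0, 3}]) (i := 0) 1 4 2
      (fun P hP => e4 hg (v := {0, 3}) (w := {2}) (by decide) (by decide) (by rw [dd1, hg.q34]) (by decide) hP)
      (fun P hP => f2' hg (v := {1}) (by decide) (by rw [dd1]; exact hg.g1) hP) (by norm_num)
  rw [triv_of_inv hg.toPG h1 h2 h (sigma_mul hg.toPG h1 h2 h (by decide)) (step4 hg) (step6 hg)]
  have := h.upper0 (t := 1) (by omega)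
  have := step16 hg k2 k3
  omega

theorem step20 (hg : CG g) (k2 : hh (MQ g [{0, 1, 2, 3}]) ≤ 4) (k3 : hh (MQ g [{0, 2, 3}]) ≤ 2)
    (hyp : hh (MQ g [{0, 1}, {0, 3}, {2}]) = 4) : hh (MQ g [{0}, {1}, {2}, {3}]) ≤ 2 := by
  have ha := MQ_qe hg.toPG (W := [{1}, {2}, {0, 3}]) (W' := [{0}, {1}, {2}, {3}]) (w := {0}) (by decide) (by decide) (by decide) (by decide)
  have ht := MQ_qe hg.toPG (W := [{0, 1}, {0, 3}, {2}]) (W' := [{0}, {1}, {2}, {3}]) (w := {0}) (by decide) (by decide) (by decide) (by decide)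
  have hp := MQ_qe hg.toPG (W := [{0}, {3}, {2}]) (W' := [{0}, {1}, {2}, {3}]) (w := {1}) (by decide) (by decide) (by decide) (by decide)
  have ua := unram hg.toPG ha (fun P hP => test2 hg.toPG hP.1 (ramA hg ha hP {0} (by decide) (by decide))
    (ramB hg ha hP {2, 3} (by decide) (by decide) hg.qs1) (by decide))
  have ut := unram hg.toPG ht (fun P hP => test2 hg.toPG hP.1 (ramA hg ht hP {0} (by decide) (by decide))
    (ramB hg ht hP {1} (by decide) (by decide) hg.p1) (by decide))
  have e := sigma_mul hg.toPG ha hp ht (by decide)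
  have := step17 hg k2 k3
  refine group20 (clAct hg.q0.sigma) (clAct ha.sigma) (clAct ht.sigma) (fun x hx => hg.q0.inv (step9 hg) x hx) (step11 hg)
    (by omega) (by omega) (fun x hx => ?_) (Function.Involutive.injective (letI := ha.alg; clAct_invol ha.isQuad))
  rw [← e, clAct_mul, hp.inv (step10 hg) x hx, map_inv]
end
end

section
open scoped nonZeroDivisors

theorem sq_mod {l m : ℕ} (hl : l.Prime) (hm : ¬ l ∣ m) {n : ℤ} (hn : ¬ (l : ℤ) ∣ n) {a b : ℚ}
    (h : (n : ℚ) = a ^ 2 - (l * m : ℕ) * b ^ 2) : IsSquare (n : ZMod l) := by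
  haveI : Fact l.Prime := ⟨hl⟩
  have hli := Nat.prime_iff_prime_int.1 hl
  have main : ∀ k : ℕ, ∀ x y z : ℤ, z.natAbs ≤ k → z ≠ 0 → n * z ^ 2 = x ^ 2 - (l * m : ℕ) * y ^ 2 →
      IsSquare (n : ZMod l) := by
    intro k
    induction k with
    | zero => intro x y z hz h0; exact absurd (Int.natAbs_eq_zero.1 (by omega)) h0
    | succ k ih =>
      intro x y z hz h0 e
      by_cases hlz : (l : ℤ) ∣ z
      · obtain ⟨z, rfl⟩ := hlz
        have h1 : (l : ℤ) ∣ x ^ 2 := ⟨n * l * z ^ 2 + m * y ^ 2, by push_cast at e; linear_combination -e⟩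
        obtain ⟨x, rfl⟩ := hli.dvd_of_dvd_pow h1
        have hl0 : (l : ℤ) ≠ 0 := hli.ne_zero
        have h2 : (l : ℤ) ∣ m * y ^ 2 := ⟨x ^ 2 - n * z ^ 2, by
          apply mul_left_cancel₀ hl0; push_cast at e; linear_combination e⟩
        have h3 := (hli.dvd_mul.1 h2).resolve_left (by exact_mod_cast hm)
        obtain ⟨y, rfl⟩ := hli.dvd_of_dvd_pow h3
        have hz0 : z ≠ 0 := by rintro rfl; simp at h0
        refine ih x y z ?_ hz0 ?_
        · rw [Int.natAbs_mul, Int.natAbs_natCast] at hz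
          have := hl.two_le
          have : 0 < z.natAbs := Int.natAbs_pos.2 hz0
          nlinarith
        · apply mul_left_cancel₀ (pow_ne_zero 2 hl0)
          linear_combination e
      · have e' := congrArg (fun t : ℤ => (t : ZMod l)) e
        push_cast at e'
        rw [ZMod.natCast_self] at e'
        have hz' : (z : ZMod l) ≠ 0 := by rwa [Ne, ZMod.intCast_zmod_eq_zero_iff_dvd]
        refine ⟨(x : ZMod l) / z, ?_⟩
        field_simp
        linear_combination e'
  have ha := Rat.num_div_den a
  have hb := Rat.num_div_den b
  have a0 : (a.den : ℚ) ≠ 0 := Nat.cast_ne_zero.2 a.den_ne_zero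
  have b0 : (b.den : ℚ) ≠ 0 := Nat.cast_ne_zero.2 b.den_ne_zero
  refine main _ (a.num * b.den) (b.num * a.den) (a.den * b.den) le_rfl
    (mul_ne_zero (Nat.cast_ne_zero.2 a.den_ne_zero) (Nat.cast_ne_zero.2 b.den_ne_zero)) ?_
  have : (n : ℚ) * (a.den * b.den) ^ 2 = (a.num * b.den) ^ 2 - (l * m : ℕ) * (b.num * a.den) ^ 2 := by
    rw [← ha, ← hb] at h
    field_simp at h
    linear_combination h
  exact_mod_cast this

section
variable {G : Type*} [CommGroup G]

theorem h2f_inj [Finite G] {s : G →* G} {n k : ℕ} (h : h2f s ≤ n) (f : Fin k → G) (hf : Function.Injective f)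
    (h1 : ∀ i, f i ∈ tp G) (h2 : ∀ i, s (f i) = f i) : k ≤ n := by
  have : Nat.card (Fin k) ≤ h2f s := by
    apply Nat.card_le_card_of_injective (fun i => (⟨f i, h1 i, mem_phiHom_ker.2 (h2 i)⟩ :
      (tp G ⊓ (phiHom s).ker : Subgroup G)))
    intro a b hab
    have : f a = f b := by injection hab
    exact hf this
  simp at this
  omega

theorem exists_ord4 {x : G} (hx : x ∈ tp G) (hx2 : x ^ 2 ≠ 1) : ∃ y ∈ tp G, y ^ 2 ≠ 1 ∧ y ^ 4 = 1 := by
  obtain ⟨n, hn⟩ := mem_tp.1 hx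
  induction n generalizing x with
  | zero => simp at hn; simp [hn] at hx2
  | succ n ih =>
    by_cases h4 : x ^ 4 = 1
    · exact ⟨x, hx, hx2, h4⟩
    · exact ih (x := x ^ 2) (pow_mem hx 2) (by rwa [← pow_mul]) (by rw [← pow_mul]; rwa [pow_succ, mul_comm] at hn)

theorem grp_a {M B b y m Y : G} (e1 : M * b = B * y) (e2 : m * B = b * Y) : M * m = y * Y := by
  apply mul_right_cancel (b := B * b)
  calc M * m * (B * b) = (M * b) * (m * B) := by simp only [mul_assoc, mul_comm, mul_left_comm]
    _ = _ := by rw [e1, e2]; simp only [mul_assoc, mul_comm, mul_left_comm]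

theorem grp_b (M B b : G) : M * b = B * (M / B ^ 2 * (B * b)) := by
  rw [div_mul_eq_mul_div, mul_div_assoc', eq_div_iff_mul_eq', sq]
  simp only [mul_assoc, mul_comm, mul_left_comm]

theorem sqinv {x : G} (h : x ^ 2 = 1) : x⁻¹ = x := inv_eq_of_mul_eq_one_left (by rw [← sq]; exact h)

theorem group14 [Finite G] (q : G →* G) (hq : ∀ x ∈ tp G, q x = x⁻¹) (hq2 : h2f q ≤ 4) {c d : G}
    (hc : c ^ 2 = 1) (hd : d ^ 2 = 1) (nc : ∀ y, c ≠ y ^ 2) (nd : ∀ y, d ≠ y ^ 2) (ncd : ∀ y, c * d ≠ y ^ 2) : h2 G ≤ 4 := by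
  have tpc : ∀ x : G, x ^ 2 = 1 → x ∈ tp G := fun x hx => ⟨1, by simpa using hx⟩
  by_cases hall : ∀ x ∈ tp G, x ^ 2 = 1
  · rw [← h2f_eq_h2 q]
    · exact hq2
    · intro x hx; rw [hq x hx]; exact sqinv (hall x hx)
  · exfalso
    push Not at hall
    obtain ⟨x, hx, hx2⟩ := hall
    obtain ⟨y, hy, hy2, hy4⟩ := exists_ord4 hx hx2
    have c1 : c ≠ 1 := by simpa using nc 1
    have d1 : d ≠ 1 := by simpa using nd 1
    have cd1 : c * d ≠ 1 := by simpa using ncd 1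
    have hcd : (c * d) ^ 2 = 1 := by rw [mul_pow, hc, hd, one_mul]
    have hyy : (y ^ 2) ^ 2 = 1 := by rw [← pow_mul]; exact hy4
    have cd : c ≠ d := by
      intro h; apply cd1; rw [← h, ← sq]; exact hc
    have h5 := h2f_inj (k := 5) hq2 ![1, c, d, c * d, y ^ 2] (by
      have s1 := nc y
      have s2 := nd y
      have s3 := ncd y
      have c1' := c1.symm
      have d1' := d1.symm
      have cd1' := cd1.symm
      have cd' := cd.symm
      have s1' := s1.symm
      have s2' := s2.symm
      have s3' := s3.symm
      have hy2' := hy2.symm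
      intro a b hab
      fin_cases a <;> fin_cases b <;> first | rfl | (exfalso; simp at hab; tauto)) (by
      intro i; fin_cases i
      · exact one_mem _
      · exact tpc _ hc
      · exact tpc _ hd
      · exact tpc _ hcd
      · exact tpc _ hyy) (by
      intro i; fin_cases i
      · exact map_one _
      · exact (hq _ (tpc _ hc)).trans (sqinv hc)
      · exact (hq _ (tpc _ hd)).trans (sqinv hd)
      · exact (hq _ (tpc _ hcd)).trans (sqinv hcd)
      · exact (hq _ (tpc _ hyy)).trans (sqinv hyy))
    omega

theorem group15 [Finite G] (q : G →* G) (hq : ∀ x ∈ tp G, q x = x⁻¹) (hq2 : h2f q ≤ 2) {c : G}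
    (hc : c ^ 2 = 1) (nc : ∀ y, c ≠ y ^ 2) : h2 G ≤ 2 := by
  have tpc : ∀ x : G, x ^ 2 = 1 → x ∈ tp G := fun x hx => ⟨1, by simpa using hx⟩
  by_cases hall : ∀ x ∈ tp G, x ^ 2 = 1
  · rw [← h2f_eq_h2 q]
    · exact hq2
    · intro x hx; rw [hq x hx]; exact sqinv (hall x hx)
  · exfalso
    push Not at hall
    obtain ⟨x, hx, hx2⟩ := hall
    obtain ⟨y, hy, hy2, hy4⟩ := exists_ord4 hx hx2
    have hyy : (y ^ 2) ^ 2 = 1 := by rw [← pow_mul]; exact hy4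
    refine nc y (h2f_three hq2 (tpc _ hc) (tpc _ hyy) ?_ ?_ ?_ hy2)
    · exact (hq _ (tpc _ hc)).trans (sqinv hc)
    · exact (hq _ (tpc _ hyy)).trans (sqinv hyy)
    · simpa using nc 1
end

theorem sq_class {K L : IntermediateField ℚ ℂ} {r : ℂ} [NumberField K] [NumberField L] (h : QE K L r)
    (hK : Subsingleton (ClassGroup (𝓞 K))) (M : FI L) (m : Lˣ) (hm : ((m : L) : ℂ) ∈ K)
    (hM : M ^ 2 = toPrincipalIdeal (𝓞 L) L m) (c : ClassGroup (𝓞 L)) (hc : ClassGroup.mk L M = c ^ 2) :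
    ∃ w ∈ K, IsUn w ∧ NF K (r ^ 2) (w * (m : L)) := by
  letI := h.alg
  have hq := h.isQuad
  set σ := h.sigma
  obtain ⟨B, rfl⟩ := mk_surj c
  obtain ⟨J, hJ⟩ := norm_mem_ext hq B
  have hJ2 : J ∈ (toPrincipalIdeal (𝓞 K) K).range := by
    rw [← mk_ker]; exact Subsingleton.elim _ _
  obtain ⟨z, rfl⟩ := hJ2
  rw [extI_principal] at hJ
  rw [← map_pow, ← div_eq_one, ← map_div] at hc
  have hx : M / B ^ 2 ∈ (toPrincipalIdeal (𝓞 L) L).range := by rw [← mk_ker]; exact hc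
  obtain ⟨x, hx⟩ := hx
  set y := x * kEmb K L z with hy
  have e1 : M * idAct σ B = B * toPrincipalIdeal (𝓞 L) L y := by
    rw [hy, map_mul, hx, hJ]
    exact grp_b _ _ _
  have invB : idAct σ (idAct σ B) = B := by
    have := congrArg (idAct σ) hJ
    rw [← extI_principal, idAct_extI hq, extI_principal, hJ, map_mul, mul_comm] at this
    exact (mul_left_cancel this).symm
  have e2 := congrArg (idAct σ) e1
  rw [map_mul, map_mul, invB, idAct_principal] at e2
  have e3 : M * idAct σ M = toPrincipalIdeal (𝓞 L) L (y * Units.map (σ : L →* L) y) := by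
    rw [map_mul]
    exact grp_a e1 e2
  have σm : Units.map (σ : L →* L) m = m := by
    ext1; exact h.sigma_K _ hm
  have e4 : toPrincipalIdeal (𝓞 L) L ((y * Units.map (σ : L →* L) y / m) ^ 2) = 1 := by
    rw [map_pow, map_div, ← e3, div_pow, ← map_pow, div_eq_one, mul_pow, ← map_pow, hM, idAct_principal, σm, map_pow, sq]
  have e5 : (y * Units.map (σ : L →* L) y / m) ^ 2 ∈ (uEmb L).range := by
    rw [← principal_ker]; exact e4
  have hn := h.norm_NF (y : L)
  obtain ⟨u0, u1, u2⟩ := isUn_of_mem_uEmb _ e5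
  set n : ℂ := ((y * h.sigma y : L) : ℂ) with hnn
  have hval : ((((y * Units.map (σ : L →* L) y / m) ^ 2 : Lˣ) : L) : ℂ) = (n / (m : L)) ^ 2 := by
    push_cast; rw [hnn]; push_cast; rfl
  rw [hval] at u0 u1 u2
  have hnK : n ∈ K := by
    obtain ⟨a, ha, b, hb, e⟩ := hn
    rw [e]; exact sub_mem (pow_mem ha 2) (mul_mem h.sq (pow_mem hb 2))
  have m0 : ((m : L) : ℂ) ≠ 0 := by
    intro h0; exact m.ne_zero (Subtype.ext h0)
  refine ⟨n / (m : L), div_mem hnK hm, ⟨fun h0 => u0 (by rw [h0]; ring), u1.of_pow (by norm_num),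
    (by rw [← inv_pow] at u2; exact u2.of_pow (by norm_num))⟩, ?_⟩
  rwa [div_mul_cancel₀ _ m0]
end

section
open scoped nonZeroDivisors

section
variable {g : Fin 4 → ℕ}

theorem nil_sub : Subsingleton (ClassGroup (𝓞 (MQ g []))) := by
  rw [MQ_nil]
  have e : (⊥ : IntermediateField ℚ ℂ) ≃+* ℚ := (IntermediateField.botEquiv ℚ ℂ).toRingEquiv
  have e2 := ClassGroup.mulEquiv (RingOfIntegers.mapRingEquiv e)
  have h1 : Nat.card (ClassGroup (𝓞 ℚ)) = 1 := by
    have := Rat.classNumber_eq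
    rw [classNumber, ← Nat.card_eq_fintype_card] at this
    exact this
  have h2 : Nat.card (ClassGroup (𝓞 (⊥ : IntermediateField ℚ ℂ))) = 1 := by
    rw [Nat.card_congr e2.toEquiv]; exact h1
  exact (Nat.card_eq_one_iff_unique.1 h2).1

theorem mem_nil {x : ℂ} (h : x ∈ MQ g []) : ∃ a : ℚ, (a : ℂ) = x := by
  rw [MQ_nil] at h
  obtain ⟨a, ha⟩ := IntermediateField.mem_bot.1 h
  exact ⟨a, by rw [← ha]; simp⟩

/-- natural numbers as units -/
noncomputable def nU (L : IntermediateField ℚ ℂ) (n : ℕ) (h : n ≠ 0) : Lˣ := Units.mk0 (n : L) (Nat.cast_ne_zero.2 h)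

theorem exists_root (hg : PG g) (w : Finset (Fin 4)) (i : Fin 4) (hi : i ∈ w) :
    ∃ M : FI (MQ g [w]), M ^ 2 = toPrincipalIdeal (𝓞 (MQ g [w])) (MQ g [w]) (nU _ (g i) (hg.prime i).ne_zero) := by
  obtain ⟨r, hr⟩ := (OI_R hg (W := [w]) (v := w) (by simp only [sp, List.map, List.mem_append, List.mem_singleton]; right; exact (symmDiff_bot w).symm)).lift
  have hr2 : r ^ 2 = ((dd g w : ℕ) : 𝓞 (MQ g [w])) := by
    ext; push_cast; rw [hr, R_sq]
  set k := dd g (w.erase i)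
  have hk : (g i : 𝓞 (MQ g [w])) * k = r ^ 2 := by
    rw [hr2, ← dd_erase hi]; push_cast; rfl
  have hcop : IsCoprime ((g i : ℕ) : ℤ) (k : ℤ) := by
    rw [Nat.isCoprime_iff_coprime]
    exact (dd_coprime hg (Finset.notMem_erase i w)).symm
  obtain ⟨a, b, hab⟩ := hcop
  have hab' : (a : 𝓞 (MQ g [w])) * g i + b * k = 1 := by exact_mod_cast congrArg (Int.cast : ℤ → 𝓞 (MQ g [w])) hab
  set m : 𝓞 (MQ g [w]) := (g i : 𝓞 (MQ g [w])) with hm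
  have m0 : m ≠ 0 := Nat.cast_ne_zero.2 (hg.prime i).ne_zero
  have hI : (Ideal.span {m, r}) * (Ideal.span {m, r}) = Ideal.span {m} := by
    rw [Ideal.span_pair_mul_span_pair]
    apply le_antisymm
    · rw [Ideal.span_le]
      intro x hx
      simp only [Set.mem_insert_iff, Set.mem_singleton_iff] at hx
      rw [SetLike.mem_coe, Ideal.mem_span_singleton]
      rcases hx with rfl | rfl | rfl | rfl
      · exact ⟨m, rfl⟩
      · exact ⟨r, rfl⟩
      · exact ⟨r, mul_comm _ _⟩
      · exact ⟨k, by rw [hk, sq]⟩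
    · rw [Ideal.span_singleton_le_iff_mem]
      have : m = a * (m * m) + b * (r * r) := by
        rw [← sq r, ← hk]; linear_combination (-m) * hab'
      have hin : a * (m * m) + b * (r * r) ∈ Ideal.span {m * m, m * r, r * m, r * r} := add_mem (Ideal.mul_mem_left _ _ (Ideal.subset_span (by simp)))
        (Ideal.mul_mem_left _ _ (Ideal.subset_span (by simp)))
      rwa [← this] at hin
  have hne : Ideal.span {m, r} ≠ ⊥ := by
    intro h0
    rw [Ideal.span_eq_bot] at h0
    exact m0 (h0 m (by simp))
  refine ⟨fu _ hne, ?_⟩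
  ext1
  rw [coe_toPrincipalIdeal, sq, Units.val_mul, fu_coe, ← FractionalIdeal.coeIdeal_mul, hI, FractionalIdeal.coeIdeal_span_singleton]
  congr 1

theorem sq_class2 (hg : PG g) {w : Finset (Fin 4)} (h : QE (MQ g []) (MQ g [w]) (R g w)) {n : ℕ} (hn : n ≠ 0)
    {M : FI (MQ g [w])} (hM : M ^ 2 = toPrincipalIdeal (𝓞 (MQ g [w])) (MQ g [w]) (nU _ n hn))
    (c : ClassGroup (𝓞 (MQ g [w]))) (hc : ClassGroup.mk (MQ g [w]) M = c ^ 2) :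
    ∃ e : ℤ, (e = 1 ∨ e = -1) ∧ ∃ a b : ℚ, ((e * n : ℤ) : ℚ) = a ^ 2 - (dd g w : ℕ) * b ^ 2 := by
  obtain ⟨u, hu, hU, a, ha, b, hb, e⟩ := sq_class h nil_sub M _ (natCast_mem' _ n) hM c hc
  obtain ⟨u, rfl⟩ := mem_nil hu
  obtain ⟨a, rfl⟩ := mem_nil ha
  obtain ⟨b, rfl⟩ := mem_nil hb
  have int : ∀ x : ℚ, IsIntegral ℤ (x : ℂ) → ∃ y : ℤ, (y : ℚ) = x := by
    intro x hx
    have : IsIntegral ℤ x := (isIntegral_algebraMap_iff (A := ℚ) (B := ℂ) (FaithfulSMul.algebraMap_injective ℚ ℂ)).1 (by simpa using hx)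
    exact IsIntegrallyClosed.isIntegral_iff.1 this
  obtain ⟨y, rfl⟩ := int u hU.2.1
  obtain ⟨z, hz⟩ := int (y : ℚ)⁻¹ (by simpa using hU.2.2)
  have y0 : (y : ℚ) ≠ 0 := by
    intro h0; apply hU.1; rw [h0]; simp
  have hyz : y * z = 1 := by
    have : (y : ℚ) * z = 1 := by rw [hz]; field_simp
    exact_mod_cast this
  refine ⟨y, Int.isUnit_iff.1 (IsUnit.of_mul_eq_one _ hyz), a, b, ?_⟩
  rw [R_sq] at e
  have e' : ((y : ℚ) : ℂ) * (n : ℂ) = (a : ℂ) ^ 2 - (dd g w : ℂ) * (b : ℂ) ^ 2 := e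
  have e2 : (y : ℚ) * n = a ^ 2 - dd g w * b ^ 2 := by exact_mod_cast e'
  push_cast; exact e2

theorem mod_i (hg : PG g) {w : Finset (Fin 4)} {i : Fin 4} (hi : i ∈ w) {e : ℤ} (he : e = 1 ∨ e = -1) {n : ℕ} (hn : ¬ g i ∣ n)
    {a b : ℚ} (h : ((e * n : ℤ) : ℚ) = a ^ 2 - (dd g w : ℕ) * b ^ 2) : IsSquare ((e : ZMod (g i)) * n) := by
  rw [← dd_erase hi] at h
  have := sq_mod (hg.prime i) (fun hd => (Finset.notMem_erase i w) ((prime_dvd_dd hg).1 hd)) (n := e * n) (by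
    rcases he with rfl | rfl
    · rw [one_mul]; exact_mod_cast hn
    · rw [neg_one_mul, dvd_neg]; exact_mod_cast hn) h
  simpa using this

theorem notq (hg : CG g) {w : Finset (Fin 4)} (h2 : 2 ∈ w) (h3 : 3 ∈ w)
    (hk : IsSquare (-(dd g (w.erase 2) : ZMod (g 2))) ↔ IsSquare (g 3 : ZMod (g 2)))
    {e : ℤ} (he : e = 1 ∨ e = -1) {a b : ℚ}
    (h : ((e * g 2 : ℤ) : ℚ) = a ^ 2 - (dd g w : ℕ) * b ^ 2) : False := by
  have q0 : (g 2 : ℚ) ≠ 0 := Nat.cast_ne_zero.2 (hg.prime 2).ne_zero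
  haveI : Fact (g 2).Prime := ⟨hg.prime 2⟩
  haveI : Fact (g 3).Prime := ⟨hg.prime 3⟩
  have n23 : ¬ g 3 ∣ g 2 := by
    rw [Nat.prime_dvd_prime_iff_eq (hg.prime 3) (hg.prime 2)]
    exact fun e => absurd (hg.inj e) (by decide)
  have s1 := mod_i hg.toPG h3 he n23 h
  have s2 := mod_i hg.toPG h2 (e := -e) (by omega) (n := dd g (w.erase 2)) (fun hd => (Finset.notMem_erase 2 w) ((prime_dvd_dd hg.toPG).1 hd))
    (a := dd g (w.erase 2) * b) (b := a / g 2) (by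
    rw [← dd_erase h2] at h ⊢
    push_cast at h ⊢
    field_simp
    linear_combination (-(dd g (w.erase 2)) : ℚ) * h)
  have k0 : (-(dd g (w.erase 2)) : ZMod (g 2)) ≠ 0 := by
    rw [neg_ne_zero, Ne, ZMod.natCast_eq_zero_iff]
    exact (fun hd => (Finset.notMem_erase 2 w) ((prime_dvd_dd hg.toPG).1 hd))
  have m2 := nsq_m1 hg.toPG hg.q34
  have m3 := nsq_m1 hg.toPG hg.g3
  have hqs := hg.sqqs
  rcases he with rfl | rfl
  · simp at s1 s2
    tauto
  · push_cast at s1 s2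
    rw [isSquare_mul_iff' (by simp) (ZMod_ne_zero hg.toPG (by decide))] at s1
    have : (1 : ZMod (g 2)) * (dd g (w.erase 2)) = (-1) * (-(dd g (w.erase 2))) := by ring
    rw [this, isSquare_mul_iff' (by simp) k0] at s2
    tauto

theorem step15 (hg : CG g) : hh (MQ g [{0, 2, 3}]) ≤ 2 := by
  have h := MQ_qe hg.toPG (W := []) (W' := [{0, 2, 3}]) (w := {0, 2, 3}) (by decide) (by decide) (by decide) (by decide)
  haveI : Fact (g 2).Prime := ⟨hg.prime 2⟩
  have ht : (ramSet h.sigma).ncard ≤ 3 := by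
    refine (le_ram hg.toPG h {0, 2, 3} (fun P hP => by
      simpa using ramA hg h hP {0, 2, 3} (by decide) (by decide))).trans ?_
    have a : ∀ i ∈ ({0, 2, 3} : Finset (Fin 4)), (PO (MQ g [{0, 2, 3}]) (g i)).ncard ≤ 1 := fun i hi =>
      cnt hg.toPG (W := [{0, 2, 3}]) (i := i) 1 2 1 (fun P hP => e2 hg.toPG (v := {0, 2, 3}) (by decide) hi hP)
        (fun P hP => f1 hg.toPG hP) (by norm_num)
    simpa using Finset.sum_le_card_nsmul _ _ 1 a
  have u := h.upper1 (-1) (neg_mem (one_mem _)) IsUn.neg_one (nonnorm_odd hg.toPG 3 hg.g3 (by decide) (by simp)) ht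
  rw [hh_nil] at u
  obtain ⟨M, hM⟩ := exists_root hg.toPG {0, 2, 3} 2 (by decide)
  refine group15 (clAct h.sigma) (h.inv hh_nil) (by omega) (c := ClassGroup.mk _ M) ?_ ?_
  · rw [← map_pow, hM]
    have : toPrincipalIdeal (𝓞 (MQ g [{0, 2, 3}])) (MQ g [{0, 2, 3}]) (nU _ (g 2) (hg.prime 2).ne_zero) ∈ (ClassGroup.mk (MQ g [{0, 2, 3}])).ker := by
      rw [mk_ker]; exact ⟨_, rfl⟩
    exact this
  · intro y hy
    obtain ⟨e, he, a, b, h⟩ := sq_class2 hg.toPG h _ hM y hy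
    refine notq hg (w := {0, 2, 3}) (by decide) (by decide) ?_ he h
    have : ({0, 2, 3} : Finset (Fin 4)).erase 2 = {0, 3} := by decide
    rw [this, dd2 (by decide)]
    have e2 : (-((g 0 * g 3 : ℕ) : ZMod (g 2))) = (-1) * (g 0 * g 3) := by push_cast; ring
    rw [e2, isSquare_mul_iff' (by simp) (mul_ne_zero (ZMod_ne_zero hg.toPG (by decide)) (ZMod_ne_zero hg.toPG (by decide))),
      isSquare_mul_iff' (ZMod_ne_zero hg.toPG (by decide)) (ZMod_ne_zero hg.toPG (by decide))]
    have := hg.n2q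
    have := nsq_m1 hg.toPG hg.q34
    tauto

theorem step14 (hg : CG g) : hh (MQ g [{0, 1, 2, 3}]) ≤ 4 := by
  have h := MQ_qe hg.toPG (W := []) (W' := [{0, 1, 2, 3}]) (w := {0, 1, 2, 3}) (by decide) (by decide) (by decide) (by decide)
  haveI : Fact (g 2).Prime := ⟨hg.prime 2⟩
  haveI : Fact (g 1).Prime := ⟨hg.prime 1⟩
  have ht : (ramSet h.sigma).ncard ≤ 4 := by
    refine (le_ram hg.toPG h {0, 1, 2, 3} (fun P hP => by
      simpa using ramA hg h hP {0, 1, 2, 3} (by decide) (by decide))).trans ?_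
    have a : ∀ i ∈ ({0, 1, 2, 3} : Finset (Fin 4)), (PO (MQ g [{0, 1, 2, 3}]) (g i)).ncard ≤ 1 := fun i hi =>
      cnt hg.toPG (W := [{0, 1, 2, 3}]) (i := i) 1 2 1 (fun P hP => e2 hg.toPG (v := {0, 1, 2, 3}) (by decide) hi hP)
        (fun P hP => f1 hg.toPG hP) (by norm_num)
    simpa using Finset.sum_le_card_nsmul _ _ 1 a
  have u := h.upper1 (-1) (neg_mem (one_mem _)) IsUn.neg_one (nonnorm_odd hg.toPG 3 hg.g3 (by decide) (by simp)) ht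
  rw [hh_nil] at u
  obtain ⟨M, hM⟩ := exists_root hg.toPG {0, 1, 2, 3} 2 (by decide)
  obtain ⟨N, hN⟩ := exists_root hg.toPG {0, 1, 2, 3} 0 (by decide)
  have hMN : (M * N) ^ 2 = toPrincipalIdeal (𝓞 (MQ g [{0, 1, 2, 3}])) (MQ g [{0, 1, 2, 3}])
      (nU _ (g 2 * g 0) (mul_ne_zero (hg.prime 2).ne_zero (hg.prime 0).ne_zero)) := by
    rw [mul_pow, hM, hN, ← map_mul]
    congr 1; ext1; simp [nU]
  have pr : ∀ x, toPrincipalIdeal (𝓞 (MQ g [{0, 1, 2, 3}])) (MQ g [{0, 1, 2, 3}]) x ∈ (ClassGroup.mk (MQ g [{0, 1, 2, 3}])).ker := by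
      intro x; rw [mk_ker]; exact ⟨_, rfl⟩
  have m1 : IsSquare (-1 : ZMod (g 1)) := by
    rw [ZMod.exists_sq_eq_neg_one_iff]; have := hg.g1; omega
  have se : ∀ e : ℤ, e = 1 ∨ e = -1 → IsSquare (e : ZMod (g 1)) ∧ (e : ZMod (g 1)) ≠ 0 := by
    rintro e (rfl | rfl)
    · simp
    · simpa using m1
  have np : ∀ j : Fin 4, j ≠ 1 → ¬ g 1 ∣ g j := by
    intro j hj
    rw [Nat.prime_dvd_prime_iff_eq (hg.prime 1) (hg.prime j)]
    exact fun e => hj (hg.inj e).symm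
  have n2p := hg.n2p
  have sqqp := hg.sqqp
  refine group14 (clAct h.sigma) (h.inv hh_nil) (by omega) (c := ClassGroup.mk _ M) (d := ClassGroup.mk _ N) ?_ ?_ ?_ ?_ ?_
  · rw [← map_pow, hM]; exact pr _
  · rw [← map_pow, hN]; exact pr _
  · intro y hy
    obtain ⟨e, he, a, b, h⟩ := sq_class2 hg.toPG h _ hM y hy
    refine notq hg (w := {0, 1, 2, 3}) (by decide) (by decide) ?_ he h
    have : ({0, 1, 2, 3} : Finset (Fin 4)).erase 2 = {0, 1, 3} := by decide
    rw [this, dd3 (by decide) (by decide) (by decide)]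
    have e2 : (-((g 0 * (g 1 * g 3) : ℕ) : ZMod (g 2))) = (-1) * (g 0 * (g 1 * g 3)) := by push_cast; ring
    have z0 : ((g 0 : ℕ) : ZMod (g 2)) ≠ 0 := ZMod_ne_zero hg.toPG (by decide)
    have z1 : ((g 1 : ℕ) : ZMod (g 2)) ≠ 0 := ZMod_ne_zero hg.toPG (by decide)
    have z3 : ((g 3 : ℕ) : ZMod (g 2)) ≠ 0 := ZMod_ne_zero hg.toPG (by decide)
    rw [e2, isSquare_mul_iff' (by simp) (mul_ne_zero z0 (mul_ne_zero z1 z3)),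
      isSquare_mul_iff' z0 (mul_ne_zero z1 z3), isSquare_mul_iff' z1 z3]
    have := hg.n2q
    have := hg.q2
    have := nsq_m1 hg.toPG hg.q34
    tauto
  · intro y hy
    obtain ⟨e, he, a, b, h⟩ := sq_class2 hg.toPG h _ hN y hy
    have := mod_i hg.toPG (i := 1) (by decide) he (np 0 (by decide)) h
    rw [isSquare_mul_iff' (se e he).2 (ZMod_ne_zero hg.toPG (by decide))] at this
    have := (se e he).1
    tauto
  · intro y hy
    rw [← map_mul] at hy
    obtain ⟨e, he, a, b, h⟩ := sq_class2 hg.toPG h _ hMN y hy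
    have := mod_i hg.toPG (i := 1) (by decide) he (fun hd => by
      rcases (hg.prime 1).dvd_mul.1 hd with hd | hd
      · exact np 2 (by decide) hd
      · exact np 0 (by decide) hd) h
    have z0 : ((g 0 : ℕ) : ZMod (g 1)) ≠ 0 := ZMod_ne_zero hg.toPG (by decide)
    have z2 : ((g 2 : ℕ) : ZMod (g 1)) ≠ 0 := ZMod_ne_zero hg.toPG (by decide)
    push_cast at this
    rw [isSquare_mul_iff' (se e he).2 (mul_ne_zero z2 z0), isSquare_mul_iff' z2 z0] at this
    have := (se e he).1
    tauto
end
end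

section
open scoped nonZeroDivisors

theorem QE.liftAut {K L : IntermediateField ℚ ℂ} {r : ℂ} (h : QE K L r) [NumberField L]
    (s : K ≃ₐ[ℚ] K) (a : K) (ha : s ⟨r ^ 2, h.sq⟩ = a ^ 2 * ⟨r ^ 2, h.sq⟩) :
    ∃ τ : L ≃ₐ[ℚ] L, ∀ (x : L) (c d : K), (x : ℂ) = c + d * r → (τ x : ℂ) = s c + s d * (a * r) := by
  classical
  have hsq := congrArg (Subtype.val) ha
  have H : ∀ x : L, ∃ y : L, ∀ c d : K, (x : ℂ) = c + d * r → (y : ℂ) = s c + s d * (a * r) := by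
    intro x
    obtain ⟨a1, ha1, b1, hb1, e⟩ := h.gen x x.2
    refine ⟨⟨s ⟨a1, ha1⟩ + s ⟨b1, hb1⟩ * (a * r), add_mem (h.le (s _).2) (mul_mem (h.le (s _).2)
      (mul_mem (h.le a.2) h.mem))⟩, ?_⟩
    intro c d e'
    obtain ⟨e1, e2⟩ := h.uniq ha1 hb1 c.2 d.2 (e.symm.trans e')
    have e1' : (⟨a1, ha1⟩ : K) = c := Subtype.ext e1
    have e2' : (⟨b1, hb1⟩ : K) = d := Subtype.ext e2
    rw [← e1', ← e2']
  choose f hf using H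
  have H2 : ∀ x : L, ∃ c d : K, (x : ℂ) = c + d * r := by
    intro x
    obtain ⟨a1, ha1, b1, hb1, e⟩ := h.gen x x.2
    exact ⟨⟨a1, ha1⟩, ⟨b1, hb1⟩, e⟩
  let F : L →ₐ[ℚ] L :=
    { toFun := f
      map_one' := by
        ext1
        rw [hf 1 1 0 (by push_cast; ring)]
        rw [map_one, map_zero]; push_cast; ring
      map_zero' := by
        ext1
        rw [hf 0 0 0 (by push_cast; ring)]
        rw [map_zero]; push_cast; ring
      map_mul' := by
        intro x y
        obtain ⟨c, d, e⟩ := H2 x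
        obtain ⟨c', d', e'⟩ := H2 y
        ext1
        rw [hf (x * y) (c * c' + d * d' * ⟨r ^ 2, h.sq⟩) (c * d' + d * c')
          (by push_cast; rw [e, e']; ring)]
        push_cast
        rw [hf x c d e, hf y c' d' e']
        simp only [map_add, map_mul]
        push_cast
        push_cast at hsq
        rw [hsq]; ring
      map_add' := by
        intro x y
        obtain ⟨c, d, e⟩ := H2 x
        obtain ⟨c', d', e'⟩ := H2 y
        ext1
        rw [hf (x + y) (c + c') (d + d') (by push_cast; rw [e, e']; ring)]
        push_cast
        rw [hf x c d e, hf y c' d' e']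
        simp only [map_add]
        push_cast
        ring
      commutes' := by
        intro q
        ext1
        rw [hf _ (algebraMap ℚ K q) 0 (by rw [ZeroMemClass.coe_zero, zero_mul, add_zero]; rfl)]
        rw [map_zero, AlgEquiv.commutes, ZeroMemClass.coe_zero, zero_mul, add_zero]; rfl }
  have hb : Function.Bijective F := Algebra.IsAlgebraic.algHom_bijective F
  exact ⟨AlgEquiv.ofBijective F hb, fun x c d e => hf x c d e⟩

structure Tower (K : ℕ → IntermediateField ℚ ℂ) (x : ℕ → ℂ) : Prop where
  x0 : x 0 = 0
  sq : ∀ n, x (n + 1) ^ 2 = 2 + x n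
  ne : ∀ n, x (n + 1) ≠ 0
  le : ∀ n, K n ≤ K (n + 1)
  mem' : ∀ n, x (n + 1) ∈ K (n + 1)
  gen : ∀ n (M : IntermediateField ℚ ℂ), K n ≤ M → x (n + 1) ∈ M → K (n + 1) ≤ M
  nm : x 1 ∉ K 0

theorem two_mem' (F : IntermediateField ℚ ℂ) : (2 : ℂ) ∈ F := by
  simpa using F.algebraMap_mem 2

namespace Tower
variable {K : ℕ → IntermediateField ℚ ℂ} {x : ℕ → ℂ}

theorem mem (T : Tower K x) (n : ℕ) : x n ∈ K n := by
  cases n with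
  | zero => rw [T.x0]; exact zero_mem _
  | succ n => exact T.mem' n

theorem bn (T : Tower K x) (n : ℕ) : ∃ b ∈ K n, b ≠ 0 ∧ 2 - x n = (b * x (n + 1)) ^ 2 := by
  induction n with
  | zero => exact ⟨1, one_mem _, one_ne_zero, by rw [one_mul, T.sq, T.x0]; ring⟩
  | succ n ih =>
    obtain ⟨b, hb, hb0, e⟩ := ih
    have h1 := T.ne n
    have h2 := T.ne (n + 1)
    have s1 := T.sq n
    have s2 := T.sq (n + 1)
    have hm : x (n + 1 + 1) ^ 2 ∈ K (n + 1) := by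
      rw [s2]; exact add_mem (two_mem' _) (T.mem _)
    refine ⟨b * x (n + 1) / x (n + 1 + 1) ^ 2, div_mem (mul_mem (T.le n hb) (T.mem _)) hm,
      div_ne_zero (mul_ne_zero hb0 h1) (pow_ne_zero _ h2), ?_⟩
    have : (b * x (n + 1) / x (n + 1 + 1) ^ 2 * x (n + 1 + 1)) ^ 2 = (b * x (n + 1)) ^ 2 / x (n + 1 + 1) ^ 2 := by
      field_simp
    rw [this, ← e, eq_div_iff (pow_ne_zero _ h2), s2]
    linear_combination -s1

theorem qe (T : Tower K x) (n : ℕ) : QE (K n) (K (n + 1)) (x (n + 1)) := by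
  induction n with
  | zero =>
    refine QE.mk' (T.le 0) (T.mem 1) T.nm ?_ (T.gen 0)
    rw [T.sq]; exact add_mem (two_mem' _) (T.mem _)
  | succ n ih =>
    refine QE.mk' (T.le _) (T.mem _) ?_ ?_ (T.gen _)
    · intro hy
      obtain ⟨b, hb, hb0, e⟩ := T.bn n
      obtain ⟨c, hc, d, hd, e1⟩ := ih.gen _ hy
      have s2 := T.sq (n + 1)
      have s1 := T.sq n
      have hX : x (n + 1) ^ 2 ∈ K n := ih.sq
      have e2 : (c ^ 2 + d ^ 2 * x (n + 1) ^ 2) + (2 * c * d) * x (n + 1) = 2 + 1 * x (n + 1) := by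
        rw [e1] at s2; linear_combination s2
      obtain ⟨u1, u2⟩ := ih.uniq (add_mem (pow_mem hc 2) (mul_mem (pow_mem hd 2) hX))
        (mul_mem (mul_mem (two_mem' _) hc) hd) (two_mem' _) (one_mem _) e2
      -- norm
      have e3 : (c ^ 2 - d ^ 2 * x (n + 1) ^ 2) ^ 2 = (b * x (n + 1)) ^ 2 := by
        rw [← e]
        have : (c ^ 2 - d ^ 2 * x (n + 1) ^ 2) ^ 2 = (c ^ 2 + d ^ 2 * x (n + 1) ^ 2) ^ 2 -
          (2 * c * d) ^ 2 * x (n + 1) ^ 2 := by ring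
        rw [this, u1, u2, s1]; ring
      have hN : c ^ 2 - d ^ 2 * x (n + 1) ^ 2 ∈ K n := sub_mem (pow_mem hc 2) (mul_mem (pow_mem hd 2) hX)
      apply ih.nmem
      rcases sq_eq_sq_iff_eq_or_eq_neg.1 e3 with h | h
      · have : x (n + 1) = (c ^ 2 - d ^ 2 * x (n + 1) ^ 2) / b := by rw [h]; field_simp
        rw [this]; exact div_mem hN hb
      · have : x (n + 1) = -(c ^ 2 - d ^ 2 * x (n + 1) ^ 2) / b := by rw [h]; field_simp
        rw [this]; exact div_mem (neg_mem hN) hb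
    · rw [T.sq]; exact add_mem (two_mem' _) (T.mem _)

theorem nf (T : Tower K x) (h : NumberField (K 0)) (n : ℕ) : NumberField (K n) := by
  induction n with
  | zero => exact h
  | succ n ih => exact (T.qe n).numberField

theorem tau (T : Tower K x) (n : ℕ) [NumberField (K (n + 2))] :
    ∃ τ : K (n + 2) ≃ₐ[ℚ] K (n + 2),
      (∀ (y : K (n + 1)), τ ⟨y, T.le _ y.2⟩ = ⟨(T.qe n).sigma y, T.le _ ((T.qe n).sigma y).2⟩) ∧
      (∀ y, τ (τ y) = (T.qe (n + 1)).sigma y) := by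
  obtain ⟨b, hb, hb0, e⟩ := T.bn n
  have hX1 := T.mem (n + 1)
  have h1 := T.ne n
  have h2 := T.ne (n + 1)
  have s1 := T.sq n
  have s2 := T.sq (n + 1)
  let X : K (n + 1) := ⟨x (n + 1), hX1⟩
  let B : K (n + 1) := ⟨b, T.le n hb⟩
  let a : K (n + 1) := (2 - X) / (B * X)
  set s := (T.qe n).sigma with hs
  have sX : s X = - X := (T.qe n).sigma_r X 1 (one_mem _) (by rw [one_mul])
  have sB : s B = B := (T.qe n).sigma_K B hb
  have hBX : B * X ≠ 0 := by
    intro h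
    have := congrArg Subtype.val h
    exact mul_ne_zero hb0 h1 this
  have hX0 : X ≠ 0 := right_ne_zero_of_mul hBX
  have hB0 : B ≠ 0 := left_ne_zero_of_mul hBX
  have key : (2 - X) * (2 + X) = (B * X) ^ 2 := by
    ext1
    change (2 - x (n + 1)) * (2 + x (n + 1)) = (b * x (n + 1)) ^ 2
    rw [← e]; linear_combination -s1
  have hsq : (⟨x (n + 1 + 1) ^ 2, (T.qe (n + 1)).sq⟩ : K (n + 1)) = 2 + X := by
    ext1
    exact s2
  have s22 : s 2 = 2 := map_ofNat s 2
  have ha : s ⟨x (n + 1 + 1) ^ 2, (T.qe (n + 1)).sq⟩ = a ^ 2 * ⟨x (n + 1 + 1) ^ 2, (T.qe (n + 1)).sq⟩ := by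
    rw [hsq, map_add, s22, sX]
    have : a ^ 2 * (2 + X) = (2 - X) * ((2 - X) * (2 + X)) / (B * X) ^ 2 := by
      simp only [a]; field_simp
    rw [this, key]
    rw [mul_div_assoc, div_self (pow_ne_zero _ hBX)]; ring
  have haa : a * s a = -1 := by
    have : s a = (2 + X) / (B * (-X)) := by
      simp only [a]
      rw [map_div₀, map_mul, map_sub, s22, sX, sB]; congr 1; ring
    rw [this]
    have : a * ((2 + X) / (B * (-X))) = - (((2 - X) * (2 + X)) / (B * X) ^ 2) := by
      simp only [a]; field_simp
    rw [this, key, div_self (pow_ne_zero _ hBX)]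
  obtain ⟨τ, hτ⟩ := (T.qe (n + 1)).liftAut s a ha
  refine ⟨τ, ?_, ?_⟩
  · intro y
    ext1
    rw [hτ _ y 0 (by rw [ZeroMemClass.coe_zero, zero_mul, add_zero])]
    rw [map_zero, ZeroMemClass.coe_zero, zero_mul, add_zero]
  · intro y
    obtain ⟨c, hc, d, hd, e1⟩ := (T.qe (n + 1)).gen _ y.2
    have e2 := hτ y ⟨c, hc⟩ ⟨d, hd⟩ e1
    have e3 := hτ (τ y) (s ⟨c, hc⟩) (s ⟨d, hd⟩ * a) (by rw [e2]; push_cast; ring)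
    ext1
    rw [e3, (T.qe (n + 1)).sigma_eq y hc hd e1]
    have inv : ∀ z, s (s z) = z := (T.qe n).cj_cj
    rw [map_mul, inv, inv]
    have haa' := congrArg Subtype.val haa
    push_cast at haa' ⊢
    linear_combination (d * x (n + 1 + 1)) * haa'

end Tower
end

section
open scoped nonZeroDivisors

theorem QE.mem_of_fix {K L : IntermediateField ℚ ℂ} {r : ℂ} (h : QE K L r) (x : L)
    (hx : h.sigma x = x) : (x : ℂ) ∈ K := by
  obtain ⟨a, ha, b, hb, e⟩ := h.gen x x.2
  have e1 := h.sigma_eq x ha hb e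
  rw [hx, e] at e1
  have hr0 : r ≠ 0 := by
    rintro rfl
    exact h.nmem (zero_mem _)
  have : b * r = 0 := by linear_combination e1 / 2
  rw [e, this, add_zero]; exact ha

theorem QE.sigma_invol {K L : IntermediateField ℚ ℂ} {r : ℂ} (h : QE K L r) (x : L) :
    h.sigma (h.sigma x) = x := h.cj_cj x

theorem QE.sigma_ne {K L : IntermediateField ℚ ℂ} {r : ℂ} (h : QE K L r) : ∃ x, h.sigma x ≠ x :=
  ⟨⟨r, h.mem⟩, fun hx => h.nmem (h.mem_of_fix _ hx)⟩

theorem QE.real {K L : IntermediateField ℚ ℂ} {r : ℂ} (h : QE K L r) [IsTotallyReal K]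
    (hr : ∀ φ : L →+* ℂ, (starRingEnd ℂ) (φ ⟨r, h.mem⟩) = φ ⟨r, h.mem⟩) : IsTotallyReal L := by
  apply totReal_of
  intro φ y
  obtain ⟨a, ha, b, hb, e⟩ := h.gen y y.2
  have e1 : y = (IntermediateField.inclusion h.le ⟨a, ha⟩) +
      (IntermediateField.inclusion h.le ⟨b, hb⟩) * ⟨r, h.mem⟩ := by
    ext1; exact e
  have h1 := real_of_totReal (φ.comp (IntermediateField.inclusion h.le).toRingHom) ⟨a, ha⟩
  have h2 := real_of_totReal (φ.comp (IntermediateField.inclusion h.le).toRingHom) ⟨b, hb⟩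
  have h1' : (starRingEnd ℂ) (φ (IntermediateField.inclusion h.le ⟨a, ha⟩)) =
    φ (IntermediateField.inclusion h.le ⟨a, ha⟩) := h1
  have h2' : (starRingEnd ℂ) (φ (IntermediateField.inclusion h.le ⟨b, hb⟩)) =
    φ (IntermediateField.inclusion h.le ⟨b, hb⟩) := h2
  rw [e1, map_add, map_mul, map_add, map_mul, h1', h2', hr]

namespace Tower
variable {K : ℕ → IntermediateField ℚ ℂ} {x : ℕ → ℂ}

theorem bound (T : Tower K x) (n : ℕ) : ∀ φ : K n →+* ℂ, ∃ t : ℝ, φ ⟨x n, T.mem n⟩ = t ∧ |t| ≤ 2 := by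
  induction n with
  | zero =>
    intro φ
    refine ⟨0, ?_, by norm_num⟩
    have : (⟨x 0, T.mem 0⟩ : K 0) = 0 := by ext1; exact T.x0
    rw [this]; simp
  | succ n ih =>
    intro φ
    obtain ⟨t, ht, hb⟩ := ih (φ.comp (IntermediateField.inclusion (T.le n)).toRingHom)
    have ht' : φ (IntermediateField.inclusion (T.le n) ⟨x n, T.mem n⟩) = t := ht
    have e : (φ ⟨x (n + 1), T.mem (n + 1)⟩) ^ 2 = ((2 + t : ℝ) : ℂ) := by
      rw [← map_pow]
      have : (⟨x (n + 1), T.mem (n + 1)⟩ : K (n + 1)) ^ 2 =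
        2 + IntermediateField.inclusion (T.le n) ⟨x n, T.mem n⟩ := by
        ext1; exact T.sq n
      rw [this, map_add, ht', map_ofNat]; push_cast; rfl
    have hb' := abs_le.1 hb
    have h0 : (0 : ℝ) ≤ 2 + t := by linarith
    have : (φ ⟨x (n + 1), T.mem (n + 1)⟩) ^ 2 = ((Real.sqrt (2 + t) : ℝ) : ℂ) ^ 2 := by
      rw [e, ← Complex.ofReal_pow, Real.sq_sqrt h0]
    have h2 : |Real.sqrt (2 + t)| ≤ 2 := by
      rw [abs_of_nonneg (Real.sqrt_nonneg _)]
      rw [Real.sqrt_le_left (by norm_num)]; linarith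
    rcases sq_eq_sq_iff_eq_or_eq_neg.1 this with h | h
    · exact ⟨_, h, h2⟩
    · exact ⟨-Real.sqrt (2 + t), by rw [h]; push_cast; rfl, by rwa [abs_neg]⟩

theorem real (T : Tower K x) (h : IsTotallyReal (K 0)) (n : ℕ) : IsTotallyReal (K n) := by
  induction n with
  | zero => exact h
  | succ n ih =>
    apply (T.qe n).real
    intro φ
    obtain ⟨t, ht, -⟩ := T.bound (n + 1) φ
    rw [ht]; simp

theorem descend (T : Tower K x) (n : ℕ) [NumberField (K (n + 2))] {u : ℂ} (hu : u ∈ K n) (hu0 : u ≠ 0)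
    (y : K (n + 2)) (hy : ((y * (T.qe (n + 1)).sigma y : K (n + 2)) : ℂ) = u) :
    ∃ w : K (n + 1), ((w * (T.qe n).sigma w : K (n + 1)) : ℂ) = u := by
  obtain ⟨τ, h1, h2⟩ := T.tau n
  set σ := (T.qe (n + 1)).sigma with hσ
  have hinv : ∀ z, σ (σ z) = z := (T.qe (n + 1)).sigma_invol
  have ht4 : ∀ z, τ (τ (τ (τ z))) = z := by intro z; rw [h2, h2, hinv]
  have huK : u ∈ K (n + 1) := T.le _ hu
  let U : K (n + 2) := ⟨u, T.le _ huK⟩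
  have hU : y * τ (τ y) = U := by ext1; rw [h2]; exact hy
  have hU0 : U ≠ 0 := fun h => hu0 (congrArg Subtype.val h)
  have tU : τ U = U := by
    have := h1 ⟨u, huK⟩
    rw [(T.qe n).sigma_K ⟨u, huK⟩ hu] at this
    exact this
  have hy0 : y ≠ 0 := by
    rintro rfl
    apply hU0
    rw [← hU, zero_mul]
  have hty0 : τ y ≠ 0 := fun h => hy0 (τ.injective (by rw [h, map_zero]))
  have htty0 : τ (τ y) ≠ 0 := fun h => hty0 (τ.injective (by rw [h, map_zero]))
  have hU' : τ y * τ (τ (τ y)) = U := by rw [← map_mul, hU, tU]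
  obtain ⟨z, hz⟩ := h90_units σ hinv (T.qe (n + 1)).sigma_ne (Units.mk0 (y / τ y) (div_ne_zero hy0 hty0)) (by
    ext1
    change y / τ y * σ (y / τ y) = 1
    rw [← h2, map_div₀, map_div₀, div_mul_div_comm, hU, hU', div_self hU0])
  have hz' : y / τ y = (z : K (n + 2)) / τ (τ z) := by
    have := congrArg Units.val hz
    rw [h2]
    simpa using this
  have hz0 : (z : K (n + 2)) ≠ 0 := z.ne_zero
  generalize (z : K (n + 2)) = Z at hz' hz0
  have htz0 : τ Z ≠ 0 := fun h => hz0 (τ.injective (by rw [h, map_zero]))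
  have httz0 : τ (τ Z) ≠ 0 := fun h => htz0 (τ.injective (by rw [h, map_zero]))
  have e1 : y * τ (τ Z) = Z * τ y := by
    rw [div_eq_div_iff hty0 httz0] at hz'; exact hz'
  set w := y / (Z * τ Z) with hw
  have tw : τ w = w := by
    rw [hw, map_div₀, map_mul, div_eq_div_iff (mul_ne_zero htz0 httz0) (mul_ne_zero hz0 htz0)]
    linear_combination (- τ Z) * e1
  have sw : σ w = w := by rw [← h2, tw, tw]
  have w1 : (w : ℂ) ∈ K (n + 1) := (T.qe (n + 1)).mem_of_fix w sw
  have w2 : (T.qe n).sigma ⟨w, w1⟩ = ⟨w, w1⟩ := by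
    have := h1 ⟨w, w1⟩
    have e : (⟨(w : ℂ), T.le _ w1⟩ : K (n + 2)) = w := rfl
    rw [e, tw] at this
    ext1
    exact (congrArg Subtype.val this).symm
  set v := Z * σ Z with hv
  have sv : σ v = v := by rw [hv, map_mul, hinv, mul_comm]
  have v1 : (v : ℂ) ∈ K (n + 1) := (T.qe (n + 1)).mem_of_fix v sv
  have tv := h1 ⟨v, v1⟩
  have e : (⟨(v : ℂ), T.le _ v1⟩ : K (n + 2)) = v := rfl
  rw [e] at tv
  have tv' := congrArg Subtype.val tv
  refine ⟨⟨w, w1⟩ * ⟨v, v1⟩, ?_⟩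
  rw [map_mul, w2]
  push_cast
  have tv'' : (((T.qe n).sigma ⟨v, v1⟩ : K (n + 1)) : ℂ) = (τ v : K (n + 2)) := tv'.symm
  rw [tv'']
  have : w * v * (w * τ v) = U := by
    have yw : y = w * (Z * τ Z) := by rw [hw]; field_simp
    rw [← hU]
    have : τ (τ y) = w * (τ (τ Z) * τ (τ (τ Z))) := by
      rw [yw]; simp only [map_mul, tw]
    rw [this]
    rw [yw, hv, map_mul, ← h2]; ring
  have := congrArg Subtype.val this
  exact this

theorem nonnorm (T : Tower K x) [∀ n, NumberField (K n)] {u : ℂ} (hu : u ∈ K 0) (hu0 : u ≠ 0)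
    (h : ∀ w : K 1, ((w * (T.qe 0).sigma w : K 1) : ℂ) ≠ u) (n : ℕ) :
    ∀ w : K (n + 1), ((w * (T.qe n).sigma w : K (n + 1)) : ℂ) ≠ u := by
  have hun : ∀ n, u ∈ K n := by
    intro n
    induction n with
    | zero => exact hu
    | succ n ih => exact T.le _ ih
  induction n with
  | zero => exact h
  | succ n ih =>
    intro w hw
    obtain ⟨w', hw'⟩ := T.descend n (hun n) hu0 w hw
    exact ih w' hw'

theorem nonNF (T : Tower K x) (n : ℕ) {u : ℂ}
    (h : ∀ w : K (n + 1), ((w * (T.qe n).sigma w : K (n + 1)) : ℂ) ≠ u) : ¬ NF (K n) (x (n + 1) ^ 2) u := by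
  rintro ⟨a, ha, b, hb, e⟩
  apply h ⟨a + b * x (n + 1), add_mem (T.le _ ha) (mul_mem (T.le _ hb) (T.mem _))⟩
  push_cast
  rw [(T.qe n).sigma_eq _ ha hb rfl, e]; ring

theorem integral (T : Tower K x) (n : ℕ) : IsIntegral ℤ (x n) := by
  induction n with
  | zero => rw [T.x0]; exact isIntegral_zero
  | succ n ih =>
    apply IsIntegral.of_pow (n := 2) (by norm_num)
    rw [T.sq]
    exact IsIntegral.add (by simpa using (isIntegral_algebraMap (R := ℤ) (A := ℂ) (x := 2))) ih

theorem memle (T : Tower K x) {m n : ℕ} (h : m ≤ n) : K m ≤ K n := by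
  induction h with
  | refl => exact le_rfl
  | step _ ih => exact ih.trans (T.le _)

theorem OIx (T : Tower K x) {m n : ℕ} (h : m ≤ n) : OI (K n) (x m) := ⟨T.memle h (T.mem m), T.integral m⟩

/-- ramification only above 2 -/
theorem ram (T : Tower K x) [∀ n, NumberField (K n)] (n : ℕ) :
    ramSet (T.qe n).sigma ⊆ PO (K (n + 1)) 2 := by
  intro P hP
  refine ⟨hP.1, hP.2.1, ?_⟩
  have h1 := ram_gen (T.qe n) hP (zero_mem _) (one_mem _) (by rw [zero_add, one_mul]; exact T.integral _)
  rw [mul_one] at h1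
  rcases inP.prime hP.1 OI.two (T.OIx le_rfl) h1 with h | h
  · exact_mod_cast h
  · have key : ∀ m, m ≤ n + 1 → inP P (x m - 2) → inP P (2 : ℂ) := by
      intro m
      induction m with
      | zero =>
        intro _ h
        rw [T.x0] at h
        convert h.neg using 1; ring
      | succ m ih =>
        intro hm h
        apply ih (by omega)
        have := inP.mul_left ((T.OIx hm).add OI.two) h
        convert this using 1
        linear_combination - T.sq m
    have goal : inP P (2 : ℂ) := by
      cases n with
      | zero =>
        have := inP.mul_left (T.OIx (Nat.le_refl 1)) h
        convert this using 1
        rw [← pow_two, T.sq 0, T.x0]; ring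
      | succ m =>
        apply key m (by omega)
        have h3 : inP P (x (m + 1) + 2) := by
          have := inP.mul_left (T.OIx (Nat.le_refl (m + 1 + 1))) h
          convert this using 1
          rw [← pow_two, T.sq]; ring
        have := inP.mul_left ((T.OIx (show m + 1 ≤ m + 1 + 1 by omega)).sub OI.two) h3
        convert this using 1
        linear_combination - T.sq m
    exact_mod_cast goal
end Tower
end

section
open scoped nonZeroDivisors

theorem inP_iAct {L : IntermediateField ℚ ℂ} [NumberField L] (τ : L ≃ₐ[ℚ] L) (P : Ideal (𝓞 L)) (y : L) :
    inP (iAct τ P) (τ y : ℂ) ↔ inP P (y : ℂ) := by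
  constructor
  · rintro ⟨z, hz, e⟩
    obtain ⟨w, hw, rfl⟩ := (mem_iAct _ _ _).1 hz
    refine ⟨w, hw, ?_⟩
    have : τ (w : L) = τ y := Subtype.ext e
    rw [τ.injective this]
  · rintro ⟨z, hz, e⟩
    refine ⟨oAct τ z, (mem_iAct _ _ _).2 ⟨z, hz, rfl⟩, ?_⟩
    rw [oAct_coe]
    have : (z : L) = y := Subtype.ext e
    rw [this]

theorem ideal_ext_inP {L : IntermediateField ℚ ℂ} [NumberField L] {P Q : Ideal (𝓞 L)}
    (h : ∀ y : L, inP P (y : ℂ) ↔ inP Q (y : ℂ)) : P = Q := by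
  ext z
  rw [← inP_coe, ← inP_coe]; exact h z

theorem iAct_comp {L : IntermediateField ℚ ℂ} [NumberField L] (σ τ : L ≃ₐ[ℚ] L) (ρ : L ≃ₐ[ℚ] L)
    (h : ∀ y, σ (τ y) = ρ y) (P : Ideal (𝓞 L)) :
    iAct σ (iAct τ P) = iAct ρ P := by
  apply ideal_ext_inP
  intro y
  obtain ⟨y, rfl⟩ := ρ.surjective y
  rw [inP_iAct, ← h, inP_iAct, inP_iAct]

theorem iAct_inj {L : IntermediateField ℚ ℂ} [NumberField L] (σ : L ≃ₐ[ℚ] L) {P Q : Ideal (𝓞 L)}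
    (h : iAct σ P = iAct σ Q) : P = Q := by
  apply ideal_ext_inP
  intro y
  rw [← inP_iAct σ P, h, inP_iAct]

theorem iAct_prime' {L : IntermediateField ℚ ℂ} [NumberField L] (σ : L ≃ₐ[ℚ] L) {P : Ideal (𝓞 L)} (hP : P.IsPrime) :
    (iAct σ P).IsPrime := Ideal.map_isPrime_of_equiv (oAct σ)

theorem iAct_PO {L : IntermediateField ℚ ℂ} [NumberField L] (σ : L ≃ₐ[ℚ] L) {P : Ideal (𝓞 L)} {l : ℕ} (hP : P ∈ PO L l)
   : iAct σ P ∈ PO L l := by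
  refine ⟨iAct_prime' σ hP.1, ?_, ?_⟩
  · intro h
    apply hP.2.1
    apply iAct_inj σ
    rw [h, iAct, Ideal.map_bot]
  · have := (inP_iAct σ P (l : L)).2 (by simpa using hP.2.2)
    simpa using this

theorem QE.over {K L : IntermediateField ℚ ℂ} {r : ℂ} (h : QE K L r) [NumberField K] [NumberField L]
    {P P' : Ideal (𝓞 L)} (hP : P.IsPrime) (hP0 : P ≠ ⊥) (hP' : P'.IsPrime)
    (hu : ∀ z ∈ K, inP P z → inP P' z) : P' = P ∨ P' = iAct h.sigma P := by
  letI := h.alg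
  have hq := h.isQuad
  haveI := hP
  have hle : (P.under (𝓞 K)).map (algebraMap (𝓞 K) (𝓞 L)) ≤ P' := by
    rw [Ideal.map_le_iff_le_comap]
    intro z hz
    rw [Ideal.mem_comap, ← inP_coe]
    apply hu
    · exact (z : K).2
    · exact (inP_coe _).2 hz
  have hmax : P.IsMaximal := hP.isMaximal hP0
  have c1 : P ≤ P' → P' = P := fun hh => (hmax.eq_of_le hP'.ne_top hh).symm
  have c2 : iAct h.sigma P ≤ P' → P' = iAct h.sigma P := by
    intro hh
    have hm2 : (iAct h.sigma P).IsMaximal := by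
      apply (iAct_prime' h.sigma hP).isMaximal
      intro hb
      apply hP0
      apply iAct_inj h.sigma
      rw [hb, iAct, Ideal.map_bot]
    exact (hm2.eq_of_le hP'.ne_top hh).symm
  rcases hq.trichotomy P hP0 with ⟨_, e⟩ | ⟨_, e | ⟨e, _⟩⟩
  · rw [e, hP'.mul_le] at hle
    exact hle.imp c1 c2
  · rw [e] at hle; exact Or.inl (c1 hle)
  · rw [e, pow_two, hP'.mul_le] at hle
    exact Or.inl (hle.elim c1 c1)

/-- restriction of ideals -/
noncomputable def resP {K L : IntermediateField ℚ ℂ} (h : K ≤ L) (P : Ideal (𝓞 L)) : Ideal (𝓞 K) :=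
  P.comap (RingOfIntegers.mapRingHom (IntermediateField.inclusion h).toRingHom)

theorem inP_resP {K L : IntermediateField ℚ ℂ} (h : K ≤ L) (P : Ideal (𝓞 L)) (z : K) :
    inP (resP h P) (z : ℂ) ↔ inP P (z : ℂ) := by
  constructor
  · rintro ⟨y, hy, e⟩
    exact ⟨_, hy, e⟩
  · intro hz
    obtain ⟨w, hw⟩ := (show OI K z from ⟨z.2, hz.oi.2⟩).lift
    refine ⟨w, ?_, hw⟩
    change RingOfIntegers.mapRingHom (IntermediateField.inclusion h).toRingHom w ∈ P
    rw [← inP_coe]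
    rw [← hw] at hz
    exact hz

theorem resP_PO {K L : IntermediateField ℚ ℂ} (h : K ≤ L) {P : Ideal (𝓞 L)} {l : ℕ} (hl : l ≠ 0)
    (hP : P ∈ PO L l) : resP h P ∈ PO K l := by
  have := hP.1
  have h1 : inP (resP h P) (l : ℂ) := by
    have := (inP_resP h P (l : K)).2 (by simpa using hP.2.2)
    simpa using this
  refine ⟨Ideal.comap_isPrime _ _, ?_, h1⟩
  intro hb
  rw [hb, inP_nat, Ideal.mem_bot] at h1
  exact hl (by exact_mod_cast h1)

namespace Tower
variable {K : ℕ → IntermediateField ℚ ℂ} {x : ℕ → ℂ}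

theorem stable (T : Tower K x) [∀ n, NumberField (K n)]
    (h0 : ∀ P ∈ PO (K 1) 2, iAct (T.qe 0).sigma P = P) (n : ℕ) :
    ∀ P ∈ PO (K (n + 1)) 2, iAct (T.qe n).sigma P = P := by
  induction n with
  | zero => exact h0
  | succ n ih =>
    intro P hP
    obtain ⟨τ, h1, h2⟩ := T.tau n
    have hτ : iAct τ (iAct τ P) = iAct (T.qe (n + 1)).sigma P := iAct_comp τ τ _ h2 P
    have hQ := ih _ (resP_PO (T.le (n + 1)) two_ne_zero hP)
    have hτP := iAct_PO τ hP
    rcases (T.qe (n + 1)).over hP.1 hP.2.1 hτP.1 (by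
      intro z hz hzP
      have e1 := (inP_resP (T.le (n + 1)) P ⟨z, hz⟩).2 hzP
      have e3 : (T.qe n).sigma ((T.qe n).sigma ⟨z, hz⟩) = ⟨z, hz⟩ := (T.qe n).sigma_invol _
      rw [← hQ, ← e3, inP_iAct, inP_resP] at e1
      have e2 := (inP_iAct τ P ⟨_, T.le _ ((T.qe n).sigma ⟨z, hz⟩).2⟩).2 e1
      rw [h1, e3] at e2
      exact e2) with h | h
    · rw [← hτ, h, h]
    · rw [← hτ] at h
      have := iAct_inj τ h
      rw [← hτ, ← this, ← this]

theorem count (T : Tower K x) [∀ n, NumberField (K n)]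
    (h0 : ∀ P ∈ PO (K 1) 2, iAct (T.qe 0).sigma P = P) {c : ℕ} (hc : (PO (K 1) 2).ncard ≤ c) (n : ℕ) :
    (PO (K (n + 1)) 2).ncard ≤ c := by
  induction n with
  | zero => exact hc
  | succ n ih =>
    refine le_trans ?_ ih
    apply Set.ncard_le_ncard_of_injOn (resP (T.le (n + 1)))
      (fun P hP => resP_PO (T.le (n + 1)) two_ne_zero hP) ?_ (PO_finite two_ne_zero)
    intro P hP P' hP' e
    rcases (T.qe (n + 1)).over hP.1 hP.2.1 hP'.1 (by
      intro z hz hzP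
      have e1 := (inP_resP (T.le (n + 1)) P ⟨z, hz⟩).2 hzP
      rw [e] at e1
      exact (inP_resP (T.le (n + 1)) P' ⟨z, hz⟩).1 e1) with h | h
    · exact h.symm
    · rw [T.stable h0 _ P hP] at h; exact h.symm

theorem ramcount (T : Tower K x) [∀ n, NumberField (K n)]
    (h0 : ∀ P ∈ PO (K 1) 2, iAct (T.qe 0).sigma P = P) {c : ℕ} (hc : (PO (K 1) 2).ncard ≤ c) (n : ℕ) :
    (ramSet (T.qe n).sigma).ncard ≤ c :=
  (Set.ncard_le_ncard (T.ram n) (PO_finite two_ne_zero)).trans (T.count h0 hc n)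
end Tower
end

section
open scoped nonZeroDivisors

theorem naka_fix {A : Type*} [CommGroup A] [Finite A] (hA : ∀ a : A, ∃ n : ℕ, a ^ 2 ^ n = 1) (t : A →* A)
    (ht : ∀ a, t (t (t (t a))) = a) (H : Subgroup A) (hH : ∀ a ∈ H, phiHom t a ∈ H) (hne : H ≠ ⊥) :
    ∃ c ∈ H, c ≠ 1 ∧ c ^ 2 = 1 ∧ t c = c := by
  obtain ⟨a, haH, ha1⟩ := (Subgroup.ne_bot_iff_exists_ne_one.1 hne).elim
    (fun a ha => (⟨a.1, a.2, fun h => ha (Subtype.ext h)⟩ : ∃ a ∈ H, a ≠ 1))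
  -- a two torsion element
  have h2 : ∃ b ∈ H, b ≠ 1 ∧ b ^ 2 = 1 := by
    obtain ⟨n, hn⟩ := hA a
    induction n generalizing a with
    | zero => exact absurd (by simpa using hn) ha1
    | succ n ih =>
      by_cases h : a ^ 2 = 1
      · exact ⟨a, haH, ha1, h⟩
      · exact ih (a ^ 2) (pow_mem haH 2) h (by rw [← pow_mul, ← pow_succ']; exact hn)
  obtain ⟨b, hb, hb1, hb2⟩ := h2
  have hphi2 : ∀ c : A, c ^ 2 = 1 → (phiHom t c) ^ 2 = 1 := by
    intro c hc; rw [← map_pow, hc, map_one]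
  have hphi1 : ∀ c : A, phiHom t c = 1 → t c = c := fun c hc => mem_phiHom_ker.1 hc
  have hinv : ∀ c : A, c ^ 2 = 1 → c⁻¹ = c := by
    intro c hc
    rw [inv_eq_iff_mul_eq_one, ← pow_two, hc]
  set b1 := phiHom t b with e1
  set b2 := phiHom t b1 with e2
  set b3 := phiHom t b2 with e3
  have hb1H : b1 ∈ H := hH _ hb
  have hb2H : b2 ∈ H := hH _ hb1H
  have hb3H : b3 ∈ H := hH _ hb2H
  have q1 := hphi2 _ hb2
  have q2 := hphi2 _ q1
  have q3 := hphi2 _ q2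
  by_cases c1 : b1 = 1
  · exact ⟨b, hb, hb1, hb2, hphi1 _ c1⟩
  by_cases c2 : b2 = 1
  · exact ⟨b1, hb1H, c1, q1, hphi1 _ c2⟩
  by_cases c3 : b3 = 1
  · exact ⟨b2, hb2H, c2, q2, hphi1 _ c3⟩
  refine ⟨b3, hb3H, c3, q3, hphi1 _ ?_⟩
  have f1 : ∀ c, c ^ 2 = 1 → phiHom t c = c * t c := by
    intro c hc
    change c / t c = _
    rw [div_eq_mul_inv, hinv _ (by rw [← map_pow, hc, map_one])]
  have f2 : ∀ c, c ^ 2 = 1 → phiHom t (phiHom t c) = c * t (t c) := by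
    intro c hc
    rw [f1 _ (hphi2 c hc), f1 c hc, map_mul]
    have : t c * t c = 1 := by rw [← pow_two, ← map_pow, hc, map_one]
    calc c * t c * (t c * t (t c)) = c * (t c * t c) * t (t c) := by simp only [mul_assoc]
      _ = _ := by rw [this, mul_one]
  rw [e3, f2 _ q2, f2 _ hb2, map_mul, map_mul, ht]
  have : t (t b) * t (t b) = 1 := by rw [← pow_two, ← map_pow, ← map_pow, hb2, map_one, map_one]
  calc b * t (t b) * (t (t b) * b) = b * (t (t b) * t (t b)) * b := by simp only [mul_assoc]
      _ = 1 := by rw [this, mul_one, ← pow_two, hb2]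

theorem naka {A : Type*} [CommGroup A] [Finite A] (hA : ∀ a : A, ∃ n : ℕ, a ^ 2 ^ n = 1) (t : A →* A)
    (ht : ∀ a, t (t (t (t a))) = a) (hc : Nat.card (phiHom (t.comp t)).ker ≤ 2) : Nat.card A ≤ 2 := by
  by_cases hA1 : (⊤ : Subgroup A) = ⊥
  · have : Nat.card (⊤ : Subgroup A) = 1 := by rw [hA1]; simp
    rw [Subgroup.card_top] at this; omega
  obtain ⟨c, -, c1, -, ct⟩ := naka_fix hA t ht ⊤ (fun _ _ => trivial) hA1
  set f := phiHom t with hf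
  set F := phiHom (t.comp t) with hF
  have hle : f.ker ≤ F.ker := by
    intro a ha
    have := mem_phiHom_ker.1 ha
    apply mem_phiHom_ker.2
    rw [MonoidHom.comp_apply, this, this]
  have k1 : 1 < Nat.card f.ker := by
    apply Finite.one_lt_card_iff_nontrivial.2
    exact ⟨⟨⟨c, mem_phiHom_ker.2 ct⟩, 1, fun h => c1 (congrArg Subtype.val h)⟩⟩
  have k2 : Nat.card f.ker ≤ Nat.card F.ker := Nat.card_le_card_of_injective _ (Subgroup.inclusion_injective hle)
  have k3 : Nat.card f.ker = 2 := by omega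
  have k4 : Nat.card F.ker = 2 := by omega
  have i1 : Nat.card f.range * Nat.card f.ker = Nat.card A := by
    rw [← Nat.card_congr (QuotientGroup.quotientKerEquivRange f).toEquiv]
    exact (Subgroup.card_eq_card_quotient_mul_card_subgroup f.ker).symm
  have i2 : Nat.card F.range * Nat.card F.ker = Nat.card A := by
    rw [← Nat.card_congr (QuotientGroup.quotientKerEquivRange F).toEquiv]
    exact (Subgroup.card_eq_card_quotient_mul_card_subgroup F.ker).symm
  have i3 : Nat.card f.range = Nat.card F.range := by rw [k3] at i1; rw [k4] at i2; omega
  let g := nuHom t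
  have hgf : ∀ a, F a = g (f a) := by
    intro a
    change a / t (t a) = (a / t a) * t (a / t a)
    rw [map_div, div_mul_div_cancel]
  by_cases hB : f.range = ⊥
  · rw [hB, k3] at i1
    simp at i1; omega
  exfalso
  obtain ⟨b, hb, hb1, hb2, hbt⟩ := naka_fix hA t ht f.range (fun a _ => ⟨a, rfl⟩) hB
  -- g : f.range → F.range is surjective hence injective
  let G : f.range → F.range := fun a => ⟨g a, by
    obtain ⟨a, z, rfl⟩ := a
    exact ⟨z, hgf z⟩⟩
  have hGs : Function.Surjective G := by
    rintro ⟨_, z, rfl⟩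
    exact ⟨⟨f z, z, rfl⟩, Subtype.ext (hgf z).symm⟩
  have hGi : Function.Bijective G := hGs.bijective_of_nat_card_le i3.le
  have : (⟨b, hb⟩ : f.range) = 1 := by
    apply hGi.1
    apply Subtype.ext
    change b * t b = 1 * t 1
    rw [hbt, ← pow_two, hb2, map_one, one_mul]
  exact hb1 (congrArg Subtype.val this)

theorem naka2 {G : Type*} [CommGroup G] [Finite G] (t s : G →* G) (hs : ∀ a, s a = t (t a))
    (hi : ∀ a, s (s a) = a) (hc : h2f s ≤ 2) : h2 G ≤ 2 := by
  let t' : tp G →* tp G := (t.comp (tp G).subtype).codRestrict (tp G) (fun a => map_tp t a.2)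
  apply naka (A := tp G) ?_ t'
  · intro a
    ext1
    change t (t (t (t a))) = a
    rw [← hs, ← hs, hi]
  · refine le_trans ?_ hc
    apply Nat.card_le_card_of_injective (fun a => (⟨a.1.1, a.1.2, ?_⟩ : (tp G ⊓ (phiHom s).ker : Subgroup G)))
    · intro a b hab
      injection hab with h
      exact Subtype.ext (Subtype.ext h)
    · have := mem_phiHom_ker.1 a.2
      apply mem_phiHom_ker.2
      rw [hs]
      exact congrArg Subtype.val this
  · rintro ⟨a, n, hn⟩
    exact ⟨n, Subtype.ext (by simpa using hn)⟩

namespace Tower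
variable {K : ℕ → IntermediateField ℚ ℂ} {x : ℕ → ℂ}

theorem upper (T : Tower K x) [∀ n, NumberField (K n)] [∀ n, IsTotallyReal (K n)]
    (h0 : ∀ P ∈ PO (K 1) 2, iAct (T.qe 0).sigma P = P) (hc : (PO (K 1) 2).ncard ≤ 2)
    {u : ℂ} (hu : u ∈ K 0) (hu1 : IsUn u)
    (hn : ∀ w : K 1, ((w * (T.qe 0).sigma w : K 1) : ℂ) ≠ u) (hh1 : hh (K 1) ≤ 2) (n : ℕ) :
    hh (K (n + 1)) ≤ 2 := by
  induction n with
  | zero => exact hh1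
  | succ n ih =>
    have h1 := (T.qe (n + 1)).upper1 u (T.memle (Nat.zero_le _) hu) hu1
      (T.nonNF _ (T.nonnorm hu hu1.1 hn (n + 1))) (T.ramcount h0 hc (n + 1))
    obtain ⟨τ, h3, h4⟩ := T.tau n
    refine naka2 (clAct τ) (clAct (T.qe (n + 1)).sigma) ?_ ?_ (by omega)
    · intro a
      rw [← clAct_mul]
      congr 2
      ext1 y
      exact (h4 y).symm
    · intro a
      letI := (T.qe (n + 1)).alg
      exact clAct_invol (T.qe (n + 1)).isQuad a
end Tower
end

section
open scoped nonZeroDivisors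

section
variable {K L : Type*} [Field K] [NumberField K] [Field L] [NumberField L] [Algebra K L]

theorem map_inj_ideal {I J : Ideal (𝓞 K)} (hI : I ≠ ⊥) (hJ : J ≠ ⊥)
    (h : I.map (algebraMap (𝓞 K) (𝓞 L)) = J.map (algebraMap (𝓞 K) (𝓞 L))) : I = J := by
  have : fu I hI = fu J hJ := by
    apply extI_inj (K := K) (L := L)
    ext1
    rw [extI_coe _ _ (fu_coe _ _), extI_coe _ _ (fu_coe _ _), h]
  have := congrArg Units.val this
  rw [fu_coe, fu_coe] at this
  exact FractionalIdeal.coeIdeal_injective this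

theorem mem_of_map_mem {I : Ideal (𝓞 K)} (hI : I ≠ ⊥) {y : 𝓞 K}
    (h : algebraMap (𝓞 K) (𝓞 L) y ∈ I.map (algebraMap (𝓞 K) (𝓞 L))) : y ∈ I := by
  have : I ⊔ Ideal.span {y} = I := by
    apply map_inj_ideal (L := L) _ hI
    · rw [Ideal.map_sup, Ideal.map_span, sup_eq_left]
      rw [Set.image_singleton, Ideal.span_singleton_le_iff_mem]; exact h
    · intro h
      rw [sup_eq_bot_iff] at h
      exact hI h.1
  rw [sup_eq_left, Ideal.span_singleton_le_iff_mem] at this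
  exact this
end

theorem PO_over {K L : IntermediateField ℚ ℂ} {r : ℂ} (h : QE K L r) [NumberField K] [NumberField L]
    {l : ℕ} {p : Ideal (𝓞 K)} (hp : p ∈ PO K l) : ∃ P ∈ PO L l, resP h.le P = p := by
  letI := h.alg
  haveI : p.IsMaximal := hp.1.isMaximal hp.2.1
  obtain ⟨P, hP, ho⟩ := Ideal.exists_maximal_ideal_liesOver_of_isIntegral (S := 𝓞 L) p
  have e : resP h.le P = p := ho.over.symm
  have h1 : inP P (l : ℂ) := by
    have := hp.2.2
    rw [← e] at this
    have := (inP_resP h.le P (l : K)).1 (by simpa using this)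
    simpa using this
  refine ⟨P, ⟨hP.isPrime, ?_, h1⟩, e⟩
  rintro rfl
  apply hp.2.1
  rw [← e]
  rw [eq_bot_iff]
  intro z hz
  rw [← inP_coe, inP_resP] at hz
  obtain ⟨y, hy, e⟩ := hz
  rw [Ideal.mem_bot] at hy
  rw [hy] at e
  rw [Ideal.mem_bot]
  apply RingOfIntegers.coe_injective
  ext1
  rw [← e]; simp

theorem PO_nonempty {L : IntermediateField ℚ ℂ} [NumberField L] {l : ℕ} (hl : l.Prime) : (PO L l).Nonempty := by
  haveI : (Ideal.span {(l : ℤ)}).IsMaximal :=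
    (PrincipalIdealRing.isMaximal_of_irreducible (Nat.prime_iff_prime_int.1 hl).irreducible)
  obtain ⟨P, hP, ho⟩ := Ideal.exists_maximal_ideal_liesOver_of_isIntegral (S := 𝓞 L) (Ideal.span {(l : ℤ)})
  have hm : (l : 𝓞 L) ∈ P := by
    have : (l : ℤ) ∈ P.under ℤ := by rw [← ho.over]; exact Ideal.mem_span_singleton_self _
    rw [Ideal.mem_comap] at this
    simpa using this
  refine ⟨P, hP.isPrime, ?_, (inP_nat l).2 hm⟩
  rintro rfl
  rw [Ideal.mem_bot] at hm
  exact hl.ne_zero (by exact_mod_cast hm)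
end

section
open scoped nonZeroDivisors

section
variable {g : Fin 4 → ℕ}

theorem CG.h01 (hg : CG g) : QE (MQ g [{1}, {2}, {3}]) (MQ g [{0}, {1}, {2}, {3}]) (R g {0}) :=
  MQ_qe hg.toPG (by decide) (by decide) (by decide) (by decide)

theorem exists_m8 (hg : CG g) : ∃ m : Finset (Fin 4), (m = {2, 3} ∨ m = {1, 2, 3}) ∧ dd g m % 8 = 1 := by
  have h2 := hg.g2
  have h3 := hg.g3
  have h1 := hg.g1
  rcases (by omega : g 3 % 8 = 3 ∨ g 3 % 8 = 7) with h | h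
  · refine ⟨{2, 3}, Or.inl rfl, ?_⟩
    rw [dd2 (by decide), Nat.mul_mod, h2, h]
  · refine ⟨{1, 2, 3}, Or.inr rfl, ?_⟩
    rw [dd3 (by decide) (by decide) (by decide), Nat.mul_mod, Nat.mul_mod (g 2), h1, h2, h]

theorem half_or {L : IntermediateField ℚ ℂ} {m : Finset (Fin 4)} (h : dd g m % 8 = 1) (hm : OI L ((1 + R g m) / 2))
    {P : Ideal (𝓞 L)} (hP : P ∈ PO L 2) : inP P ((1 + R g m) / 2) ∨ inP P (1 - (1 + R g m) / 2) := by
  apply inP.prime hP.1 hm (OI.one.sub hm)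
  have h2 : inP P (2 : ℂ) := by exact_mod_cast hP.2.2
  obtain ⟨k, hk⟩ : ∃ k, dd g m = 8 * k + 1 := ⟨dd g m / 8, by omega⟩
  have := inP.mul_left (OI.nat (L := L) k).neg h2
  convert this using 1
  have e := R_sq (g := g) m
  rw [hk] at e
  push_cast at e
  linear_combination (- 1 / 4 : ℂ) * e

theorem half_not {L : IntermediateField ℚ ℂ} {w : ℂ} {P : Ideal (𝓞 L)} (hP : P.IsPrime) (h1 : inP P w)
    (h2 : inP P (1 - w)) : False := by
  apply not_inP_one hP
  have := h1.add h2
  convert this using 1; ring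

theorem PO1_card (hg : CG g) : (PO (MQ g [{0}, {1}, {2}, {3}]) 2).ncard ≤ 2 := by
  have := cnt (W := [{0}, {1}, {2}, {3}]) hg.toPG (i := 0) 2 4 2
    (fun P hP => e4 hg (v := {0}) (w := {2}) (by decide) (by decide) (by rw [dd1]; have := hg.g2; omega) (by decide) hP)
    (fun P hP => f2' hg (v := {1}) (by decide) (by rw [dd1]; exact hg.g1) hP) (by norm_num)
  rwa [hg.g0] at this

/-- an element distinguishing the two primes over 2 -/
theorem exists_w (hg : CG g) : ∃ w : ℂ, w ∈ MQ g [{1}, {2}, {3}] ∧ (∀ P ∈ PO (MQ g [{0}, {1}, {2}, {3}]) 2, inP P w ∨ inP P (1 - w)) ∧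
    (∀ z : MQ g [{0}, {1}, {2}, {3}], (z : ℂ) = w → (hg.q0.sigma z : ℂ) = 1 - w) := by
  obtain ⟨m, hm, h8⟩ := exists_m8 hg
  have hm0 : m ∈ sp [{1}, {2}, {3}] := by rcases hm with rfl | rfl <;> decide
  have hm1 : m ∈ sp [{0}, {1}, {2}, {3}] := by rcases hm with rfl | rfl <;> decide
  have hm2 : symmDiff {2} m ∈ sp [{0}, {1}, {3}] := by rcases hm with rfl | rfl <;> decide
  refine ⟨(1 + R g m) / 2, (OI_half hg.toPG hm0 (by omega)).1, fun P hP => half_or h8 (OI_half hg.toPG hm1 (by omega)) hP, ?_⟩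
  intro z hz
  obtain ⟨r, hr⟩ : ∃ r : MQ g [{0}, {1}, {2}, {3}], (r : ℂ) = R g m := ⟨⟨_, R_mem hg.toPG hm1⟩, rfl⟩
  have e1 := sigma_R_neg hg.toPG hg.q0 hm2 r hr
  have e2 : z = (1 + r) / 2 := by ext1; push_cast; rw [hz, hr]; rfl
  rw [e2, map_div₀, map_add, map_one, map_ofNat]
  push_cast
  rw [e1, show ((2 : MQ g [{0}, {1}, {2}, {3}]) : ℂ) = 2 from rfl]; ring

theorem theta_ne (hg : CG g) : ∀ P ∈ PO (MQ g [{0}, {1}, {2}, {3}]) 2, iAct hg.q0.sigma P ≠ P ∧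
    (∀ P' ∈ PO (MQ g [{0}, {1}, {2}, {3}]) 2, (∀ z ∈ MQ g [{1}, {2}, {3}], inP P z → inP P' z) → P' = P) := by
  intro P hP
  obtain ⟨w, hw, h1, h2⟩ := exists_w hg
  have hwL := hg.h01.le hw
  have e1 := h2 ⟨w, hwL⟩ rfl
  have e2 : ((hg.q0.sigma (1 - ⟨w, hwL⟩) : MQ g [{0}, {1}, {2}, {3}]) : ℂ) = w := by
    rw [map_sub, map_one]; push_cast; rw [e1]; ring
  have hθ := iAct_PO hg.q0.sigma hP
  have key : ∀ P' ∈ PO (MQ g [{0}, {1}, {2}, {3}]) 2, (∀ z ∈ MQ g [{1}, {2}, {3}], inP P z → inP P' z) →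
      iAct hg.q0.sigma P ≠ P' := by
    rintro P' hP' hz rfl
    rcases h1 P hP with h | h
    · have h3 := (inP_iAct hg.q0.sigma P ⟨w, hwL⟩).2 h
      rw [e1] at h3
      exact half_not hP'.1 (hz _ hw h) h3
    · have h3 := (inP_iAct hg.q0.sigma P (1 - ⟨w, hwL⟩)).2 (by push_cast; exact h)
      rw [e2] at h3
      exact half_not hP'.1 h3 (hz _ (sub_mem (one_mem _) hw) h)
  have k0 := key P hP (fun _ _ h => h)
  refine ⟨k0, ?_⟩
  intro P' hP' hz
  by_contra hne
  have k1 := key P' hP' hz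
  have : ({P, P', iAct hg.q0.sigma P} : Set _).ncard ≤ 2 :=
    (Set.ncard_le_ncard (by
      rintro Q (rfl | rfl | rfl)
      · exact hP
      · exact hP'
      · exact hθ) (PO_finite two_ne_zero)).trans (PO1_card hg)
  rw [Set.ncard_eq_three.2 ⟨P, P', iAct hg.q0.sigma P, fun h => hne h.symm, fun h => k0 h.symm, fun h => k1 h.symm, rfl⟩] at this
  omega

theorem stable1 (hg : CG g) : ∀ P ∈ PO (MQ g [{0}, {1}, {2}, {3}]) 2, iAct hg.h01.sigma P = P := by
  intro P hP
  refine (theta_ne hg P hP).2 _ (iAct_PO _ hP) ?_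
  intro z hz hzP
  have h1 := (inP_iAct hg.h01.sigma P ⟨z, hg.h01.le hz⟩).2 hzP
  rw [hg.h01.sigma_K _ hz] at h1
  exact h1

theorem theta_K0 (hg : CG g) (z : MQ g [{0}, {1}, {2}, {3}]) (hz : (z : ℂ) ∈ MQ g [{1}, {2}, {3}]) :
    (hg.q0.sigma z : ℂ) ∈ MQ g [{1}, {2}, {3}] := by
  have hQ : QE (MQ g [{1}, {3}]) (MQ g [{1}, {2}, {3}]) (R g {2}) :=
    MQ_qe hg.toPG (by decide) (by decide) (by decide) (by decide)
  have hle : MQ g [{1}, {3}] ≤ MQ g [{0}, {1}, {3}] := MQ_le hg.toPG (by decide)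
  obtain ⟨a, ha, b, hb, e⟩ := hQ.gen _ hz
  rw [hg.q0.sigma_eq z (hle ha) (hle hb) e]
  exact sub_mem (hQ.le ha) (mul_mem (hQ.le hb) hQ.mem)

theorem ram1 (hg : CG g) : letI := hg.h01.alg
   ∀ P ∈ PO (MQ g [{0}, {1}, {2}, {3}]) 2,
     (P.under (𝓞 (MQ g [{1}, {2}, {3}]))).map (algebraMap (𝓞 (MQ g [{1}, {2}, {3}])) (𝓞 (MQ g [{0}, {1}, {2}, {3}]))) = P ^ 2 := by
  letI := hg.h01.alg
  intro P hP
  haveI := hP.1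
  have hs := stable1 hg P hP
  rcases hg.h01.isQuad.trichotomy P hP.2.1 with ⟨h, _⟩ | ⟨_, h | ⟨h, _⟩⟩
  · exact absurd hs h
  swap
  · exact h
  exfalso
  have hθP := iAct_PO hg.q0.sigma hP
  have hθn := (theta_ne hg P hP).1
  -- the conjugate is also inert
  have h' : ((iAct hg.q0.sigma P).under (𝓞 (MQ g [{1}, {2}, {3}]))).map (algebraMap (𝓞 (MQ g [{1}, {2}, {3}])) (𝓞 (MQ g [{0}, {1}, {2}, {3}]))) = iAct hg.q0.sigma P := by
    apply le_antisymm Ideal.map_comap_le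
    have : P ≤ ((((iAct hg.q0.sigma P).under (𝓞 (MQ g [{1}, {2}, {3}]))).map (algebraMap (𝓞 (MQ g [{1}, {2}, {3}])) (𝓞 (MQ g [{0}, {1}, {2}, {3}])))).comap (oAct hg.q0.sigma)) := by
      nth_rewrite 1 [← h]
      rw [Ideal.map_le_iff_le_comap]
      intro z hz
      rw [Ideal.mem_comap, Ideal.mem_comap]
      have hz' : inP P ((z : MQ g [{1}, {2}, {3}]) : ℂ) := (inP_coe (P := P) (algebraMap _ (𝓞 (MQ g [{0}, {1}, {2}, {3}])) z)).2 hz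
      have h5 := (inP_iAct hg.q0.sigma P ⟨_, hg.h01.le (z : MQ g [{1}, {2}, {3}]).2⟩).2 hz'
      have h6 := theta_K0 hg ⟨_, hg.h01.le (z : MQ g [{1}, {2}, {3}]).2⟩ (z : MQ g [{1}, {2}, {3}]).2
      obtain ⟨y, hy⟩ := (show OI (MQ g [{1}, {2}, {3}]) _ from ⟨h6, h5.oi.2⟩).lift
      have h7 : oAct hg.q0.sigma (algebraMap _ _ z) = algebraMap _ _ y := by
        apply RingOfIntegers.coe_injective
        ext1
        exact hy.symm
      rw [h7]
      apply Ideal.mem_map_of_mem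
      rw [Ideal.mem_comap, ← inP_coe]
      rw [← hy] at h5
      exact h5
    rw [iAct, Ideal.map_le_iff_le_comap]
    exact this
  have all : ∀ Q ∈ PO (MQ g [{0}, {1}, {2}, {3}]) 2,
     (Q.under (𝓞 (MQ g [{1}, {2}, {3}]))).map (algebraMap (𝓞 (MQ g [{1}, {2}, {3}])) (𝓞 (MQ g [{0}, {1}, {2}, {3}]))) = Q := by
    intro Q hQ
    by_cases q1 : Q = P
    · rw [q1, h]
    by_cases q2 : Q = iAct hg.q0.sigma P
    · rw [q2, h']
    exfalso
    have : ({P, Q, iAct hg.q0.sigma P} : Set _).ncard ≤ 2 :=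
      (Set.ncard_le_ncard (by
        rintro Q' (rfl | rfl | rfl)
        · exact hP
        · exact hQ
        · exact hθP) (PO_finite two_ne_zero)).trans (PO1_card hg)
    rw [Set.ncard_eq_three.2 ⟨P, Q, iAct hg.q0.sigma P, fun h => q1 h.symm, fun h => hθn h.symm, q2, rfl⟩] at this
    omega
  have hc := cnt (W := [{1}, {2}, {3}]) hg.toPG (i := 0) 1 4 2
    (fun p hp => by
      obtain ⟨Q, hQ, rfl⟩ := PO_over hg.h01 hp
      have h8 := e4 hg (v := {0}) (w := {2}) (by decide) (by decide) (by rw [dd1]; have := hg.g2; omega) (by decide) hQ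
      rw [inP_nat] at h8 ⊢
      rw [hg.g0] at hQ
      nth_rewrite 1 [← all Q hQ] at h8
      rw [← Ideal.map_pow] at h8
      exact mem_of_map_mem (L := MQ g [{0}, {1}, {2}, {3}]) (pow_ne_zero _ hp.2.1) (by rw [map_natCast]; exact h8))
    (fun p hp => f2' hg (v := {1}) (by decide) (by rw [dd1]; exact hg.g1) hp) (by norm_num)
  rw [hg.g0] at hc
  have e := (Set.ncard_le_one (PO_finite two_ne_zero)).1 hc _ (resP_PO hg.h01.le two_ne_zero hP) _ (resP_PO hg.h01.le two_ne_zero hθP)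
  exact hθn ((theta_ne hg P hP).2 _ hθP (by
    intro z hz hzP
    have e1 := (inP_resP hg.h01.le P ⟨z, hz⟩).2 hzP
    rw [e] at e1
    exact (inP_resP hg.h01.le _ ⟨z, hz⟩).1 e1))

theorem base_unit (hg : CG g) (h0 : hh (MQ g [{1}, {2}, {3}]) = 2) (h1 : hh (MQ g [{0}, {1}, {2}, {3}]) ≤ 2) :
    ∃ u ∈ MQ g [{1}, {2}, {3}], IsUn u ∧
    ∀ w : MQ g [{0}, {1}, {2}, {3}], ((w * hg.h01.sigma w : MQ g [{0}, {1}, {2}, {3}]) : ℂ) ≠ u := by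
  letI := hg.h01.alg
  obtain ⟨P, hP⟩ := PO_nonempty (L := MQ g [{0}, {1}, {2}, {3}]) Nat.prime_two
  have hθP := iAct_PO hg.q0.sigma hP
  have hall : ∀ i, ![P, iAct hg.q0.sigma P] i ∈ PO (MQ g [{0}, {1}, {2}, {3}]) 2 := by
    intro i; fin_cases i
    · exact hP
    · exact hθP
  have hr := ramIdx_ge hg.h01.isQuad (k := 2) ![P, iAct hg.q0.sigma P] (by
    intro i j hij
    have := (theta_ne hg P hP).1
    fin_cases i <;> fin_cases j <;> first | rfl | exact absurd hij this | exact absurd hij.symm this)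
    (fun i => (hall i).1) (fun i => (hall i).2.1) (fun i => ram1 hg _ (hall i)) (fun i => stable1 hg _ (hall i))
  obtain ⟨u, hu, hs, hn⟩ := exists_nonnorm hg.h01.isQuad hr (by
    have : h2f (clAct hg.h01.sigma) ≤ hh (MQ g [{0}, {1}, {2}, {3}]) := by
      apply Nat.card_le_card_of_injective _ (Subgroup.inclusion_injective inf_le_left)
    change _ < hh _ * _
    rw [h0]; omega)
  refine ⟨_, hg.h01.mem_of_fix _ hs, isUn_of_mem_uEmb _ hu, ?_⟩
  intro w hw
  exact hn w (Subtype.ext hw)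
end
end

section
open scoped nonZeroDivisors

theorem kb {A B C T k : ℤ} (a0 : 0 ≤ A) (a1 : A ≤ T) (b0 : 0 ≤ B) (b1 : B ≤ T) (c0 : 0 ≤ C) (c1 : C < T) (t : 0 < T)
    (h : A - B - C = T * k) : -2 < k ∧ k ≤ 1 := by
  constructor
  · by_contra hk; push Not at hk
    nlinarith
  · by_contra hk; push Not at hk
    nlinarith

/-- Legendre-type pigeonhole -/
theorem leg0 {p q s : ℕ} (hp : p.Prime) (hq : q.Prime) (hs : s.Prime) (hpq : p ≠ q) (hps : p ≠ s) (hqs : q ≠ s)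
    (h1 : IsSquare (((q * s : ℕ)) : ZMod p)) (h2 : IsSquare (p : ZMod q)) (h3 : IsSquare (p : ZMod s)) :
    ∃ x y z : ℤ, z ≠ 0 ∧ x ^ 2 - p * y ^ 2 = q * s * z ^ 2 := by
  haveI : Fact p.Prime := ⟨hp⟩
  haveI : Fact q.Prime := ⟨hq⟩
  haveI : Fact s.Prime := ⟨hs⟩
  obtain ⟨e, he⟩ := h1
  obtain ⟨c, hc⟩ := h2
  obtain ⟨d, hd⟩ := h3
  have nsq : ∀ n : ℕ, n * n ≠ p := fun n hn => hp.not_isSquare ⟨n, hn.symm⟩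
  have nsqz : ∀ n : ℤ, n ^ 2 ≠ p := fun n hn => nsq n.natAbs (by
    have : ((n.natAbs * n.natAbs : ℕ) : ℤ) = p := by rw [← hn]; push_cast; rw [abs_mul_abs_self]; ring
    exact_mod_cast this)
  set X := Nat.sqrt (p * (q * s)) with hX
  set Y := Nat.sqrt (q * s) with hY
  set Z := Nat.sqrt p with hZ
  let f : Fin (X + 1) × Fin (Y + 1) × Fin (Z + 1) → ZMod p × ZMod q × ZMod s := fun t =>
    ((t.1 : ZMod p) - e * t.2.2, (t.1 : ZMod q) - c * t.2.1, (t.1 : ZMod s) - d * t.2.1)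
  have hcard : Fintype.card (ZMod p × ZMod q × ZMod s) < Fintype.card (Fin (X + 1) × Fin (Y + 1) × Fin (Z + 1)) := by
    simp only [Fintype.card_prod, ZMod.card, Fintype.card_fin]
    have a1 := Nat.lt_succ_sqrt (p * (q * s))
    have a2 := Nat.lt_succ_sqrt (q * s)
    have a3 := Nat.lt_succ_sqrt p
    rw [← hX] at a1; rw [← hY] at a2; rw [← hZ] at a3
    simp only [Nat.succ_eq_add_one] at a1 a2 a3
    have b1 := Nat.mul_lt_mul'' a2 a3
    have b2 := Nat.mul_lt_mul'' a1 b1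
    apply lt_of_pow_lt_pow_left₀ 2 (Nat.zero_le _)
    calc _ = (p * (q * s)) * ((q * s) * p) := by ring
      _ < _ := b2
      _ = _ := by ring
  obtain ⟨t, t', hne, hf⟩ := Fintype.exists_ne_map_eq_of_card_lt f hcard
  simp only [f, Prod.mk.injEq] at hf
  obtain ⟨f1, f2, f3⟩ := hf
  set x : ℤ := (t.1 : ℕ) - (t'.1 : ℕ) with hx
  set y : ℤ := (t.2.1 : ℕ) - (t'.2.1 : ℕ) with hy
  set z : ℤ := (t.2.2 : ℕ) - (t'.2.2 : ℕ) with hz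
  have bx : x ^ 2 ≤ X ^ 2 := by
    have := t.1.2; have := t'.1.2
    rw [sq_le_sq, abs_le]; rw [abs_of_nonneg (by positivity)]; omega
  have bY : y ^ 2 ≤ Y ^ 2 := by
    have := t.2.1.2; have := t'.2.1.2
    rw [sq_le_sq, abs_le]; rw [abs_of_nonneg (by positivity)]; omega
  have bz : z ^ 2 ≤ Z ^ 2 := by
    have := t.2.2.2; have := t'.2.2.2
    rw [sq_le_sq, abs_le]; rw [abs_of_nonneg (by positivity)]; omega
  have cx : ((X : ℤ)) ^ 2 ≤ p * (q * s) := by exact_mod_cast Nat.sqrt_le' (p * (q * s))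
  have cy : ((Y : ℤ)) ^ 2 ≤ q * s := by exact_mod_cast Nat.sqrt_le' (q * s)
  have cz : ((Z : ℤ)) ^ 2 ≤ p := by exact_mod_cast Nat.sqrt_le' p
  have pp : (0 : ℤ) < p := by exact_mod_cast hp.pos
  have pq : (0 : ℤ) < q := by exact_mod_cast hq.pos
  have ps : (0 : ℤ) < s := by exact_mod_cast hs.pos
  have pqs : (0 : ℤ) < q * s := mul_pos pq ps
  have gz : z ^ 2 < p := lt_of_le_of_ne (bz.trans cz) (nsqz z)
  have gx : x ^ 2 ≤ p * (q * s) := bx.trans cx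
  have gy : y ^ 2 ≤ q * s := bY.trans cy
  -- divisibility
  have d1 : (p : ℤ) ∣ x ^ 2 - p * y ^ 2 - q * s * z ^ 2 := by
    rw [← ZMod.intCast_zmod_eq_zero_iff_dvd]
    push_cast
    have hxz : (x : ZMod p) = e * z := by rw [hx, hz]; push_cast; linear_combination f1
    rw [hxz]; push_cast at he
    rw [ZMod.natCast_self]
    linear_combination (-(z : ZMod p) ^ 2) * he
  have d2 : (q : ℤ) ∣ x ^ 2 - p * y ^ 2 - q * s * z ^ 2 := by
    rw [← ZMod.intCast_zmod_eq_zero_iff_dvd]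
    push_cast
    have hxz : (x : ZMod q) = c * y := by rw [hx, hy]; push_cast; linear_combination f2
    rw [hxz, ZMod.natCast_self]
    linear_combination (-(y : ZMod q) ^ 2) * hc
  have d3 : (s : ℤ) ∣ x ^ 2 - p * y ^ 2 - q * s * z ^ 2 := by
    rw [← ZMod.intCast_zmod_eq_zero_iff_dvd]
    push_cast
    have hxz : (x : ZMod s) = d * y := by rw [hx, hy]; push_cast; linear_combination f3
    rw [hxz, ZMod.natCast_self]
    linear_combination (-(y : ZMod s) ^ 2) * hd
  have k1 : IsCoprime (q : ℤ) s := Nat.isCoprime_iff_coprime.2 ((Nat.coprime_primes hq hs).2 hqs)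
  have k2 : IsCoprime (p : ℤ) (q * s) := IsCoprime.mul_right (Nat.isCoprime_iff_coprime.2 ((Nat.coprime_primes hp hq).2 hpq))
    (Nat.isCoprime_iff_coprime.2 ((Nat.coprime_primes hp hs).2 hps))
  obtain ⟨k, hk⟩ := k2.mul_dvd d1 (k1.mul_dvd d2 d3)
  have py : (p : ℤ) * y ^ 2 ≤ p * (q * s) := by nlinarith
  have pz : (q * s : ℤ) * z ^ 2 < p * (q * s) := by nlinarith
  have zz : 0 ≤ (q * s : ℤ) * z ^ 2 := by positivity
  have yy : 0 ≤ (p : ℤ) * y ^ 2 := by positivity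
  have pos : (0 : ℤ) < p * (q * s) := mul_pos pp pqs
  obtain ⟨hk2, hk1⟩ := kb (sq_nonneg x) gx yy py zz pz pos hk
  have xne : ∀ a b : ℤ, a ^ 2 = p * b ^ 2 → b = 0 := by
    intro a b hab
    by_contra hb
    have h2 : ((a : ℚ) / b) ^ 2 = p := by
      have : (b : ℚ) ≠ 0 := by exact_mod_cast hb
      field_simp
      have : (a : ℚ) ^ 2 = p * b ^ 2 := by exact_mod_cast hab
      linarith
    have h3 : IsSquare (p : ℚ) := ⟨_, h2.symm.trans (sq _)⟩
    rw [Rat.isSquare_natCast_iff] at h3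
    exact hp.not_isSquare h3
  rcases (by omega : k = -1 ∨ k = 0 ∨ k = 1) with rfl | rfl | rfl
  · refine ⟨x * z + p * y, x + y * z, z ^ 2 - p, sub_ne_zero.2 (nsqz z), ?_⟩
    linear_combination (z ^ 2 - p : ℤ) * hk
  · refine ⟨x, y, z, ?_, by linear_combination hk⟩
    intro z0
    rw [z0] at hk
    have y0 := xne x y (by linear_combination hk)
    rw [y0] at hk
    have x0 : x = 0 := by
      have : x ^ 2 = 0 := by linear_combination hk
      exact pow_eq_zero_iff two_ne_zero |>.1 this
    apply hne
    ext <;> omega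
  · exfalso
    have x1 : x ^ 2 = p * (q * s) := by linarith
    obtain ⟨u, hu⟩ : (p : ℤ) ∣ x := (Nat.prime_iff_prime_int.1 hp).dvd_of_dvd_pow ⟨_, x1⟩
    rw [hu] at x1
    have : (p : ℤ) ∣ q * s := ⟨u ^ 2, by
      apply mul_left_cancel₀ pp.ne'
      linear_combination -x1⟩
    have := (k2.symm.isUnit_of_dvd' this dvd_rfl)
    exact (Nat.prime_iff_prime_int.1 hp).not_unit this

theorem prim {p n : ℤ} {x y z : ℤ} (hz : z ≠ 0) (h : x ^ 2 - p * y ^ 2 = n * z ^ 2) :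
    ∃ d X Y Z : ℤ, d ≠ 0 ∧ x = d * X ∧ y = d * Y ∧ z = d * Z ∧ X ^ 2 - p * Y ^ 2 = n * Z ^ 2 ∧
      ∀ l : ℤ, Prime l → l ∣ X → l ∣ Y → l ∣ Z → False := by
  set d : ℤ := GCDMonoid.gcd x (GCDMonoid.gcd y z) with hd
  have d0 : d ≠ 0 := by
    intro h0
    rw [h0] at hd
    have := (gcd_eq_zero_iff _ _).1 hd.symm
    exact hz ((gcd_eq_zero_iff _ _).1 this.2).2
  obtain ⟨X, hX⟩ : d ∣ x := gcd_dvd_left _ _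
  obtain ⟨Y, hY⟩ : d ∣ y := (gcd_dvd_right _ _).trans (gcd_dvd_left _ _)
  obtain ⟨Z, hZ⟩ : d ∣ z := (gcd_dvd_right _ _).trans (gcd_dvd_right _ _)
  refine ⟨d, X, Y, Z, d0, hX, hY, hZ, ?_, ?_⟩
  · have : d ^ 2 ≠ 0 := pow_ne_zero _ d0
    apply mul_left_cancel₀ this
    rw [hX, hY, hZ] at h
    linear_combination h
  · intro l hl h1 h2 h3
    have : l * d ∣ d := by
      nth_rewrite 2 [hd]
      apply dvd_gcd
      · rw [hX, mul_comm d]; exact mul_dvd_mul_right h1 _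
      apply dvd_gcd
      · rw [hY, mul_comm d]; exact mul_dvd_mul_right h2 _
      · rw [hZ, mul_comm d]; exact mul_dvd_mul_right h3 _
    obtain ⟨k, hk⟩ := this
    apply hl.not_unit
    apply IsUnit.of_mul_eq_one k
    apply mul_left_cancel₀ d0
    linear_combination -hk

theorem leg1 {p q s : ℕ} (hp : p.Prime) (hq : q.Prime) (hs : s.Prime) (hpq : p ≠ q) (hps : p ≠ s) (hqs : q ≠ s)
    (h1 : IsSquare (((q * s : ℕ)) : ZMod p)) (h2 : IsSquare (p : ZMod q)) (h3 : IsSquare (p : ZMod s))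
    (p8 : p % 8 = 5) (q4 : q * s % 4 = 1) :
    ∃ x y z : ℤ, Odd z ∧ x ^ 2 - p * y ^ 2 = q * s * z ^ 2 := by
  obtain ⟨x, y, z, z0, h⟩ := leg0 hp hq hs hpq hps hqs h1 h2 h3
  obtain ⟨d, x, y, z, d0, -, -, -, h, hl⟩ := prim z0 h
  obtain ⟨a, ha⟩ : ∃ a : ℤ, (p : ℤ) = 8 * a + 5 := ⟨p / 8, by omega⟩
  obtain ⟨b, hb⟩ : ∃ b : ℤ, (q * s : ℤ) = 4 * b + 1 := ⟨((q * s : ℕ) : ℤ) / 4, by push_cast; rw [← Nat.cast_mul]; omega⟩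
  rcases Int.even_or_odd' z with ⟨z', hz | hz⟩
  swap
  · exact ⟨x, y, z, ⟨z', hz⟩, h⟩
  have pr2 := hl 2 Int.prime_two
  have h0 := h
  rw [ha, hb, hz] at h
  rcases Int.even_or_odd' x with ⟨x', hx | hx⟩ <;> rcases Int.even_or_odd' y with ⟨y', hy | hy⟩
  · exact (pr2 ⟨_, hx⟩ ⟨_, hy⟩ ⟨_, hz⟩).elim
  · exfalso; rw [hx, hy] at h; ring_nf at h; omega
  · exfalso; rw [hx, hy] at h; ring_nf at h; omega
  -- both odd
  obtain ⟨u, hu⟩ : (8 : ℤ) ∣ x ^ 2 + 3 * p * y ^ 2 := by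
    rw [ha, hx, hy]
    obtain ⟨m, hm⟩ := Int.even_mul_succ_self x'
    obtain ⟨n, hn⟩ := Int.even_mul_succ_self y'
    exact ⟨m + 2 + 12 * a * n + 3 * a + 15 * n + 12 * a * n + 0, by linear_combination 4 * hm + 4 * (3 * (8 * a + 5)) * hn⟩
  obtain ⟨v, hv⟩ : (8 : ℤ) ∣ 3 * x ^ 2 + p * y ^ 2 := by
    rw [ha, hx, hy]
    obtain ⟨m, hm⟩ := Int.even_mul_succ_self x'
    obtain ⟨n, hn⟩ := Int.even_mul_succ_self y'
    exact ⟨3 * m + 1 + 8 * a * n + a + 5 * n, by linear_combination 12 * hm + 4 * ((8 * a + 5)) * hn⟩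
  refine ⟨x * u, y * v, q * s * z' ^ 3, ?_, ?_⟩
  · refine Odd.mul ?_ (Odd.pow ?_)
    · rw [hb]; exact ⟨2 * b, by ring⟩
    · rw [hx, hy] at h
      by_contra hc
      rw [Int.not_odd_iff_even] at hc
      obtain ⟨m, hm⟩ := hc
      obtain ⟨m', hm'⟩ := Int.even_mul_succ_self x'
      obtain ⟨n, hn⟩ := Int.even_mul_succ_self y'
      rw [hm] at h
      have : (4 : ℤ) = 8 * (m' - 5 * n - 8 * a * n  - a - 2 * (4 * b + 1) * m ^ 2) := by
        linear_combination -h + 4 * hm' - 4 * (8 * a + 5) * hn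
      omega
  · have e1 : 64 * ((x * u) ^ 2 - p * (y * v) ^ 2) = (x ^ 2 - p * y ^ 2) ^ 3 := by
      have : 64 * ((x * u) ^ 2 - p * (y * v) ^ 2) = x ^ 2 * (8 * u) ^ 2 - p * y ^ 2 * (8 * v) ^ 2 := by ring
      rw [this, ← hu, ← hv]; ring
    rw [h0, hz] at e1
    have : (64 : ℤ) ≠ 0 := by norm_num
    apply mul_left_cancel₀ this
    rw [e1]; ring

theorem leg2 {p q s : ℕ} (hp : p.Prime) (hq : q.Prime) (hs : s.Prime) (hpq : p ≠ q) (hps : p ≠ s) (hqs : q ≠ s)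
    (h1 : IsSquare (((q * s : ℕ)) : ZMod p)) (h2 : IsSquare (p : ZMod q)) (h3 : IsSquare (p : ZMod s))
    (p8 : p % 8 = 5) (q4 : q * s % 4 = 1) :
    ∃ x y z : ℤ, 0 < x ∧ Odd x ∧ Even y ∧ z ≠ 0 ∧ x ^ 2 - p * y ^ 2 = q * s * z ^ 2 ∧ IsCoprime x (p * y ^ 2) := by
  obtain ⟨x, y, z, z0, h⟩ := leg1 hp hq hs hpq hps hqs h1 h2 h3 p8 q4
  have zn : z ≠ 0 := by rintro rfl; exact absurd z0 (by decide)
  obtain ⟨d, x, y, z', d0, -, -, hz', h, hl⟩ := prim zn h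
  have zo : Odd z' := by rw [hz'] at z0; exact (Int.odd_mul.1 z0).2
  have zn' : z' ≠ 0 := by rintro rfl; exact absurd zo (by decide)
  obtain ⟨a, ha⟩ : ∃ a : ℤ, (p : ℤ) = 8 * a + 5 := ⟨p / 8, by omega⟩
  obtain ⟨b, hb⟩ : ∃ b : ℤ, (q * s : ℤ) = 4 * b + 1 := ⟨((q * s : ℕ) : ℤ) / 4, by push_cast; rw [← Nat.cast_mul]; omega⟩
  have par : Odd x ∧ Even y := by
    obtain ⟨w, hw⟩ := zo
    rw [ha, hb, hw] at h
    rcases Int.even_or_odd' x with ⟨x', hx | hx⟩ <;> rcases Int.even_or_odd' y with ⟨y', hy | hy⟩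
    · exfalso; rw [hx, hy] at h; ring_nf at h; omega
    · exfalso; rw [hx, hy] at h; ring_nf at h; omega
    · exact ⟨⟨_, hx⟩, ⟨y', by omega⟩⟩
    · exfalso; rw [hx, hy] at h; ring_nf at h; omega
  have hcop : IsCoprime x (p * y ^ 2) := by
    have k1 : Nat.Coprime q s := (Nat.coprime_primes hq hs).2 hqs
    have k2 : IsCoprime (p : ℤ) (q * s) := IsCoprime.mul_right (Nat.isCoprime_iff_coprime.2 ((Nat.coprime_primes hp hq).2 hpq))
      (Nat.isCoprime_iff_coprime.2 ((Nat.coprime_primes hp hs).2 hps))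
    have sqf : Squarefree ((q : ℤ) * s) := by
      have : Squarefree (q * s) := (Nat.squarefree_mul k1).2 ⟨hq.squarefree, hs.squarefree⟩
      exact_mod_cast Int.squarefree_natCast.2 this
    have x0 : x ≠ 0 := by rintro rfl; exact absurd par.1 (by decide)
    refine isCoprime_of_prime_dvd (fun h => x0 h.1) ?_
    intro l hlp hx hy
    obtain ⟨x', rfl⟩ := hx
    have last : l ∣ y → l ∣ z' := by
      rintro ⟨y', rfl⟩
      by_contra hz
      have c1 : IsCoprime (l * l) (z' ^ 2) := by
        have := (hlp.irreducible.coprime_iff_not_dvd (n := z')).2 hz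
        exact (IsCoprime.mul_left this this).pow_right
      have : l * l ∣ (q * s : ℤ) := c1.dvd_of_dvd_mul_right ⟨x' ^ 2 - p * y' ^ 2, by linear_combination -h⟩
      exact hlp.not_unit (sqf l this)
    rcases hlp.dvd_or_dvd hy with hpl | hyl
    · have hz : l ∣ z' := by
        have c1 : IsCoprime l (q * s : ℤ) := k2.of_isCoprime_of_dvd_left hpl
        obtain ⟨u, hu⟩ := hpl
        have : l ∣ z' ^ 2 := c1.dvd_of_dvd_mul_left ⟨l * x' ^ 2 - u * y ^ 2, by rw [hu] at h; linear_combination -h⟩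
        exact hlp.dvd_of_dvd_pow this
      obtain ⟨w, hw⟩ := hz
      obtain ⟨u, hu⟩ := hpl
      have hun : IsUnit u := by
        rcases (Nat.prime_iff_prime_int.1 hp).irreducible.isUnit_or_isUnit hu with h | h
        · exact absurd h hlp.not_unit
        · exact h
      have : l ∣ u * y ^ 2 := ⟨x' ^ 2 - q * s * w ^ 2, by
        apply mul_left_cancel₀ hlp.ne_zero
        rw [hu, hw] at h; linear_combination -h⟩
      have hy2 : l ∣ y := hlp.dvd_of_dvd_pow (hun.dvd_mul_left.1 this)
      exact hl l hlp (dvd_mul_right _ _) hy2 ⟨w, hw⟩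
    · have hy2 : l ∣ y := hlp.dvd_of_dvd_pow hyl
      exact hl l hlp (dvd_mul_right _ _) hy2 (last hy2)
  have x0 : x ≠ 0 := by rintro rfl; exact absurd par.1 (by decide)
  rcases lt_or_gt_of_ne x0 with hx | hx
  · exact ⟨-x, y, z', by omega, par.1.neg, par.2, zn', by linear_combination h, hcop.neg_left⟩
  · exact ⟨x, y, z', hx, par.1, par.2, zn', h, hcop⟩
end

section
open scoped nonZeroDivisors

theorem Tower.nmem_step {K : ℕ → IntermediateField ℚ ℂ} {x : ℕ → ℂ} (T : Tower K x) {r : ℂ} (n : ℕ) (h2 : r ^ 2 ∈ K n)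
    (hr : r ∉ K (n + 1)) : r ∉ K (n + 2) := by
  intro hm
  obtain ⟨a, ha, b, hb, e⟩ := (T.qe (n + 1)).gen _ hm
  have hX := (T.qe (n + 1)).sq
  have e2 := (T.qe (n + 1)).uniq (T.le _ h2) (zero_mem _) (add_mem (pow_mem ha 2) (mul_mem (pow_mem hb 2) hX))
    (mul_mem (mul_mem (two_mem' _) ha) hb) (by rw [e]; ring)
  have hb0 : b ≠ 0 := by
    rintro rfl
    apply hr; rw [e]; simpa using ha
  have ha0 : a = 0 := by
    have := e2.2.symm
    simpa [hb0] using this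
  have e3 := e2.1
  rw [ha0, T.sq] at e3
  obtain ⟨c, hc, d, hd, rfl⟩ := (T.qe n).gen _ hb
  have hY := (T.qe n).sq
  have e4 := (T.qe n).uniq h2 (zero_mem _)
    (add_mem (mul_mem (two_mem' _) (add_mem (pow_mem hc 2) (mul_mem (pow_mem hd 2) hY))) (mul_mem (mul_mem (two_mem' _) (mul_mem hc hd)) hY))
    (add_mem (add_mem (pow_mem hc 2) (mul_mem (pow_mem hd 2) hY)) (mul_mem (add_mem (two_mem' _) (two_mem' _)) (mul_mem hc hd)))
    (by rw [e3]; ring)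
  obtain ⟨b', hb', hb0', e5⟩ := T.bn n
  have hYx := T.sq n
  set X := x (n + 1)
  have e6 : (r ^ 2) ^ 2 = ((c ^ 2 - d ^ 2 * X ^ 2) * b' * X) ^ 2 := by
    have : ((c ^ 2 - d ^ 2 * X ^ 2) * b' * X) ^ 2 = (c ^ 2 - d ^ 2 * X ^ 2) ^ 2 * (2 - x n) := by rw [e5]; ring
    rw [this, show (2 : ℂ) - x n = 4 - X ^ 2 by rw [hYx]; ring]
    have e7 : r ^ 2 = (c - d * X) ^ 2 * (2 - X) := by
      rw [e4.1]
      linear_combination (-X) * e4.2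
    calc (r ^ 2) ^ 2 = r ^ 2 * r ^ 2 := by ring
      _ = (0 ^ 2 + (c + d * X) ^ 2 * (2 + X)) * ((c - d * X) ^ 2 * (2 - X)) := by rw [← e3, ← e7]
      _ = _ := by ring
  have r0 : r ≠ 0 := by rintro rfl; exact hr (zero_mem _)
  have hN : (c ^ 2 - d ^ 2 * X ^ 2) * b' ∈ K n := mul_mem (sub_mem (pow_mem hc 2) (mul_mem (pow_mem hd 2) hY)) hb'
  have hN0 : (c ^ 2 - d ^ 2 * X ^ 2) * b' ≠ 0 := by
    intro h
    rw [h] at e6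
    simp [r0] at e6
  apply (T.qe n).nmem
  change X ∈ K n
  rcases sq_eq_sq_iff_eq_or_eq_neg.1 e6 with h | h
  · have : X = r ^ 2 / ((c ^ 2 - d ^ 2 * X ^ 2) * b') := by rw [h, eq_div_iff hN0]; ring
    rw [this]; exact div_mem h2 hN
  · have : X = - (r ^ 2 / ((c ^ 2 - d ^ 2 * X ^ 2) * b')) := by rw [h, neg_div, neg_neg, eq_div_iff hN0]; ring
    rw [this]; exact neg_mem (div_mem h2 hN)

theorem Tower.nmem {K : ℕ → IntermediateField ℚ ℂ} {x : ℕ → ℂ} (T : Tower K x) {r : ℂ} (h2 : r ^ 2 ∈ K 0)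
    (hr : r ∉ K 1) (n : ℕ) : r ∉ K (n + 1) := by
  induction n with
  | zero => exact hr
  | succ n ih => exact T.nmem_step n (T.memle (Nat.zero_le n) h2) ih

section
variable {g : Fin 4 → ℕ}

theorem r_nmem (hg : CG g) {x y z : ℤ} (hz : z ≠ 0) (h : x ^ 2 - g 1 * y ^ 2 = g 2 * g 3 * z ^ 2) {r : ℂ}
    (hr : r ^ 2 = x + y * R g {1}) : r ∉ MQ g [{0}, {1}, {2}, {3}] := by
  intro hm
  have hP : QE (MQ g [{0}, {2}, {3}]) (MQ g [{0}, {1}, {2}, {3}]) (R g {1}) :=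
    MQ_qe hg.toPG (by decide) (by decide) (by decide) (by decide)
  have hPQ : QE (MQ g [{0}, {3}, {1, 2}]) (MQ g [{0}, {1}, {2}, {3}]) (R g {1}) :=
    MQ_qe hg.toPG (by decide) (by decide) (by decide) (by decide)
  have c1 := sigma_mul hg.toPG hg.q0 hP hPQ (by decide)
  have c2 := sigma_mul hg.toPG hP hg.q0 hPQ (by decide)
  have hcomm : ∀ w, hg.q0.sigma (hP.sigma w) = hP.sigma (hg.q0.sigma w) := by
    intro w
    have := DFunLike.congr_fun (c1.trans c2.symm) w
    exact this
  set ρ : MQ g [{0}, {1}, {2}, {3}] := ⟨r, hm⟩ with hρ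
  obtain ⟨R1, hR1⟩ : ∃ w : MQ g [{0}, {1}, {2}, {3}], (w : ℂ) = R g {1} := ⟨⟨_, R_mem hg.toPG (by decide)⟩, rfl⟩
  obtain ⟨R23, hR23⟩ : ∃ w : MQ g [{0}, {1}, {2}, {3}], (w : ℂ) = R g {2, 3} := ⟨⟨_, R_mem hg.toPG (by decide)⟩, rfl⟩
  have hsq : ρ ^ 2 = (x : MQ g [{0}, {1}, {2}, {3}]) + y * R1 := by
    ext1; push_cast; rw [hR1]; exact hr
  have s1 : hg.q0.sigma R1 = R1 := by
    ext1; rw [sigma_R_fix hg.toPG hg.q0 (by decide) R1 hR1, hR1]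
  have s2 : hP.sigma R1 = -R1 := by
    ext1; rw [sigma_R_neg hg.toPG hP (by decide) R1 hR1]; push_cast; rw [hR1]
  have s3 : hg.q0.sigma R23 = -R23 := by
    ext1; rw [sigma_R_neg hg.toPG hg.q0 (by decide) R23 hR23]; push_cast; rw [hR23]
  have q1 : (hg.q0.sigma ρ) ^ 2 = ρ ^ 2 := by
    rw [← map_pow, hsq, map_add, map_mul, map_intCast, map_intCast, s1]
  have q2 : (hP.sigma ρ) ^ 2 = (x : MQ g [{0}, {1}, {2}, {3}]) - y * R1 := by
    rw [← map_pow, hsq, map_add, map_mul, map_intCast, map_intCast, s2]; ring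
  have q3 : (ρ * hP.sigma ρ) ^ 2 = (z * R23) ^ 2 := by
    rw [mul_pow, q2, hsq]
    ext1
    push_cast
    rw [hR1, hR23]
    have a1 := R_sq (g := g) {1}
    have a2 := R_sq (g := g) {2, 3}
    rw [dd1] at a1
    rw [dd2 (by decide)] at a2
    have h' : (x : ℂ) ^ 2 - g 1 * y ^ 2 = g 2 * g 3 * z ^ 2 := by exact_mod_cast h
    push_cast at a2
    linear_combination (-(y : ℂ) ^ 2) * a1 - (z : ℂ) ^ 2 * a2 + h'
  have fix : hg.q0.sigma (ρ * hP.sigma ρ) = ρ * hP.sigma ρ := by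
    rw [map_mul, hcomm]
    rcases sq_eq_sq_iff_eq_or_eq_neg.1 q1 with h | h <;> rw [h]
    rw [map_neg]; ring
  have z0 : (z : MQ g [{0}, {1}, {2}, {3}]) * R23 ≠ 0 := by
    apply mul_ne_zero (by exact_mod_cast hz)
    intro h0
    rw [h0] at hR23
    exact R_ne_zero hg.toPG _ hR23.symm
  apply z0
  have two0 : (2 : MQ g [{0}, {1}, {2}, {3}]) ≠ 0 := two_ne_zero
  rcases sq_eq_sq_iff_eq_or_eq_neg.1 q3 with h | h
  · rw [h, map_mul, map_intCast, s3] at fix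
    apply mul_left_cancel₀ two0
    linear_combination -fix
  · rw [h, map_neg, map_mul, map_intCast, s3] at fix
    apply mul_left_cancel₀ two0
    linear_combination fix

theorem lower (hg : CG g) {K : IntermediateField ℚ ℂ} [NumberField K] [IsTotallyReal K]
    (hK : MQ g [{1}, {2}, {3}] ≤ K) {x y z : ℤ} (hx0 : 0 < x) (hx : Odd x) (hy : Even y) (hz : z ≠ 0)
    (h : x ^ 2 - g 1 * y ^ 2 = g 2 * g 3 * z ^ 2) (hc : IsCoprime x (g 1 * y ^ 2)) {r : ℂ}
    (hr : r ^ 2 = x + y * R g {1}) (hrK : r ∉ K) : 2 ≤ hh K := by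
  have hR1 : R g {1} ∈ K := hK (R_mem hg.toPG (by decide))
  have hR2 : R g {2} ∈ K := hK (R_mem hg.toPG (by decide))
  have hR23 : R g {2, 3} ∈ K := hK (R_mem hg.toPG (by decide))
  have hα : (x : ℂ) + y * R g {1} ∈ K := add_mem (intCast_mem _ _) (mul_mem (intCast_mem _ _) hR1)
  have h2K : r ^ 2 ∈ K := by rw [hr]; exact hα
  have hQ : QE K (quadExt K r hrK h2K) r := ⟨fun x hx => ⟨x, hx, 0, zero_mem _, by ring⟩,
    ⟨0, zero_mem _, 1, one_mem _, by ring⟩, hrK, h2K, fun x hx => hx⟩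
  generalize quadExt K r hrK h2K = L at hQ
  haveI : NumberField L := hQ.numberField
  have a1 := R_sq (g := g) {1}
  have a2 := R_sq (g := g) {2, 3}
  rw [dd1] at a1
  rw [dd2 (by decide)] at a2
  push_cast at a2
  have h' : (x : ℂ) ^ 2 - g 1 * y ^ 2 = g 2 * g 3 * z ^ 2 := by exact_mod_cast h
  have r0 : r ≠ 0 := by rintro rfl; exact hrK (zero_mem _)
  -- totally real
  haveI : IsTotallyReal L := by
    apply hQ.real
    intro φ
    set t := φ ⟨R g {1}, hQ.le hR1⟩ with ht
    have e1 : (φ ⟨r, hQ.mem⟩) ^ 2 = x + y * t := by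
      rw [ht, ← map_pow, ← map_intCast φ x, ← map_intCast φ y, ← map_mul, ← map_add]
      congr 1; ext1; push_cast; exact hr
    have e2 : t ^ 2 = (R g {1}) ^ 2 := by
      rw [a1, ht, ← map_pow, ← map_natCast φ]
      congr 1; ext1; push_cast; exact a1
    set ρ : ℝ := Real.sqrt (dd g {1} : ℝ) with hρ
    have hRρ : R g {1} = (ρ : ℂ) := rfl
    have hρ2 : ρ ^ 2 = g 1 := by rw [hρ, Real.sq_sqrt (by positivity), dd1]
    have hpr : (0 : ℝ) ≤ (x + y * ρ) * (x - y * ρ) := by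
      have h'' : (x : ℝ) ^ 2 - g 1 * y ^ 2 = g 2 * g 3 * z ^ 2 := by exact_mod_cast h
      have : (x + y * ρ) * (x - y * ρ) = g 2 * g 3 * z ^ 2 := by rw [← h'', ← hρ2]; ring
      rw [this]; positivity
    have hx0' : (0 : ℝ) < x := by exact_mod_cast hx0
    have p1 : 0 ≤ (x : ℝ) + y * ρ := by
      by_contra hn; push Not at hn
      have : 0 < (x : ℝ) - y * ρ := by linarith
      nlinarith
    have p2 : 0 ≤ (x : ℝ) - y * ρ := by
      by_contra hn; push Not at hn
      have : 0 < (x : ℝ) + y * ρ := by linarith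
      nlinarith
    rcases sq_eq_sq_iff_eq_or_eq_neg.1 e2 with h | h
    · apply real_of_sq p1
      rw [e1, h, hRρ]; push_cast; ring
    · apply real_of_sq p2
      rw [e1, h, hRρ]; push_cast; ring
  -- unramified
  have hram : ramSet hQ.sigma = ∅ := by
    rw [Set.eq_empty_iff_forall_notMem]
    intro P hP
    have hPp := hP.1
    have iR1 : IsIntegral ℤ (R g {1}) := isIntegral_R _
    have iα : IsIntegral ℤ ((x : ℂ) + y * R g {1}) :=
      (isIntegral_algebraMap (x := x)).add ((isIntegral_algebraMap (x := y)).mul iR1)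
    have ir : IsIntegral ℤ r := by
      apply IsIntegral.of_pow (n := 2) (by norm_num); rw [hr]; exact iα
    have iα' : IsIntegral ℤ ((x : ℂ) - y * R g {1}) :=
      (isIntegral_algebraMap (x := x)).sub ((isIntegral_algebraMap (x := y)).mul iR1)
    set r' := z * R g {2, 3} / r with hr'
    have er' : r' ^ 2 = x - y * R g {1} := by
      rw [hr', div_pow, hr, div_eq_iff (by rw [← hr]; exact pow_ne_zero _ r0)]
      linear_combination (z : ℂ) ^ 2 * a2 - h' + (y : ℂ) ^ 2 * a1
    have ir' : IsIntegral ℤ r' := by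
      apply IsIntegral.of_pow (n := 2) (by norm_num); rw [er']; exact iα'
    have er2 : r' = z * R g {2, 3} / r ^ 2 * r := by rw [hr']; field_simp
    have cK : z * R g {2, 3} / r ^ 2 ∈ K := div_mem (mul_mem (intCast_mem _ _) hR23) h2K
    have b1 : inP P (2 * r) := by
      have := ram_gen hQ hP (zero_mem K) (one_mem K) (by simpa using ir)
      convert this using 1; ring
    have b2 : inP P (2 * r') := by
      have := ram_gen hQ hP (zero_mem K) cK (by rw [zero_add, ← er2]; exact ir')
      rw [er2]; convert this using 1; ring
    have Or : OI L r := ⟨hQ.mem, ir⟩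
    have Or' : OI L r' := ⟨by rw [er2]; exact mul_mem (hQ.le cK) hQ.mem, ir'⟩
    by_cases t2 : inP P (2 : ℂ)
    · obtain ⟨k, hk⟩ := hy
      have hω := isIntegral_half (g := g) (v := {1}) hg.p1
      obtain ⟨β, hβK, hβi, hβ⟩ : ∃ β ∈ K, IsIntegral ℤ β ∧ IsIntegral ℤ ((β ^ 2 - r ^ 2) / 4) := by
        have hxy : Odd (x - y) := by rw [hk]; exact hx.sub_even ⟨k, rfl⟩
        obtain ⟨m, hm⟩ := hxy
        rcases Int.even_or_odd' m with ⟨m', hm' | hm'⟩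
        · refine ⟨1, one_mem _, isIntegral_one, ?_⟩
          have : ((1 : ℂ) ^ 2 - r ^ 2) / 4 = ((-m' : ℤ) : ℂ) - (k : ℂ) * ((1 + R g {1}) / 2) := by
            rw [hr]
            have hx' : x = 4 * m' + 1 + 2 * k := by omega
            have hy' : y = 2 * k := by omega
            rw [hx', hy']; push_cast; ring
          rw [this]
          exact (isIntegral_algebraMap (x := -m')).sub ((isIntegral_algebraMap (x := k)).mul hω)
        · refine ⟨R g {2}, hR2, isIntegral_R _, ?_⟩
          obtain ⟨j, hj⟩ : ∃ j : ℤ, (g 2 : ℤ) = 4 * j + 3 := ⟨g 2 / 4, by have := hg.g2; omega⟩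
          have a3 := R_sq (g := g) {2}
          rw [dd1] at a3
          have : ((R g {2}) ^ 2 - r ^ 2) / 4 = ((j - m' : ℤ) : ℂ) - (k : ℂ) * ((1 + R g {1}) / 2) := by
            rw [hr, a3]
            have hx' : x = 4 * m' + 3 + 2 * k := by omega
            have hy' : y = 2 * k := by omega
            have hj' : (g 2 : ℂ) = 4 * j + 3 := by exact_mod_cast hj
            rw [hx', hy', hj']; push_cast; ring
          rw [this]
          exact (isIntegral_algebraMap (x := j - m')).sub ((isIntegral_algebraMap (x := k)).mul hω)
      have hIntg : IsIntegral ℤ (β / 2 + 1 / 2 * r) := by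
        have hsq : IsIntegral ℤ ((2 * (β / 2 + 1 / 2 * r) - β) ^ 2) := by
          convert iα using 1; rw [← hr]; ring
        -- root of t² - β t + (β² - α)/4
        have hA : IsIntegral (integralClosure ℤ ℂ) (β / 2 + 1 / 2 * r) := by
          refine ⟨Polynomial.X ^ 2 - Polynomial.C (⟨β, hβi⟩ : integralClosure ℤ ℂ) * Polynomial.X +
            Polynomial.C (⟨_, hβ⟩ : integralClosure ℤ ℂ), ?_, ?_⟩
          · have : (Polynomial.X ^ 2 - Polynomial.C (⟨β, hβi⟩ : integralClosure ℤ ℂ) * Polynomial.X +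
              Polynomial.C (⟨_, hβ⟩ : integralClosure ℤ ℂ)) = Polynomial.X ^ 2 + (Polynomial.C (-(⟨β, hβi⟩ : integralClosure ℤ ℂ)) * Polynomial.X +
              Polynomial.C (⟨_, hβ⟩ : integralClosure ℤ ℂ)) := by rw [Polynomial.C_neg]; ring
            rw [this]
            exact Polynomial.monic_X_pow_add (by compute_degree!)
          · simp only [Polynomial.eval₂_add, Polynomial.eval₂_sub, Polynomial.eval₂_mul, Polynomial.eval₂_X, Polynomial.eval₂_C,
              Polynomial.eval₂_pow]
            change (β / 2 + 1 / 2 * r) ^ 2 - β * (β / 2 + 1 / 2 * r) + (β ^ 2 - r ^ 2) / 4 = 0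
            ring
        exact isIntegral_trans _ hA
      have b3 : inP P r := by
        have := ram_gen hQ hP (div_mem hβK (two_mem' K)) (div_mem (one_mem K) (two_mem' K)) hIntg
        convert this using 1; ring
      have b4 : inP P ((x : ℂ) + y * R g {1}) := by
        have := inP.mul_left Or b3
        rw [← hr, sq]; exact this
      have b5 : inP P (x : ℂ) := by
        have b6 : inP P ((y : ℂ) * R g {1}) := by
          have := inP.mul_left ((OI.int (L := L) k).mul ⟨hQ.le hR1, iR1⟩) t2
          convert this using 1; rw [hk]; push_cast; ring
        have := b4.sub b6
        convert this using 1; ring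
      obtain ⟨m, hm⟩ := hx
      have : IsCoprime (2 : ℤ) x := ⟨-m, 1, by rw [hm]; ring⟩
      exact inP_coprime hPp this (by exact_mod_cast t2) b5
    · have c1 : inP P r := (inP.prime hPp OI.two Or b1).resolve_left t2
      have c2 : inP P r' := (inP.prime hPp OI.two Or' b2).resolve_left t2
      have c3 : inP P ((x : ℂ) + y * R g {1}) := by
        have := inP.mul_left Or c1
        rw [← hr, sq]; exact this
      have c4 : inP P ((x : ℂ) - y * R g {1}) := by
        have := inP.mul_left Or' c2
        rw [← er', sq]; exact this
      have c5 : inP P (x : ℂ) := by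
        have : inP P (2 * (x : ℂ)) := by convert c3.add c4 using 1; ring
        exact (inP.prime hPp OI.two (OI.int x) this).resolve_left t2
      have c6 : inP P ((y : ℂ) * R g {1}) := by
        convert c3.sub c5 using 1; ring
      have c7 : inP P (((g 1 * y ^ 2 : ℤ)) : ℂ) := by
        have := inP.mul_left c6.oi c6
        convert this using 1; push_cast; linear_combination (-(y : ℂ) ^ 2) * a1
      exact inP_coprime hPp hc c5 c7
  have := hQ.upper0 (t := 0) (by rw [hram]; simp)
  have hpos : 0 < h2f (clAct hQ.sigma) := Nat.card_pos
  omega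
end
end

section
open scoped nonZeroDivisors

section
variable {g : Fin 4 → ℕ}

theorem stable_tr (hg : CG g) {K0 K1 : IntermediateField ℚ ℂ} [NumberField K0] [NumberField K1] {r : ℂ} (h : QE K0 K1 r)
    (e0 : K0 = MQ g [{1}, {2}, {3}]) (e1 : K1 = MQ g [{0}, {1}, {2}, {3}]) (er : r = R g {0}) :
    (∀ P ∈ PO K1 2, iAct h.sigma P = P) ∧ (PO K1 2).ncard ≤ 2 := by
  subst e0 e1 er
  exact ⟨stable1 hg, PO1_card hg⟩

theorem unit_tr (hg : CG g) {K0 K1 : IntermediateField ℚ ℂ} [NumberField K0] [NumberField K1] {r : ℂ} (h : QE K0 K1 r)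
    (e0 : K0 = MQ g [{1}, {2}, {3}]) (e1 : K1 = MQ g [{0}, {1}, {2}, {3}]) (er : r = R g {0})
    (h0 : hh K0 = 2) (h1 : hh K1 ≤ 2) :
    ∃ u ∈ K0, IsUn u ∧ ∀ w : K1, ((w * h.sigma w : K1) : ℂ) ≠ u := by
  subst e0 e1 er
  exact base_unit hg h0 h1

theorem hh_tower (hg : CG g) {K : ℕ → IntermediateField ℚ ℂ} {x : ℕ → ℂ} (T : Tower K x)
    (e0 : K 0 = MQ g [{1}, {2}, {3}]) (e1 : K 1 = MQ g [{0}, {1}, {2}, {3}]) (ex : x 1 = R g {0})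
    (hA : hh (MQ g [{1, 2, 3}]) = 4) (hB : hh (MQ g [{0, 1}, {0, 3}, {2}]) = 4) :
    (∀ n, NumberField (K n)) ∧ ∀ n, hh (K n) = 2 := by
  have nf := T.nf (e0 ▸ inferInstance)
  refine ⟨nf, ?_⟩
  haveI := nf
  haveI tr := T.real (e0 ▸ inferInstance)
  have hq : IsSquare ((g 2 * g 3 : ℕ) : ZMod (g 1)) := by
    push_cast; exact IsSquare.mul hg.sqqp hg.sqsp
  have ne : ∀ i j : Fin 4, i ≠ j → g i ≠ g j := fun i j h e => h (hg.inj e)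
  obtain ⟨X, y, z, hx0, hx, hy, hz, h, hc⟩ := leg2 (hg.prime 1) (hg.prime 2) (hg.prime 3)
    (ne _ _ (by decide)) (ne _ _ (by decide)) (ne _ _ (by decide)) hq hg.q2 hg.q3 hg.g1 (by
      rw [Nat.mul_mod, hg.g3, hg.q34])
  obtain ⟨r, hr⟩ : ∃ r : ℂ, r ^ 2 = X + y * R g {1} := IsSquare.exists_sq _ (IsAlgClosed.exists_eq_mul_self _) |>.imp fun _ h => h.symm
  have nm1 := r_nmem hg hz h hr
  have r2 : r ^ 2 ∈ K 0 := by
    rw [hr, e0]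
    exact add_mem (intCast_mem _ _) (mul_mem (intCast_mem _ _) (R_mem hg.toPG (by decide)))
  have nm : ∀ n, r ∉ K n := by
    intro n
    cases n with
    | zero => exact fun h => nm1 (e1 ▸ T.le 0 h)
    | succ n => exact T.nmem r2 (by rw [e1]; exact nm1) n
  have lo : ∀ n, 2 ≤ hh (K n) := fun n =>
    lower hg (e0 ▸ T.memle (Nat.zero_le n)) hx0 hx hy hz h hc hr (nm n)
  have u0 : hh (K 0) ≤ 2 := by rw [e0]; exact step13 hg hA
  have u1 : hh (K 1) ≤ 2 := by rw [e1]; exact step20 hg (step14 hg) (step15 hg) hB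
  obtain ⟨s1, s2⟩ := stable_tr hg (T.qe 0) e0 e1 ex
  obtain ⟨u, hu, hu1, hn⟩ := unit_tr hg (T.qe 0) e0 e1 ex (le_antisymm u0 (lo 0)) u1
  intro n
  refine le_antisymm ?_ (lo n)
  cases n with
  | zero => exact u0
  | succ n => exact T.upper s1 s2 hu hu1 hn u1 n
end

noncomputable def xc (n : ℕ) : ℂ := ((2 * Real.cos (2 * Real.pi / 2 ^ (n + 2)) : ℝ) : ℂ)

theorem xc_zero : xc 0 = 0 := by
  have : 2 * Real.pi / 2 ^ (0 + 2) = Real.pi / 2 := by ring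
  rw [xc, this, Real.cos_pi_div_two]; simp

theorem xc_sq (n : ℕ) : xc (n + 1) ^ 2 = 2 + xc n := by
  have h := Real.cos_sq (2 * Real.pi / 2 ^ (n + 1 + 2))
  have : 2 * (2 * Real.pi / 2 ^ (n + 1 + 2)) = 2 * Real.pi / 2 ^ (n + 2) := by
    rw [show n + 1 + 2 = (n + 2) + 1 by ring, pow_succ]; field_simp
  rw [this] at h
  rw [xc, xc, ← Complex.ofReal_pow, mul_pow, h]
  push_cast; ring

theorem xc_pos (n : ℕ) : 0 < 2 * Real.cos (2 * Real.pi / 2 ^ (n + 1 + 2)) := by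
  apply mul_pos two_pos
  apply Real.cos_pos_of_mem_Ioo
  have h8 : (8 : ℝ) ≤ 2 ^ (n + 1 + 2) := by
    have : (2 : ℝ) ^ 3 ≤ 2 ^ (n + 1 + 2) := pow_le_pow_right₀ (by norm_num) (by omega)
    norm_num at this ⊢; exact this
  have hpi := Real.pi_pos
  have : 0 < 2 * Real.pi / 2 ^ (n + 1 + 2) := by positivity
  constructor
  · linarith
  · rw [div_lt_iff₀ (by positivity)]; nlinarith

theorem xc_ne (n : ℕ) : xc (n + 1) ≠ 0 := by
  rw [xc]; exact_mod_cast (xc_pos n).ne'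

theorem xc_one : xc 1 = ((Real.sqrt 2 : ℝ) : ℂ) := by
  rw [xc]
  congr 1
  symm
  rw [Real.sqrt_eq_iff_mul_self_eq_of_pos (xc_pos 0)]
  have h := xc_sq 0
  rw [xc_zero, xc] at h
  rw [add_zero, ← Complex.ofReal_pow] at h
  have h2 : (2 * Real.cos (2 * Real.pi / 2 ^ (0 + 1 + 2))) ^ 2 = 2 :=
    Complex.ofReal_injective (h.trans (by norm_num))
  rw [sq] at h2
  first
    | exact h2
    | exact h2.symm

theorem CnF_le_iff {p q s n : ℕ} {M : IntermediateField ℚ ℂ} : CnF p q s n ≤ M ↔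
    ((Real.sqrt p : ℝ) : ℂ) ∈ M ∧ ((Real.sqrt q : ℝ) : ℂ) ∈ M ∧ ((Real.sqrt s : ℝ) : ℂ) ∈ M ∧ xc n ∈ M := by
  rw [CnF, IntermediateField.adjoin_le_iff]
  constructor
  · intro h
    exact ⟨h (by simp), h (by simp), h (by simp), h (by simp [xc])⟩
  · rintro ⟨h1, h2, h3, h4⟩ _ (rfl | rfl | rfl | rfl)
    exacts [h1, h2, h3, h4]

theorem CnF_main
    (p q s : ℕ) (hp : p.Prime) (hq : q.Prime) (hs : s.Prime)
    (hpq : p ≠ q) (hps : p ≠ s) (hqs : q ≠ s)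
    (hp8 : p % 8 = 5) (hq8 : q % 8 = 3) (hs4 : s % 4 = 3)
    (hQRq : IsSquare (p : ZMod q)) (hQRs : IsSquare (p : ZMod s))
    (h1 : ∀ Q : Sylow 2 (ClassGroup (𝓞 (quadF (p * q * s)))),
      Nat.card (Q : Subgroup (ClassGroup (𝓞 (quadF (p * q * s))))) = 4)
    (h2 : ∀ Q : Sylow 2 (ClassGroup (𝓞 (CK p q s))),
      Nat.card (Q : Subgroup (ClassGroup (𝓞 (CK p q s)))) = 4) :
    ∀ n : ℕ, ∀ P : Sylow 2 (ClassGroup (𝓞 (CnF p q s n))),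
      Nat.card (P : Subgroup (ClassGroup (𝓞 (CnF p q s n)))) = 2 := by
  obtain ⟨g, g0, g1, g2, g3⟩ : ∃ g : Fin 4 → ℕ, g 0 = 2 ∧ g 1 = p ∧ g 2 = q ∧ g 3 = s := ⟨![2, p, q, s], rfl, rfl, rfl, rfl⟩
  have hg : CG g := by
    refine ⟨⟨?_, ?_⟩, g0, by rw [g1]; exact hp8, by rw [g2]; exact hq8, by rw [g3]; exact hs4,
      by rw [g1, g2]; exact hQRq, by rw [g1, g3]; exact hQRs⟩
    · intro i; fin_cases i
      · exact g0 ▸ Nat.prime_two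
      · exact g1 ▸ hp
      · exact g2 ▸ hq
      · exact g3 ▸ hs
    · have p2 : p ≠ 2 := by omega
      have q2 : q ≠ 2 := by omega
      have s2 : s ≠ 2 := by omega
      intro i j hij
      fin_cases i <;> fin_cases j <;> simp [g0, g1, g2, g3] at hij ⊢ <;> omega
  have r0 : R g {0} = ((Real.sqrt 2 : ℝ) : ℂ) := by rw [R, dd1, g0]; norm_num
  have r1 : R g {1} = ((Real.sqrt p : ℝ) : ℂ) := by rw [R, dd1, g1]
  have r2 : R g {2} = ((Real.sqrt q : ℝ) : ℂ) := by rw [R, dd1, g2]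
  have r3 : R g {3} = ((Real.sqrt s : ℝ) : ℂ) := by rw [R, dd1, g3]
  have r01 : R g {0, 1} = ((Real.sqrt (2 * p) : ℝ) : ℂ) := by rw [R, dd2 (by decide), g0, g1]; push_cast; rfl
  have r03 : R g {0, 3} = ((Real.sqrt (2 * s) : ℝ) : ℂ) := by rw [R, dd2 (by decide), g0, g3]; push_cast; rfl
  have r123 : R g {1, 2, 3} = ((Real.sqrt ((p * q * s : ℕ)) : ℝ) : ℂ) := by
    rw [R, dd3 (by decide) (by decide) (by decide), g1, g2, g3, mul_assoc]
  have eA : quadF (p * q * s) = MQ g [{1, 2, 3}] := by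
    rw [quadF, MQ, ← r123]; congr 1; ext x; simp
  have eB : CK p q s = MQ g [{0, 1}, {0, 3}, {2}] := by
    rw [CK, MQ, ← r01, ← r03, ← r2]; congr 1; ext x; simp
  have e0 : CnF p q s 0 = MQ g [{1}, {2}, {3}] := by
    apply le_antisymm
    · rw [CnF_le_iff, ← r1, ← r2, ← r3, xc_zero]
      exact ⟨R_mem hg.toPG (by decide), R_mem hg.toPG (by decide), R_mem hg.toPG (by decide), zero_mem _⟩
    · rw [MQ_le_iff]
      obtain ⟨a, b, c, -⟩ := CnF_le_iff.1 (le_refl (CnF p q s 0))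
      simp only [List.forall_mem_cons]
      rw [r1, r2, r3]
      exact ⟨a, b, c, by simp⟩
  have e1 : CnF p q s 1 = MQ g [{0}, {1}, {2}, {3}] := by
    apply le_antisymm
    · rw [CnF_le_iff, ← r1, ← r2, ← r3, xc_one, ← r0]
      exact ⟨R_mem hg.toPG (by decide), R_mem hg.toPG (by decide), R_mem hg.toPG (by decide), R_mem hg.toPG (by decide)⟩
    · rw [MQ_le_iff]
      obtain ⟨a, b, c, d⟩ := CnF_le_iff.1 (le_refl (CnF p q s 1))
      simp only [List.forall_mem_cons]
      rw [r0, r1, r2, r3, ← xc_one]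
      exact ⟨d, a, b, c, by simp⟩
  have T : Tower (CnF p q s) xc := by
    refine ⟨xc_zero, xc_sq, xc_ne, ?_, ?_, ?_, ?_⟩
    · intro n
      obtain ⟨a, b, c, d⟩ := CnF_le_iff.1 (le_refl (CnF p q s (n + 1)))
      refine CnF_le_iff.2 ⟨a, b, c, ?_⟩
      have : xc n = xc (n + 1) ^ 2 - 2 := by rw [xc_sq]; ring
      rw [this]; exact sub_mem (pow_mem d 2) (two_mem' _)
    · intro n
      exact (CnF_le_iff.1 (le_refl (CnF p q s (n + 1)))).2.2.2
    · intro n M hM hx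
      obtain ⟨a, b, c, d⟩ := CnF_le_iff.1 hM
      exact CnF_le_iff.2 ⟨a, b, c, hx⟩
    · rw [e0, xc_one, ← r0]
      exact hg.h01.nmem
  have nA : NumberField (quadF (p * q * s)) := eA ▸ inferInstance
  have nB : NumberField (CK p q s) := eB ▸ inferInstance
  have hA : hh (MQ g [{1, 2, 3}]) = 4 := by
    rw [← eA]
    exact (sylow_card (default : Sylow 2 (ClassGroup (𝓞 (quadF (p * q * s)))))).symm.trans (h1 _)
  have hB : hh (MQ g [{0, 1}, {0, 3}, {2}]) = 4 := by
    rw [← eB]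
    exact (sylow_card (default : Sylow 2 (ClassGroup (𝓞 (CK p q s))))).symm.trans (h2 _)
  obtain ⟨nf, hf⟩ := hh_tower hg T e0 e1 (by rw [xc_one, r0]) hA hB
  intro n P
  haveI := nf n
  rw [sylow_card]
  exact hf n
end

theorem two_class_number_of_CnF_eq_two
    (p q s : ℕ) (hp : p.Prime) (hq : q.Prime) (hs : s.Prime)
    (hpq : p ≠ q) (hps : p ≠ s) (hqs : q ≠ s)
    (hp8 : p % 8 = 5) (hq8 : q % 8 = 3) (hs4 : s % 4 = 3)
    (hQRq : IsSquare (p : ZMod q)) (hQRs : IsSquare (p : ZMod s))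
    (h1 : ∀ Q : Sylow 2 (ClassGroup (𝓞 (quadF (p * q * s)))),
      Nat.card (Q : Subgroup (ClassGroup (𝓞 (quadF (p * q * s))))) = 4)
    (h2 : ∀ Q : Sylow 2 (ClassGroup (𝓞 (CK p q s))),
      Nat.card (Q : Subgroup (ClassGroup (𝓞 (CK p q s)))) = 4) :
    ∀ n : ℕ, ∀ P : Sylow 2 (ClassGroup (𝓞 (CnF p q s n))),
      Nat.card (P : Subgroup (ClassGroup (𝓞 (CnF p q s n)))) = 2 := by
  exact CnF_main p q s hp hq hs hpq hps hqs hp8 hq8 hs4 hQRq hQRs h1 h2
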